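/- Let n ≥ 5 and let a₁,…,aₙ be positive integers. There exists a constant C > 0, depending only on a₁,…,aₙ, such that for every integer m ≥ 3, the m-gonal form ⟨a₁,…,aₙ⟩_m represents over ℕ₀ every positive integer N satisfying both N ≥ C·(m−2)³ and that N is locally represented by ⟨a₁,…,aₙ⟩_m. -/

import Mathlib

/-- The `x`-th `m`-gonal number `P_m(x) = ((m-2)/2)(x² - x) + x`.
Since `x * (x - 1)` is always even, the integer division by `2` is exact. -/
def polyNum (m x : ℤ) : ℤ := (m - 2) * (x * (x - 1)) / 2 + x

namespace PF
open Finset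

lemma exp_bound (k : ℕ) : ∃ D : ℕ, 1 ≤ D ∧ ∀ e : ℕ, (e + 1) ^ k ≤ D * 2 ^ e := by
  have h := tendsto_pow_const_div_const_pow_of_one_lt k (show (1:ℝ) < 2 by norm_num)
  obtain ⟨M, hM⟩ := h.bddAbove_range
  have hM' : ∀ e : ℕ, (e:ℝ)^k / 2^e ≤ M := fun e => hM ⟨e, rfl⟩
  obtain ⟨D, hD⟩ := exists_nat_ge (2 * M)
  refine ⟨D + 1, by omega, fun e => ?_⟩
  have h1 := hM' (e+1)
  rw [div_le_iff₀ (by positivity)] at h1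
  have : (((e + 1) ^ k : ℕ) : ℝ) ≤ (((D+1) * 2 ^ e : ℕ) : ℝ) := by
    push_cast at h1 ⊢
    have h2 : (0:ℝ) < 2^e := by positivity
    rw [pow_succ] at h1
    nlinarith
  exact_mod_cast this

lemma tau_pow_le (k : ℕ) : ∃ C : ℕ, 1 ≤ C ∧ ∀ n : ℕ, 0 < n → (n.divisors.card) ^ k ≤ C * n := by
  obtain ⟨D, hD1, hD⟩ := exp_bound k
  refine ⟨D ^ (2 ^ k), Nat.one_le_pow _ _ hD1, fun n hn => ?_⟩
  rw [Nat.card_divisors hn.ne', ← Finset.prod_pow]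
  have key : ∀ p ∈ n.primeFactors, (n.factorization p + 1) ^ k ≤
      (if p < 2 ^ k then D else 1) * p ^ n.factorization p := by
    intro p hp
    have hp2 : 2 ≤ p := (Nat.prime_of_mem_primeFactors hp).two_le
    split_ifs with h
    · exact (hD _).trans (Nat.mul_le_mul_left _ (Nat.pow_le_pow_left hp2 _))
    · rw [one_mul]
      calc (n.factorization p + 1) ^ k ≤ (2 ^ n.factorization p) ^ k :=
            Nat.pow_le_pow_left (Nat.lt_two_pow_self) _
        _ = (2 ^ k) ^ n.factorization p := by rw [← pow_mul, ← pow_mul, mul_comm]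
        _ ≤ _ := Nat.pow_le_pow_left (by omega) _
  refine (Finset.prod_le_prod' key).trans ?_
  rw [Finset.prod_mul_distrib]
  have e2 : ∏ p ∈ n.primeFactors, p ^ n.factorization p = n :=
    Nat.prod_factorization_pow_eq_self hn.ne'
  rw [e2]
  refine Nat.mul_le_mul_right _ ?_
  rw [Finset.prod_ite, Finset.prod_const, Finset.prod_const_one, mul_one]
  refine Nat.pow_le_pow_right hD1 ?_
  calc _ ≤ (range (2^k)).card := by
        apply Finset.card_le_card
        intro p hp
        simp at hp ⊢
        exact hp.2
    _ = _ := by simp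

lemma le_totient_mul_tau (n : ℕ) (hn : 0 < n) : n ≤ n.totient * n.divisors.card := by
  rw [Nat.card_divisors hn.ne', Nat.totient_eq_prod_factorization hn.ne', Finsupp.prod,
    Nat.support_factorization, ← Finset.prod_mul_distrib]
  conv_lhs => rw [← Nat.prod_factorization_pow_eq_self hn.ne']
  rw [Finsupp.prod, Nat.support_factorization]
  apply Finset.prod_le_prod'
  intro p hp
  have hpp := Nat.prime_of_mem_primeFactors hp
  have he : 0 < n.factorization p := hpp.factorization_pos_of_dvd hn.ne' (Nat.dvd_of_mem_primeFactors hp)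
  obtain ⟨e, he'⟩ : ∃ e, n.factorization p = e + 1 := ⟨_, (Nat.succ_pred_eq_of_pos he).symm⟩
  obtain ⟨q, hq⟩ : ∃ q, p = q + 2 := ⟨p - 2, by have := hpp.two_le; omega⟩
  rw [he', pow_succ, mul_assoc]
  apply Nat.mul_le_mul_left
  subst hq
  simp
  nlinarith [Nat.zero_le q, Nat.zero_le e, Nat.zero_le (q*e)]

lemma gcd_eq_sum (d n : ℕ) (hn : 0 < n) :
    d.gcd n = ∑ g ∈ n.divisors, if g ∣ d then g.totient else 0 := by
  rw [← Finset.sum_filter, ← Nat.sum_totient (d.gcd n)]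
  apply Finset.sum_congr _ (fun _ _ => rfl)
  ext g
  have : d.gcd n ≠ 0 := (Nat.gcd_pos_of_pos_right _ hn).ne'
  simp [Nat.dvd_gcd_iff, hn.ne', this]
  tauto

lemma sum_gcd_le (X n : ℕ) (hn : 0 < n) :
    ∑ d ∈ Icc 1 X, d.gcd n ≤ X * n.divisors.card := by
  simp_rw [fun d => gcd_eq_sum d n hn]
  rw [Finset.sum_comm]
  calc _ ≤ ∑ g ∈ n.divisors, X := by
        apply Finset.sum_le_sum
        intro g hg
        rw [← Finset.sum_filter, Finset.sum_const, smul_eq_mul]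
        have : ((Icc 1 X).filter (g ∣ ·)).card = X / g := by
          rw [← Nat.Ioc_filter_dvd_card_eq_div]; rfl
        rw [this]
        calc X / g * g.totient ≤ X / g * g := Nat.mul_le_mul_left _ (Nat.totient_le g)
          _ ≤ X := Nat.div_mul_le_self X g
    _ = _ := by simp [mul_comm]

lemma sum_inv_sq_le (a b : ℕ) (ha : 0 < a) : ∑ e ∈ Ioc a b, (1:ℝ) / (e:ℝ)^2 ≤ 1 / a := by
  have : ∀ k : ℕ, ∑ e ∈ Ioc a (a+k), (1:ℝ) / (e:ℝ)^2 ≤ 1 / a - 1 / (a + k : ℝ) := by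
    intro k
    induction k with
    | zero => simp
    | succ k ih =>
      rw [← add_assoc, Finset.sum_Ioc_succ_top (by omega)]
      have hh : (1:ℝ) / ((a + k + 1 : ℕ):ℝ)^2 ≤ 1 / (a + k : ℝ) - 1 / (a + (k+1:ℕ) : ℝ) := by
        have hx : (0:ℝ) < a + k := by positivity
        push_cast
        rw [div_sub_div _ _ hx.ne' (by positivity), div_le_div_iff₀ (by positivity) (by positivity)]
        nlinarith
      linarith
  rcases le_or_gt a b with h | h
  · obtain ⟨k, rfl⟩ := Nat.exists_eq_add_of_le h
    refine (this k).trans ?_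
    have : (0:ℝ) ≤ 1 / (a + k : ℝ) := by positivity
    linarith
  · rw [Finset.Ioc_eq_empty (by omega)]; simp

lemma sum_inv_sq_le' (a b : ℕ) : ∑ e ∈ Ioc a b, (1:ℝ) / (e:ℝ)^2 ≤ 2 / (a + 1) := by
  rcases Nat.eq_zero_or_pos a with rfl | ha
  · rcases Nat.eq_zero_or_pos b with rfl | hb
    · simp
    · have : Ioc 0 b = insert 1 (Ioc 1 b) := by ext; simp; omega
      rw [this, Finset.sum_insert (by simp)]
      have := sum_inv_sq_le 1 b one_pos
      norm_num at this ⊢; linarith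
  · refine (sum_inv_sq_le a b ha).trans ?_
    have : (1:ℝ) ≤ a := by exact_mod_cast ha
    rw [div_le_div_iff₀ (by positivity) (by positivity)]; linarith

lemma sum_gcd_tail (Y Z n : ℕ) (hn : 0 < n) (hY : 0 < Y) :
    ∑ d ∈ Ioc Y Z, (d.gcd n : ℝ) / (d:ℝ)^2 ≤ 2 * n.divisors.card / Y := by
  simp_rw [fun d => gcd_eq_sum d n hn]
  push_cast
  simp_rw [Finset.sum_div]
  rw [Finset.sum_comm]
  calc _ ≤ ∑ g ∈ n.divisors, (2:ℝ) / Y := by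
        apply Finset.sum_le_sum
        intro g hg
        have hg0 : 0 < g := Nat.pos_of_mem_divisors hg
        have hgR : (0:ℝ) < g := by exact_mod_cast hg0
        calc _ ≤ ∑ d ∈ (Ioc Y Z).filter (g ∣ ·), (g:ℝ) / (d:ℝ)^2 := by
              rw [Finset.sum_filter]
              apply Finset.sum_le_sum
              intro d _
              split_ifs
              · gcongr; exact Nat.totient_le g
              · simp
          _ ≤ ∑ e ∈ Ioc (Y / g) (Z / g), (g:ℝ) / ((g * e : ℕ):ℝ)^2 := by
              apply le_of_eq
              apply Finset.sum_bij' (fun d _ => d / g) (fun e _ => g * e)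
              · intro d hd
                simp only [mem_filter, mem_Ioc] at hd ⊢
                obtain ⟨⟨h1, h2⟩, c, rfl⟩ := hd
                rw [Nat.mul_div_cancel_left _ hg0]
                refine ⟨(Nat.div_lt_iff_lt_mul hg0).2 (by rwa [mul_comm]), (Nat.le_div_iff_mul_le hg0).2 (by rwa [mul_comm])⟩
              · intro e he
                simp only [mem_filter, mem_Ioc] at he ⊢
                refine ⟨⟨?_, ?_⟩, dvd_mul_right _ _⟩
                · have := (Nat.div_lt_iff_lt_mul hg0).1 he.1; rwa [mul_comm]
                · have := (Nat.le_div_iff_mul_le hg0).1 he.2; rwa [mul_comm]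
              · intro d hd
                simp only [mem_filter] at hd
                exact Nat.mul_div_cancel' hd.2
              · intro e he
                exact Nat.mul_div_cancel_left _ hg0
              · intro d hd
                simp only [mem_filter] at hd
                rw [Nat.mul_div_cancel' hd.2]
          _ = (1 / g) * ∑ e ∈ Ioc (Y / g) (Z / g), (1:ℝ) / (e:ℝ)^2 := by
              rw [Finset.mul_sum]
              apply Finset.sum_congr rfl
              intro e he
              have : 0 < e := lt_of_le_of_lt (Nat.zero_le _) (mem_Ioc.1 he).1
              have : (0:ℝ) < e := by exact_mod_cast this
              push_cast
              field_simp
          _ ≤ (1 / g) * (2 / ((Y / g : ℕ) + 1)) := by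
              gcongr; exact sum_inv_sq_le' _ _
          _ ≤ 2 / Y := by
              have h1 : (Y:ℝ) ≤ g * ((Y / g : ℕ) + 1) := by
                have := Nat.lt_mul_div_succ Y hg0
                exact_mod_cast this.le
              have hYR : (0:ℝ) < Y := by exact_mod_cast hY
              rw [div_mul_div_comm, one_mul]
              gcongr
    _ = _ := by simp; ring

end PF

namespace PF
open Finset

section
variable {d : ℕ} [NeZero d]

/-- size of the annihilator -/
def ann (w : ZMod d) : ℕ := (univ.filter (fun z : ZMod d => w * z = 0)).card

lemma ann_mul_le (x y : ZMod d) : ann (x * y) ≤ ann x * ann y := by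
  unfold ann
  rw [mul_comm (#{z | x * z = 0})]
  apply Finset.card_le_mul_card_image_of_maps_to (f := fun z => y * z)
  · intro z hz
    simp at hz ⊢
    rw [← mul_assoc, hz]
  · intro b hb
    rcases Finset.eq_empty_or_nonempty (univ.filter (fun z : ZMod d => x * y * z = 0) |>.filter (fun z => y * z = b)) with h | ⟨z0, h0⟩
    · rw [h]; simp
    · apply Finset.card_le_card_of_injOn (fun z => z - z0)
      · intro z hz
        simp at hz h0 ⊢
        rw [mul_sub, hz.2, h0.2, sub_self]
      · intro a _ b _ h
        simpa using h

lemma ann_intCast_le (a : ℤ) : ann (a : ZMod d) ≤ Int.gcd a d := by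
  have hd : 0 < d := Nat.pos_of_ne_zero (NeZero.ne d)
  set g := Int.gcd a d with hg
  have hgpos : 0 < g := Int.gcd_pos_of_ne_zero_right _ (by exact_mod_cast hd.ne')
  have hgd : g ∣ d := by exact_mod_cast Int.gcd_dvd_right a (d:ℤ)
  have hq : 0 < d / g := Nat.div_pos (Nat.le_of_dvd hd hgd) hgpos
  have key : ∀ z : ZMod d, (a : ZMod d) * z = 0 → (d / g) ∣ z.val := by
    intro z hz
    have : ((a * (z.val : ℤ) : ℤ) : ZMod d) = 0 := by
      push_cast; rw [ZMod.natCast_zmod_val]; exact hz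
    rw [ZMod.intCast_zmod_eq_zero_iff_dvd] at this
    have h1 : ((d / g : ℕ) : ℤ) ∣ (z.val : ℤ) := by
      have h2 := Int.dvd_of_dvd_mul_right_of_gcd_one (a := ((d/g : ℕ):ℤ)) (b := a / g) (c := (z.val : ℤ))
      apply h2
      · have hga : (g:ℤ) ∣ a := Int.gcd_dvd_left a (d:ℤ)
        have : (g:ℤ) * ((d/g : ℕ):ℤ) ∣ (g:ℤ) * (a / g * z.val) := by
          rw [← mul_assoc, Int.mul_ediv_cancel' hga]
          have : (g:ℤ) * ((d/g : ℕ):ℤ) = d := by exact_mod_cast Nat.mul_div_cancel' hgd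
          rw [this]; assumption
        exact Int.dvd_of_mul_dvd_mul_left (by exact_mod_cast hgpos.ne') this
      · rw [Int.gcd_comm]
        have := Int.gcd_div_gcd_div_gcd (i := a) (j := (d:ℤ)) (by rw [← hg]; exact hgpos)
        rw [← hg] at this
        push_cast
        exact this
    exact_mod_cast h1
  calc ann (a : ZMod d) ≤ (range g).card := by
        apply Finset.card_le_card_of_injOn (fun z => z.val / (d / g))
        · intro z hz
          simp at hz ⊢
          rw [Nat.div_lt_iff_lt_mul hq, Nat.mul_div_cancel' hgd]
          exact ZMod.val_lt z
        · intro z hz z' hz' h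
          simp at hz hz' h
          have h1 := Nat.div_mul_cancel (key z hz)
          have h2 := Nat.div_mul_cancel (key z' hz')
          rw [h, h2] at h1
          exact ZMod.val_injective d h1.symm
    _ = g := by simp

lemma sum_ann_le : ∑ w : ZMod d, ann w ≤ d * d.divisors.card := by
  have hd : 0 < d := Nat.pos_of_ne_zero (NeZero.ne d)
  have h1 : ∀ w : ZMod d, ann w ≤ Nat.gcd w.val d := by
    intro w
    have := ann_intCast_le (d := d) (w.val : ℤ)
    rw [Int.gcd_natCast_natCast] at this
    rwa [Int.cast_natCast, ZMod.natCast_zmod_val] at this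
  refine (Finset.sum_le_sum (fun w _ => h1 w)).trans ?_
  refine le_trans ?_ (sum_gcd_le d d hd)
  have h2 : ∑ w : ZMod d, Nat.gcd w.val d = ∑ k ∈ range d, Nat.gcd k d := by
    apply Finset.sum_bij' (fun (w : ZMod d) _ => w.val) (fun (k : ℕ) _ => (k : ZMod d))
    · intro w _; simp [ZMod.val_lt]
    · simp
    · intro w _; simp
    · intro k hk; simp at hk; exact ZMod.val_cast_of_lt hk
    · simp
  rw [h2]
  obtain ⟨e, rfl⟩ : ∃ e, d = e + 1 := ⟨d - 1, by omega⟩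
  have h3 : Icc 1 (e+1) = Ico (0+1) (e+1+1) := by ext; simp only [mem_Icc, mem_Ico]; omega
  rw [Finset.sum_range_succ', h3, ← Finset.sum_Ico_add', ← Finset.range_eq_Ico, Finset.sum_range_succ]
  simp

lemma orth (ψ : AddChar (ZMod d) ℂ) (hψ : ψ.IsPrimitive) {I : Type*} [Fintype I] (s t : I → ZMod d) :
    ∑ x : ZMod d, ∑ y : ZMod d, ‖∑ i, ψ (x * s i + y * t i)‖ ^ 2 =
      (d:ℝ)^2 * (univ.filter (fun p : I × I => s p.1 = s p.2 ∧ t p.1 = t p.2)).card := by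
  have : ((∑ x : ZMod d, ∑ y : ZMod d, ‖∑ i, ψ (x * s i + y * t i)‖ ^ 2 : ℝ) : ℂ) =
      (d:ℂ)^2 * (univ.filter (fun p : I × I => s p.1 = s p.2 ∧ t p.1 = t p.2)).card := by
    push_cast
    have h1 : ∀ x y : ZMod d, ((‖∑ i, ψ (x * s i + y * t i)‖:ℂ) ^ 2) =
        ∑ p : I × I, ψ (x * (s p.1 - s p.2)) * ψ (y * (t p.1 - t p.2)) := by
      intro x y
      rw [← Complex.mul_conj', map_sum, Finset.sum_mul_sum, Fintype.sum_prod_type]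
      refine Finset.sum_congr rfl fun i _ => Finset.sum_congr rfl fun j _ => ?_
      rw [← AddChar.map_neg_eq_conj, ← AddChar.map_add_eq_mul, ← AddChar.map_add_eq_mul]
      congr 1; ring
    simp_rw [h1]
    have h2 : ∀ x : ZMod d, ∑ y : ZMod d, ∑ p : I × I, ψ (x * (s p.1 - s p.2)) * ψ (y * (t p.1 - t p.2)) =
        ∑ p : I × I, ψ (x * (s p.1 - s p.2)) * ∑ y : ZMod d, ψ (y * (t p.1 - t p.2)) := by
      intro x; rw [Finset.sum_comm]; simp_rw [Finset.mul_sum]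
    simp_rw [h2]
    rw [Finset.sum_comm]
    simp_rw [← Finset.sum_mul, AddChar.sum_mulShift _ hψ, ZMod.card, sub_eq_zero]
    rw [Finset.card_filter]
    push_cast
    rw [Finset.mul_sum]
    refine Finset.sum_congr rfl fun p _ => ?_
    split_ifs <;> simp_all
    ring
  exact_mod_cast this

/-- Kloosterman sum -/
noncomputable def Kl (ψ : AddChar (ZMod d) ℂ) (x y : ZMod d) : ℂ :=
  ∑ u : (ZMod d)ˣ, ψ (x * u + y * (u⁻¹ : (ZMod d)ˣ))

lemma Kl_shift (ψ : AddChar (ZMod d) ℂ) (x y : ZMod d) (v : (ZMod d)ˣ) :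
    Kl ψ (x * v) (y * (v⁻¹ : (ZMod d)ˣ)) = Kl ψ x y := by
  unfold Kl
  apply Fintype.sum_equiv (Equiv.mulLeft v)
  intro u
  simp [mul_assoc]
  congr 1
  ring

lemma Kl_count (h2 : IsUnit (2 : ZMod d)) :
    (univ.filter (fun p : ((ZMod d)ˣ × (ZMod d)ˣ) × ((ZMod d)ˣ × (ZMod d)ˣ) =>
      (p.1.1 + p.1.2 : ZMod d) = p.2.1 + p.2.2 ∧
      ((p.1.1⁻¹ : (ZMod d)ˣ) + (p.1.2⁻¹ : (ZMod d)ˣ) : ZMod d) = (p.2.1⁻¹ : (ZMod d)ˣ) + (p.2.2⁻¹ : (ZMod d)ˣ))).card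
      ≤ (d * d.divisors.card) ^ 2 := by
  calc _ ≤ (univ.filter (fun q : (ZMod d × ZMod d) × ZMod d => q.1.1 * q.1.2 * q.2 = 0)).card := by
        apply Finset.card_le_card_of_injOn (fun p => (((p.1.1 : ZMod d) + p.1.2, (p.2.1 : ZMod d) - p.1.1), (p.2.1 : ZMod d) - p.1.2))
        · rintro ⟨⟨a, b⟩, c, e⟩ hp
          simp only [coe_filter, mem_univ, true_and, Set.mem_ofPred_eq] at hp ⊢
          obtain ⟨h1, h3⟩ := hp
          have ha := a.mul_inv
          have hb := b.mul_inv
          have hc := c.mul_inv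
          have he := e.mul_inv
          generalize ((a⁻¹ : (ZMod d)ˣ) : ZMod d) = a' at *
          generalize ((b⁻¹ : (ZMod d)ˣ) : ZMod d) = b' at *
          generalize ((c⁻¹ : (ZMod d)ˣ) : ZMod d) = c' at *
          generalize ((e⁻¹ : (ZMod d)ˣ) : ZMod d) = e' at *
          generalize (a : ZMod d) = a at *
          generalize (b : ZMod d) = b at *
          generalize (c : ZMod d) = c at *
          generalize (e : ZMod d) = e at *
          have e1 : (a + b) * (c * e) = (c + e) * (a * b) := by
            have : (a' + b') * (a * b * (c * e)) = (c' + e') * (a * b * (c * e)) := by rw [h3]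
            linear_combination this - (b * c * e) * ha - a * c * e * hb + a * b * e * hc + a * b * c * he
          have e2 : e = a + b - c := by linear_combination -h1
          subst e2
          linear_combination -e1
        · rintro ⟨⟨a, b⟩, c, e⟩ hp ⟨⟨a', b'⟩, c', e'⟩ hp' h
          simp only [coe_filter, mem_univ, true_and, Set.mem_ofPred_eq] at hp hp'
          simp only [Prod.mk.injEq] at h
          obtain ⟨⟨g1, g2⟩, g3⟩ := h
          have k1 : (2 : ZMod d) * a = 2 * a' := by linear_combination g1 + g3 - g2
          have k1 := h2.mul_left_cancel k1
          have k2 : (b : ZMod d) = b' := by linear_combination g1 - k1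
          have k3 : (c : ZMod d) = c' := by linear_combination g2 + k1
          have k4 : (e : ZMod d) = e' := by linear_combination -hp.1 + hp'.1 + k1 + k2 - k3
          rw [Units.ext_iff.2 k1, Units.ext_iff.2 k2, Units.ext_iff.2 k3, Units.ext_iff.2 k4]
    _ = ∑ q : ZMod d × ZMod d, ann (q.1 * q.2) := by
        rw [Finset.card_filter, Fintype.sum_prod_type]
        refine Finset.sum_congr rfl fun q _ => ?_
        rw [ann, Finset.card_filter]
    _ ≤ ∑ q : ZMod d × ZMod d, ann q.1 * ann q.2 := Finset.sum_le_sum fun q _ => ann_mul_le _ _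
    _ = (∑ w : ZMod d, ann w) ^ 2 := by
        rw [Fintype.sum_prod_type, sq, Finset.sum_mul_sum]
    _ ≤ _ := Nat.pow_le_pow_left sum_ann_le 2

lemma Kl_bound (ψ : AddChar (ZMod d) ℂ) (hψ : ψ.IsPrimitive) (h2 : IsUnit (2 : ZMod d)) (x y : ZMod d) :
    ‖Kl ψ x y‖ ^ 4 ≤ (ann x : ℝ) * d ^ 3 * (d.divisors.card : ℝ) ^ 3 := by
  have hd : 0 < d := Nat.pos_of_ne_zero (NeZero.ne d)
  have hm := orth ψ hψ (I := (ZMod d)ˣ × (ZMod d)ˣ) (fun p => (p.1 : ZMod d) + p.2)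
    (fun p => ((p.1⁻¹ : (ZMod d)ˣ) : ZMod d) + (p.2⁻¹ : (ZMod d)ˣ))
  have hk : ∀ x y : ZMod d, ‖∑ p : (ZMod d)ˣ × (ZMod d)ˣ, ψ (x * ((p.1 : ZMod d) + p.2) +
      y * (((p.1⁻¹ : (ZMod d)ˣ) : ZMod d) + (p.2⁻¹ : (ZMod d)ˣ)))‖ ^ 2 = ‖Kl ψ x y‖ ^ 4 := by
    intro x y
    have : ∑ p : (ZMod d)ˣ × (ZMod d)ˣ, ψ (x * ((p.1 : ZMod d) + p.2) +
      y * (((p.1⁻¹ : (ZMod d)ˣ) : ZMod d) + (p.2⁻¹ : (ZMod d)ˣ))) = Kl ψ x y ^ 2 := by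
      rw [Kl, sq, Finset.sum_mul_sum, Fintype.sum_prod_type]
      refine Finset.sum_congr rfl fun i _ => Finset.sum_congr rfl fun j _ => ?_
      rw [← AddChar.map_add_eq_mul]; congr 1; ring
    rw [this, norm_pow]; ring
  simp_rw [hk] at hm
  have hN := Kl_count (d := d) h2
  have hN' : ∑ x : ZMod d, ∑ y : ZMod d, ‖Kl ψ x y‖ ^ 4 ≤ (d:ℝ)^2 * ((d:ℝ) * d.divisors.card) ^ 2 := by
    rw [hm]
    gcongr
    exact_mod_cast hN
  -- orbit
  have horb : (d.totient : ℝ) * ‖Kl ψ x y‖ ^ 4 ≤ ann x * ∑ x : ZMod d, ∑ y : ZMod d, ‖Kl ψ x y‖ ^ 4 := by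
    have e1 : (d.totient : ℝ) * ‖Kl ψ x y‖ ^ 4 =
        ∑ v : (ZMod d)ˣ, ‖Kl ψ (x * v) (y * (v⁻¹ : (ZMod d)ˣ))‖ ^ 4 := by
      simp_rw [Kl_shift]
      rw [Finset.sum_const, Finset.card_univ, ZMod.card_units_eq_totient, nsmul_eq_mul]
    rw [e1, ← Fintype.sum_prod_type' (f := fun x y => ‖Kl ψ x y‖ ^ 4), Finset.mul_sum]
    rw [← Finset.sum_fiberwise (s := univ) (g := fun v : (ZMod d)ˣ => (x * (v : ZMod d), y * ((v⁻¹ : (ZMod d)ˣ) : ZMod d)))]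
    apply Finset.sum_le_sum
    rintro ⟨a, b⟩ _
    calc _ = ∑ v ∈ univ.filter (fun v : (ZMod d)ˣ => (x * (v : ZMod d), y * ((v⁻¹ : (ZMod d)ˣ) : ZMod d)) = (a, b)), ‖Kl ψ a b‖ ^ 4 := by
          refine Finset.sum_congr rfl fun v hv => ?_
          simp only [mem_filter, Prod.mk.injEq] at hv
          rw [hv.2.1, hv.2.2]
      _ ≤ _ := by
          rw [Finset.sum_const, nsmul_eq_mul]
          gcongr
          rcases Finset.eq_empty_or_nonempty (univ.filter (fun v : (ZMod d)ˣ => (x * (v : ZMod d), y * ((v⁻¹ : (ZMod d)ˣ) : ZMod d)) = (a, b))) with h | ⟨v0, h0⟩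
          · rw [h]; simp
          · unfold ann
            apply Finset.card_le_card_of_injOn (fun v : (ZMod d)ˣ => (v : ZMod d) - v0)
            · intro v hv
              simp at hv h0 ⊢
              rw [mul_sub, hv.1, h0.1, sub_self]
            · intro v _ w _ h
              simpa [Units.ext_iff] using h
  have hphi : (d:ℝ) ≤ d.totient * d.divisors.card := by exact_mod_cast le_totient_mul_tau d hd
  have hdR : (0:ℝ) < d := by exact_mod_cast hd
  have hK : 0 ≤ ‖Kl ψ x y‖ ^ 4 := by positivity
  have hann : (0:ℝ) ≤ ann x := by positivity
  have f1 : (d:ℝ) * ‖Kl ψ x y‖ ^ 4 ≤ d.divisors.card * (ann x * ((d:ℝ)^2 * ((d:ℝ) * d.divisors.card) ^ 2)) := by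
    calc (d:ℝ) * ‖Kl ψ x y‖ ^ 4 ≤ d.totient * d.divisors.card * ‖Kl ψ x y‖ ^ 4 := by gcongr
      _ = d.divisors.card * (d.totient * ‖Kl ψ x y‖ ^ 4) := by ring
      _ ≤ _ := by
          refine mul_le_mul_of_nonneg_left ?_ (by positivity)
          exact horb.trans (mul_le_mul_of_nonneg_left hN' hann)
  rw [← mul_le_mul_iff_right₀ hdR]
  refine f1.trans (le_of_eq ?_)
  ring
end
end PF

namespace PF
open Finset

/-- quadratic Gauss sum with linear term -/
noncomputable def gs {d : ℕ} [NeZero d] (ψ : AddChar (ZMod d) ℂ) (s t : ZMod d) : ℂ :=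
  ∑ x : ZMod d, ψ (s * x ^ 2 + t * x)

section
variable {d : ℕ} [NeZero d]

lemma gs_norm_sq_le (ψ : AddChar (ZMod d) ℂ) (hψ : ψ.IsPrimitive) (s t : ZMod d) :
    ‖gs ψ s t‖ ^ 2 ≤ d * ann (2 * s) := by
  have h1 : ((‖gs ψ s t‖ ^ 2 : ℝ) : ℂ) =
      ∑ h : ZMod d, ψ (s * h ^ 2 + t * h) * ∑ y : ZMod d, ψ (y * (2 * s * h)) := by
    push_cast
    rw [← Complex.mul_conj', gs, map_sum, Finset.sum_mul_sum, Finset.sum_comm]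
    simp_rw [Finset.mul_sum]
    rw [Finset.sum_comm (s := univ) (t := univ) (f := fun h y => ψ (s * h ^ 2 + t * h) * ψ (y * (2 * s * h)))]
    refine Finset.sum_congr rfl fun y _ => ?_
    apply Fintype.sum_equiv (Equiv.subRight y)
    intro x
    rw [← AddChar.map_neg_eq_conj, ← AddChar.map_add_eq_mul, ← AddChar.map_add_eq_mul]
    congr 1
    simp only [Equiv.subRight_apply]
    ring
  have h2 : ‖gs ψ s t‖ ^ 2 = ‖((‖gs ψ s t‖ ^ 2 : ℝ) : ℂ)‖ := by
    rw [Complex.norm_real, Real.norm_of_nonneg (by positivity)]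
  rw [h2, h1]
  refine (norm_sum_le _ _).trans ?_
  simp_rw [norm_mul, AddChar.norm_apply, one_mul, AddChar.sum_mulShift _ hψ, ZMod.card]
  have : ∀ h : ZMod d, ‖(((if 2 * s * h = 0 then d else 0 : ℕ)) : ℂ)‖ = d * (if 2 * s * h = 0 then 1 else 0) := by
    intro h; split_ifs <;> simp
  simp_rw [this]
  rw [← Finset.mul_sum, ann, Finset.card_filter]
  push_cast
  rfl

lemma gs_square (ψ : AddChar (ZMod d) ℂ) (s t : ZMod d) (q : ZMod d) (hq : q * (4 * s) = 1) :
    gs ψ s t = ψ (- (t ^ 2 * q)) * gs ψ s 0 := by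
  unfold gs
  rw [Finset.mul_sum]
  apply Fintype.sum_equiv (Equiv.addRight (2 * t * q))
  intro x
  simp only [Equiv.coe_addRight]
  rw [← AddChar.map_add_eq_mul]
  congr 1
  linear_combination (- t * x - t ^ 2 * q) * hq

lemma gs_mulShift (ψ : AddChar (ZMod d) ℂ) (u s t : ZMod d) :
    gs (ψ.mulShift u) s t = gs ψ (u * s) (u * t) := by
  unfold gs
  refine Finset.sum_congr rfl fun x _ => ?_
  rw [AddChar.mulShift_apply]; congr 1; ring

lemma gs_abs (ψ : AddChar (ZMod d) ℂ) (hψ : ψ.IsPrimitive) (s : ZMod d) (h : IsUnit (2 * s)) :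
    ‖gs ψ s 0‖ ^ 2 ≤ d := by
  refine (gs_norm_sq_le ψ hψ s 0).trans ?_
  have : ann (2 * s) = 1 := by
    unfold ann
    rw [Finset.card_eq_one]
    refine ⟨0, ?_⟩
    ext z; simp [h.mul_right_eq_zero]
  rw [this]; simp

lemma isPrimitive_mulShift (ψ : AddChar (ZMod d) ℂ) (hψ : ψ.IsPrimitive) (u : (ZMod d)ˣ) :
    (ψ.mulShift (u : ZMod d)).IsPrimitive := by
  intro a ha
  rw [AddChar.mulShift_mulShift]
  apply hψ
  simpa using ha

lemma exists_std (ψ : AddChar (ZMod d) ℂ) (hψ : ψ.IsPrimitive) :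
    ∃ u : (ZMod d)ˣ, ψ = (ZMod.stdAddChar (N := d)).mulShift (u : ZMod d) := by
  have hinj := AddChar.to_mulShift_inj_of_isPrimitive (ZMod.isPrimitive_stdAddChar d)
  have hbij := (Fintype.bijective_iff_injective_and_card _).2 ⟨hinj, by rw [AddChar.card_eq]⟩
  obtain ⟨u, hu⟩ := hbij.2 ψ
  have hunit : IsUnit u := by
    rw [isUnit_iff_mem_nonZeroDivisors_of_finite, mem_nonZeroDivisors_iff_right]
    intro x hx
    by_contra hx0
    apply hψ hx0
    rw [← hu, AddChar.mulShift_mulShift, mul_comm, hx]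
    ext; simp
  obtain ⟨u, rfl⟩ := hunit
  exact ⟨u, hu.symm⟩
end

/-- CRT splitting of characters -/
lemma crt_split {d1 d2 : ℕ} [NeZero d1] [NeZero d2] [NeZero (d1 * d2)] (h : Nat.Coprime d1 d2)
    (ψ : AddChar (ZMod (d1 * d2)) ℂ) (hψ : ψ.IsPrimitive) :
    ∃ (ψ1 : AddChar (ZMod d1) ℂ) (ψ2 : AddChar (ZMod d2) ℂ), ψ1.IsPrimitive ∧ ψ2.IsPrimitive ∧
      ∀ x, ψ x = ψ1 (ZMod.chineseRemainder h x).1 * ψ2 (ZMod.chineseRemainder h x).2 := by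
  set e := ZMod.chineseRemainder h
  let ψ1 : AddChar (ZMod d1) ℂ :=
    ψ.compAddMonoidHom ((e.symm : (ZMod d1 × ZMod d2) →+ ZMod (d1*d2)).comp (AddMonoidHom.inl _ _))
  let ψ2 : AddChar (ZMod d2) ℂ :=
    ψ.compAddMonoidHom ((e.symm : (ZMod d1 × ZMod d2) →+ ZMod (d1*d2)).comp (AddMonoidHom.inr _ _))
  have e1 : ∀ x, ψ1 x = ψ (e.symm (x, 0)) := fun x => rfl
  have e2 : ∀ x, ψ2 x = ψ (e.symm (0, x)) := fun x => rfl
  refine ⟨ψ1, ψ2, ?_, ?_, ?_⟩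
  · intro a ha hh
    apply hψ (a := e.symm (a, 0))
    · simpa using ha
    · ext x
      rw [AddChar.mulShift_apply]
      have := DFunLike.congr_fun hh (e x).1
      rw [AddChar.mulShift_apply, e1] at this
      have hx : e.symm (a, 0) * x = e.symm (a * (e x).1, 0) := by
        apply e.injective; ext <;> simp
      rw [hx]
      simpa using this
  · intro a ha hh
    apply hψ (a := e.symm (0, a))
    · simpa using ha
    · ext x
      rw [AddChar.mulShift_apply]
      have := DFunLike.congr_fun hh (e x).2
      rw [AddChar.mulShift_apply, e2] at this
      have hx : e.symm (0, a) * x = e.symm (0, a * (e x).2) := by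
        apply e.injective; ext <;> simp
      rw [hx]
      simpa using this
  · intro x
    rw [e1, e2, ← AddChar.map_add_eq_mul, ← map_add]
    simp

lemma gs_crt {d1 d2 : ℕ} [NeZero d1] [NeZero d2] [NeZero (d1 * d2)] (h : Nat.Coprime d1 d2)
    (ψ : AddChar (ZMod (d1 * d2)) ℂ) (ψ1 : AddChar (ZMod d1) ℂ) (ψ2 : AddChar (ZMod d2) ℂ)
    (hs : ∀ x, ψ x = ψ1 (ZMod.chineseRemainder h x).1 * ψ2 (ZMod.chineseRemainder h x).2) (s t : ZMod (d1*d2)) :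
    gs ψ s t = gs ψ1 (ZMod.chineseRemainder h s).1 (ZMod.chineseRemainder h t).1 *
      gs ψ2 (ZMod.chineseRemainder h s).2 (ZMod.chineseRemainder h t).2 := by
  unfold gs
  rw [Finset.sum_mul_sum, ← Fintype.sum_prod_type']
  apply Fintype.sum_equiv (ZMod.chineseRemainder h).toEquiv
  intro x
  rw [hs]
  simp

section
variable (p : ℕ) [hp : Fact p.Prime]

lemma gs_prime (hp2 : p ≠ 2) (a : Fin 4 → ℤ) (ha : ∀ j, ¬ (p:ℤ) ∣ a j) (ψ : AddChar (ZMod p) ℂ) (hψ : ψ.IsPrimitive) :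
    ∏ j, gs ψ (a j : ZMod p) 0 = (jacobiSym (∏ j, a j) p : ℂ) * (p:ℂ) ^ 2 := by
  have hchar : ringChar (ZMod p) ≠ 2 := by rwa [ZMod.ringChar_zmod_n]
  set χ : MulChar (ZMod p) ℂ := (quadraticChar (ZMod p)).ringHomComp (Int.castRingHom ℂ) with hχ
  have hχ1 : χ ≠ 1 := by
    have := quadraticChar_ne_one hchar
    rw [Ne, MulChar.ringHomComp_eq_one_iff]
    · exact this
    · exact Int.cast_injective
  have hχq : χ.IsQuadratic := (quadraticChar_isQuadratic (ZMod p)).comp _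
  have key : ∀ j, gs ψ (a j : ZMod p) 0 = χ (a j : ZMod p) * gaussSum χ ψ := by
    intro j
    have hu : (a j : ZMod p) ≠ 0 := by
      rw [Ne, ZMod.intCast_zmod_eq_zero_iff_dvd]; exact ha j
    have hψ' : (ψ.mulShift (a j : ZMod p)).IsPrimitive := isPrimitive_mulShift ψ hψ (Units.mk0 _ hu)
    have h1 : gs ψ (a j : ZMod p) 0 = ∑ y : ZMod p, (1 + χ y) * (ψ.mulShift (a j : ZMod p)) y := by
      unfold gs
      rw [← Finset.sum_fiberwise (s := univ) (g := fun x : ZMod p => x ^ 2)]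
      refine Finset.sum_congr rfl fun y _ => ?_
      have : ∀ x ∈ univ.filter (fun x : ZMod p => x ^ 2 = y), ψ ((a j : ZMod p) * x ^ 2 + 0 * x) =
          (ψ.mulShift (a j : ZMod p)) y := by
        intro x hx
        simp at hx
        rw [AddChar.mulShift_apply, ← hx]; simp
      rw [Finset.sum_congr rfl this, Finset.sum_const, nsmul_eq_mul]
      congr 1
      have hc := quadraticChar_card_sqrts hchar y
      have : ((#{x : ZMod p | x ^ 2 = y} : ℤ) : ℂ) = ((quadraticChar (ZMod p) y + 1 : ℤ) : ℂ) := by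
        rw [← hc]
        have : #{x : ZMod p | x ^ 2 = y} = {x : ZMod p | x ^ 2 = y}.toFinset.card := by
          congr 1; ext; simp
        rw [this]
      push_cast at this
      rw [this, hχ, MulChar.ringHomComp_apply]
      simp [add_comm]
    rw [h1]
    simp_rw [add_mul, one_mul]
    rw [Finset.sum_add_distrib, AddChar.sum_eq_zero_of_ne_one, zero_add]
    · have h2 := gaussSum_mulShift χ ψ (Units.mk0 _ hu)
      rw [← h2]
      simp only [Units.val_mk0]
      rw [← mul_assoc, ← map_mul, ← sq]
      have : χ ((a j : ZMod p) ^ 2) = 1 := by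
        rw [hχ, MulChar.ringHomComp_apply, quadraticChar_sq_one' hu]; simp
      rw [this, one_mul]; rfl
    · have := hψ'
      have h3 := this (one_ne_zero)
      rwa [AddChar.mulShift_one] at h3
  simp_rw [key]
  rw [Finset.prod_mul_distrib, Finset.prod_const, Finset.card_univ, Fintype.card_fin]
  have h4 : gaussSum χ ψ ^ 4 = (p:ℂ)^2 := by
    have := gaussSum_sq hχ1 hχq hψ
    rw [show gaussSum χ ψ ^ 4 = (gaussSum χ ψ ^ 2) ^ 2 by ring, this, mul_pow, ← map_pow]
    simp [ZMod.card]
  rw [h4, ← jacobiSym.legendreSym.to_jacobiSym, legendreSym, ← map_prod, hχ, MulChar.ringHomComp_apply]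
  simp

lemma std_eq {N : ℕ} [NeZero N] (j : ℕ) : ZMod.stdAddChar (N := N) (j : ZMod N) =
    Complex.exp (2 * Real.pi * Complex.I * j / N) := by
  have := ZMod.stdAddChar_coe (N := N) (j : ℤ)
  push_cast at this
  exact this

lemma sum_zmod {d : ℕ} [NeZero d] (F : ZMod d → ℂ) : ∑ x : ZMod d, F x = ∑ k ∈ range d, F (k : ZMod d) := by
  apply Finset.sum_bij' (fun (w : ZMod d) _ => w.val) (fun (k : ℕ) _ => (k : ZMod d))
  · intro w _; simp [ZMod.val_lt]
  · simp
  · intro w _; simp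
  · intro k hk; simp at hk; exact ZMod.val_cast_of_lt hk
  · simp

lemma sum_periodic (m q : ℕ) (F : ℕ → ℂ) (hF : ∀ y, F (m + y) = F y) :
    ∑ y ∈ range (m * q), F y = q * ∑ y ∈ range m, F y := by
  induction q with
  | zero => simp
  | succ q ih =>
    rw [mul_add, mul_one, add_comm, Finset.sum_range_add]
    simp_rw [hF]
    rw [ih]; push_cast; ring

lemma gs_step (hp2 : p ≠ 2) (k : ℕ) (a : ℤ) (ha : ¬ (p:ℤ) ∣ a) [NeZero (p^(k+2))] [NeZero (p^k)] :
    gs (ZMod.stdAddChar (N := p ^ (k+2))) (a : ZMod (p^(k+2))) 0 =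
      p * gs (ZMod.stdAddChar (N := p ^ k)) (a : ZMod (p^k)) 0 := by
  have hpp := hp.out
  set d := p ^ (k+2) with hd
  set ψ := ZMod.stdAddChar (N := d) with hψ
  have hprim : ψ.IsPrimitive := ZMod.isPrimitive_stdAddChar d
  have hd0 : (d:ℂ) ≠ 0 := by exact_mod_cast NeZero.ne d
  set π : ZMod d := ((p ^ (k+1) : ℕ) : ZMod d) with hπ
  have hπ2 : π ^ 2 = 0 := by
    rw [hπ, ← Nat.cast_pow, ZMod.natCast_eq_zero_iff, hd, ← pow_mul]
    exact pow_dvd_pow _ (by omega)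
  have e1 : (d:ℂ) * gs ψ (a : ZMod d) 0 = ∑ z : ZMod d, ∑ x : ZMod d, ψ ((a : ZMod d) * x ^ 2) * ψ (z * (2 * a * π * x)) := by
    rw [show (d:ℂ) * gs ψ (a : ZMod d) 0 = ∑ z : ZMod d, gs ψ (a : ZMod d) 0 by
      rw [Finset.sum_const, Finset.card_univ, ZMod.card, nsmul_eq_mul]]
    refine Finset.sum_congr rfl fun z _ => ?_
    unfold gs
    symm
    apply Fintype.sum_equiv (Equiv.addRight (π * z))
    intro x
    rw [← AddChar.map_add_eq_mul]
    congr 1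
    simp only [Equiv.coe_addRight]
    linear_combination (- a * z ^ 2) * hπ2
  have e2 : gs ψ (a : ZMod d) 0 = ∑ x : ZMod d, if 2 * a * π * x = 0 then ψ ((a : ZMod d) * x ^ 2) else 0 := by
    apply mul_left_cancel₀ hd0
    rw [e1, Finset.sum_comm, Finset.mul_sum]
    refine Finset.sum_congr rfl fun x _ => ?_
    rw [← Finset.mul_sum, AddChar.sum_mulShift _ hprim, ZMod.card]
    split_ifs <;> simp [mul_comm]
  have hcond : ∀ x : ℕ, (2 * a * π * (x : ZMod d) = 0) ↔ p ∣ x := by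
    intro x
    have : (2 * a * π * (x : ZMod d)) = ((2 * a * (p ^ (k+1) : ℕ) * x : ℤ) : ZMod d) := by
      rw [hπ]; push_cast; ring
    rw [this, ZMod.intCast_zmod_eq_zero_iff_dvd, hd]
    push_cast
    rw [show (2 * a * (p:ℤ) ^ (k+1) * x) = (p:ℤ) ^ (k+1) * (2 * a * x) by ring,
      show (p:ℤ) ^ (k+2) = p ^ (k+1) * p by ring]
    rw [Int.mul_dvd_mul_iff_left (pow_ne_zero _ (by exact_mod_cast hpp.ne_zero))]
    have hpI : Prime (p:ℤ) := Nat.prime_iff_prime_int.1 hpp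
    constructor
    · intro h
      rcases hpI.dvd_or_dvd h with h | h
      · rcases hpI.dvd_or_dvd h with h | h
        · exfalso
          have : p ∣ 2 := by exact_mod_cast h
          exact hp2 ((Nat.prime_dvd_prime_iff_eq hpp Nat.prime_two).1 this)
        · exact absurd h ha
      · exact_mod_cast h
    · intro h
      exact Dvd.dvd.mul_left (by exact_mod_cast h) _
  rw [e2, sum_zmod]
  simp_rw [hcond]
  rw [← Finset.sum_filter]
  have e3 : ∑ x ∈ range d with p ∣ x, ψ ((a : ZMod d) * (x : ZMod d) ^ 2) =
      ∑ y ∈ range (p ^ k * p), ψ ((a : ZMod d) * ((p * y : ℕ) : ZMod d) ^ 2) := by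
    apply Finset.sum_bij' (fun x _ => x / p) (fun y _ => p * y)
    · intro x hx
      simp only [mem_filter, mem_range] at hx ⊢
      rw [Nat.div_lt_iff_lt_mul hpp.pos]
      refine hx.1.trans_le (le_of_eq ?_)
      rw [hd]; ring
    · intro y hy
      simp only [mem_filter, mem_range] at hy ⊢
      refine ⟨?_, dvd_mul_right _ _⟩
      calc p * y < p * (p ^ k * p) := (Nat.mul_lt_mul_left hpp.pos).2 hy
        _ = d := by rw [hd]; ring
    · intro x hx
      simp only [mem_filter] at hx
      exact Nat.mul_div_cancel' hx.2
    · intro y hy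
      exact Nat.mul_div_cancel_left _ hpp.pos
    · intro x hx
      simp only [mem_filter] at hx
      rw [Nat.mul_div_cancel' hx.2]
  rw [e3]
  have e4 : ∀ y : ℕ, ψ ((a : ZMod d) * ((p * y : ℕ) : ZMod d) ^ 2) =
      ZMod.stdAddChar (N := p ^ k) ((a : ZMod (p^k)) * (y : ZMod (p^k)) ^ 2 + 0 * y) := by
    intro y
    have h1 : ((a : ZMod d) * ((p * y : ℕ) : ZMod d) ^ 2) = ((a * (p * y) ^ 2 : ℤ) : ZMod d) := by push_cast; ring
    have h2 : ((a : ZMod (p^k)) * (y : ZMod (p^k)) ^ 2 + 0 * y) = ((a * y ^ 2 : ℤ) : ZMod (p^k)) := by push_cast; ring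
    rw [h1, h2, hψ, ZMod.stdAddChar_coe, ZMod.stdAddChar_coe]
    congr 1
    have : (p:ℂ) ≠ 0 := by exact_mod_cast hpp.ne_zero
    rw [hd]
    push_cast
    field_simp
    ring
  simp_rw [e4]
  rw [sum_periodic]
  · unfold gs
    rw [← sum_zmod (fun y => ZMod.stdAddChar (N := p ^ k) ((a : ZMod (p^k)) * y ^ 2 + 0 * y))]
  · intro y
    have : ((p ^ k + y : ℕ) : ZMod (p^k)) = y := by
      rw [Nat.cast_add, ZMod.natCast_self, zero_add]
    rw [this]

lemma gs_prime_pow (hp2 : p ≠ 2) (a : Fin 4 → ℤ) (ha : ∀ j, ¬ (p:ℤ) ∣ a j) : ∀ k : ℕ, ∀ [NeZero (p^k)],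
    ∏ j, gs (ZMod.stdAddChar (N := p ^ k)) (a j : ZMod (p^k)) 0 =
      (jacobiSym (∏ j, a j) (p^k) : ℂ) * ((p^k : ℕ):ℂ) ^ 2
  | 0, _ => by
    have : ∀ j, gs (ZMod.stdAddChar (N := p ^ 0)) (a j : ZMod (p^0)) 0 = 1 := by
      intro j
      unfold gs
      rw [sum_zmod]
      rw [show range (p^0) = {0} by simp, Finset.sum_singleton, Nat.cast_zero,
        show ((a j : ZMod (p^0)) * 0 ^ 2 + 0 * 0) = 0 by ring, AddChar.map_zero_eq_one]
    rw [Finset.prod_congr rfl (fun j _ => this j)]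
    simp
  | 1, _ => by
    have h1 : p ^ 1 = p := pow_one p
    have key : ∀ q : ℕ, ∀ [NeZero q], q = p → ∏ j, gs (ZMod.stdAddChar (N := q)) (a j : ZMod q) 0 =
      (jacobiSym (∏ j, a j) q : ℂ) * ((q : ℕ):ℂ) ^ 2 := by
      rintro q _ rfl
      exact gs_prime q hp2 a ha _ (ZMod.isPrimitive_stdAddChar q)
    exact key _ h1
  | k+2, _ => by
    have : NeZero (p^k) := ⟨pow_ne_zero _ hp.out.ne_zero⟩
    have ih := gs_prime_pow hp2 a ha k
    simp_rw [fun j => gs_step p hp2 k (a j) (ha j)]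
    rw [Finset.prod_mul_distrib, ih, Finset.prod_const, Finset.card_univ, Fintype.card_fin]
    have hsq : (jacobiSym (∏ j, a j) p) ^ 2 = 1 := by
      apply jacobiSym.sq_one
      rw [Int.gcd_comm, Int.isCoprime_iff_gcd_eq_one.symm]
      have hpI : Prime (p:ℤ) := Nat.prime_iff_prime_int.1 hp.out
      rw [hpI.coprime_iff_not_dvd, hpI.dvd_finsetProd_iff]
      push Not
      exact fun j _ => ha j
    rw [jacobiSym.pow_right, jacobiSym.pow_right, pow_add, hsq]
    push_cast
    ring
end

lemma gs_prod (a : Fin 4 → ℤ) : ∀ d : ℕ, ∀ [NeZero d], (Nat.Coprime d (2 * ∏ j, a j).natAbs) →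
    ∀ ψ : AddChar (ZMod d) ℂ, ψ.IsPrimitive →
    ∏ j, gs ψ (a j : ZMod d) 0 = (jacobiSym (∏ j, a j) d : ℂ) * (d:ℂ) ^ 2 := by
  intro d
  induction d using Nat.recOnPosPrimePosCoprime with
  | prime_pow p n hp hn =>
    intro _ hcop ψ hψ
    have : Fact p.Prime := ⟨hp⟩
    obtain ⟨u, rfl⟩ := exists_std ψ hψ
    have hcop : Nat.Coprime p (2 * ∏ j, a j).natAbs := Nat.Coprime.coprime_dvd_left (dvd_pow_self p hn.ne') hcop
    have hnd : ¬ (p:ℤ) ∣ (2 * ∏ j, a j) := by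
      rw [Nat.Prime.coprime_iff_not_dvd hp] at hcop
      rwa [← Int.natCast_dvd] at hcop
    have hp2 : p ≠ 2 := by
      rintro rfl
      exact hnd ⟨_, rfl⟩
    have ha : ∀ j, ¬ (p:ℤ) ∣ a j := by
      intro j h
      exact hnd (Dvd.dvd.mul_left (h.trans (Finset.dvd_prod_of_mem _ (mem_univ j))) _)
    simp_rw [gs_mulShift, mul_zero]
    set w : ℤ := ((u : ZMod (p^n)).val : ℤ) with hw
    have hwu : (w : ZMod (p^n)) = u := by rw [hw]; simp
    have hwp : ¬ (p:ℤ) ∣ w := by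
      have h1 := ZMod.val_coe_unit_coprime u
      have h2 : Nat.Coprime (u : ZMod (p^n)).val p := Nat.Coprime.coprime_dvd_right (dvd_pow_self p hn.ne') h1
      rw [hw]
      rw [Nat.coprime_comm, Nat.Prime.coprime_iff_not_dvd hp] at h2
      exact_mod_cast h2
    have hpI : Prime (p:ℤ) := Nat.prime_iff_prime_int.1 hp
    have := gs_prime_pow p hp2 (fun j => w * a j) (fun j h => (hpI.dvd_or_dvd h).elim hwp (ha j)) n
    push_cast at this
    rw [hwu] at this
    rw [this]
    have hcw : (jacobiSym w (p^n)) ^ 2 = 1 := by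
      apply jacobiSym.sq_one
      rw [Int.gcd_comm, Int.isCoprime_iff_gcd_eq_one.symm]
      push_cast
      apply IsCoprime.pow_left
      rwa [hpI.coprime_iff_not_dvd]
    have h4 : jacobiSym (∏ j, w * a j) (p^n) = jacobiSym (∏ j, a j) (p^n) := by
      rw [Finset.prod_mul_distrib, Finset.prod_const, Finset.card_univ, Fintype.card_fin,
        jacobiSym.mul_left, jacobiSym.pow_left, show (jacobiSym w (p^n)) ^ 4 = (jacobiSym w (p^n) ^ 2) ^ 2 by ring, hcw, one_pow, one_mul]
    rw [h4]
    push_cast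
    ring
  | zero => intro h; exact absurd rfl h.out
  | one =>
    intro _ _ ψ _
    have : ∀ j, gs ψ (a j : ZMod 1) 0 = 1 := by
      intro j
      unfold gs
      rw [sum_zmod]
      simp
    rw [Finset.prod_congr rfl (fun j _ => this j)]
    simp
  | coprime d1 d2 h1 h2 hc ih1 ih2 =>
    intro _ hcop ψ hψ
    have : NeZero d1 := ⟨by omega⟩
    have : NeZero d2 := ⟨by omega⟩
    obtain ⟨ψ1, ψ2, hψ1, hψ2, hs⟩ := crt_split hc ψ hψ
    simp_rw [fun s t => gs_crt hc ψ ψ1 ψ2 hs s t]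
    rw [Finset.prod_mul_distrib]
    have i1 := ih1 (Nat.Coprime.coprime_dvd_left (dvd_mul_right _ _) hcop) ψ1 hψ1
    have i2 := ih2 (Nat.Coprime.coprime_dvd_left (dvd_mul_left _ _) hcop) ψ2 hψ2
    simp only [map_intCast, map_zero, Prod.fst_intCast, Prod.snd_intCast, Prod.fst_zero, Prod.snd_zero]
    rw [i1, i2, jacobiSym.mul_right]
    push_cast
    ring
end PF

namespace PF
open Finset

/-- complete exponential sum -/
noncomputable def Ssum (α β : Fin 4 → ℤ) (γ : ℤ) {d : ℕ} [NeZero d] (ψ : AddChar (ZMod d) ℂ) (c : Fin 4 → ZMod d) : ℂ :=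
  ∑ u : (ZMod d)ˣ, ψ (-(u * γ)) * ∏ j, gs ψ (u * α j) (u * β j + c j)

variable (α β : Fin 4 → ℤ) (γ : ℤ)

lemma Ssum_crt {d1 d2 : ℕ} [NeZero d1] [NeZero d2] [NeZero (d1 * d2)] (h : Nat.Coprime d1 d2)
    (ψ : AddChar (ZMod (d1 * d2)) ℂ) (ψ1 : AddChar (ZMod d1) ℂ) (ψ2 : AddChar (ZMod d2) ℂ)
    (hs : ∀ x, ψ x = ψ1 (ZMod.chineseRemainder h x).1 * ψ2 (ZMod.chineseRemainder h x).2)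
    (c : Fin 4 → ZMod (d1 * d2)) :
    Ssum α β γ ψ c = Ssum α β γ ψ1 (fun j => (ZMod.chineseRemainder h (c j)).1) *
      Ssum α β γ ψ2 (fun j => (ZMod.chineseRemainder h (c j)).2) := by
  unfold Ssum
  rw [Finset.sum_mul_sum, ← Fintype.sum_prod_type']
  apply Fintype.sum_equiv ((Units.mapEquiv (ZMod.chineseRemainder h).toMulEquiv).trans MulEquiv.prodUnits).toEquiv
  intro u
  rw [hs]
  simp_rw [fun s t => gs_crt h ψ ψ1 ψ2 hs s t]
  rw [Finset.prod_mul_distrib]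
  have h1 : (((MulEquiv.prodUnits (Units.mapEquiv (ZMod.chineseRemainder h).toMulEquiv u)).1 : (ZMod d1)ˣ) : ZMod d1) =
    (ZMod.chineseRemainder h u).1 := rfl
  have h2 : (((MulEquiv.prodUnits (Units.mapEquiv (ZMod.chineseRemainder h).toMulEquiv u)).2 : (ZMod d2)ˣ) : ZMod d2) =
    (ZMod.chineseRemainder h u).2 := rfl
  simp only [MulEquiv.toEquiv_eq_coe, EquivLike.coe_coe, MulEquiv.trans_apply, h1, h2]
  simp
  ring

section
variable {d : ℕ} [NeZero d] (ψ : AddChar (ZMod d) ℂ)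

lemma ann_unit_mul (hψ : ψ.IsPrimitive) (u : (ZMod d)ˣ) (x : ZMod d) : ann ((u : ZMod d) * x) = ann x := by
  unfold ann
  congr 1
  ext z
  simp [mul_assoc]

lemma Ssum_norm_le (hψ : ψ.IsPrimitive) (hα : ∀ j, 0 < α j) (c : Fin 4 → ZMod d) :
    ‖Ssum α β γ ψ c‖ ^ 2 ≤ (16 * ∏ j, (α j : ℝ)) * d ^ 6 := by
  have hd : 0 < d := Nat.pos_of_ne_zero (NeZero.ne d)
  set M : ℝ := Real.sqrt ((16 * ∏ j, (α j : ℝ)) * d ^ 4) with hM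
  have hprod : 0 < ∏ j, (α j : ℝ) := Finset.prod_pos fun j _ => by exact_mod_cast hα j
  have hM2 : M ^ 2 = (16 * ∏ j, (α j : ℝ)) * d ^ 4 := Real.sq_sqrt (by positivity)
  have key : ∀ u : (ZMod d)ˣ, ‖ψ (-(u * γ)) * ∏ j, gs ψ (u * α j) (u * β j + c j)‖ ≤ M := by
    intro u
    rw [norm_mul, AddChar.norm_apply, one_mul, norm_prod]
    apply Real.le_sqrt_of_sq_le
    rw [← Finset.prod_pow]
    calc ∏ j, ‖gs ψ (u * α j) (u * β j + c j)‖ ^ 2 ≤ ∏ j, ((d:ℝ) * (2 * α j)) := by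
          apply Finset.prod_le_prod (fun j _ => by positivity)
          intro j _
          refine (gs_norm_sq_le ψ hψ _ _).trans ?_
          gcongr
          have e : (2 * (u * α j) : ZMod d) = (u : ZMod d) * ((2 * α j : ℤ) : ZMod d) := by push_cast; ring
          rw [e, ann_unit_mul ψ hψ]
          have h1 := ann_intCast_le (d := d) (2 * α j)
          have h2 : ((2 * α j).gcd d : ℤ) ≤ 2 * α j :=
            Int.le_of_dvd (by have := hα j; omega) (Int.gcd_dvd_left _ _)
          have h3 : (ann ((2 * α j : ℤ) : ZMod d) : ℤ) ≤ 2 * α j := le_trans (by exact_mod_cast h1) h2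
          exact_mod_cast h3
      _ = _ := by
          rw [Finset.prod_mul_distrib, Finset.prod_mul_distrib]
          simp only [Finset.prod_const, Finset.card_univ, Fintype.card_fin]
          ring
  have h1 : ‖Ssum α β γ ψ c‖ ≤ d * M := by
    unfold Ssum
    refine (norm_sum_le _ _).trans ?_
    refine (Finset.sum_le_sum fun u _ => key u).trans ?_
    rw [Finset.sum_const, Finset.card_univ, ZMod.card_units_eq_totient, nsmul_eq_mul]
    gcongr
    exact Nat.totient_le d
  calc ‖Ssum α β γ ψ c‖ ^ 2 ≤ (d * M) ^ 2 := by gcongr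
    _ = _ := by rw [mul_pow, hM2]; ring

/-- discriminant-like quantity -/
def DD (α β : Fin 4 → ℤ) (γ : ℤ) : ℤ :=
  4 * (∏ j, α j) * γ + ∑ j, β j ^ 2 * ∏ i ∈ univ.erase j, α i

lemma unit_of_coprime (hψ : ψ.IsPrimitive) (a : ℤ) (h : Nat.Coprime d a.natAbs) : IsUnit (a : ZMod d) := by
  rw [ZMod.coe_int_isUnit_iff_isCoprime, Int.isCoprime_iff_gcd_eq_one]
  simpa [Int.gcd] using h

lemma Ssum_good (hψ : ψ.IsPrimitive) (hcop : Nat.Coprime d (2 * ∏ j, α j).natAbs) (c : Fin 4 → ZMod d) :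
    ∃ (κ y x : ZMod d), ((4 * ∏ j, α j : ℤ) : ZMod d) * x = - DD α β γ ∧ (c = 0 → y = 0 ∧ κ = 0) ∧
    Ssum α β γ ψ c = (jacobiSym (∏ j, α j) d : ℂ) * (d:ℂ) ^ 2 * ψ κ * Kl ψ x y := by
  have h2α : ∀ j, IsUnit (4 * α j : ZMod d) := by
    intro j
    have h1 := unit_of_coprime ψ hψ _ hcop
    push_cast at h1
    have h2 : IsUnit (2 : ZMod d) := isUnit_of_mul_isUnit_left h1
    have h3 : IsUnit (α j : ZMod d) :=
      isUnit_of_dvd_unit (Finset.dvd_prod_of_mem (fun j => (α j : ZMod d)) (mem_univ j)) (isUnit_of_mul_isUnit_right h1)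
    have : (4 : ZMod d) = 2 * 2 := by norm_num
    rw [this]
    exact (h2.mul h2).mul h3
  choose v hv using fun j => (h2α j).exists_left_inv
  refine ⟨-∑ j, 2 * β j * c j * v j, -∑ j, c j ^ 2 * v j, -(γ + ∑ j, β j ^ 2 * v j), ?_, ?_, ?_⟩
  · unfold DD
    push_cast
    have hv' : ∀ j, (4 * ∏ i, (α i : ZMod d)) * v j = ∏ i ∈ univ.erase j, (α i : ZMod d) := by
      intro j
      rw [← Finset.mul_prod_erase univ (fun i => (α i : ZMod d)) (mem_univ j)]
      linear_combination (∏ i ∈ univ.erase j, (α i : ZMod d)) * hv j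
    simp_rw [← hv']
    rw [mul_neg, mul_add, Finset.mul_sum]
    congr 2
    refine Finset.sum_congr rfl fun j _ => ?_
    ring
  · rintro rfl; simp
  · unfold Ssum Kl
    rw [Finset.mul_sum]
    refine Finset.sum_congr rfl fun u _ => ?_
    have hg : ∀ j, gs ψ (u * α j) (u * β j + c j) =
        ψ (-((u * β j + c j) ^ 2 * (v j * (u⁻¹ : (ZMod d)ˣ)))) * gs (ψ.mulShift (u : ZMod d)) (α j) 0 := by
      intro j
      rw [gs_mulShift, mul_zero]
      apply gs_square
      have := u.inv_mul
      linear_combination hv j * ((u⁻¹ : (ZMod d)ˣ) : ZMod d) * u + this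
    simp_rw [hg]
    rw [Finset.prod_mul_distrib, gs_prod α d hcop _ (isPrimitive_mulShift ψ hψ u)]
    have hpr : ∀ f : Fin 4 → ZMod d, ∏ j, ψ (f j) = ψ (∑ j, f j) := by
      intro f; simp only [Fin.prod_univ_four, Fin.sum_univ_four, AddChar.map_add_eq_mul]
    rw [hpr]
    have e : -((u : ZMod d) * γ) + ∑ j, -(((u : ZMod d) * β j + c j) ^ 2 * (v j * (u⁻¹ : (ZMod d)ˣ))) =
        (-∑ j, 2 * β j * c j * v j) + ((-(γ + ∑ j, β j ^ 2 * v j)) * u + (-∑ j, c j ^ 2 * v j) * (u⁻¹ : (ZMod d)ˣ)) := by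
      simp_rw [Finset.sum_neg_distrib]
      have : ∀ j, ((u : ZMod d) * β j + c j) ^ 2 * (v j * (u⁻¹ : (ZMod d)ˣ)) =
          2 * β j * c j * v j + (β j ^ 2 * v j * u + c j ^ 2 * v j * (u⁻¹ : (ZMod d)ˣ)) := by
        intro j
        have := u.mul_inv
        linear_combination (β j ^ 2 * v j * u + 2 * β j * c j * v j) * this
      simp_rw [this, Finset.sum_add_distrib, ← Finset.sum_mul]
      ring
    calc _ = (jacobiSym (∏ j, α j) d : ℂ) * (d:ℂ) ^ 2 * (ψ (-((u : ZMod d) * γ)) *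
            ψ (∑ j, -(((u : ZMod d) * β j + c j) ^ 2 * (v j * (u⁻¹ : (ZMod d)ˣ))))) := by ring
      _ = _ := by rw [← AddChar.map_add_eq_mul, e, AddChar.map_add_eq_mul]; ring

lemma Ssum_good_norm (hψ : ψ.IsPrimitive) (hcop : Nat.Coprime d (2 * ∏ j, α j).natAbs) (c : Fin 4 → ZMod d) :
    ‖Ssum α β γ ψ c‖ ^ 4 ≤ (Int.gcd (DD α β γ) d : ℝ) * d ^ 11 * (d.divisors.card : ℝ) ^ 3 := by
  obtain ⟨κ, y, x, hx, -, hS⟩ := Ssum_good α β γ ψ hψ hcop c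
  have hu := unit_of_coprime ψ hψ _ hcop
  push_cast at hu
  have h2 : IsUnit (2 : ZMod d) := isUnit_of_mul_isUnit_left hu
  have hK := Kl_bound ψ hψ h2 x y
  have hann : ann x ≤ Int.gcd (DD α β γ) d := by
    obtain ⟨u, hu'⟩ := h2.mul hu
    have e : (u : ZMod d) * x = ((-DD α β γ : ℤ) : ZMod d) := by
      rw [hu']; push_cast at hx ⊢; rw [← hx]; ring
    rw [← ann_unit_mul ψ hψ u x, e]
    refine (ann_intCast_le _).trans ?_
    rw [Int.neg_gcd]
  have hj : ‖(jacobiSym (∏ j, α j) d : ℂ)‖ ≤ 1 := by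
    rcases jacobiSym.trichotomy (∏ j, α j) d with h | h | h <;> rw [h] <;> simp
  rw [hS, norm_mul, norm_mul, norm_mul, AddChar.norm_apply, norm_pow, Complex.norm_natCast, mul_one]
  calc (‖(jacobiSym (∏ j, α j) d : ℂ)‖ * (d:ℝ) ^ 2 * ‖Kl ψ x y‖) ^ 4 ≤ (1 * (d:ℝ) ^ 2 * ‖Kl ψ x y‖) ^ 4 := by gcongr
    _ = (d:ℝ) ^ 8 * ‖Kl ψ x y‖ ^ 4 := by ring
    _ ≤ (d:ℝ) ^ 8 * ((ann x : ℝ) * d ^ 3 * (d.divisors.card : ℝ) ^ 3) := by gcongr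
    _ ≤ (d:ℝ) ^ 8 * ((Int.gcd (DD α β γ) d : ℝ) * d ^ 3 * (d.divisors.card : ℝ) ^ 3) := by gcongr
    _ = _ := by ring

end

lemma decomp (B : ℕ) (hB : 0 < B) : ∀ d : ℕ, 0 < d → ∃ d1 d2 : ℕ, d = d1 * d2 ∧ Nat.Coprime d1 d2 ∧ Nat.Coprime d2 B ∧
    (∀ p, p.Prime → p ∣ d1 → p ∣ B) ∧ (∀ j, d1 ≤ 2 ^ j → d1 ∣ B ^ j) := by
  intro d
  induction d using Nat.strong_induction_on with
  | _ d ih =>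
    intro hd
    by_cases hc : Nat.Coprime d B
    · refine ⟨1, d, by simp, by simp, hc, ?_, by simp⟩
      intro p hp h
      exact absurd (Nat.dvd_one.1 h) hp.ne_one
    · obtain ⟨p, hp, hpd, hpB⟩ := Nat.Prime.not_coprime_iff_dvd.1 hc
      obtain ⟨e, d', hnd, rfl⟩ := Nat.exists_eq_pow_mul_and_not_dvd hd.ne' p hp.ne_one
      have he : 0 < e := by
        rcases Nat.eq_zero_or_pos e with rfl | h
        · simp at hpd; exact absurd hpd hnd
        · exact h
      have hd' : 0 < d' := Nat.pos_of_mul_pos_left hd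
      have hlt : d' < p ^ e * d' := by
        have : 2 ≤ p ^ e := hp.two_le.trans (Nat.le_self_pow he.ne' p)
        nlinarith
      obtain ⟨d1, d2, rfl, h12, h2B, hpr, hj⟩ := ih d' hlt hd'
      refine ⟨p ^ e * d1, d2, by ring, ?_, h2B, ?_, ?_⟩
      · apply Nat.Coprime.mul_left _ h12
        apply Nat.Coprime.pow_left
        rw [Nat.Prime.coprime_iff_not_dvd hp]
        exact fun h => hnd (Dvd.dvd.mul_left h _)
      · intro q hq h
        rcases (Nat.Prime.dvd_mul hq).1 h with h | h
        · have := (Nat.prime_dvd_prime_iff_eq hq hp).1 (hq.dvd_of_dvd_pow h)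
          rw [this]; exact hpB
        · exact hpr q hq h
      · intro j hle
        have h1 : 0 < d1 := Nat.pos_of_mul_pos_right hd'
        have h2e : 2 ^ e * d1 ≤ 2 ^ j := le_trans (Nat.mul_le_mul_right _ (Nat.pow_le_pow_left hp.two_le e)) hle
        have hej : e ≤ j := by
          by_contra hlt'
          have : 2 ^ j < 2 ^ e := Nat.pow_lt_pow_right (by norm_num) (by omega)
          have h4 : 2 ^ e * 1 ≤ 2 ^ e * d1 := Nat.mul_le_mul_left _ h1
          omega
        obtain ⟨i, rfl⟩ := Nat.exists_eq_add_of_le hej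
        rw [pow_add] at h2e
        have := hj i (Nat.le_of_mul_le_mul_left h2e (by positivity))
        rw [pow_add]
        exact mul_dvd_mul (pow_dvd_pow_of_dvd hpB e) this

lemma Ssum_bound (hα : ∀ j, 0 < α j) {d : ℕ} [NeZero d] (ψ : AddChar (ZMod d) ℂ) (hψ : ψ.IsPrimitive) (c : Fin 4 → ZMod d)
    (j : ℕ) (hj : d ≤ 2 ^ j) :
    ‖Ssum α β γ ψ c‖ ^ 4 ≤ (16 * ∏ j, (α j : ℝ)) ^ 2 * (d:ℝ) ^ 11 *
      (Nat.gcd d ((DD α β γ).natAbs * (2 * ∏ j, α j).natAbs ^ j) : ℝ) * (d.divisors.card : ℝ) ^ 3 := by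
  have hd : 0 < d := Nat.pos_of_ne_zero (NeZero.ne d)
  have hprod : 0 < ∏ j, α j := Finset.prod_pos fun j _ => hα j
  have hBpos : 0 < (2 * ∏ j, α j).natAbs := Int.natAbs_pos.2 (by positivity)
  set B := (2 * ∏ j, α j).natAbs with hB
  obtain ⟨d1, d2, hdd, h12, h2B, hpr, hdj⟩ := decomp B hBpos d hd
  subst hdd
  have hd1 : 0 < d1 := Nat.pos_of_mul_pos_right hd
  have hd2 : 0 < d2 := Nat.pos_of_mul_pos_left hd
  have : NeZero d1 := ⟨hd1.ne'⟩
  have : NeZero d2 := ⟨hd2.ne'⟩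
  obtain ⟨ψ1, ψ2, hψ1, hψ2, hs⟩ := crt_split h12 ψ hψ
  rw [Ssum_crt α β γ h12 ψ ψ1 ψ2 hs, norm_mul, mul_pow]
  set c1 : Fin 4 → ZMod d1 := fun j => (ZMod.chineseRemainder h12 (c j)).1
  set c2 : Fin 4 → ZMod d2 := fun j => (ZMod.chineseRemainder h12 (c j)).2
  have hb1 := Ssum_norm_le α β γ ψ1 hψ1 hα c1
  have hb2 := Ssum_good_norm α β γ ψ2 hψ2 h2B c2
  have hprodR : 0 < ∏ j, (α j : ℝ) := by exact_mod_cast hprod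
  have hb1' : ‖Ssum α β γ ψ1 c1‖ ^ 4 ≤ (16 * ∏ j, (α j : ℝ)) ^ 2 * (d1:ℝ) ^ 12 := by
    calc ‖Ssum α β γ ψ1 c1‖ ^ 4 = (‖Ssum α β γ ψ1 c1‖ ^ 2) ^ 2 := by ring
      _ ≤ ((16 * ∏ j, (α j : ℝ)) * d1 ^ 6) ^ 2 := by gcongr
      _ = _ := by ring
  have htau : d2.divisors.card ≤ (d1 * d2).divisors.card :=
    Finset.card_le_card (Nat.divisors_subset_of_dvd hd.ne' (dvd_mul_left _ _))
  have hg : d1 * Int.gcd (DD α β γ) d2 ≤ Nat.gcd (d1 * d2) ((DD α β γ).natAbs * B ^ j) := by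
    apply Nat.le_of_dvd (Nat.gcd_pos_of_pos_left _ hd)
    apply Nat.dvd_gcd
    · apply mul_dvd_mul_left
      have : (Int.gcd (DD α β γ) d2 : ℤ) ∣ (d2 : ℤ) := Int.gcd_dvd_right _ _
      exact_mod_cast this
    · rw [mul_comm]
      apply mul_dvd_mul
      · exact Int.natCast_dvd.1 (Int.gcd_dvd_left (DD α β γ) (d2:ℤ))
      · apply hdj
        exact le_trans (Nat.le_mul_of_pos_right _ hd2) hj
  have hg' : (d1:ℝ) * (Int.gcd (DD α β γ) d2 : ℝ) ≤ (Nat.gcd (d1 * d2) ((DD α β γ).natAbs * B ^ j) : ℝ) := by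
    exact_mod_cast hg
  calc _ ≤ ((16 * ∏ j, (α j : ℝ)) ^ 2 * (d1:ℝ) ^ 12) *
      ((Int.gcd (DD α β γ) d2 : ℝ) * d2 ^ 11 * (d2.divisors.card : ℝ) ^ 3) := by gcongr
    _ = (16 * ∏ j, (α j : ℝ)) ^ 2 * ((d1:ℝ) * d2) ^ 11 * (d1 * (Int.gcd (DD α β γ) d2 : ℝ)) * (d2.divisors.card : ℝ) ^ 3 := by ring
    _ ≤ _ := by
      push_cast
      gcongr

/-- Ramanujan sum -/
noncomputable def ram (d : ℕ) [NeZero d] (n : ℤ) : ℂ := ∑ u : (ZMod d)ˣ, ZMod.stdAddChar (N := d) ((u : ZMod d) * n)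

lemma Ssum_zero_bad (hα0 : ∀ p : ℕ, p.Prime → (p:ℤ) ∣ 2 * ∏ j, α j → (p:ℤ) ∣ α 0)
    (hβ0 : IsCoprime (β 0) (2 * ∏ j, α j)) (hB : 2 * ∏ j, α j ≠ 0) {d : ℕ} [NeZero d]
    (ψ : AddChar (ZMod d) ℂ) (hψ : ψ.IsPrimitive) (hc : ¬ Nat.Coprime d (2 * ∏ j, α j).natAbs) :
    Ssum α β γ ψ 0 = 0 := by
  have hd : 0 < d := Nat.pos_of_ne_zero (NeZero.ne d)
  have hBpos : 0 < (2 * ∏ j, α j).natAbs := Int.natAbs_pos.2 hB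
  set B := (2 * ∏ j, α j).natAbs with hBdef
  obtain ⟨d1, d2, hdd, h12, h2B, hpr, hdj⟩ := decomp B hBpos d hd
  subst hdd
  have hd1 : 0 < d1 := Nat.pos_of_mul_pos_right hd
  have hd2 : 0 < d2 := Nat.pos_of_mul_pos_left hd
  have : NeZero d1 := ⟨hd1.ne'⟩
  have : NeZero d2 := ⟨hd2.ne'⟩
  have hd1' : d1 ≠ 1 := by rintro rfl; rw [one_mul] at hc; exact hc h2B
  obtain ⟨ψ1, ψ2, hψ1, hψ2, hs⟩ := crt_split h12 ψ hψ
  rw [Ssum_crt α β γ h12 ψ ψ1 ψ2 hs]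
  apply mul_eq_zero_of_left
  unfold Ssum
  apply Finset.sum_eq_zero
  intro u _
  apply mul_eq_zero_of_right
  apply Finset.prod_eq_zero (mem_univ 0)
  have hun : ∀ t : ℤ, IsUnit ((α 0 * t + β 0 : ℤ) : ZMod d1) := by
    intro t
    apply unit_of_coprime ψ1 hψ1
    rw [Nat.coprime_iff_isRelPrime, ← Nat.coprime_iff_isRelPrime]
    apply Nat.Coprime.symm
    apply Nat.coprime_of_dvd
    intro p hp h1 h2
    have hpB := hpr p hp h2
    have hpB' : (p:ℤ) ∣ 2 * ∏ j, α j := Int.natCast_dvd.2 hpB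
    have hpα := hα0 p hp hpB'
    have h1' : (p:ℤ) ∣ α 0 * t + β 0 := Int.natCast_dvd.2 h1
    have hpβ : (p:ℤ) ∣ β 0 := (Int.dvd_add_right (Dvd.dvd.mul_right hpα t)).1 h1'
    have := hβ0.isUnit_of_dvd' hpβ hpB'
    have hpI : Prime (p:ℤ) := Nat.prime_iff_prime_int.1 hp
    exact hpI.not_isUnit this
  have hinj : Function.Injective (fun x : ZMod d1 => (α 0 : ZMod d1) * x ^ 2 + β 0 * x) := by
    intro x y hxy
    simp only at hxy
    have h1 := hun ((x.val : ℤ) + y.val)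
    push_cast at h1
    simp only [ZMod.natCast_val, ZMod.cast_id', id] at h1
    have h2 : ((α 0 : ZMod d1) * (x + y) + β 0) * (x - y) = 0 := by linear_combination hxy
    exact sub_eq_zero.1 ((h1.mul_right_eq_zero).1 h2)
  have hbij := Finite.injective_iff_bijective.1 hinj
  have e : gs ψ1 (u * α 0) (u * β 0 + (ZMod.chineseRemainder h12 ((0 : Fin 4 → ZMod (d1*d2)) 0)).1) = ∑ z : ZMod d1, ψ1 (z * u) := by
    unfold gs
    apply Fintype.sum_bijective _ hbij
    intro x
    congr 1
    simp
    ring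
  rw [e, AddChar.sum_mulShift _ hψ1]
  have : (u : ZMod d1) ≠ 0 := by
    have : Fact (1 < d1) := ⟨by omega⟩
    exact u.ne_zero
  simp [this]

lemma Ssum_zero_good {d : ℕ} [NeZero d] (hcop : Nat.Coprime d (2 * ∏ j, α j).natAbs) :
    Ssum α β γ (ZMod.stdAddChar (N := d)) 0 = (jacobiSym (∏ j, α j) d : ℂ) * (d:ℂ) ^ 2 * ram d (DD α β γ) := by
  have hψ := ZMod.isPrimitive_stdAddChar d
  obtain ⟨κ, y, x, hx, h0, hS⟩ := Ssum_good α β γ _ hψ hcop 0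
  obtain ⟨rfl, rfl⟩ := h0 rfl
  rw [hS, AddChar.map_zero_eq_one, mul_one]
  congr 1
  have hu := unit_of_coprime _ hψ _ hcop
  push_cast at hu
  have h2 : IsUnit (2 : ZMod d) := isUnit_of_mul_isUnit_left hu
  obtain ⟨v, hv⟩ := (h2.mul hu).neg
  unfold Kl ram
  symm
  apply Fintype.sum_equiv (Equiv.mulLeft v)
  intro u
  simp only [Equiv.coe_mulLeft, Units.val_mul, zero_mul, add_zero]
  congr 1
  push_cast at hx
  rw [hv]
  linear_combination (u : ZMod d) * hx
end PF

namespace PF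
open Finset

/-- Ramanujan sum, concrete -/
noncomputable def cram (d : ℕ) (n : ℤ) : ℂ :=
  ∑ a ∈ (range d).filter (fun a => d.gcd a = 1), Complex.exp (2 * Real.pi * Complex.I * ((a * n : ℤ) : ℂ) / d)

lemma ram_eq_cram (d : ℕ) [NeZero d] (n : ℤ) : ram d n = cram d n := by
  unfold ram cram
  refine Finset.sum_bij' (fun (u : (ZMod d)ˣ) _ => (u : ZMod d).val)
    (fun a ha => ZMod.unitOfCoprime a (by
      simp only [mem_filter] at ha
      rw [Nat.coprime_comm]; exact ha.2)) ?hi ?hj ?l ?r ?e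
  case hi =>
    intro u _
    simp only [mem_filter, mem_range]
    refine ⟨ZMod.val_lt _, ?_⟩
    have := ZMod.val_coe_unit_coprime u
    rwa [Nat.coprime_comm] at this
  case hj => simp
  case l =>
    intro u _
    ext; simp
  case r =>
    intro a ha
    simp only [mem_filter, mem_range] at ha
    simp only [ZMod.coe_unitOfCoprime]
    exact ZMod.val_cast_of_lt ha.1
  case e =>
    intro u _
    rw [← ZMod.stdAddChar_coe]
    congr 1
    push_cast
    simp

lemma sum_cram (q : ℕ) (hq : 0 < q) (n : ℤ) :
    ∑ d ∈ q.divisors, cram d n = if (q:ℤ) ∣ n then (q:ℂ) else 0 := by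
  have : NeZero q := ⟨hq.ne'⟩
  have h1 : ∑ x : ZMod q, ZMod.stdAddChar (N := q) (x * (n : ZMod q)) = if (q:ℤ) ∣ n then (q:ℂ) else 0 := by
    rw [AddChar.sum_mulShift _ (ZMod.isPrimitive_stdAddChar q), ZMod.card]
    simp only [ZMod.intCast_zmod_eq_zero_iff_dvd]
    split_ifs <;> simp
  rw [← h1, sum_zmod]
  rw [← Finset.sum_fiberwise_of_maps_to (s := range q) (t := q.divisors) (g := fun a => q.gcd a)
    (fun a _ => Nat.mem_divisors.2 ⟨Nat.gcd_dvd_left _ _, hq.ne'⟩)]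
  rw [← Nat.sum_div_divisors q (fun d => cram d n)]
  refine Finset.sum_congr rfl fun g hg => ?_
  have hgq := (Nat.mem_divisors.1 hg).1
  have hg0 : 0 < g := Nat.pos_of_mem_divisors hg
  obtain ⟨e, rfl⟩ := hgq
  have he : 0 < e := Nat.pos_of_mul_pos_left hq
  rw [Nat.mul_div_cancel_left _ hg0]
  unfold cram
  apply Finset.sum_bij' (fun a _ => g * a) (fun b _ => b / g)
  · intro a ha
    simp only [mem_filter, mem_range] at ha ⊢
    refine ⟨(Nat.mul_lt_mul_left hg0).2 ha.1, ?_⟩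
    rw [Nat.gcd_mul_left, ha.2, mul_one]
  · intro b hb
    simp only [mem_filter, mem_range] at hb ⊢
    obtain ⟨c, rfl⟩ : g ∣ b := by rw [← hb.2]; exact Nat.gcd_dvd_right _ _
    rw [Nat.mul_div_cancel_left _ hg0]
    refine ⟨(Nat.mul_lt_mul_left hg0).1 hb.1, ?_⟩
    have := hb.2
    rw [Nat.gcd_mul_left] at this
    exact Nat.eq_of_mul_eq_mul_left hg0 (by rw [this, mul_one])
  · intro a _; exact Nat.mul_div_cancel_left _ hg0
  · intro b hb
    simp only [mem_filter, mem_range] at hb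
    exact Nat.mul_div_cancel' (by rw [← hb.2]; exact Nat.gcd_dvd_right _ _)
  · intro a _
    have e1 : (((g * a : ℕ) : ZMod (g * e)) * (n : ZMod (g*e))) = ((g * a * n : ℤ) : ZMod (g * e)) := by push_cast; ring
    rw [e1, ZMod.stdAddChar_coe]
    congr 1
    have : (g:ℂ) ≠ 0 := by exact_mod_cast hg0.ne'
    have : (e:ℂ) ≠ 0 := by exact_mod_cast he.ne'
    push_cast
    field_simp

/-- Ramanujan sum, arithmetic formula -/
noncomputable def crr (d : ℕ) (n : ℤ) : ℝ :=
  ∑ g ∈ d.divisors, if (g:ℤ) ∣ n then (g:ℝ) * (ArithmeticFunction.moebius (d / g) : ℝ) else 0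

lemma cram_eq_crr (d : ℕ) (hd : 0 < d) (n : ℤ) : cram d n = (crr d n : ℂ) := by
  have h := (ArithmeticFunction.sum_eq_iff_sum_mul_moebius_eq (f := fun d => cram d n)
    (g := fun q => if (q:ℤ) ∣ n then (q:ℂ) else 0)).1 (fun q hq => sum_cram q hq n) d hd
  rw [← h, Nat.sum_divisorsAntidiagonal' (fun x y => ((ArithmeticFunction.moebius x : ℤ) : ℂ) * if (y:ℤ) ∣ n then (y:ℂ) else 0)]
  unfold crr
  push_cast
  refine Finset.sum_congr rfl fun g _ => ?_
  split_ifs <;> push_cast <;> ring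

lemma crr_abs_le (d : ℕ) (hd : 0 < d) (D : ℕ) (hD : 0 < D) : |crr d D| ≤ d.gcd D * D.divisors.card := by
  unfold crr
  refine (Finset.abs_sum_le_sum_abs _ _).trans ?_
  calc _ ≤ ∑ g ∈ D.divisors, (d.gcd D : ℝ) := by
        rw [← Finset.sum_filter_add_sum_filter_not d.divisors (fun g : ℕ => (g:ℤ) ∣ (D:ℤ))]
        rw [Finset.sum_congr (g := fun _ => (0:ℝ)) (s₁ := d.divisors.filter (fun g : ℕ => ¬ (g:ℤ) ∣ (D:ℤ))) rfl
          (fun g hg => by rw [mem_filter] at hg; rw [if_neg hg.2]; simp), Finset.sum_const_zero, add_zero]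
        have hsub : d.divisors.filter (fun g : ℕ => (g:ℤ) ∣ (D:ℤ)) ⊆ D.divisors := by
          intro g hg
          simp only [mem_filter, Nat.mem_divisors] at hg ⊢
          exact ⟨by exact_mod_cast hg.2, hD.ne'⟩
        refine le_trans ?_ (Finset.sum_le_sum_of_subset_of_nonneg hsub (fun _ _ _ => by positivity))
        apply Finset.sum_le_sum
        intro g hg
        simp only [mem_filter, Nat.mem_divisors] at hg
        rw [if_pos hg.2, abs_mul, Nat.abs_cast]
        have h1 : |((ArithmeticFunction.moebius (d / g) : ℤ) : ℝ)| ≤ 1 := by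
          exact_mod_cast ArithmeticFunction.abs_moebius_le_one
        have h2 : g ≤ d.gcd D := Nat.le_of_dvd (Nat.gcd_pos_of_pos_left _ hd)
          (Nat.dvd_gcd hg.1.1 (by exact_mod_cast hg.2))
        have h2' : (g:ℝ) ≤ d.gcd D := by exact_mod_cast h2
        calc (g:ℝ) * _ ≤ g * 1 := by gcongr
          _ ≤ _ := by rw [mul_one]; exact h2'
    _ = _ := by simp [mul_comm]

section
variable (h : ℕ → ℝ)

lemma sum_div_ge (h1 : h 1 = 1) (hm : ∀ a b, h (a * b) = h a * h b) (hb : ∀ a, |h a| ≤ 1) (h2 : h 2 = 0) : ∀ D : ℕ, 0 < D → 1 / (D.divisors.card : ℝ) ≤ ∑ g ∈ D.divisors, h g / g := by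
  intro D
  induction D using Nat.recOnPosPrimePosCoprime with
  | prime_pow p n hp hn =>
    intro _
    rw [Nat.sum_divisors_prime_pow hp, Nat.divisors_prime_pow hp, Finset.card_map, Finset.card_range]
    have hpow : ∀ i, h (p ^ i) / ((p ^ i : ℕ) : ℝ) = (h p / p) ^ i := by
      intro i
      induction i with
      | zero => simp [h1]
      | succ i ih => rw [pow_succ, hm, pow_succ, ← ih]; push_cast; rw [mul_div_mul_comm]
    simp_rw [hpow]
    have hx : |h p / p| ≤ 1 / 2 := by
      rw [abs_div, Nat.abs_cast]
      have : (2:ℝ) ≤ p := by exact_mod_cast hp.two_le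
      rw [div_le_div_iff₀ (by linarith) (by norm_num)]
      have := hb p
      linarith
    set x := h p / p
    have hg := mul_neg_geom_sum x (n+1)
    have hxp : x ^ (n+1) ≤ 1 / 4 := by
      calc x ^ (n+1) ≤ |x ^ (n+1)| := le_abs_self _
        _ = |x| ^ (n+1) := abs_pow _ _
        _ ≤ (1/2) ^ (n+1) := by gcongr
        _ ≤ (1/2) ^ 2 := pow_le_pow_of_le_one (by norm_num) (by norm_num) (by omega)
        _ = 1/4 := by norm_num
    rw [abs_le] at hx
    have hS : (1:ℝ)/2 ≤ ∑ i ∈ range (n+1), x ^ i := by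
      set S := ∑ i ∈ range (n+1), x ^ i
      by_contra hlt
      push Not at hlt
      have : (1 - x) * S < 3 / 4 := by nlinarith
      linarith
    refine le_trans ?_ hS
    have : (1:ℝ) ≤ n := by exact_mod_cast hn
    push_cast
    rw [div_le_div_iff₀ (by linarith) (by norm_num)]
    linarith
  | zero => intro h; omega
  | one => intro _; simp [h1]
  | coprime a b ha hb' hab iha ihb =>
    intro _
    have := iha (by omega)
    have := ihb (by omega)
    rw [Nat.Coprime.card_divisors_mul hab]
    have e : ∑ g ∈ (a * b).divisors, h g / g = (∑ g ∈ a.divisors, h g / g) * ∑ g ∈ b.divisors, h g / g := by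
      rw [Nat.divisors_mul, Finset.mul_def, Finset.sum_image hab.mul_injOn_divisors, Finset.sum_product, Finset.sum_mul_sum]
      refine Finset.sum_congr rfl fun x _ => Finset.sum_congr rfl fun y _ => ?_
      simp only [hm]
      push_cast
      rw [mul_div_mul_comm]
    rw [e]
    push_cast
    rw [← one_div_mul_one_div]
    have h5 : (0:ℝ) ≤ ∑ g ∈ a.divisors, h g / g := le_trans (by positivity) (iha (by omega))
    gcongr

/-- inner sum -/
noncomputable def II (n : ℕ) : ℝ := ∑ e ∈ Icc 1 n, h e * (ArithmeticFunction.moebius e : ℝ) / (e:ℝ)^2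

lemma term_le (h1 : h 1 = 1) (hm : ∀ a b, h (a * b) = h a * h b) (hb : ∀ a, |h a| ≤ 1) (h2 : h 2 = 0) (e : ℕ) : |h e * (ArithmeticFunction.moebius e : ℝ) / (e:ℝ)^2| ≤ 1 / (e:ℝ)^2 := by
  rw [abs_div, abs_mul, abs_of_nonneg (by positivity : (0:ℝ) ≤ (e:ℝ)^2)]
  have h3 : |((ArithmeticFunction.moebius e : ℤ) : ℝ)| ≤ 1 := by
    exact_mod_cast ArithmeticFunction.abs_moebius_le_one
  gcongr
  calc _ ≤ (1:ℝ) * 1 := by gcongr; exact hb e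
    _ = 1 := by norm_num

lemma II_diff (h1 : h 1 = 1) (hm : ∀ a b, h (a * b) = h a * h b) (hb : ∀ a, |h a| ≤ 1) (h2 : h 2 = 0) (a b : ℕ) (hab : a ≤ b) : |II h b - II h a| ≤ 2 / (a + 1) := by
  have : II h b = II h a + ∑ e ∈ Ioc a b, h e * (ArithmeticFunction.moebius e : ℝ) / (e:ℝ)^2 := by
    unfold II
    have : Icc 1 b = Icc 1 a ∪ Ioc a b := by ext; simp; omega
    rw [this, Finset.sum_union]
    rw [Finset.disjoint_left]; intro x; simp; omega
  rw [this, add_sub_cancel_left]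
  refine (Finset.abs_sum_le_sum_abs _ _).trans ?_
  refine (Finset.sum_le_sum fun e _ => term_le h h1 hm hb h2 e).trans ?_
  exact sum_inv_sq_le' a b

lemma II_ge (h1 : h 1 = 1) (hm : ∀ a b, h (a * b) = h a * h b) (hb : ∀ a, |h a| ≤ 1) (h2 : h 2 = 0) (n : ℕ) (hn : 1 ≤ n) : 3 / 4 ≤ II h n := by
  have h0 : II h n = 1 + ∑ e ∈ Ioc 1 n, h e * (ArithmeticFunction.moebius e : ℝ) / (e:ℝ)^2 := by
    unfold II
    have : Icc 1 n = insert 1 (Ioc 1 n) := by ext; simp; omega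
    rw [this, Finset.sum_insert (by simp)]
    simp [h1]
  have hodd : ∀ k : ℕ, ∑ e ∈ Ioc 1 (2 * k + 1), (if Odd e then 1 / (e:ℝ)^2 else 0) ≤ 1 / 4 - 1 / (4 * ((k:ℝ) + 1)) := by
    intro k
    induction k with
    | zero => simp
    | succ k ih =>
      rw [show 2 * (k + 1) + 1 = 2 * k + 1 + 1 + 1 by ring, Finset.sum_Ioc_succ_top (by omega), Finset.sum_Ioc_succ_top (by omega)]
      rw [if_neg (by simp; exact ⟨k+1, by ring⟩), if_pos ⟨k+1, by ring⟩]
      have : (1:ℝ) / ((2 * k + 2 + 1 : ℕ) : ℝ)^2 ≤ 1 / (4 * (k+1)) - 1 / (4 * (((k+1 : ℕ):ℝ) + 1)) := by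
        push_cast
        rw [div_sub_div _ _ (by positivity) (by positivity), div_le_div_iff₀ (by positivity) (by positivity)]
        nlinarith
      linarith
  have hle : |∑ e ∈ Ioc 1 n, h e * (ArithmeticFunction.moebius e : ℝ) / (e:ℝ)^2| ≤ 1 / 4 := by
    refine (Finset.abs_sum_le_sum_abs _ _).trans ?_
    calc _ ≤ ∑ e ∈ Ioc 1 n, (if Odd e then 1 / (e:ℝ)^2 else 0) := by
          apply Finset.sum_le_sum
          intro e _
          split_ifs with ho
          · exact term_le h h1 hm hb h2 e
          · rw [Nat.not_odd_iff_even] at ho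
            obtain ⟨k, rfl⟩ := ho.two_dvd
            rw [hm, h2]; simp
      _ ≤ ∑ e ∈ Ioc 1 (2 * n + 1), (if Odd e then 1 / (e:ℝ)^2 else 0) := by
          apply Finset.sum_le_sum_of_subset_of_nonneg
          · intro x; simp; omega
          · intro e _ _; split_ifs <;> positivity
      _ ≤ _ := by
          have := hodd n
          have : (0:ℝ) ≤ 1 / (4 * (n + 1)) := by positivity
          linarith
  rw [abs_le] at hle
  linarith

lemma sing_ge (h1 : h 1 = 1) (hm : ∀ a b, h (a * b) = h a * h b) (hb : ∀ a, |h a| ≤ 1) (h2 : h 2 = 0) (D Y : ℕ) (hD : 0 < D) (hY : 0 < Y) :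
    3 / 4 / (D.divisors.card : ℝ) - 2 * D.divisors.card / Y ≤ ∑ d ∈ Icc 1 Y, h d * crr d D / (d:ℝ)^2 := by
  have key : ∑ d ∈ Icc 1 Y, h d * crr d D / (d:ℝ)^2 = ∑ g ∈ D.divisors, h g / g * II h (Y / g) := by
    have e1 : ∀ d ∈ Icc 1 Y, h d * crr d D / (d:ℝ)^2 = ∑ g ∈ D.divisors, if g ∣ d then
        h d * (g * (ArithmeticFunction.moebius (d / g) : ℝ)) / (d:ℝ)^2 else 0 := by
      intro d hd
      have hd0 : d ≠ 0 := by simp at hd; omega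
      unfold crr
      rw [Finset.mul_sum, Finset.sum_div, ← Finset.sum_filter]
      have : D.divisors.filter (fun g => g ∣ d) = d.divisors.filter (fun g => g ∣ D) := by
        ext g; simp [hD.ne', hd0]; tauto
      rw [this, Finset.sum_filter]
      refine Finset.sum_congr rfl fun g _ => ?_
      simp only [Int.natCast_dvd_natCast]
      split_ifs <;> simp
    rw [Finset.sum_congr rfl e1, Finset.sum_comm]
    refine Finset.sum_congr rfl fun g hg => ?_
    have hg0 : 0 < g := Nat.pos_of_mem_divisors hg
    have hgR : (g:ℝ) ≠ 0 := by exact_mod_cast hg0.ne'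
    rw [← Finset.sum_filter, II, Finset.mul_sum]
    apply Finset.sum_bij' (fun d _ => d / g) (fun e _ => g * e)
    · intro d hd
      simp only [mem_filter, mem_Icc] at hd ⊢
      obtain ⟨⟨h1, h2⟩, c, rfl⟩ := hd
      rw [Nat.mul_div_cancel_left _ hg0]
      refine ⟨Nat.pos_of_ne_zero ?_, (Nat.le_div_iff_mul_le hg0).2 (by rwa [mul_comm])⟩
      rintro rfl; omega
    · intro e he
      simp only [mem_filter, mem_Icc] at he ⊢
      refine ⟨⟨?_, ?_⟩, dvd_mul_right _ _⟩
      · exact Nat.mul_pos hg0 he.1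
      · have := (Nat.le_div_iff_mul_le hg0).1 he.2; rwa [mul_comm]
    · intro d hd
      simp only [mem_filter] at hd
      exact Nat.mul_div_cancel' hd.2
    · intro e he
      exact Nat.mul_div_cancel_left _ hg0
    · intro d hd
      simp only [mem_filter, mem_Icc] at hd
      obtain ⟨⟨h1', h2'⟩, c, rfl⟩ := hd
      rw [Nat.mul_div_cancel_left _ hg0, hm]
      have : (c:ℝ) ≠ 0 := by
        have : c ≠ 0 := by rintro rfl; omega
        exact_mod_cast this
      push_cast
      field_simp
  rw [key]
  have hF := sum_div_ge h h1 hm hb h2 D hD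
  have hI := II_ge h h1 hm hb h2 Y hY
  have hτ : (0:ℝ) < D.divisors.card := by
    have : 0 < D.divisors.card := Finset.card_pos.2 ⟨1, by simp [hD.ne']⟩
    exact_mod_cast this
  have hYR : (0:ℝ) < Y := by exact_mod_cast hY
  have herr : |∑ g ∈ D.divisors, h g / g * II h (Y / g) - II h Y * ∑ g ∈ D.divisors, h g / g| ≤ 2 * D.divisors.card / Y := by
    rw [Finset.mul_sum, ← Finset.sum_sub_distrib]
    refine (Finset.abs_sum_le_sum_abs _ _).trans ?_
    calc _ ≤ ∑ g ∈ D.divisors, (2:ℝ) / Y := by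
          apply Finset.sum_le_sum
          intro g hg
          have hg0 : 0 < g := Nat.pos_of_mem_divisors hg
          have hgR : (0:ℝ) < g := by exact_mod_cast hg0
          have hd := II_diff h h1 hm hb h2 (Y / g) Y (Nat.div_le_self _ _)
          have hle : (Y:ℝ) ≤ g * ((Y / g : ℕ) + 1) := by
            have := Nat.lt_mul_div_succ Y hg0
            exact_mod_cast this.le
          rw [show h g / g * II h (Y / g) - II h Y * (h g / g) = - (h g / g * (II h Y - II h (Y / g))) by ring, abs_neg, abs_mul,
            abs_div, abs_of_pos hgR]
          calc |h g| / g * |II h Y - II h (Y / g)| ≤ 1 / g * (2 / ((Y / g : ℕ) + 1)) := by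
                gcongr; exact hb g
            _ ≤ 2 / Y := by
              rw [div_mul_div_comm, one_mul]
              gcongr
      _ = _ := by simp; ring
  rw [abs_le] at herr
  have : 3 / 4 / (D.divisors.card : ℝ) ≤ II h Y * ∑ g ∈ D.divisors, h g / g := by
    calc 3 / 4 / (D.divisors.card : ℝ) = 3 / 4 * (1 / (D.divisors.card : ℝ)) := by ring
      _ ≤ _ := by gcongr
  linarith [herr.1]
end
end PF

namespace PF
open Finset

lemma period_aux (A : ℕ) (q B : ℝ) (hq : 0 < q) (F : ℕ → ℝ → ℝ)
    (hF : ∀ i x, HasDerivAt (F i) (F (i+1) x) x) (hper : ∀ i, F i 0 = F i q)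
    (hB : ∀ x ∈ Set.Icc 0 q, |F A x| ≤ B) :
    ∀ n i, i + n = A → 0 < i → ∀ x ∈ Set.Icc 0 q, |F i x| ≤ q ^ n * B := by
  intro n
  induction n with
  | zero => intro i hi _ x hx; obtain rfl : i = A := by omega
            simpa using hB x hx
  | succ n ih =>
    intro i hi hi0 x hx
    obtain ⟨j, rfl⟩ : ∃ j, i = j + 1 := ⟨i - 1, by omega⟩
    obtain ⟨ξ, hξ, h0⟩ := exists_hasDerivAt_eq_zero (f := F j) (f' := F (j+1)) hq
      (fun x _ => (hF j x).continuousAt.continuousWithinAt) (hper j) (fun x _ => hF j x)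
    have := Convex.norm_image_sub_le_of_norm_hasDerivWithin_le (f := F (j+1)) (f' := F (j+1+1)) (s := Set.Icc 0 q)
      (C := q ^ n * B) (x := ξ) (y := x) (fun x _ => (hF _ x).hasDerivWithinAt)
      (fun x hx => ih (j+1+1) (by omega) (by omega) x hx) (convex_Icc _ _) ⟨hξ.1.le, hξ.2.le⟩ hx
    rw [h0, sub_zero, Real.norm_eq_abs, Real.norm_eq_abs] at this
    have hB0 : 0 ≤ B := (abs_nonneg _).trans (hB x hx)
    calc _ ≤ _ := this
      _ ≤ q ^ n * B * q := by
        gcongr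
        rw [abs_le]; constructor <;> linarith [hx.1, hx.2, hξ.1, hξ.2]
      _ = _ := by ring

lemma period_aux0 (A : ℕ) (hA : 0 < A) (q B : ℝ) (hq : 0 < q) (F : ℕ → ℝ → ℝ)
    (hF : ∀ i x, HasDerivAt (F i) (F (i+1) x) x) (hper : ∀ i, F i 0 = F i q)
    (hB : ∀ x ∈ Set.Icc 0 q, |F A x| ≤ B) :
    ∀ x ∈ Set.Icc 0 q, ∀ y ∈ Set.Icc 0 q, |F 0 x - F 0 y| ≤ q ^ A * B := by
  intro x hx y hy
  obtain ⟨n, rfl⟩ : ∃ j, A = j + 1 := ⟨A - 1, by omega⟩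
  have := Convex.norm_image_sub_le_of_norm_hasDerivWithin_le (f := F 0) (f' := F 1) (s := Set.Icc 0 q)
      (C := q ^ n * B) (x := y) (y := x) (fun x _ => (hF _ x).hasDerivWithinAt)
      (fun x hx => period_aux _ q B hq F hF hper hB n 1 (by omega) (by omega) x hx) (convex_Icc _ _) hy hx
  rw [Real.norm_eq_abs, Real.norm_eq_abs] at this
  have hB0 : 0 ≤ B := (abs_nonneg _).trans (hB x hx)
  calc _ ≤ _ := this
      _ ≤ q ^ n * B * q := by
        gcongr
        rw [abs_le]; constructor <;> linarith [hx.1, hx.2, hy.1, hy.2]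
      _ = _ := by ring

lemma hasDerivAt_iter (g : ℝ → ℝ) (hg : ContDiff ℝ (⊤:ℕ∞) g) (i : ℕ) (x : ℝ) :
    HasDerivAt (iteratedDeriv i g) (iteratedDeriv (i+1) g x) x := by
  have : Differentiable ℝ (iteratedDeriv i g) := by
    apply hg.differentiable_iteratedDeriv i
    exact_mod_cast ENat.natCast_lt_top i
  rw [iteratedDeriv_succ]
  exact (this x).hasDerivAt

lemma period_sum {ι : Type*} (S : Finset ι) (φ : ι → ℝ → ℝ) (hφ : ∀ k, ContDiff ℝ (⊤:ℕ∞) (φ k))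
    (A : ℕ) (hA : 0 < A) (q B : ℝ) (hq : 0 < q)
    (hper : ∀ t, |t| < 1 → ∑ k ∈ S, φ k (t + q) = ∑ k ∈ S, φ k t)
    (hB : ∀ k t, |iteratedDeriv A (φ k) t| ≤ B) :
    ∀ x ∈ Set.Icc 0 q, ∀ y ∈ Set.Icc 0 q, |∑ k ∈ S, φ k x - ∑ k ∈ S, φ k y| ≤ q ^ A * (S.card * B) := by
  have hsm : ContDiff ℝ (⊤:ℕ∞) (fun t => ∑ k ∈ S, φ k t) := ContDiff.sum fun k _ => hφ k
  have := period_aux0 A hA q (S.card * B) hq (fun i => iteratedDeriv i (fun t => ∑ k ∈ S, φ k t))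
    (fun i x => hasDerivAt_iter _ hsm i x) ?_ ?_
  · simpa using this
  · intro i
    have h1 : iteratedDeriv i (fun t => ∑ k ∈ S, φ k (t + q)) 0 = iteratedDeriv i (fun t => ∑ k ∈ S, φ k t) 0 := by
      apply Filter.EventuallyEq.iteratedDeriv_eq
      filter_upwards [Metric.ball_mem_nhds (0:ℝ) one_pos] with t ht
      apply hper
      simpa using ht
    rw [← h1]
    have := congrFun (iteratedDeriv_comp_add_const i (fun t => ∑ k ∈ S, φ k t) q) 0
    rw [zero_add] at this
    exact this
  · intro x _
    have : iteratedDeriv A (fun t => ∑ k ∈ S, φ k t) x = ∑ k ∈ S, iteratedDeriv A (φ k) x := by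
      apply iteratedDeriv_fun_sum
      intro k _
      exact ((hφ k).of_le (by exact_mod_cast le_top)).contDiffAt
    simp only [this]
    refine (Finset.abs_sum_le_sum_abs _ _).trans ?_
    refine (Finset.sum_le_sum fun k _ => hB k x).trans ?_
    simp

lemma em_sum (g : ℝ → ℝ) (hg : ContDiff ℝ (⊤:ℕ∞) g) (K : ℕ) (R : ℝ) (hR : R + 1 ≤ K)
    (hsupp : ∀ x, R ≤ |x| → g x = 0) (A : ℕ) (hA : 0 < A) (B : ℝ) (hB : ∀ t, |iteratedDeriv A g t| ≤ B) :
    |∑ k ∈ Icc (-K:ℤ) K, g k - ∫ x in (-K:ℝ)..(K+1), g x| ≤ (2*K+1) * B := by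
  have hper := period_sum (Icc (-K:ℤ) K) (fun k t => g (k + t)) (fun k => hg.comp (contDiff_const.add contDiff_id))
    A hA 1 B one_pos ?_ ?_
  · have hcard : ((Icc (-K:ℤ) K).card : ℝ) = 2 * K + 1 := by
      rw [Int.card_Icc]
      have : ((K:ℤ) + 1 - -K).toNat = 2 * K + 1 := by omega
      rw [this]; push_cast; ring
    have hintg : ∫ x in (-K:ℝ)..(K+1), g x = ∫ t in (0:ℝ)..1, ∑ k ∈ Icc (-K:ℤ) K, g (k + t) := by
      rw [intervalIntegral.integral_finsetSum (fun k _ => by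
        apply Continuous.intervalIntegrable
        exact hg.continuous.comp (by fun_prop))]
      have e := intervalIntegral.sum_integral_adjacent_intervals (f := g) (μ := MeasureTheory.volume)
        (a := fun i : ℕ => (-K:ℝ) + i) (n := 2 * K + 1) (fun k _ => hg.continuous.intervalIntegrable _ _)
      simp only [Nat.cast_zero, add_zero] at e
      rw [show (-K:ℝ) + ((2*K+1 : ℕ):ℝ) = K + 1 by push_cast; ring] at e
      rw [← e]
      refine Finset.sum_bij (fun (i:ℕ) _ => (-K:ℤ) + i) ?_ ?_ ?_ ?_
      · intro i hi; simp at hi ⊢; omega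
      · intro i _ j _ h; simpa using h
      · intro b hb
        simp at hb
        exact ⟨(b + K).toNat, by simp; omega, by simp; omega⟩
      · intro i _
        rw [intervalIntegral.integral_comp_add_left (f := g)]
        push_cast
        congr 1 <;> ring
    rw [hintg]
    have h3 : ∀ t ∈ Set.uIoc (0:ℝ) 1, ‖∑ k ∈ Icc (-K:ℤ) K, g k - ∑ k ∈ Icc (-K:ℤ) K, g (k + t)‖ ≤ (2*K+1) * B := by
      intro t ht
      rw [Set.uIoc_of_le zero_le_one] at ht
      have := hper 0 (by simp) t ⟨ht.1.le, ht.2⟩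
      rw [hcard] at this; simpa using this
    have h4 := intervalIntegral.norm_integral_le_of_norm_le_const h3
    rw [intervalIntegral.integral_sub (by simp) (by
      apply Continuous.intervalIntegrable
      exact continuous_finsetSum _ fun k _ => hg.continuous.comp (by fun_prop))] at h4
    simpa using h4
  · intro t ht
    apply Finset.sum_bij_ne_zero (fun k _ _ => k + 1)
    · intro k hk hne
      rw [mem_Icc] at hk ⊢
      rw [abs_lt] at ht
      have : ¬ R ≤ |(k:ℝ) + (t + 1)| := fun h => hne (hsupp _ h)
      push Not at this
      rw [abs_lt] at this
      refine ⟨by omega, ?_⟩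
      have : (k:ℝ) + 1 < K := by linarith [this.2]
      have : k + 1 < (K:ℤ) := by exact_mod_cast this
      omega
    · intro a _ _ b _ _ h; simpa using h
    · intro k hk hne
      refine ⟨k - 1, ?_, ?_, by ring⟩
      · rw [mem_Icc] at hk ⊢
        rw [abs_lt] at ht
        have : ¬ R ≤ |(k:ℝ) + t| := fun h => hne (hsupp _ h)
        push Not at this
        rw [abs_lt] at this
        refine ⟨?_, by omega⟩
        have : -(K:ℝ) < k := by linarith [this.1]
        have : -(K:ℤ) < k := by exact_mod_cast this
        omega
      · push_cast
        rwa [show (k:ℝ) - 1 + (t + 1) = k + t by ring]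
    · intro k _ _
      push_cast
      congr 1; ring
  · intro k t
    have := congrFun (iteratedDeriv_comp_const_add A g (k:ℝ)) t
    rw [this]
    exact hB _
end PF

namespace PF
open Finset

lemma bdd_iter (φ : ℝ → ℝ) (hφ : ContDiff ℝ (⊤:ℕ∞) φ) (R : ℝ) (hs : ∀ x, R ≤ |x| → φ x = 0) (A : ℕ) :
    ∃ C, 0 < C ∧ ∀ x, |iteratedDeriv A φ x| ≤ C := by
  have hc : HasCompactSupport φ := by
    apply HasCompactSupport.intro (isCompact_Icc (a := -R) (b := R))
    intro x hx
    apply hs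
    rw [Set.mem_Icc, ← abs_le] at hx
    exact (not_le.1 hx).le
  have h1 := hc.iteratedFDeriv (𝕜 := ℝ) A
  have h2 : Continuous (iteratedFDeriv ℝ A φ) := hφ.continuous_iteratedFDeriv (by exact_mod_cast le_top)
  obtain ⟨C, hC⟩ := h2.bounded_above_of_compact_support h1
  refine ⟨max C 1, by positivity, fun x => ?_⟩
  have := hC x
  rw [norm_iteratedFDeriv_eq_norm_iteratedDeriv] at this
  exact this.trans (le_max_left _ _)

lemma iter_scale (φ : ℝ → ℝ) (hφ : ContDiff ℝ (⊤:ℕ∞) φ) (A : ℕ) (c x : ℝ) :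
    iteratedDeriv A (fun x => φ (c * x)) x = c ^ A * iteratedDeriv A φ (c * x) := by
  have := congrFun (iteratedDeriv_comp_const_mul (n := A) (hφ.of_le (by exact_mod_cast le_top)) c) x
  simpa using this


lemma st_smooth : ContDiff ℝ (⊤:ℕ∞) Real.smoothTransition := Real.smoothTransition.contDiff

lemma st_deriv_zero (x : ℝ) (hx : x ≤ 0 ∨ 1 ≤ x) : deriv Real.smoothTransition x = 0 := by
  rcases hx with hx | hx
  · apply IsLocalMin.deriv_eq_zero
    apply Filter.Eventually.of_forall
    intro y
    rw [Real.smoothTransition.zero_of_nonpos hx]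
    exact Real.smoothTransition.nonneg y
  · apply IsLocalMax.deriv_eq_zero
    apply Filter.Eventually.of_forall
    intro y
    rw [Real.smoothTransition.one_of_one_le hx]
    exact Real.smoothTransition.le_one y

noncomputable def Psi (v : ℝ) : ℝ := Real.smoothTransition (v - 1) - Real.smoothTransition (-v - 1)
noncomputable def om (v : ℝ) : ℝ := deriv Real.smoothTransition (v - 1) + deriv Real.smoothTransition (-v - 1)

lemma Psi_smooth : ContDiff ℝ (⊤:ℕ∞) Psi := by
  unfold Psi
  exact (st_smooth.comp (by fun_prop)).sub (st_smooth.comp (by fun_prop))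

lemma om_smooth : ContDiff ℝ (⊤:ℕ∞) om := by
  have h : ContDiff ℝ (⊤:ℕ∞) (deriv Real.smoothTransition) := by
    have := (contDiff_infty_iff_deriv.1 st_smooth).2
    exact this
  unfold om
  exact (h.comp (by fun_prop)).add (h.comp (by fun_prop))

lemma Psi_deriv (v : ℝ) : HasDerivAt Psi (om v) v := by
  have hd : Differentiable ℝ Real.smoothTransition := st_smooth.differentiable (by simp)
  unfold Psi om
  have h1 : HasDerivAt (fun v : ℝ => Real.smoothTransition (v - 1)) (deriv Real.smoothTransition (v - 1) * 1) v :=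
    HasDerivAt.comp (h := fun v : ℝ => v - 1) (h₂ := Real.smoothTransition) v (hd (v-1)).hasDerivAt ((hasDerivAt_id v).sub_const 1)
  have h2 : HasDerivAt (fun v : ℝ => Real.smoothTransition (-v - 1)) (deriv Real.smoothTransition (-v - 1) * (-1)) v :=
    HasDerivAt.comp (h := fun v : ℝ => -v - 1) (h₂ := Real.smoothTransition) v (hd (-v-1)).hasDerivAt ((hasDerivAt_id v).neg.sub_const 1)
  exact (h1.sub h2).congr_deriv (by ring)

lemma Psi_neg (v : ℝ) : Psi (-v) = - Psi v := by unfold Psi; simp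
lemma om_neg (v : ℝ) : om (-v) = om v := by unfold om; simp [add_comm]

lemma om_small (v : ℝ) (hv : |v| ≤ 1) : om v = 0 := by
  rw [abs_le] at hv
  unfold om
  rw [st_deriv_zero _ (Or.inl (by linarith)), st_deriv_zero _ (Or.inl (by linarith)), add_zero]

lemma om_large (v : ℝ) (hv : 2 ≤ |v|) : om v = 0 := by
  unfold om
  rcases le_abs'.1 hv with h | h
  · rw [st_deriv_zero _ (Or.inl (by linarith)), st_deriv_zero _ (Or.inr (by linarith)), add_zero]
  · rw [st_deriv_zero _ (Or.inr (by linarith)), st_deriv_zero _ (Or.inl (by linarith)), add_zero]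

lemma Psi_small (v : ℝ) (hv : |v| ≤ 1) : Psi v = 0 := by
  rw [abs_le] at hv
  unfold Psi
  rw [Real.smoothTransition.zero_of_nonpos (by linarith), Real.smoothTransition.zero_of_nonpos (by linarith), sub_zero]

lemma Psi_large (v : ℝ) (hv : 2 ≤ v) : Psi v = 1 := by
  unfold Psi
  rw [Real.smoothTransition.one_of_one_le (by linarith), Real.smoothTransition.zero_of_nonpos (by linarith), sub_zero]

noncomputable def th (x : ℝ) : ℝ := if x = 0 then 1 else Psi |x|⁻¹

lemma th_zero : th 0 = 1 := by simp [th]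
lemma th_pos (x : ℝ) (hx : 0 < x) : th x = Psi x⁻¹ := by simp [th, hx.ne', abs_of_pos hx]
lemma th_neg (x : ℝ) : th (-x) = th x := by simp [th]
lemma th_one (x : ℝ) (hx : |x| ≤ 1/2) : th x = 1 := by
  unfold th
  split_ifs with h
  · rfl
  · apply Psi_large
    have : 0 < |x| := abs_pos.2 h
    rw [le_inv_comm₀ (by norm_num) this]; linarith
lemma th_large (x : ℝ) (hx : 1 ≤ |x|) : th x = 0 := by
  unfold th
  rw [if_neg (by rintro rfl; norm_num at hx)]
  apply Psi_small
  rw [abs_inv, abs_abs]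
  exact inv_le_one_of_one_le₀ hx

lemma th_smooth : ContDiff ℝ (⊤:ℕ∞) th := by
  rw [contDiff_iff_contDiffAt]
  intro x
  by_cases hx : x = 0
  · subst hx
    apply (contDiffAt_const (c := (1:ℝ))).congr_of_eventuallyEq
    filter_upwards [Metric.ball_mem_nhds (0:ℝ) (by norm_num : (0:ℝ) < 1/2)] with t ht
    apply th_one
    simp at ht; linarith
  · have : ContDiffAt ℝ (⊤:ℕ∞) (fun x => Psi |x|⁻¹) x := by
      apply Psi_smooth.contDiffAt.comp
      exact (contDiffAt_abs hx).inv (abs_pos.2 hx).ne'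
    apply this.congr_of_eventuallyEq
    filter_upwards [isOpen_ne.mem_nhds hx] with t ht
    unfold th; rw [if_neg ht]

noncomputable def rho (u : ℝ) : ℝ := om u / |u|

lemma rho_smooth : ContDiff ℝ (⊤:ℕ∞) rho := by
  rw [contDiff_iff_contDiffAt]
  intro x
  by_cases hx : x = 0
  · subst hx
    apply (contDiffAt_const (c := (0:ℝ))).congr_of_eventuallyEq
    filter_upwards [Metric.ball_mem_nhds (0:ℝ) (by norm_num : (0:ℝ) < 1/2)] with t ht
    unfold rho
    rw [om_small, zero_div]
    simp at ht; linarith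
  · exact om_smooth.contDiffAt.div (contDiffAt_abs hx) (abs_pos.2 hx).ne'

noncomputable def Om0 : ℝ := ∫ x in (0:ℝ)..1, th x

lemma int_even (φ : ℝ → ℝ) (hφ : Continuous φ) (he : ∀ x, φ (-x) = φ x) (r : ℝ) (hs : ∀ x, r ≤ |x| → φ x = 0)
    (a b : ℝ) (ha : a ≤ -r) (hb : r ≤ b) (hr : 0 ≤ r): ∫ x in a..b, φ x = 2 * ∫ x in (0:ℝ)..r, φ x := by
  have hi : ∀ a b : ℝ, IntervalIntegrable φ MeasureTheory.volume a b := fun a b => hφ.intervalIntegrable _ _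
  have z1 : ∫ x in a..(-r), φ x = 0 := by
    rw [intervalIntegral.integral_congr (g := fun _ => (0:ℝ))]
    · simp
    · intro x hx
      rw [Set.uIcc_of_le ha] at hx
      apply hs; rw [le_abs]; right; linarith [hx.2]
  have z2 : ∫ x in r..b, φ x = 0 := by
    rw [intervalIntegral.integral_congr (g := fun _ => (0:ℝ))]
    · simp
    · intro x hx
      rw [Set.uIcc_of_le hb] at hx
      apply hs; rw [le_abs]; left; linarith [hx.1]
  have z3 : ∫ x in (-r)..0, φ x = ∫ x in (0:ℝ)..r, φ x := by
    have := intervalIntegral.integral_comp_neg (f := φ) (a := 0) (b := r)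
    simp only [he, neg_zero] at this
    rw [this]
  rw [← intervalIntegral.integral_add_adjacent_intervals (hi a (-r)) (hi (-r) b),
    ← intervalIntegral.integral_add_adjacent_intervals (hi (-r) 0) (hi 0 b),
    ← intervalIntegral.integral_add_adjacent_intervals (hi 0 r) (hi r b), z1, z2, z3]
  ring

lemma int_rho : ∫ u in (0:ℝ)..2, rho u = Om0 := by
  have hi : ∀ a b : ℝ, IntervalIntegrable rho MeasureTheory.volume a b := fun a b => rho_smooth.continuous.intervalIntegrable _ _
  have hth : ∀ a b : ℝ, IntervalIntegrable th MeasureTheory.volume a b := fun a b => th_smooth.continuous.intervalIntegrable _ _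
  have z : ∫ u in (0:ℝ)..1, rho u = 0 := by
    rw [intervalIntegral.integral_congr (g := fun _ => (0:ℝ))]
    · simp
    · intro x hx
      rw [Set.uIcc_of_le zero_le_one] at hx
      simp only [rho]
      rw [om_small, zero_div]
      rw [abs_le]; constructor <;> linarith [hx.1, hx.2]
  rw [← intervalIntegral.integral_add_adjacent_intervals (hi 0 1) (hi 1 2), z, zero_add]
  have hF : ∀ x ∈ Set.uIcc (1:ℝ) 2, HasDerivAt (fun u => Psi u / u - ∫ t in (0:ℝ)..(u⁻¹), th t) (rho x) x := by
    intro x hx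
    rw [Set.uIcc_of_le (by norm_num)] at hx
    have hx0 : 0 < x := by linarith [hx.1]
    have h1 : HasDerivAt (fun u => Psi u / u) _ x := (Psi_deriv x).div (hasDerivAt_id x) hx0.ne'
    have h2 : HasDerivAt (fun y => ∫ t in (0:ℝ)..y, th t) (th x⁻¹) x⁻¹ :=
      intervalIntegral.integral_hasDerivAt_right (hth _ _)
        (th_smooth.continuous.stronglyMeasurableAtFilter _ _) th_smooth.continuous.continuousAt
    have h3 := h2.comp x (hasDerivAt_inv hx0.ne')
    have h4 := h1.sub h3
    refine h4.congr_deriv ?_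
    rw [th_pos _ (by positivity), inv_inv]
    simp only [rho, abs_of_pos hx0]
    field_simp
    simp
  rw [intervalIntegral.integral_eq_sub_of_hasDerivAt hF (hi _ _)]
  have hhalf : ∫ t in (0:ℝ)..(2⁻¹), th t = 2⁻¹ := by
    rw [intervalIntegral.integral_congr (g := fun _ => (1:ℝ))]
    · simp
    · intro x hx
      rw [Set.uIcc_of_le (by norm_num)] at hx
      apply th_one; rw [abs_le]; constructor <;> linarith [hx.1, hx.2]
  rw [hhalf, Psi_large 2 le_rfl, Psi_small 1 (by norm_num)]
  simp [Om0]

/-- symmetric integer sum of an even function -/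
lemma sum_even (φ : ℝ → ℝ) (he : ∀ x, φ (-x) = φ x) (K : ℕ) :
    ∑ k ∈ Icc (-K:ℤ) K, φ k = φ 0 + 2 * ∑ m ∈ Icc 1 K, φ m := by
  induction K with
  | zero => simp
  | succ K ih =>
    have e : Icc (-((K+1:ℕ):ℤ)) ((K+1:ℕ):ℤ) = insert (-((K+1:ℕ):ℤ)) (insert ((K+1:ℕ):ℤ) (Icc (-K:ℤ) K)) := by
      ext x; simp; omega
    rw [e, Finset.sum_insert (by simp; omega), Finset.sum_insert (by simp), ih, Finset.sum_Icc_succ_top (by omega)]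
    push_cast
    rw [he]
    ring

lemma Om_sum (A : ℕ) (hA : 0 < A) : ∃ C, 0 < C ∧ ∀ V : ℝ, 1 ≤ V → ∀ M : ℕ, 2 * V ≤ M →
    |∑ m ∈ Icc 1 M, om (m / V) / m - Om0| ≤ C * (1/V) ^ A := by
  obtain ⟨C, hC0, hC⟩ := bdd_iter rho rho_smooth 2 (fun x hx => by unfold rho; rw [om_large x hx, zero_div]) A
  refine ⟨6 * C, by positivity, fun V hV M hM => ?_⟩
  have hV0 : 0 < V := by linarith
  set K := ⌈2 * V⌉₊ + 1 with hK
  have hK1 : 2 * V + 1 ≤ K := by rw [hK]; push_cast; linarith [Nat.le_ceil (2*V)]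
  have hK2 : (K:ℝ) ≤ 2 * V + 2 := by rw [hK]; push_cast; linarith [(Nat.ceil_lt_add_one (by positivity : 0 ≤ 2*V))]
  have htail : ∑ m ∈ Icc 1 M, om (m / V) / m = ∑ m ∈ Icc 1 K, om (m / V) / m := by
    have hz : ∀ m : ℕ, 2 * V ≤ m → om (m / V) / m = 0 := by
      intro m hm
      rw [om_large, zero_div]
      rw [abs_of_nonneg (by positivity), le_div_iff₀ hV0]; exact hm
    have aux : ∀ M : ℕ, 2 * V ≤ M → ∑ m ∈ Icc 1 M, om (m / V) / m = ∑ m ∈ (Icc 1 M).filter (fun m : ℕ => (m:ℝ) < 2 * V), om (m / V) / m := by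
      intro M _
      rw [Finset.sum_filter_of_ne]
      intro m _ hne
      by_contra h
      exact hne (hz m (not_lt.1 h))
    rw [aux M hM, aux K (by linarith)]
    congr 1
    ext m
    simp only [mem_filter, mem_Icc]
    constructor
    · rintro ⟨⟨h1, h2⟩, h3⟩
      refine ⟨⟨h1, ?_⟩, h3⟩
      have : (m:ℝ) < K := by linarith
      exact_mod_cast this.le
    · rintro ⟨⟨h1, h2⟩, h3⟩
      refine ⟨⟨h1, ?_⟩, h3⟩
      have : (m:ℝ) < M := by linarith
      exact_mod_cast this.le
  rw [htail]
  have hsm : ContDiff ℝ (⊤:ℕ∞) (fun x => rho (V⁻¹ * x)) := rho_smooth.comp (by fun_prop)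
  have hem := em_sum (fun x => rho (V⁻¹ * x)) hsm K (2 * V) hK1 (fun x hx => by
    unfold rho
    rw [om_large, zero_div]
    rw [abs_mul, abs_of_pos (by positivity), inv_mul_eq_div, le_div_iff₀ hV0]; exact hx) A hA
    ((V⁻¹)^A * C) (fun t => by
      rw [iter_scale _ rho_smooth, abs_mul, abs_of_pos (by positivity)]
      gcongr
      exact hC _)
  have heven : ∀ x, rho (-x) = rho x := by intro x; unfold rho; rw [om_neg, abs_neg]
  rw [sum_even (fun x => rho (V⁻¹ * x)) (fun x => by rw [mul_neg, heven])] at hem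
  have e2 : ∑ m ∈ Icc 1 K, rho (V⁻¹ * m) = V * ∑ m ∈ Icc 1 K, om (m / V) / m := by
    rw [Finset.mul_sum]
    refine Finset.sum_congr rfl fun m hm => ?_
    have : 0 < (m:ℝ) := by
      have : 0 < m := by simp at hm; omega
      exact_mod_cast this
    unfold rho
    rw [abs_of_pos (by positivity), inv_mul_eq_div]
    field_simp
  have e3 : ∫ x in (-K:ℝ)..(K+1), rho (V⁻¹ * x) = V * (2 * Om0) := by
    rw [intervalIntegral.integral_comp_mul_left (f := rho) (by positivity), inv_inv,
      int_even rho rho_smooth.continuous heven 2 (fun x hx => by unfold rho; rw [om_large x hx, zero_div]) _ _ _ _ (by norm_num), int_rho]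
    · simp
    · rw [inv_mul_eq_div, div_le_iff₀ hV0]; linarith
    · rw [inv_mul_eq_div, le_div_iff₀ hV0]; linarith
  have e4 : rho (V⁻¹ * 0) = 0 := by unfold rho; rw [om_small, zero_div]; simp
  rw [e2, e3, e4, zero_add, show 2 * (V * ∑ m ∈ Icc 1 K, om (m / V) / m) - V * (2 * Om0)
    = (2 * V) * (∑ m ∈ Icc 1 K, om (m / V) / m - Om0) by ring, abs_mul, abs_of_pos (by positivity)] at hem
  have h9 : (2 * (K:ℝ) + 1) * (V⁻¹ ^ A * C) ≤ (2 * V) * (6 * C * (1/V)^A) := by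
    rw [one_div]
    have : 0 < V⁻¹ ^ A * C := by positivity
    nlinarith
  exact le_of_mul_le_mul_left (hem.trans h9) (by positivity)

/-- K-tilde -/
noncomputable def Kt (M : ℕ) (v : ℝ) : ℝ := Om0 * v - ∑ m ∈ Icc 1 M, Psi (v / m)

lemma Kt_neg (M : ℕ) (v : ℝ) : Kt M (-v) = - Kt M v := by
  unfold Kt
  simp_rw [neg_div, Psi_neg]
  rw [Finset.sum_neg_distrib]; ring

lemma Kt_deriv (M : ℕ) (v : ℝ) : HasDerivAt (Kt M) (Om0 - ∑ m ∈ Icc 1 M, om (v / m) / m) v := by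
  unfold Kt
  apply HasDerivAt.sub
  · simpa using (hasDerivAt_id v).const_mul Om0
  · apply HasDerivAt.fun_sum
    intro m _
    have := (Psi_deriv (v / m)).comp v ((hasDerivAt_id v).div_const (m:ℝ))
    exact this.congr_deriv (by ring)

lemma Kt_pos : ∃ C, 0 < C ∧ ∀ v : ℝ, 0 < v → ∀ M : ℕ, v ≤ M → |Kt M v - 1/2| ≤ C / (1 + v^2) := by
  obtain ⟨C, hC0, hC⟩ := bdd_iter th th_smooth 1 (fun x hx => th_large x hx) 3
  refine ⟨2 * (|Om0| + 1/2) + 10 * C, by positivity, fun v hv M hM => ?_⟩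
  by_cases h1 : v ≤ 1
  · have : Kt M v = Om0 * v := by
      unfold Kt
      rw [Finset.sum_eq_zero, sub_zero]
      intro m hm
      apply Psi_small
      have : 1 ≤ (m:ℝ) := by simp at hm; exact_mod_cast hm.1
      rw [abs_of_nonneg (by positivity), div_le_one (by linarith)]; linarith
    rw [this, le_div_iff₀ (by positivity)]
    have h5 : |Om0 * v - 1/2| ≤ |Om0| + 1/2 := by
      calc _ ≤ |Om0 * v| + |(1:ℝ)/2| := abs_sub _ _
        _ = |Om0| * v + 1/2 := by rw [abs_mul, abs_of_pos hv]; norm_num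
        _ ≤ |Om0| * 1 + 1/2 := by gcongr
        _ = _ := by ring
    have : (1 + v^2) ≤ 2 := by nlinarith
    calc _ ≤ (|Om0| + 1/2) * 2 := by gcongr
      _ ≤ _ := by linarith
  push Not at h1
  set K := ⌈v⌉₊ + 1 with hK
  have hK1 : v + 1 ≤ K := by rw [hK]; push_cast; linarith [Nat.le_ceil v]
  have hK2 : (K:ℝ) ≤ v + 2 := by rw [hK]; push_cast; linarith [(Nat.ceil_lt_add_one hv.le)]
  have htail : ∑ m ∈ Icc 1 M, Psi (v / m) = ∑ m ∈ Icc 1 K, Psi (v / m) := by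
    have aux : ∀ M : ℕ, v ≤ M → ∑ m ∈ Icc 1 M, Psi (v / m) = ∑ m ∈ (Icc 1 M).filter (fun m : ℕ => (m:ℝ) < v), Psi (v / m) := by
      intro M _
      rw [Finset.sum_filter_of_ne]
      intro m hm hne
      by_contra h
      apply hne
      apply Psi_small
      have : 1 ≤ (m:ℝ) := by simp at hm; exact_mod_cast hm.1
      rw [abs_of_nonneg (by positivity), div_le_one (by linarith)]; linarith
    rw [aux M hM, aux K (by linarith)]
    congr 1
    ext m
    simp only [mem_filter, mem_Icc]
    constructor
    · rintro ⟨⟨h1, h2⟩, h3⟩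
      refine ⟨⟨h1, ?_⟩, h3⟩
      have : (m:ℝ) < K := by linarith
      exact_mod_cast this.le
    · rintro ⟨⟨h1, h2⟩, h3⟩
      refine ⟨⟨h1, ?_⟩, h3⟩
      have : (m:ℝ) < M := by linarith
      exact_mod_cast this.le
  have hsm : ContDiff ℝ (⊤:ℕ∞) (fun x => th (v⁻¹ * x)) := th_smooth.comp (by fun_prop)
  have hem := em_sum (fun x => th (v⁻¹ * x)) hsm K v hK1 (fun x hx => by
    apply th_large
    rw [abs_mul, abs_of_pos (by positivity), inv_mul_eq_div, le_div_iff₀ hv]; linarith) 3 (by norm_num)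
    ((v⁻¹)^3 * C) (fun t => by
      rw [iter_scale _ th_smooth, abs_mul, abs_of_pos (by positivity)]
      gcongr
      exact hC _)
  rw [sum_even (fun x => th (v⁻¹ * x)) (fun x => by rw [mul_neg, th_neg])] at hem
  have e2 : ∑ m ∈ Icc 1 K, th (v⁻¹ * m) = ∑ m ∈ Icc 1 K, Psi (v / m) := by
    refine Finset.sum_congr rfl fun m hm => ?_
    have : 0 < (m:ℝ) := by
      have : 0 < m := by simp at hm; omega
      exact_mod_cast this
    rw [th_pos _ (by positivity)]
    congr 1
    field_simp
  have e3 : ∫ x in (-K:ℝ)..(K+1), th (v⁻¹ * x) = v * (2 * Om0) := by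
    rw [intervalIntegral.integral_comp_mul_left (f := th) (by positivity), inv_inv,
      int_even th th_smooth.continuous th_neg 1 (fun x hx => th_large x hx) _ _ _ _ (by norm_num)]
    · simp [Om0]
    · rw [inv_mul_eq_div, div_le_iff₀ hv]; linarith
    · rw [inv_mul_eq_div, le_div_iff₀ hv]; linarith
  rw [e2, e3, mul_zero, th_zero, ← htail] at hem
  have e5 : Kt M v - 1/2 = - (1/2) * (1 + 2 * ∑ m ∈ Icc 1 M, Psi (v / m) - v * (2 * Om0)) := by unfold Kt; ring
  rw [e5, abs_mul, le_div_iff₀ (by positivity)]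
  have h6 : |(-(1/2):ℝ)| = 1/2 := by rw [abs_neg]; norm_num
  rw [h6]
  have h7 : (2 * (K:ℝ) + 1) * (v⁻¹ ^ 3 * C) * (1 + v^2) ≤ 20 * C := by
    have : (2 * (K:ℝ) + 1) * (1 + v^2) ≤ 20 * v^3 := by
      have : (2 * (K:ℝ) + 1) ≤ 7 * v := by linarith
      calc _ ≤ 7 * v * (v^2 + v^2) := by gcongr; nlinarith
        _ ≤ _ := by nlinarith [pow_pos hv 3]
    calc _ = (2 * (K:ℝ) + 1) * (1 + v^2) * (v⁻¹^3 * C) := by ring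
      _ ≤ 20 * v^3 * (v⁻¹^3 * C) := by gcongr
      _ = 20 * C := by field_simp
  calc _ ≤ 1/2 * ((2 * (K:ℝ) + 1) * (v⁻¹ ^ 3 * C)) * (1 + v^2) := by gcongr
    _ ≤ 10 * C := by linarith
    _ ≤ _ := by linarith [abs_nonneg Om0]
end PF

namespace PF
open Finset

noncomputable def bump (x : ℝ) : ℝ := Real.smoothTransition (2 - x^2)

lemma bump_smooth : ContDiff ℝ (⊤:ℕ∞) bump := by
  unfold bump
  exact st_smooth.comp (by fun_prop)
lemma bump_nonneg (x : ℝ) : 0 ≤ bump x := Real.smoothTransition.nonneg _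
lemma bump_le_one (x : ℝ) : bump x ≤ 1 := Real.smoothTransition.le_one _
lemma bump_one (x : ℝ) (hx : |x| ≤ 1) : bump x = 1 := by
  unfold bump
  apply Real.smoothTransition.one_of_one_le
  have : x^2 ≤ 1 := by rw [← sq_abs]; nlinarith [abs_nonneg x]
  linarith
lemma bump_zero (x : ℝ) (hx : 3/2 ≤ |x|) : bump x = 0 := by
  unfold bump
  apply Real.smoothTransition.zero_of_nonpos
  have : 9/4 ≤ x^2 := by rw [← sq_abs]; nlinarith [abs_nonneg x]
  linarith

/-- one-dimensional weight -/
noncomputable def bw (c ρ P y : ℝ) : ℝ := bump ((y / P - c) / ρ)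

lemma bw_smooth (c ρ P : ℝ) : ContDiff ℝ (⊤:ℕ∞) (bw c ρ P) := by
  unfold bw
  exact bump_smooth.comp (by fun_prop)
lemma bw_nonneg (c ρ P y : ℝ) : 0 ≤ bw c ρ P y := bump_nonneg _
lemma bw_le_one (c ρ P y : ℝ) : bw c ρ P y ≤ 1 := bump_le_one _
lemma bw_zero (c ρ P y : ℝ) (hρ : 0 < ρ) (hP : 0 < P) (hy : (|c| + 3/2 * ρ) * P ≤ |y|) : bw c ρ P y = 0 := by
  apply bump_zero
  rw [abs_div, abs_of_pos hρ, le_div_iff₀ hρ]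
  have : |y| / P ≤ |y / P - c| + |c| := by
    have := abs_add_le (y / P - c) c
    rw [sub_add_cancel, abs_div, abs_of_pos hP] at this
    exact this
  rw [← le_div_iff₀ hP] at hy
  linarith

lemma bw_iter (c ρ : ℝ) (hρ : 0 < ρ) (A : ℕ) : ∃ C, 0 < C ∧ ∀ P : ℝ, 0 < P → ∀ y, |iteratedDeriv A (bw c ρ P) y| ≤ C * (1/P)^A := by
  set φ : ℝ → ℝ := fun x => bump ((x - c) / ρ) with hφ
  have hsm : ContDiff ℝ (⊤:ℕ∞) φ := bump_smooth.comp (by fun_prop)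
  obtain ⟨C, hC0, hC⟩ := bdd_iter φ hsm (|c| + 3/2 * ρ) (fun x hx => by
    have := bw_zero c ρ 1 x hρ one_pos (by simpa using hx)
    simpa [bw] using this) A
  refine ⟨C, hC0, fun P hP y => ?_⟩
  have : bw c ρ P = fun y => φ (P⁻¹ * y) := by
    ext y; simp only [bw, hφ]; rw [inv_mul_eq_div]
  rw [this, iter_scale _ hsm, abs_mul, abs_of_pos (by positivity), mul_comm, one_div]
  gcongr
  exact hC _

lemma quad_iter (a b c D : ℝ) (y : ℝ) (h1 : |2 * a * y + b| ≤ D) (h2 : |2 * a| ≤ D^2) (i : ℕ) (hi : 1 ≤ i) :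
    |iteratedDeriv i (fun y : ℝ => a * y^2 + b * y + c) y| ≤ D ^ i := by
  have d1 : deriv (fun y : ℝ => a * y^2 + b * y + c) = fun y => 2 * a * y + b := by
    ext y
    have h : HasDerivAt (fun y : ℝ => a * y^2 + b * y + c) (a * (2 * y) + b * 1) y := by
      have := (((hasDerivAt_id y).pow 2).const_mul a).add ((hasDerivAt_id y).const_mul b)
      have := this.add_const c
      refine this.congr_deriv ?_
      simp
    rw [h.deriv]; ring
  have d2 : deriv (fun y : ℝ => 2 * a * y + b) = fun _ => 2 * a := by
    ext y
    have h : HasDerivAt (fun y : ℝ => 2 * a * y + b) (2 * a * 1) y :=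
      ((hasDerivAt_id y).const_mul (2*a)).add_const b
    rw [h.deriv]; ring
  have hD : 0 ≤ D := (abs_nonneg _).trans h1
  match i, hi with
  | 1, _ => rw [iteratedDeriv_succ', d1]; simpa using h1
  | 2, _ => rw [iteratedDeriv_succ', d1, iteratedDeriv_succ', d2]; simpa using h2
  | (n+3), _ =>
    rw [iteratedDeriv_succ', d1, iteratedDeriv_succ', d2, iteratedDeriv_succ']
    simp
    positivity

lemma prod_iter (α β c ρ C0 : ℝ) (hρ : 0 < ρ) (hC0 : 0 < C0) (A : ℕ) : ∃ C, 0 < C ∧ ∀ P : ℝ, 1 ≤ P → ∀ X : ℝ, 0 < X → X ≤ C0 * P^2 →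
    ∀ n0 y, |iteratedDeriv A (fun y => bw c ρ P y * om ((α * y^2 + β * y + n0) / X)) y| ≤ C * (P / X)^A := by
  choose Cb hCb0 hCb using bw_iter c ρ hρ
  choose Co hCo0 hCo using bdd_iter om om_smooth 2 om_large
  set R1 := |c| + 3/2 * ρ with hR1
  have hR1p : 0 < R1 := by positivity
  set E := 1 + C0 + 2 * |α| * R1 + |β| + 2 * |α| * C0 with hE
  have hEp : 1 ≤ E := by rw [hE]; have : 0 ≤ 2 * |α| * R1 + |β| + 2 * |α| * C0 := by positivity
                         linarith
  set CB := ∑ i ∈ range (A+1), Cb i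
  set CO := ∑ i ∈ range (A+1), Co i
  have hCB : ∀ i ≤ A, Cb i ≤ CB := fun i hi =>
    Finset.single_le_sum (f := Cb) (fun j _ => (hCb0 j).le) (mem_range.2 (by omega))
  have hCO : ∀ i ≤ A, Co i ≤ CO := fun i hi =>
    Finset.single_le_sum (f := Co) (fun j _ => (hCo0 j).le) (mem_range.2 (by omega))
  have hCBp : 0 < CB := (hCb0 0).trans_le (hCB 0 (by omega))
  have hCOp : 0 < CO := (hCo0 0).trans_le (hCO 0 (by omega))
  refine ⟨2^A * (CB * (A.factorial * CO)) * E^A, by positivity, fun P hP X hX hXP n0 y => ?_⟩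
  have hP0 : 0 < P := by linarith
  set u : ℝ → ℝ := fun y => (α * y^2 + β * y + n0) / X with hu
  have husm : ContDiff ℝ (⊤:ℕ∞) u := by rw [hu]; fun_prop
  have hosm : ContDiff ℝ (⊤:ℕ∞) (fun y => om (u y)) := om_smooth.comp husm
  by_cases hy : R1 * P < |y|
  · have : iteratedDeriv A (fun y => bw c ρ P y * om (u y)) y = iteratedDeriv A (fun _ => (0:ℝ)) y := by
      apply Filter.EventuallyEq.iteratedDeriv_eq
      filter_upwards [(isOpen_lt continuous_const continuous_abs).mem_nhds hy] with t ht
      rw [bw_zero c ρ P t hρ hP0 (le_of_lt ht), zero_mul]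
    rw [this]
    simp
    positivity
  push Not at hy
  have hEX : 1 / P ≤ E * (P / X) := by
    have : C0 ≤ E := by
      have : 0 ≤ 2 * |α| * R1 + |β| + 2 * |α| * C0 := by positivity
      rw [hE]; linarith
    rw [← mul_div_assoc, div_le_div_iff₀ hP0 hX]
    calc 1 * X ≤ C0 * P^2 := by linarith
      _ ≤ E * P^2 := by gcongr
      _ = _ := by ring
  have hD1 : |2 * (α/X) * y + β/X| ≤ E * (P / X) := by
    rw [show 2 * (α/X) * y + β/X = (2 * α * y + β)/X by ring, abs_div, abs_of_pos hX, ← mul_div_assoc]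
    gcongr
    calc |2 * α * y + β| ≤ |2 * α * y| + |β| := abs_add_le _ _
      _ = 2 * |α| * |y| + |β| := by rw [abs_mul, abs_mul]; norm_num
      _ ≤ 2 * |α| * (R1 * P) + |β| * P := by
          gcongr
          nlinarith [abs_nonneg β]
      _ = (2 * |α| * R1 + |β|) * P := by ring
      _ ≤ E * P := by gcongr; rw [hE]; have : 0 ≤ 1 + C0 + 2 * |α| * C0 := by positivity
                      linarith
  have hD2 : |2 * (α/X)| ≤ (E * (P / X))^2 := by
    rw [abs_mul, abs_div, abs_of_pos hX, mul_pow, div_pow, ← mul_div_assoc, ← mul_div_assoc, div_le_div_iff₀ hX (by positivity)]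
    have : 2 * |α| * C0 ≤ E^2 := by
      have : 2 * |α| * C0 ≤ E := by
        have : 0 ≤ 1 + C0 + 2 * |α| * R1 + |β| := by positivity
        rw [hE]; linarith
      nlinarith
    calc |(2:ℝ)| * |α| * X^2 = 2 * |α| * X * X := by norm_num; ring
      _ ≤ 2 * |α| * (C0 * P^2) * X := by gcongr
      _ = 2 * |α| * C0 * P^2 * X := by ring
      _ ≤ E^2 * P^2 * X := by gcongr
  have hom : ∀ j ≤ A, ‖iteratedFDeriv ℝ j (fun y => om (u y)) y‖ ≤ A.factorial * CO * (E * (P/X))^j := by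
    intro j hj
    have := norm_iteratedFDeriv_comp_le (𝕜 := ℝ) (g := om) (f := u) (n := j) (N := ((⊤:ℕ∞):WithTop ℕ∞))
      om_smooth husm (by exact_mod_cast le_top) y
      (C := CO) (D := E * (P/X)) (fun i hi => by
        rw [norm_iteratedFDeriv_eq_norm_iteratedDeriv]
        exact (hCo i _).trans (hCO i (by omega))) (fun i hi hi' => by
        rw [norm_iteratedFDeriv_eq_norm_iteratedDeriv]
        have e : u = fun y => (α/X) * y^2 + (β/X) * y + n0/X := by ext y; rw [hu]; ring
        rw [e]
        exact quad_iter _ _ _ _ _ hD1 hD2 i hi)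
    refine this.trans ?_
    gcongr
  rw [← Real.norm_eq_abs, ← norm_iteratedFDeriv_eq_norm_iteratedDeriv]
  refine (norm_iteratedFDeriv_mul_le (N := ((⊤:ℕ∞):WithTop ℕ∞)) (bw_smooth c ρ P) hosm y (by exact_mod_cast le_top)).trans ?_
  have hterm : ∀ i ∈ range (A+1), (A.choose i : ℝ) * ‖iteratedFDeriv ℝ i (bw c ρ P) y‖ * ‖iteratedFDeriv ℝ (A - i) (fun y => om (u y)) y‖
      ≤ (A.choose i : ℝ) * ((CB * (A.factorial * CO)) * (E * (P/X))^A) := by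
    intro i hi
    rw [mem_range] at hi
    rw [mul_assoc]
    apply mul_le_mul_of_nonneg_left _ (by positivity)
    have hb : ‖iteratedFDeriv ℝ i (bw c ρ P) y‖ ≤ CB * (E * (P/X))^i := by
      rw [norm_iteratedFDeriv_eq_norm_iteratedDeriv]
      refine (hCb i P hP0 y).trans ?_
      have := hCB i (by omega)
      gcongr
    calc _ ≤ (CB * (E * (P/X))^i) * (A.factorial * CO * (E * (P/X))^(A-i)) := by
          gcongr
          exact hom _ (by omega)
      _ = (CB * (A.factorial * CO)) * ((E * (P/X))^i * (E * (P/X))^(A-i)) := by ring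
      _ = _ := by rw [← pow_add]; congr 2; omega
  refine (Finset.sum_le_sum hterm).trans ?_
  rw [← Finset.sum_mul]
  have : ∑ i ∈ range (A+1), (A.choose i : ℝ) = 2^A := by exact_mod_cast Nat.sum_range_choose A
  rw [this, mul_pow]
  apply le_of_eq; ring
end PF

namespace PF
open Finset

noncomputable def kap (M : ℕ) (v : ℝ) : ℝ := Om0 - ∑ m ∈ Icc 1 M, om (v / m) / m

lemma kap_cont (M : ℕ) : Continuous (kap M) := by
  unfold kap
  refine continuous_const.sub (continuous_finsetSum _ fun m _ => ?_)
  exact (om_smooth.continuous.comp (by fun_prop)).div_const _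

lemma Kt_cont (M : ℕ) : Continuous (Kt M) := by
  rw [continuous_iff_continuousAt]
  intro v; exact (Kt_deriv M v).continuousAt

lemma Kt_bounds : ∃ C, 0 < C ∧ ∀ (v : ℝ) (M : ℕ), |v| ≤ M → (0 ≤ v → |Kt M v - 1/2| ≤ C / (1 + v^2)) ∧
    (v ≤ 0 → |Kt M v + 1/2| ≤ C / (1 + v^2)) ∧ |Kt M v| ≤ C := by
  obtain ⟨C, hC, h⟩ := Kt_pos
  have hz : ∀ M, Kt M 0 = 0 := by intro M; unfold Kt; simp [Psi_small]
  have hp : ∀ (v : ℝ) (M : ℕ), |v| ≤ M → 0 ≤ v → |Kt M v - 1/2| ≤ (C+1) / (1 + v^2) := by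
    intro v M hv h0
    rcases h0.eq_or_lt with rfl | h0
    · rw [hz]; norm_num; linarith
    · refine (h v h0 M ((le_abs_self v).trans hv)).trans ?_
      gcongr; linarith
  have hn : ∀ (v : ℝ) (M : ℕ), |v| ≤ M → v ≤ 0 → |Kt M v + 1/2| ≤ (C+1) / (1 + v^2) := by
    intro v M hv h0
    have := hp (-v) M (by rwa [abs_neg]) (by linarith)
    rw [Kt_neg, neg_sq, ← abs_neg] at this
    convert this using 2; ring
  have hle : ∀ v : ℝ, (C+1) / (1 + v^2) ≤ C + 1 := fun v => div_le_self (by positivity) (by nlinarith [sq_nonneg v])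
  refine ⟨C + 2, by positivity, fun v M hv => ⟨fun h0 => (hp v M hv h0).trans (by gcongr; linarith),
    fun h0 => (hn v M hv h0).trans (by gcongr; linarith), ?_⟩⟩
  rcases le_total 0 v with h0 | h0
  · have h1 := abs_le.1 ((hp v M hv h0).trans (hle v))
    rw [abs_le]; constructor <;> linarith [h1.1, h1.2]
  · have h1 := abs_le.1 ((hn v M hv h0).trans (hle v))
    rw [abs_le]; constructor <;> linarith [h1.1, h1.2]

set_option maxHeartbeats 2000000 in
lemma td_int (α β : ℝ) (hα : 0 < α) : ∃ C c P0 : ℝ, 0 < C ∧ 0 < c ∧ 1 ≤ P0 ∧ ∀ P : ℝ, P0 ≤ P → ∀ n0 : ℝ,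
    α * (P / (2 * √α))^2 + β * (P / (2 * √α)) + n0 < 0 → 0 < α * (3 * P / (2 * √α))^2 + β * (3 * P / (2 * √α)) + n0 →
    ∃ g0 : ℝ, c / P ≤ g0 ∧ g0 ≤ C / P ∧ ∀ X : ℝ, 0 < X → ∀ M : ℕ, 
      (∀ y ∈ Set.Icc (P / (4 * √α)) (7 * P / (4 * √α)), |α * y^2 + β * y + n0| ≤ M * X) →
      |(∫ y in (P / (4 * √α))..(7 * P / (4 * √α)), bw (1/√α) (1/(2*√α)) P y * kap M ((α * y^2 + β * y + n0) / X)) - X * g0| ≤ C * X^2 / P^3 ∧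
      |(∫ y in (P / (4 * √α))..(7 * P / (4 * √α)), bw (1/√α) (1/(2*√α)) P y * kap M ((α * y^2 + β * y + n0) / X))| ≤ C * X / P := by
  set s := √α with hs
  have hs0 : 0 < s := Real.sqrt_pos.2 hα
  have hss : s^2 = α := Real.sq_sqrt hα.le
  obtain ⟨CK, hCK, hK⟩ := Kt_bounds
  obtain ⟨Cb, hCb0, hCb⟩ := bw_iter (1/s) (1/(2*s)) (by positivity) 1
  -- derivative bound constant
  set G := 4 * Cb / s + 2 * α * 16 / s^2 with hG
  have hG0 : 0 < G := by positivity
  set C1 := G * CK * (4 / s) * (2 * Real.pi) with hC1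
  set C2 := G * CK * (2 / s) with hC2
  have hC10 : 0 < C1 := by have := Real.pi_pos; positivity
  have hC20 : 0 < C2 := by positivity
  refine ⟨C1 + C2 + 4/s, 1/(4*s), max 1 (4 * |β| / s), by positivity, by positivity, le_max_left _ _, ?_⟩
  intro P hP n0 hlo0 hhi0
  have hP1 : 1 ≤ P := (le_max_left _ _).trans hP
  have hP0 : 0 < P := by linarith
  have hβ : |β| ≤ s * P / 4 := by
    have := (le_max_right _ _).trans hP
    rw [div_le_iff₀ hs0] at this
    linarith
  rw [abs_le] at hβ
  set f : ℝ → ℝ := fun y => α * y^2 + β * y + n0 with hf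
  set f' : ℝ → ℝ := fun y => 2 * α * y + β with hf'
  have hfd : ∀ y, HasDerivAt f (f' y) y := by
    intro y
    have := ((((hasDerivAt_id y).pow 2).const_mul α).add ((hasDerivAt_id y).const_mul β)).add_const n0
    refine this.congr_deriv ?_
    simp [hf']; ring
  have hfc : Continuous f := by rw [hf]; fun_prop
  have hfc' : Continuous f' := by rw [hf']; fun_prop
  set lo := P / (4 * s) with hlo
  set hi := 7 * P / (4 * s) with hhi
  have hlohi : lo ≤ hi := by rw [hlo, hhi]; gcongr; linarith
  have hslo : s * lo = P / 4 := by rw [hlo]; field_simp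
  have hshi : s * hi = 7 * P / 4 := by rw [hhi]; field_simp
  have hlen : hi - lo ≤ 2 / s * P := by
    have : hi - lo = 3 / 2 / s * P := by rw [hlo, hhi]; field_simp; ring
    rw [this]; gcongr; norm_num
  have hfl : ∀ y ∈ Set.Icc lo hi, s * P / 4 ≤ f' y ∧ f' y ≤ 4 * s * P := by
    intro y hy
    have h1 : s * lo ≤ s * y := by gcongr; exact hy.1
    have h2 : s * y ≤ s * hi := by gcongr; exact hy.2
    rw [hslo] at h1
    rw [hshi] at h2
    have e : f' y = 2 * s * (s * y) + β := by rw [hf', ← hss]; ring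
    rw [e]
    constructor <;> nlinarith
  have hfpos : ∀ y ∈ Set.Icc lo hi, 0 < f' y := fun y hy => lt_of_lt_of_le (by positivity) (hfl y hy).1
  have hmono : StrictMonoOn f (Set.Icc lo hi) := by
    apply strictMonoOn_of_hasDerivWithinAt_pos (convex_Icc _ _) hfc.continuousOn (fun x _ => (hfd x).hasDerivWithinAt)
    intro x hx
    exact hfpos x (interior_subset hx)
  -- the weight
  set b : ℝ → ℝ := bw (1/s) (1/(2*s)) P with hb
  have hbarg : ∀ y, (y / P - 1/s) / (1/(2*s)) = 2 * (s * y) / P - 2 := by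
    intro y; field_simp
  have hbd : ∀ y, HasDerivAt b (iteratedDeriv 1 b y) y := by
    intro y
    have := hasDerivAt_iter b (bw_smooth _ _ _) 0 y
    simpa using this
  have hbc' : Continuous (iteratedDeriv 1 b) := by
    apply (bw_smooth (1/s) (1/(2*s)) P).continuous_iteratedDeriv 1
    exact_mod_cast le_top
  have hblo : b lo = 0 := by
    apply bump_zero; rw [hbarg, hslo]; rw [show 2 * (P/4) / P - 2 = -(3/2) by field_simp; norm_num]; rw [abs_neg]; exact le_abs_self _
  have hbhi : b hi = 0 := by
    apply bump_zero; rw [hbarg, hshi]; rw [show 2 * (7 * P/4) / P - 2 = (3/2) by field_simp; norm_num]; exact le_abs_self _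
  -- root
  have hmid : P / (2 * s) ≤ 3 * P / (2 * s) := by gcongr; linarith
  obtain ⟨ζ, hζ, hζ0⟩ := intermediate_value_Icc hmid hfc.continuousOn ⟨hlo0.le, hhi0.le⟩
  have hζs1 : P / 2 ≤ s * ζ := by
    have : s * (P / (2 * s)) ≤ s * ζ := by gcongr; exact hζ.1
    rwa [show s * (P / (2 * s)) = P / 2 by field_simp] at this
  have hζs2 : s * ζ ≤ 3 * P / 2 := by
    have : s * ζ ≤ s * (3 * P / (2 * s)) := by gcongr; exact hζ.2
    rwa [show s * (3 * P / (2 * s)) = 3 * P / 2 by field_simp] at this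
  have hζm : ζ ∈ Set.Icc lo hi := by
    constructor
    · exact le_of_mul_le_mul_left (by rw [hslo]; linarith) hs0
    · exact le_of_mul_le_mul_left (by rw [hshi]; linarith) hs0
  have hbζ : b ζ = 1 := by
    apply bump_one; rw [hbarg, abs_le]
    have h1 : 1 ≤ 2 * (s * ζ) / P := by rw [le_div_iff₀ hP0]; linarith
    have h2 : 2 * (s * ζ) / P ≤ 3 := by rw [div_le_iff₀ hP0]; linarith
    constructor <;> linarith
  -- g
  set g : ℝ → ℝ := fun y => b y / f' y with hg
  set g' : ℝ → ℝ := fun y => (iteratedDeriv 1 b y * f' y - b y * (2 * α)) / (f' y)^2 with hg'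
  have hgd : ∀ y ∈ Set.Icc lo hi, HasDerivAt g (g' y) y := by
    intro y hy
    have h2 : HasDerivAt f' (2 * α) y := by
      have := ((hasDerivAt_id y).const_mul (2 * α)).add_const β
      exact this.congr_deriv (by ring)
    exact (hbd y).div h2 (hfpos y hy).ne'
  have hg'c : ContinuousOn g' (Set.Icc lo hi) := by
    apply ContinuousOn.div
    · exact ((hbc'.mul hfc').sub ((bw_smooth _ _ _).continuous.mul continuous_const)).continuousOn
    · exact (hfc'.pow 2).continuousOn
    · intro y hy; exact (pow_pos (hfpos y hy) 2).ne'
  have hg'b : ∀ y ∈ Set.Icc lo hi, |g' y| ≤ G / P^2 := by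
    intro y hy
    have hfp := hfpos y hy
    have e : g' y = iteratedDeriv 1 b y / f' y - b y * (2 * α) / (f' y)^2 := by
      rw [hg']; field_simp
    rw [e]
    have t1 : |iteratedDeriv 1 b y / f' y| ≤ 4 * Cb / s / P^2 := by
      rw [abs_div, abs_of_pos hfp]
      have h1 := hCb P hP0 y
      calc _ ≤ (Cb * (1/P)^1) / (s * P / 4) := by gcongr; exact (hfl y hy).1
        _ = _ := by field_simp
    have t2 : |b y * (2 * α) / (f' y)^2| ≤ 2 * α * 16 / s^2 / P^2 := by
      rw [abs_of_nonneg (by have := bw_nonneg (1/s) (1/(2*s)) P y; positivity)]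
      calc _ ≤ 1 * (2 * α) / (s * P / 4)^2 := by
            gcongr
            · exact bw_le_one _ _ _ _
            · exact (hfl y hy).1
        _ = _ := by field_simp; ring
    calc _ ≤ _ := abs_sub _ _
      _ ≤ 4 * Cb / s / P^2 + 2 * α * 16 / s^2 / P^2 := add_le_add t1 t2
      _ = _ := by rw [hG]; ring
  have hgζ : g ζ = 1 / f' ζ := by rw [hg]; simp only [hbζ]
  refine ⟨g ζ, ?_, ?_, ?_⟩
  · rw [hgζ, div_div]
    apply one_div_le_one_div_of_le (hfpos ζ hζm)
    have := (hfl ζ hζm).2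
    linarith
  · rw [hgζ]
    calc 1 / f' ζ ≤ 1 / (s * P / 4) := one_div_le_one_div_of_le (by positivity) (hfl ζ hζm).1
      _ = 4 / s / P := by field_simp
      _ ≤ _ := by gcongr; linarith
  intro X hX M hM
  have hMv : ∀ y ∈ Set.Icc lo hi, |f y / X| ≤ M := by
    intro y hy
    rw [abs_div, abs_of_pos hX, div_le_iff₀ hX]
    exact hM y hy
  have huI : Set.uIcc lo hi = Set.Icc lo hi := Set.uIcc_of_le hlohi
  set v : ℝ → ℝ := fun y => X * Kt M (f y / X) with hv
  have hvd : ∀ y, HasDerivAt v (kap M (f y / X) * f' y) y := by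
    intro y
    have h1 := HasDerivAt.comp (h := fun y => f y / X) (h₂ := Kt M) y (Kt_deriv M (f y / X)) ((hfd y).div_const X)
    have h2 := h1.const_mul X
    refine h2.congr_deriv ?_
    unfold kap
    field_simp
  have hvc : Continuous v := by
    rw [hv]; exact continuous_const.mul ((Kt_cont M).comp (hfc.div_const X))
  have hg'i : ∀ a ∈ Set.Icc lo hi, ∀ c ∈ Set.Icc lo hi, IntervalIntegrable g' MeasureTheory.volume a c := by
    intro a ha c hc
    apply ContinuousOn.intervalIntegrable
    apply hg'c.mono
    rw [← huI]
    exact Set.uIcc_subset_uIcc (by rwa [huI]) (by rwa [huI])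
  have hlom : lo ∈ Set.Icc lo hi := ⟨le_rfl, hlohi⟩
  have hhim : hi ∈ Set.Icc lo hi := ⟨hlohi, le_rfl⟩
  have hparts := intervalIntegral.integral_mul_deriv_eq_deriv_mul (a := lo) (b := hi) (u := g) (v := v) (u' := g')
    (v' := fun y => kap M (f y / X) * f' y) (fun x hx => hgd x (by rwa [huI] at hx)) (fun x _ => hvd x)
    (hg'i _ hlom _ hhim) (by
      apply Continuous.intervalIntegrable
      exact ((kap_cont M).comp (hfc.div_const X)).mul hfc')
  have hglo : g lo = 0 := by rw [hg]; simp only [hblo, zero_div]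
  have hghi : g hi = 0 := by rw [hg]; simp only [hbhi, zero_div]
  rw [hglo, hghi, zero_mul, zero_mul, sub_zero, zero_sub] at hparts
  have hI : ∫ y in lo..hi, b y * kap M (f y / X) = - ∫ x in lo..hi, g' x * v x := by
    rw [← hparts]
    apply intervalIntegral.integral_congr
    intro y hy
    rw [huI] at hy
    have := (hfpos y hy).ne'
    simp only [hg]
    field_simp
  change |(∫ y in lo..hi, b y * kap M (f y / X)) - X * g ζ| ≤ _ ∧ |∫ y in lo..hi, b y * kap M (f y / X)| ≤ _
  rw [hI]
  constructor
  · -- split at ζ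
    have hgv : ∀ a ∈ Set.Icc lo hi, ∀ c ∈ Set.Icc lo hi, IntervalIntegrable (fun x => g' x * v x) MeasureTheory.volume a c := by
      intro a ha c hc
      exact (hg'i a ha c hc).mul_continuousOn hvc.continuousOn
    have i1 : ∫ x in lo..ζ, g' x = g ζ := by
      rw [intervalIntegral.integral_eq_sub_of_hasDerivAt (f := g) _ (hg'i _ hlom _ hζm), hglo, sub_zero]
      intro x hx
      rw [Set.uIcc_of_le hζm.1] at hx
      exact hgd x ⟨hx.1, hx.2.trans hζm.2⟩
    have i2 : ∫ x in ζ..hi, g' x = - g ζ := by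
      rw [intervalIntegral.integral_eq_sub_of_hasDerivAt (f := g) _ (hg'i _ hζm _ hhim), hghi, zero_sub]
      intro x hx
      rw [Set.uIcc_of_le hζm.2] at hx
      exact hgd x ⟨hζm.1.trans hx.1, hx.2⟩
    have e1 : ∫ x in lo..ζ, g' x * (X * (Kt M (f x / X) + 1/2)) = (∫ x in lo..ζ, g' x * v x) + X / 2 * g ζ := by
      rw [← i1, ← intervalIntegral.integral_const_mul, ← intervalIntegral.integral_add (hgv _ hlom _ hζm) ((hg'i _ hlom _ hζm).const_mul _)]
      congr 1; ext x; simp only [hv]; ring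
    have e2 : ∫ x in ζ..hi, g' x * (X * (Kt M (f x / X) - 1/2)) = (∫ x in ζ..hi, g' x * v x) + X / 2 * g ζ := by
      have : X / 2 * g ζ = - (X/2) * ∫ x in ζ..hi, g' x := by rw [i2]; ring
      rw [this, ← intervalIntegral.integral_const_mul, ← intervalIntegral.integral_add (hgv _ hζm _ hhim) ((hg'i _ hζm _ hhim).const_mul _)]
      congr 1; ext x; simp only [hv]; ring
    have hdat : ∀ y, HasDerivAt (fun y => G / P^2 * X * CK * (4 / (s * P)) * X * Real.arctan (f y / X))
        (G / P^2 * X * CK * (4 / (s * P)) * (f' y * (1 / (1 + (f y / X)^2)))) y := by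
      intro y
      have h1 := HasDerivAt.comp (h := fun y => f y / X) (h₂ := Real.arctan) y (Real.hasDerivAt_arctan (f y / X)) ((hfd y).div_const X)
      have h2 := h1.const_mul (G / P^2 * X * CK * (4 / (s * P)) * X)
      refine h2.congr_deriv ?_
      field_simp
    have hmajc : Continuous (fun y => G / P^2 * X * CK * (4 / (s * P)) * (f' y * (1 / (1 + (f y / X)^2)))) := by
      refine continuous_const.mul (hfc'.mul (continuous_const.div ?_ ?_))
      · exact continuous_const.add ((hfc.div_const X).pow 2)
      · intro y; positivity
    have hmaj : ∀ y ∈ Set.Icc lo hi, G / P^2 * (X * (CK / (1 + (f y / X)^2))) ≤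
        G / P^2 * X * CK * (4 / (s * P)) * (f' y * (1 / (1 + (f y / X)^2))) := by
      intro y hy
      have h1 := (hfl y hy).1
      have h2 : 1 ≤ 4 / (s * P) * f' y := by
        rw [div_mul_eq_mul_div, le_div_iff₀ (by positivity)]; linarith
      calc _ = G / P^2 * X * CK * (1 / (1 + (f y / X)^2)) * 1 := by ring
        _ ≤ G / P^2 * X * CK * (1 / (1 + (f y / X)^2)) * (4 / (s * P) * f' y) := by gcongr
        _ = _ := by ring
    have harc : ∀ a c : ℝ, ∫ y in a..c, G / P^2 * X * CK * (4 / (s * P)) * (f' y * (1 / (1 + (f y / X)^2))) ≤ C1 / 2 * X^2 / P^3 := by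
      intro a c
      rw [intervalIntegral.integral_eq_sub_of_hasDerivAt (fun y _ => hdat y) (hmajc.intervalIntegrable _ _)]
      rw [← mul_sub]
      have h1 := Real.arctan_lt_pi_div_two (f c / X)
      have h2 := Real.neg_pi_div_two_lt_arctan (f a / X)
      calc _ ≤ G / P^2 * X * CK * (4 / (s * P)) * X * Real.pi := by gcongr; linarith
        _ = _ := by rw [hC1]; field_simp
    have b1 : |∫ x in lo..ζ, g' x * (X * (Kt M (f x / X) + 1/2))| ≤ C1 / 2 * X^2 / P^3 := by
      rw [← Real.norm_eq_abs]
      refine (intervalIntegral.norm_integral_le_of_norm_le hζm.1 ?_ (hmajc.intervalIntegrable _ _)).trans (harc lo ζ)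
      apply Filter.Eventually.of_forall
      intro y hy
      have hy' : y ∈ Set.Icc lo hi := ⟨hy.1.le, hy.2.trans hζm.2⟩
      refine le_trans ?_ (hmaj y hy')
      rw [norm_mul, norm_mul, Real.norm_eq_abs, Real.norm_eq_abs, Real.norm_eq_abs, abs_of_pos hX]
      have hneg : f y / X ≤ 0 := by
        apply div_nonpos_of_nonpos_of_nonneg _ hX.le
        rw [← hζ0]
        exact hmono.monotoneOn hy' hζm hy.2
      have h1 := hg'b y hy'
      have h2 := (hK _ M (hMv y hy')).2.1 hneg
      gcongr
    have b2 : |∫ x in ζ..hi, g' x * (X * (Kt M (f x / X) - 1/2))| ≤ C1 / 2 * X^2 / P^3 := by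
      rw [← Real.norm_eq_abs]
      refine (intervalIntegral.norm_integral_le_of_norm_le hζm.2 ?_ (hmajc.intervalIntegrable _ _)).trans (harc ζ hi)
      apply Filter.Eventually.of_forall
      intro y hy
      have hy' : y ∈ Set.Icc lo hi := ⟨hζm.1.trans hy.1.le, hy.2⟩
      refine le_trans ?_ (hmaj y hy')
      rw [norm_mul, norm_mul, Real.norm_eq_abs, Real.norm_eq_abs, Real.norm_eq_abs, abs_of_pos hX]
      have hneg : 0 ≤ f y / X := by
        apply div_nonneg _ hX.le
        rw [← hζ0]
        exact hmono.monotoneOn hζm hy' hy.1.le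
      have h1 := hg'b y hy'
      have h2 := (hK _ M (hMv y hy')).1 hneg
      gcongr
    rw [← intervalIntegral.integral_add_adjacent_intervals (hgv _ hlom _ hζm) (hgv _ hζm _ hhim)]
    have e3 : -((∫ x in lo..ζ, g' x * v x) + ∫ x in ζ..hi, g' x * v x) - X * g ζ
      = - ((∫ x in lo..ζ, g' x * (X * (Kt M (f x / X) + 1/2))) + ∫ x in ζ..hi, g' x * (X * (Kt M (f x / X) - 1/2))) := by
      rw [e1, e2]; ring
    rw [e3, abs_neg]
    calc _ ≤ _ := abs_add_le _ _
      _ ≤ C1 / 2 * X^2 / P^3 + C1 / 2 * X^2 / P^3 := add_le_add b1 b2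
      _ = C1 * X^2 / P^3 := by ring
      _ ≤ _ := by gcongr; have : 0 < 4/s := by positivity
                  linarith
  · rw [abs_neg]
    have := intervalIntegral.norm_integral_le_of_norm_le_const (a := lo) (b := hi) (f := fun x => g' x * v x) (C := G / P^2 * (X * CK)) (by
      intro y hy
      rw [Set.uIoc_of_le hlohi] at hy
      have hy' : y ∈ Set.Icc lo hi := ⟨hy.1.le, hy.2⟩
      rw [norm_mul, hv, norm_mul, Real.norm_eq_abs, Real.norm_eq_abs, Real.norm_eq_abs, abs_of_pos hX]
      have h1 := hg'b y hy'
      have h2 := (hK _ M (hMv y hy')).2.2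
      gcongr)
    rw [Real.norm_eq_abs, abs_of_nonneg (by linarith : 0 ≤ hi - lo)] at this
    calc _ ≤ _ := this
      _ ≤ G / P^2 * (X * CK) * (2 / s * P) := by gcongr
      _ = C2 * X / P := by rw [hC2]; field_simp
      _ ≤ _ := by gcongr; have : 0 < 4/s := by positivity
                  linarith
end PF

namespace PF
open Finset

noncomputable def bx (K : ℕ) : Finset (Fin 4 → ℤ) := Fintype.piFinset fun _ => Icc (-K : ℤ) K

lemma mem_bx {K : ℕ} {y : Fin 4 → ℤ} : y ∈ bx K ↔ ∀ j, |y j| ≤ K := by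
  simp [bx, Fintype.mem_piFinset, abs_le]

lemma card_bx (K : ℕ) : (bx K).card = (2*K+1)^4 := by
  simp only [bx, Fintype.card_piFinset, Int.card_Icc, prod_const, card_univ, Fintype.card_fin]
  congr 1; omega

noncomputable def GG (Φ : (Fin 4 → ℝ) → ℝ) (d K : ℕ) (r : Fin 4 → ℝ) : ℝ :=
  ∑ k ∈ bx K, Φ (fun j => r j + d * k j)

/-- Hypotheses on a weight. -/
structure Wt (Φ : (Fin 4 → ℝ) → ℝ) (R : ℝ) (A : ℕ) (M : ℝ) : Prop where
  supp : ∀ t j, R ≤ |t j| → Φ t = 0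
  sm : ∀ t j, ContDiff ℝ (⊤ : ℕ∞) (fun s => Φ (Function.update t j s))
  bd : ∀ t j s, |iteratedDeriv A (fun s => Φ (Function.update t j s)) s| ≤ M

lemma GG_step {Φ : (Fin 4 → ℝ) → ℝ} {R : ℝ} {A : ℕ} {M : ℝ} (h : Wt Φ R A M) (hA : 1 ≤ A)
    (d K : ℕ) (hd : 0 < d) (hK : R + 1 ≤ K) (r : Fin 4 → ℝ) (j : Fin 4) (x y : ℝ) (hx : x ∈ Set.Icc (0:ℝ) d) (hy : y ∈ Set.Icc (0:ℝ) d) :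
    |GG Φ d K (Function.update r j x) - GG Φ d K (Function.update r j y)| ≤ (d:ℝ)^A * ((bx K).card * M) := by
  set φ : (Fin 4 → ℤ) → ℝ → ℝ := fun k t => Φ (Function.update (fun i => r i + d * k i) j (t + d * k j)) with hφ
  have hd1 : (1:ℝ) ≤ d := by exact_mod_cast hd
  have hG : ∀ t, GG Φ d K (Function.update r j t) = ∑ k ∈ bx K, φ k t := by
    intro t
    unfold GG
    apply sum_congr rfl; intro k _
    simp only [hφ]
    congr 1; ext i
    by_cases hi : i = j
    · subst hi; simp
    · simp [Function.update_of_ne hi]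
  have hne : ∀ k t, φ k t ≠ 0 → |t + d * k j| < R := by
    intro k t hk
    by_contra hc
    apply hk
    apply h.supp _ j
    simpa using not_lt.1 hc
  rw [hG, hG]
  refine period_sum (bx K) φ ?_ A hA d M (by positivity) ?_ ?_ x hx y hy
  · intro k
    exact (h.sm (fun i => r i + d * k i) j).comp (by fun_prop)
  · intro t ht
    rw [abs_lt] at ht
    have : ∑ k ∈ bx K with φ k (t + d) ≠ 0, φ k (t + d) = ∑ k ∈ bx K, φ k t := by
      apply sum_of_injOn (fun k => k + Pi.single j 1)
      · intro a _ b _ hab; exact add_right_cancel hab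
      · intro k hk
        simp only [coe_filter, Set.mem_ofPred_eq, mem_bx] at hk
        have h1 := hne k _ hk.2
        rw [abs_lt] at h1
        simp only [mem_coe, mem_bx]
        intro i
        by_cases hi : i = j
        · subst hi
          simp only [Pi.add_apply, Pi.single_eq_same]
          have h2 : |(k i : ℝ) + 1| ≤ K := by
            have h3 : (d:ℝ) * (k i + 1) < K := by linarith
            have h4 : -(K:ℝ) < d * (k i + 1) := by linarith
            rw [abs_le]
            constructor
            · by_contra hc; push Not at hc
              have : (d:ℝ) * (k i + 1) ≤ 1 * (k i + 1) := by
                apply mul_le_mul_of_nonpos_right hd1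
                have : (0:ℝ) ≤ K := by positivity
                linarith
              linarith
            · by_contra hc; push Not at hc
              have : 1 * ((k i : ℝ) + 1) ≤ (d:ℝ) * (k i + 1) := by
                gcongr
                have : (0:ℝ) ≤ K := by positivity
                linarith
              linarith
          exact_mod_cast h2
        · simpa [Pi.single_eq_of_ne hi] using hk.1 i
      · intro k hk hk'
        by_contra h0
        apply hk'
        have h1 := hne k t h0
        rw [mem_bx] at hk
        rw [abs_lt] at h1
        refine ⟨k - Pi.single j 1, ?_, by simp⟩
        have e : φ (k - Pi.single j 1) (t + d) = φ k t := by
          simp only [hφ]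
          congr 1; ext i
          by_cases hi : i = j
          · subst hi; simp; ring
          · simp [Function.update_of_ne hi, Pi.single_eq_of_ne hi]
        simp only [coe_filter, Set.mem_ofPred_eq, mem_bx, e]
        refine ⟨?_, h0⟩
        intro i
        by_cases hi : i = j
        · subst hi
          simp only [Pi.sub_apply, Pi.single_eq_same]
          have := abs_le.1 (hk i)
          rw [abs_le]
          constructor
          · by_contra hc; push Not at hc
            have : k i = -K := by omega
            have : (k i : ℝ) = - K := by exact_mod_cast this
            rw [this] at h1
            nlinarith [(Nat.cast_nonneg K : (0:ℝ) ≤ K)]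
          · omega
        · simpa [Pi.single_eq_of_ne hi] using hk i
      · intro k hk
        simp only [hφ]
        congr 1; ext i
        by_cases hi : i = j
        · subst hi; simp; ring
        · simp [Function.update_of_ne hi, Pi.single_eq_of_ne hi]
    rw [← this, sum_filter_ne_zero]
  · intro k t
    have e : φ k = fun t => (fun s => Φ (Function.update (fun i => r i + d * k i) j s)) (t + d * k j) := rfl
    have h2 := congrFun (iteratedDeriv_comp_add_const A (fun s => Φ (Function.update (fun i => r i + d * k i) j s)) ((d:ℝ) * k j)) t
    rw [e]
    refine (congrArg abs h2).trans_le ?_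
    exact h.bd _ _ _

lemma GG_zero {Φ : (Fin 4 → ℝ) → ℝ} {R : ℝ} {A : ℕ} {M : ℝ} (h : Wt Φ R A M) (hA : 1 ≤ A)
    (d K : ℕ) (hd : 0 < d) (hK : R + 1 ≤ K) (r : Fin 4 → ℝ) (hr : ∀ j, r j ∈ Set.Icc (0:ℝ) d) :
    |GG Φ d K r - GG Φ d K 0| ≤ 4 * ((d:ℝ)^A * ((bx K).card * M)) := by
  set E := (d:ℝ)^A * ((bx K).card * M)
  have key : ∀ s : Finset (Fin 4), |GG Φ d K r - GG Φ d K (s.piecewise 0 r)| ≤ s.card * E := by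
    intro s
    induction s using Finset.induction_on with
    | empty => simp
    | insert j s hj ih =>
      rw [piecewise_insert, card_insert_of_notMem hj]
      have := GG_step h hA d K hd hK (s.piecewise 0 r) j (r j) 0 (hr j) ⟨le_rfl, by positivity⟩
      have e : Function.update (s.piecewise 0 r) j (r j) = s.piecewise 0 r := by
        rw [Function.update_eq_self_iff]; simp [hj]
      rw [e] at this
      push_cast
      calc _ ≤ _ := abs_sub_le _ (GG Φ d K (s.piecewise 0 r)) _
        _ ≤ s.card * E + E := add_le_add ih this
        _ = _ := by ring
  have := key univ
  simpa using this

lemma sum_res {E : Type*} [AddCommMonoid E] (g : (Fin 4 → ℤ) → E) (d K : ℕ) [NeZero d] (hg : ∀ y, y ∉ bx K → g y = 0) (r : Fin 4 → ZMod d) :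
    ∑ y ∈ bx K with (fun j => ((y j : ℤ) : ZMod d)) = r, g y = ∑ k ∈ bx K, g (fun j => ((r j).val : ℤ) + d * k j) := by
  have hd : (0:ℤ) < d := by exact_mod_cast Nat.pos_of_ne_zero (NeZero.ne d)
  have hmod : ∀ y : Fin 4 → ℤ, (fun j => ((y j : ℤ) : ZMod d)) = r → ∀ j, ((r j).val : ℤ) = y j % d := by
    intro y hy j
    rw [← hy, ZMod.val_intCast]
  have hback : ∀ y : Fin 4 → ℤ, (fun j => ((y j : ℤ) : ZMod d)) = r → (fun j => ((r j).val : ℤ) + d * (y j / d)) = y := by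
    intro y hy
    ext j
    rw [hmod y hy]; exact Int.emod_add_mul_ediv _ _
  apply sum_of_injOn (fun (y : Fin 4 → ℤ) j => y j / (d:ℤ))
  · intro y hy z hz hyz
    simp only [coe_filter, Set.mem_ofPred_eq] at hy hz
    rw [← hback y hy.2, ← hback z hz.2]
    ext j; rw [show y j / d = z j / d from congrFun hyz j]
  · intro y hy
    simp only [coe_filter, Set.mem_ofPred_eq, mem_bx] at hy
    simp only [mem_coe, mem_bx]
    intro j
    have := abs_le.1 (hy.1 j)
    rw [abs_le]
    constructor
    · rw [Int.le_ediv_iff_mul_le hd]; nlinarith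
    · apply Int.le_of_lt_add_one
      rw [Int.ediv_lt_iff_lt_mul hd]; nlinarith
  · intro k hk hk'
    apply hg
    intro hm
    apply hk'
    refine ⟨fun j => ((r j).val : ℤ) + d * k j, ?_, ?_⟩
    · simp only [coe_filter, Set.mem_ofPred_eq]
      refine ⟨hm, ?_⟩
      ext j; simp
    · ext j
      show (((r j).val : ℤ) + d * k j) / d = k j
      rw [Int.add_mul_ediv_left _ _ hd.ne', Int.ediv_eq_zero_of_lt (by positivity) (by exact_mod_cast ZMod.val_lt _), zero_add]
  · intro y hy
    simp only [mem_filter] at hy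
    rw [hback y hy.2]

lemma sum_res' {E : Type*} [AddCommMonoid E] (g : (Fin 4 → ℤ) → E) (d K : ℕ) [NeZero d] (hg : ∀ y, y ∉ bx K → g y = 0) :
    ∑ y ∈ bx K, g y = ∑ r : Fin 4 → ZMod d, ∑ k ∈ bx K, g (fun j => ((r j).val : ℤ) + d * k j) := by
  rw [← sum_fiberwise (bx K) (fun y => (fun j => ((y j : ℤ) : ZMod d)))]
  exact sum_congr rfl fun r _ => sum_res g d K hg r

lemma equi {Φ : (Fin 4 → ℝ) → ℝ} {R : ℝ} {A : ℕ} {M : ℝ} (h : Wt Φ R A M) (hA : 1 ≤ A)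
    (d K : ℕ) [NeZero d] (hK : R + 1 ≤ K) (F : (Fin 4 → ZMod d) → ℂ) (B : ℝ) (hB : ∀ r, ‖F r‖ ≤ B) :
    ‖∑ y ∈ bx K, (Φ (fun j => (y j : ℝ)) : ℂ) * F (fun j => (y j : ZMod d)) -
      (∑ r, F r) / d^4 * ((∑ y ∈ bx K, Φ (fun j => (y j : ℝ)) : ℝ) : ℂ)‖ ≤ d^4 * B * (8 * ((d:ℝ)^A * ((bx K).card * M))) := by
  set E := (d:ℝ)^A * ((bx K).card * M) with hE
  have hd : 0 < d := Nat.pos_of_ne_zero (NeZero.ne d)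
  have hdR : (0:ℝ) < d := by exact_mod_cast hd
  have hdC : (d:ℂ) ≠ 0 := by exact_mod_cast hd.ne'
  have hz : ∀ y : Fin 4 → ℤ, y ∉ bx K → Φ (fun j => (y j : ℝ)) = 0 := by
    intro y hy
    rw [mem_bx] at hy
    push Not at hy
    obtain ⟨j, hj⟩ := hy
    apply h.supp _ j
    have : (K:ℝ) < |(y j : ℝ)| := by exact_mod_cast hj
    linarith
  set V : (Fin 4 → ZMod d) → ℝ := fun r => GG Φ d K (fun j => ((r j).val : ℝ)) with hV
  have hV0 : ∀ r, |V r - GG Φ d K 0| ≤ 4 * E := by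
    intro r
    apply GG_zero h hA d K hd hK
    intro j
    exact ⟨by positivity, by exact_mod_cast (ZMod.val_lt (r j)).le⟩
  have e1 : ∑ y ∈ bx K, (Φ (fun j => (y j : ℝ)) : ℂ) * F (fun j => (y j : ZMod d)) = ∑ r, (V r : ℂ) * F r := by
    rw [sum_res' _ d K (fun y hy => by rw [hz y hy]; simp)]
    apply sum_congr rfl; intro r _
    simp only [hV, GG]
    push_cast
    rw [sum_mul]
    apply sum_congr rfl; intro k _
    congr 2
    ext j; simp
  have e2 : ∑ y ∈ bx K, Φ (fun j => (y j : ℝ)) = ∑ r, V r := by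
    rw [sum_res' _ d K (fun y hy => hz y hy)]
    apply sum_congr rfl; intro r _
    simp only [hV, GG]
    push_cast
    rfl
  have hcard : (Fintype.card (Fin 4 → ZMod d) : ℝ) = d^4 := by
    rw [Fintype.card_fun, ZMod.card, Fintype.card_fin]; push_cast; rfl
  rw [e1, e2]
  set G0 := GG Φ d K 0
  have e3 : ∑ r, (V r : ℂ) * F r - (∑ r, F r) / d^4 * ((∑ r, V r : ℝ) : ℂ)
      = ∑ r, ((V r - G0 : ℝ) : ℂ) * F r - (∑ r, F r) / d^4 * ((∑ r, (V r - G0) : ℝ) : ℂ) := by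
    have hc : ((∑ r : Fin 4 → ZMod d, G0 : ℝ) : ℂ) = d^4 * G0 := by
      rw [sum_const, card_univ, nsmul_eq_mul, hcard]; push_cast; rfl
    rw [sum_sub_distrib, Complex.ofReal_sub, hc]
    simp only [Complex.ofReal_sub, sub_mul]
    rw [sum_sub_distrib, ← mul_sum]
    field_simp
    ring
  rw [e3]
  have hB0 : 0 ≤ B := (norm_nonneg _).trans (hB 0)
  have b1 : ‖∑ r, ((V r - G0 : ℝ) : ℂ) * F r‖ ≤ d^4 * (4 * E * B) := by
    calc _ ≤ ∑ r : Fin 4 → ZMod d, 4 * E * B := by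
          apply norm_sum_le_of_le; intro r _
          rw [norm_mul, Complex.norm_real, Real.norm_eq_abs]
          have := hV0 r
          gcongr
          · exact (abs_nonneg _).trans this
          · exact hB r
      _ = _ := by rw [sum_const, card_univ, nsmul_eq_mul, hcard]
  have b2 : ‖∑ r, F r‖ ≤ d^4 * B := by
    calc _ ≤ ∑ r : Fin 4 → ZMod d, B := norm_sum_le_of_le _ fun r _ => hB r
      _ = _ := by rw [sum_const, card_univ, nsmul_eq_mul, hcard]
  have b3 : ‖((∑ r, (V r - G0) : ℝ) : ℂ)‖ ≤ d^4 * (4 * E) := by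
    rw [Complex.norm_real, Real.norm_eq_abs]
    calc _ ≤ ∑ r : Fin 4 → ZMod d, 4 * E := (abs_sum_le_sum_abs _ _).trans (sum_le_sum fun r _ => hV0 r)
      _ = _ := by rw [sum_const, card_univ, nsmul_eq_mul, hcard]
  calc _ ≤ _ := norm_sub_le _ _
    _ ≤ d^4 * (4 * E * B) + d^4 * B / d^4 * (d^4 * (4 * E)) := by
        rw [norm_mul, norm_div, norm_pow, Complex.norm_natCast]
        gcongr
    _ = _ := by field_simp; ring
end PF

namespace PF
open Finset

def fq (α β : Fin 4 → ℤ) (γ : ℤ) (y : Fin 4 → ℤ) : ℤ := ∑ j, (α j * y j ^ 2 + β j * y j) - γ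

noncomputable def Wh (d : ℕ) [NeZero d] (K : ℕ) (b : ℝ → ℝ) (c : ZMod d) : ℂ :=
  ∑ y ∈ Icc (-K:ℤ) K, (b y : ℂ) * ZMod.stdAddChar (N := d) (-(c * (y : ZMod d)))

lemma one_dim (d : ℕ) [NeZero d] (K : ℕ) (b : ℝ → ℝ) (s t : ZMod d) :
    ∑ y ∈ Icc (-K:ℤ) K, (b y : ℂ) * ZMod.stdAddChar (N := d) (s * (y : ZMod d)^2 + t * y) =
      ∑ c : ZMod d, (Wh d K b c / d) * gs (ZMod.stdAddChar (N := d)) s (t + c) := by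
  have hdC : (d:ℂ) ≠ 0 := by exact_mod_cast NeZero.ne d
  unfold Wh gs
  have : ∀ y : ℤ, ∑ c : ZMod d, ∑ x : ZMod d, ZMod.stdAddChar (N := d) (-(c * (y : ZMod d))) *
      ZMod.stdAddChar (N := d) (s * x^2 + (t + c) * x) = d * ZMod.stdAddChar (N := d) (s * (y : ZMod d)^2 + t * y) := by
    intro y
    rw [sum_comm]
    have h1 : ∀ x : ZMod d, ∑ c : ZMod d, ZMod.stdAddChar (N := d) (-(c * (y : ZMod d))) *
      ZMod.stdAddChar (N := d) (s * x^2 + (t + c) * x) = if x = y then d * ZMod.stdAddChar (N := d) (s * x^2 + t * x) else 0 := by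
      intro x
      have h2 : ∀ c : ZMod d, ZMod.stdAddChar (N := d) (-(c * (y : ZMod d))) *
        ZMod.stdAddChar (N := d) (s * x^2 + (t + c) * x) = ZMod.stdAddChar (N := d) (s * x^2 + t * x) * ZMod.stdAddChar (N := d) (c * (x - y)) := by
        intro c
        rw [← AddChar.map_add_eq_mul, ← AddChar.map_add_eq_mul]; congr 1; ring
      simp only [h2]
      rw [← mul_sum, AddChar.sum_mulShift _ (ZMod.isPrimitive_stdAddChar d), ZMod.card]
      simp only [sub_eq_zero]
      split_ifs <;> simp [mul_comm]
    simp only [h1]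
    simp
  calc _ = ∑ y ∈ Icc (-K:ℤ) K, (b y : ℂ) * ((∑ c : ZMod d, ∑ x : ZMod d, ZMod.stdAddChar (N := d) (-(c * (y : ZMod d))) *
      ZMod.stdAddChar (N := d) (s * x^2 + (t + c) * x)) / d) := by
        apply sum_congr rfl; intro y _
        rw [this]; field_simp
    _ = _ := by
        simp only [div_eq_mul_inv, sum_mul, mul_sum]
        rw [sum_comm]
        apply sum_congr rfl; intro c _
        rw [sum_comm]
        apply sum_congr rfl; intro x _
        apply sum_congr rfl; intro y _
        ring

lemma char_sum {d : ℕ} {ι : Type*} (ψ : AddChar (ZMod d) ℂ) (s : Finset ι) (f : ι → ZMod d) :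
    ψ (∑ i ∈ s, f i) = ∏ i ∈ s, ψ (f i) := by
  classical
  induction s using Finset.induction_on with
  | empty => simp
  | insert a s ha ih => rw [sum_insert ha, prod_insert ha, AddChar.map_add_eq_mul, ih]

lemma Nst_eq (α β : Fin 4 → ℤ) (γ : ℤ) (d : ℕ) [NeZero d] (K : ℕ) (b : Fin 4 → ℝ → ℝ) :
    ∑ y ∈ bx K, ((∏ j, b j (y j) : ℝ) : ℂ) * cram d (fq α β γ y) =
      ∑ c : Fin 4 → ZMod d, (∏ j, (Wh d K (b j) (c j) / d)) * Ssum α β γ (ZMod.stdAddChar (N := d)) c := by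
  have h1 : ∀ u : (ZMod d)ˣ, ∑ y ∈ bx K, ((∏ j, b j (y j) : ℝ) : ℂ) * ZMod.stdAddChar (N := d) ((u : ZMod d) * (fq α β γ y : ℤ)) =
     ∑ c : Fin 4 → ZMod d, (∏ j, (Wh d K (b j) (c j) / d)) * (ZMod.stdAddChar (N := d) (-(u * γ)) * ∏ j, gs (ZMod.stdAddChar (N := d)) (u * α j) (u * β j + c j)) := by
    intro u
    have h2 : ∀ y : Fin 4 → ℤ, ((∏ j, b j (y j) : ℝ) : ℂ) * ZMod.stdAddChar (N := d) ((u : ZMod d) * (fq α β γ y : ℤ)) =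
      ZMod.stdAddChar (N := d) (-(u * γ)) * ∏ j, ((b j (y j) : ℂ) * ZMod.stdAddChar (N := d) ((u * α j) * (y j : ZMod d)^2 + (u * β j) * y j)) := by
      intro y
      rw [prod_mul_distrib]
      have : (u : ZMod d) * (fq α β γ y : ℤ) = -((u : ZMod d) * γ) + ∑ j, (((u : ZMod d) * α j) * (y j : ZMod d)^2 + ((u : ZMod d) * β j) * y j) := by
        unfold fq
        push_cast
        rw [mul_sub, mul_sum, sub_eq_neg_add]
        congr 1
        apply sum_congr rfl; intro j _; ring
      rw [this, AddChar.map_add_eq_mul, char_sum]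
      push_cast
      ring
    simp only [h2]
    rw [← mul_sum]
    unfold bx
    rw [← Finset.prod_univ_sum (fun _ => Icc (-K:ℤ) K) (fun j (y:ℤ) => (b j y : ℂ) * ZMod.stdAddChar (N := d) ((u * α j) * (y : ZMod d)^2 + (u * β j) * y))]
    simp only [one_dim]
    rw [Finset.prod_univ_sum, mul_sum, Fintype.piFinset_univ]
    apply sum_congr rfl; intro c _
    rw [prod_mul_distrib]; ring
  simp only [← ram_eq_cram, ram, mul_sum]
  rw [sum_comm]
  simp only [h1]
  rw [sum_comm]
  simp only [Ssum, mul_sum]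

lemma Nst_le (α β : Fin 4 → ℤ) (γ : ℤ) (d : ℕ) [NeZero d] (K : ℕ) (b : Fin 4 → ℝ → ℝ) (S T : ℝ)
    (hS : ∀ c, ‖Ssum α β γ (ZMod.stdAddChar (N := d)) c‖ ≤ S) (hT : ∀ j, ∑ c : ZMod d, ‖Wh d K (b j) c / d‖ ≤ T) :
    ‖∑ y ∈ bx K, ((∏ j, b j (y j) : ℝ) : ℂ) * cram d (fq α β γ y)‖ ≤ T^4 * S := by
  rw [Nst_eq]
  have hS0 : 0 ≤ S := (norm_nonneg _).trans (hS 0)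
  calc _ ≤ ∑ c : Fin 4 → ZMod d, (∏ j, ‖Wh d K (b j) (c j) / d‖) * S := by
        apply norm_sum_le_of_le; intro c _
        rw [norm_mul, norm_prod]
        gcongr
        exact hS c
    _ = (∏ j, ∑ c : ZMod d, ‖Wh d K (b j) c / d‖) * S := by
        rw [Finset.prod_univ_sum, ← sum_mul, Fintype.piFinset_univ]
    _ ≤ (∏ j : Fin 4, T) * S := by
        gcongr with j _
        exact hT j
    _ = _ := by simp

lemma sum_shift (K : ℕ) (h : ℤ → ℂ) (h1 : h (-K) = 0) (h2 : h (K+1) = 0) :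
    ∑ y ∈ Icc (-K:ℤ) K, h (y + 1) = ∑ y ∈ Icc (-K:ℤ) K, h y := by
  have e1 : ∑ y ∈ Icc (-K:ℤ) K, h (y + 1) = ∑ y ∈ Icc (-K + 1 : ℤ) (K+1), h y := by
    rw [← map_add_right_Icc, sum_map]; rfl
  rw [e1]
  have e2 : ∑ y ∈ Icc (-K + 1 : ℤ) (K+1), h y = ∑ y ∈ Icc (-K : ℤ) (K+1), h y := by
    apply sum_subset
    · intro y; simp; omega
    · intro y hy hy'
      simp only [mem_Icc] at hy hy'
      have : y = -K := by omega
      rw [this, h1]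
  have e3 : ∑ y ∈ Icc (-K : ℤ) K, h y = ∑ y ∈ Icc (-K : ℤ) (K+1), h y := by
    apply sum_subset
    · intro y; simp; omega
    · intro y hy hy'
      simp only [mem_Icc] at hy hy'
      have : y = K + 1 := by omega
      rw [this, h2]
  rw [e2, e3]

lemma snd_diff (b : ℝ → ℝ) (hb : ContDiff ℝ (⊤:ℕ∞) b) (M : ℝ) (hM : ∀ y, |iteratedDeriv 2 b y| ≤ M) (y : ℝ) :
    |b (y + 1) - 2 * b y + b (y - 1)| ≤ M := by
  have hd0 : ∀ x, HasDerivAt b (iteratedDeriv 1 b x) x := by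
    intro x; simpa using hasDerivAt_iter b hb 0 x
  have hd1 : ∀ x, HasDerivAt (iteratedDeriv 1 b) (iteratedDeriv 2 b x) x := fun x => hasDerivAt_iter b hb 1 x
  have mv : ∀ x z, |iteratedDeriv 1 b x - iteratedDeriv 1 b z| ≤ M * |x - z| := by
    intro x z
    have := Convex.norm_image_sub_le_of_norm_hasDerivWithin_le (f := iteratedDeriv 1 b) (s := Set.univ) (C := M)
      (fun x _ => (hd1 x).hasDerivWithinAt) (fun x _ => hM x) convex_univ (Set.mem_univ z) (Set.mem_univ x)
    simpa using this
  have := Convex.norm_image_sub_le_of_norm_hasDerivWithin_le (f := fun t => b (t + 1) - b t) (f' := fun t => iteratedDeriv 1 b (t + 1) - iteratedDeriv 1 b t) (s := Set.univ) (C := M)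
      (fun x _ => (((hd0 (x+1)).comp_add_const x 1).sub (hd0 x)).hasDerivWithinAt) (fun x _ => by
        have := mv (x+1) x
        simpa using this) convex_univ (Set.mem_univ (y-1)) (Set.mem_univ y)
  simp only [Real.norm_eq_abs] at this
  have e : y - 1 + 1 = y := by ring
  rw [e, show y - (y - 1) = 1 by ring, abs_one, mul_one] at this
  convert this using 2; ring

lemma Wh_mul (d : ℕ) [NeZero d] (K : ℕ) (b : ℝ → ℝ) (R : ℝ) (hK : R + 1 ≤ K) (hR : ∀ y, R ≤ |y| → b y = 0) (c : ZMod d) :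
    (ZMod.stdAddChar (N := d) c - 2 + ZMod.stdAddChar (N := d) (-c)) * Wh d K b c =
     ∑ y ∈ Icc (-K:ℤ) K, ((b (y + 1) - 2 * b y + b (y - 1) : ℝ) : ℂ) * ZMod.stdAddChar (N := d) (-(c * (y : ZMod d))) := by
  have hz : ∀ y : ℤ, (K:ℝ) - 1 ≤ |(y:ℝ)| → b y = 0 := fun y hy => hR _ (by linarith)
  have hK0 : (0:ℝ) ≤ K := by positivity
  have s1 := sum_shift K (fun y => (b y : ℂ) * ZMod.stdAddChar (N := d) (-(c * ((y - 1 : ℤ) : ZMod d)))) (by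
    rw [hz _ (by push_cast; rw [abs_neg, abs_of_nonneg hK0]; linarith)]; simp) (by
    rw [hz _ (by push_cast; rw [abs_of_nonneg (by linarith)]; linarith)]; simp)
  have s2 := sum_shift K (fun y => (b (y - 1) : ℂ) * ZMod.stdAddChar (N := d) (-(c * ((y : ℤ) : ZMod d)))) (by
    rw [hR _ (by push_cast; rw [abs_of_nonpos (by linarith)]; linarith)]; simp) (by
    rw [hR _ (by push_cast; rw [abs_of_nonneg (by linarith)]; linarith)]; simp)
  have e1 : ZMod.stdAddChar (N := d) c * Wh d K b c = ∑ y ∈ Icc (-K:ℤ) K, (b (y + 1) : ℂ) * ZMod.stdAddChar (N := d) (-(c * (y : ZMod d))) := by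
    unfold Wh
    rw [mul_sum]
    calc _ = ∑ y ∈ Icc (-K:ℤ) K, (b y : ℂ) * ZMod.stdAddChar (N := d) (-(c * ((y - 1 : ℤ) : ZMod d))) := by
          apply sum_congr rfl; intro y _
          rw [mul_left_comm, ← AddChar.map_add_eq_mul]; congr 2; push_cast; ring
      _ = _ := by
          rw [← s1]; apply sum_congr rfl; intro y _; simp
  have e2 : ZMod.stdAddChar (N := d) (-c) * Wh d K b c = ∑ y ∈ Icc (-K:ℤ) K, (b (y - 1) : ℂ) * ZMod.stdAddChar (N := d) (-(c * (y : ZMod d))) := by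
    rw [← s2]
    unfold Wh
    rw [mul_sum]
    apply sum_congr rfl; intro y _
    rw [mul_left_comm, ← AddChar.map_add_eq_mul]; push_cast; rw [add_sub_cancel_right]; congr 2; ring
  rw [add_mul, sub_mul, e1, e2]
  unfold Wh
  rw [mul_sum, ← sum_sub_distrib, ← sum_add_distrib]
  apply sum_congr rfl; intro y _
  push_cast; ring

lemma chord (d : ℕ) [NeZero d] (c : ℕ) (hc0 : 0 < c) (hc : c < d) :
    0 < ‖ZMod.stdAddChar (N := d) (c : ZMod d) - 2 + ZMod.stdAddChar (N := d) (-(c : ZMod d))‖ ∧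
    1 / ‖ZMod.stdAddChar (N := d) (c : ZMod d) - 2 + ZMod.stdAddChar (N := d) (-(c : ZMod d))‖ ≤ (d:ℝ)^2 / 16 * (1 / (c:ℝ)^2 + 1 / ((d:ℝ) - c)^2) := by
  have hdp : (0:ℝ) < d := by exact_mod_cast hc0.trans hc
  have hcp : (0:ℝ) < c := by exact_mod_cast hc0
  have hcd : (c:ℝ) < d := by exact_mod_cast hc
  set θ : ℝ := Real.pi * c / d with hθ
  have h1 : ZMod.stdAddChar (N := d) (c : ZMod d) - 2 + ZMod.stdAddChar (N := d) (-(c : ZMod d)) = ((-(4 * Real.sin θ ^ 2) : ℝ) : ℂ) := by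
    have e1 : ZMod.stdAddChar (N := d) (c : ZMod d) = Complex.exp (((2 * θ : ℝ) : ℂ) * Complex.I) := by
      rw [std_eq]; congr 1; rw [hθ]; push_cast; ring
    have e2 : ZMod.stdAddChar (N := d) (-(c : ZMod d)) = Complex.exp (-((2 * θ : ℝ) : ℂ) * Complex.I) := by
      rw [AddChar.map_neg_eq_inv, e1, ← Complex.exp_neg, neg_mul]
    have e3 : Complex.exp (((2 * θ : ℝ) : ℂ) * Complex.I) + Complex.exp (-((2 * θ : ℝ) : ℂ) * Complex.I) = ((2 * Real.cos (2 * θ) : ℝ) : ℂ) := by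
      push_cast
      rw [← Complex.two_cos]
    rw [e1, e2, sub_add_eq_add_sub, e3, Real.cos_two_mul, Real.cos_sq']
    push_cast; ring
  rw [h1, Complex.norm_real, Real.norm_eq_abs, abs_neg, abs_of_nonneg (by positivity)]
  constructor
  · have : 0 < Real.sin θ := by
      apply Real.sin_pos_of_pos_of_lt_pi (by have := Real.pi_pos; positivity)
      rw [hθ, div_lt_iff₀ hdp]; have := Real.pi_pos; gcongr
    positivity
  rcases le_total (2 * (c:ℝ)) d with h | h
  · have h2 : 2 * c / d ≤ Real.sin θ := by
      have := Real.mul_le_sin (x := θ) (by positivity) (by rw [hθ, div_le_iff₀ hdp]; nlinarith [Real.pi_pos])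
      calc _ = 2 / Real.pi * θ := by rw [hθ]; field_simp
        _ ≤ _ := this
    calc _ ≤ 1 / (4 * (2 * c / d : ℝ)^2) := by gcongr
      _ = (d:ℝ)^2 / 16 * (1 / (c:ℝ)^2 + 0) := by field_simp; norm_num
      _ ≤ _ := by gcongr; positivity
  · have hs : Real.sin θ = Real.sin (Real.pi - θ) := (Real.sin_pi_sub θ).symm
    have e4 : Real.pi - θ = Real.pi * (d - c) / d := by rw [hθ]; field_simp
    have hdc : (0:ℝ) < d - c := by linarith
    have h2 : 2 * (d - c) / d ≤ Real.sin θ := by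
      rw [hs]
      have := Real.mul_le_sin (x := Real.pi - θ) (by rw [e4]; positivity) (by rw [e4, div_le_iff₀ hdp]; nlinarith [Real.pi_pos])
      calc _ = 2 / Real.pi * (Real.pi - θ) := by rw [e4]; field_simp
        _ ≤ _ := this
    calc _ ≤ 1 / (4 * (2 * (d - c) / d : ℝ)^2) := by gcongr
      _ = (d:ℝ)^2 / 16 * (0 + 1 / ((d:ℝ) - c)^2) := by field_simp; norm_num
      _ ≤ _ := by gcongr; positivity

lemma sum_zmod' {d : ℕ} [NeZero d] (F : ZMod d → ℝ) : ∑ x : ZMod d, F x = ∑ k ∈ range d, F (k : ℕ) := by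
  have := sum_zmod (d := d) (fun x => (F x : ℂ))
  exact_mod_cast this

lemma Wh_sum (d : ℕ) [NeZero d] (K : ℕ) (b : ℝ → ℝ) (R M : ℝ) (hK : R + 1 ≤ K) (hR : ∀ y, R ≤ |y| → b y = 0)
    (hb : ContDiff ℝ (⊤:ℕ∞) b) (hM : ∀ y, |iteratedDeriv 2 b y| ≤ M) (hb1 : ∀ y, |b y| ≤ 1) :
    ∑ c : ZMod d, ‖Wh d K b c / d‖ ≤ (2 * K + 1) / d + (2 * K + 1) * M * d / 4 := by
  have hdN : 0 < d := Nat.pos_of_ne_zero (NeZero.ne d)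
  have hdp : (0:ℝ) < d := by exact_mod_cast hdN
  have hM0 : 0 ≤ M := (abs_nonneg _).trans (hM 0)
  have hcard : ((Icc (-K:ℤ) K).card : ℝ) = 2 * K + 1 := by
    rw [Int.card_Icc]
    have : ((K:ℤ) + 1 - -K).toNat = 2 * K + 1 := by omega
    rw [this]; push_cast; ring
  have hnorm : ∀ x : ZMod d, ‖ZMod.stdAddChar (N := d) x‖ = 1 := fun x => AddChar.norm_apply _ _
  have t0 : ∀ c, ‖Wh d K b c‖ ≤ 2 * K + 1 := by
    intro c
    calc _ ≤ ∑ y ∈ Icc (-K:ℤ) K, (1:ℝ) := by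
          apply norm_sum_le_of_le; intro y _
          rw [norm_mul, hnorm, mul_one, Complex.norm_real]; exact hb1 _
      _ = _ := by rw [sum_const, nsmul_eq_mul, hcard, mul_one]
  have t1 : ∀ c ∈ Ico 1 d, ‖Wh d K b (c:ℕ)‖ ≤ (2 * K + 1) * M * ((d:ℝ)^2 / 16 * (1 / (c:ℝ)^2 + 1 / ((d:ℝ) - c)^2)) := by
    intro c hc
    rw [mem_Ico] at hc
    have h1 := Wh_mul d K b R hK hR (c : ZMod d)
    have h2 := chord d c (by omega) hc.2
    set z := ZMod.stdAddChar (N := d) (c : ZMod d) - 2 + ZMod.stdAddChar (N := d) (-(c : ZMod d)) with hz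
    have h3 : ‖z * Wh d K b (c:ℕ)‖ ≤ (2 * K + 1) * M := by
      rw [h1]
      calc _ ≤ ∑ y ∈ Icc (-K:ℤ) K, M := by
            apply norm_sum_le_of_le; intro y _
            rw [norm_mul, hnorm, mul_one, Complex.norm_real]; exact snd_diff b hb M hM _
        _ = _ := by rw [sum_const, nsmul_eq_mul, hcard]
    rw [norm_mul] at h3
    have hzn : 0 < ‖z‖ := h2.1
    have h2 := h2.2
    calc _ = (‖z‖ * ‖Wh d K b (c:ℕ)‖) * (1 / ‖z‖) := by field_simp
      _ ≤ _ := by gcongr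
  have hs : ∑ c ∈ Ico 1 d, 1 / (c:ℝ)^2 ≤ 2 := by
    have := sum_inv_sq_le' 0 (d - 1)
    have e : Ioc 0 (d-1) = Ico 1 d := by ext; simp; omega
    rw [e] at this
    simpa using this
  have hs' : ∑ c ∈ Ico 1 d, 1 / ((d:ℝ) - c)^2 ≤ 2 := by
    refine le_trans (le_of_eq ?_) hs
    have := Finset.sum_Ico_reflect (fun c => 1 / ((c:ℝ))^2) 1 (m := d) (n := d) (by omega)
    rw [show d + 1 - d = 1 by omega, show d + 1 - 1 = d by omega] at this
    rw [← this]
    apply sum_congr rfl; intro c hc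
    rw [mem_Ico] at hc
    rw [Nat.cast_sub hc.2.le]
  have e0 : ∑ c : ZMod d, ‖Wh d K b c / d‖ = (∑ c ∈ range d, ‖Wh d K b (c:ℕ)‖) / d := by
    rw [sum_zmod' (fun c : ZMod d => ‖Wh d K b c / d‖), sum_div]
    apply sum_congr rfl; intro c _
    rw [norm_div, Complex.norm_natCast]
  have e1 : ∑ c ∈ range d, ‖Wh d K b (c:ℕ)‖ = ‖Wh d K b (0:ℕ)‖ + ∑ c ∈ Ico 1 d, ‖Wh d K b (c:ℕ)‖ := by
    rw [range_eq_Ico, sum_eq_sum_Ico_succ_bot hdN]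
  have e2 : ∑ c ∈ Ico 1 d, ‖Wh d K b (c:ℕ)‖ ≤ (2 * K + 1) * M * ((d:ℝ)^2 / 16 * 4) := by
    calc _ ≤ ∑ c ∈ Ico 1 d, (2 * K + 1) * M * ((d:ℝ)^2 / 16 * (1 / (c:ℝ)^2 + 1 / ((d:ℝ) - c)^2)) := sum_le_sum t1
      _ = (2 * K + 1) * M * ((d:ℝ)^2 / 16 * (∑ c ∈ Ico 1 d, 1 / (c:ℝ)^2 + ∑ c ∈ Ico 1 d, 1 / ((d:ℝ) - c)^2)) := by
          rw [← mul_sum, ← mul_sum, sum_add_distrib]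
      _ ≤ _ := by gcongr; linarith
  rw [e0, e1]
  calc _ ≤ ((2 * K + 1) + (2 * K + 1) * M * ((d:ℝ)^2 / 16 * 4)) / d := by
        gcongr
        exact t0 _
    _ = _ := by field_simp; ring
end PF

namespace PF
open Finset

noncomputable def cc (α : Fin 4 → ℤ) (j : Fin 4) : ℝ := if j = 0 then 1/√(α 0 : ℝ) else 0
noncomputable def rr (α : Fin 4 → ℤ) (j : Fin 4) : ℝ := if j = 0 then 1/(2*√(α 0 : ℝ)) else 1/(8 * (α j : ℝ))
noncomputable def bb (α : Fin 4 → ℤ) (P : ℝ) (j : Fin 4) (y : ℝ) : ℝ := bw (cc α j) (rr α j) P y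
noncomputable def ww (α : Fin 4 → ℤ) (P : ℝ) (t : Fin 4 → ℝ) : ℝ := ∏ j, bb α P j (t j)
noncomputable def fr (α β : Fin 4 → ℤ) (γ : ℤ) (t : Fin 4 → ℝ) : ℝ := ∑ j, ((α j : ℝ) * t j ^ 2 + β j * t j) - γ
/-- bound for `|f|` on the support, divided by `P^2` -/
noncomputable def CF (α β : Fin 4 → ℤ) : ℝ := ∑ j, (4 * |(α j : ℝ)| + 2 * |(β j : ℝ)|) + 2

lemma CF_ge (α β : Fin 4 → ℤ) : 2 ≤ CF α β := by
  unfold CF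
  have : 0 ≤ ∑ j, (4 * |(α j : ℝ)| + 2 * |(β j : ℝ)|) := sum_nonneg fun j _ => by positivity
  linarith

section
variable (α β : Fin 4 → ℤ)

lemma fr_cast (γ : ℤ) (y : Fin 4 → ℤ) : fr α β γ (fun j => (y j : ℝ)) = (fq α β γ y : ℝ) := by
  unfold fr fq; push_cast; rfl

lemma bb_nonneg (P : ℝ) (j) (y : ℝ) : 0 ≤ bb α P j y := bw_nonneg _ _ _ _
lemma bb_le_one (P : ℝ) (j) (y : ℝ) : bb α P j y ≤ 1 := bw_le_one _ _ _ _
lemma bb_smooth (P : ℝ) (j) : ContDiff ℝ (⊤:ℕ∞) (bb α P j) := bw_smooth _ _ _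

lemma rr_pos (hα : ∀ j, 0 < α j) (j) : 0 < rr α j := by
  have h0 : (0:ℝ) < α 0 := by exact_mod_cast hα 0
  have hj : (0:ℝ) < α j := by exact_mod_cast hα j
  unfold rr
  split_ifs <;> positivity

lemma bb_zero (hα : ∀ j, 0 < α j) (P : ℝ) (hP : 0 < P) (j) (y : ℝ) (hy : 2 * P ≤ |y|) : bb α P j y = 0 := by
  apply bw_zero _ _ _ _ (rr_pos α hα j) hP
  refine le_trans ?_ hy
  gcongr
  unfold cc rr
  split_ifs with h
  · have h1 : (1:ℝ) ≤ √(α 0 : ℝ) := by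
      rw [Real.one_le_sqrt]; exact_mod_cast hα 0
    have h2 : 1 / √(α 0 : ℝ) ≤ 1 := by rw [div_le_one (by linarith)]; exact h1
    have h3 : 1 / (2 * √(α 0 : ℝ)) = 1/2 * (1 / √(α 0 : ℝ)) := by field_simp
    rw [abs_of_nonneg (by positivity), h3]
    linarith
  · have h1 : (1:ℝ) ≤ α j := by exact_mod_cast hα j
    have h2 : 1 / (8 * (α j : ℝ)) ≤ 1 := by rw [div_le_one (by linarith)]; linarith
    simp only [abs_zero, zero_add]
    linarith

lemma ww_zero (hα : ∀ j, 0 < α j) (P : ℝ) (hP : 0 < P) (t : Fin 4 → ℝ) (j) (ht : 2 * P ≤ |t j|) : ww α P t = 0 :=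
  prod_eq_zero (mem_univ j) (bb_zero α hα P hP j _ ht)

lemma ww_nonneg (P : ℝ) (t : Fin 4 → ℝ) : 0 ≤ ww α P t := prod_nonneg fun j _ => bb_nonneg α P j _
lemma ww_le_one (P : ℝ) (t : Fin 4 → ℝ) : ww α P t ≤ 1 :=
  prod_le_one (fun j _ => bb_nonneg α P j _) fun j _ => bb_le_one α P j _

lemma fr_bound (P : ℝ) (hP : 1 ≤ P) (γ : ℤ) (hγ : (γ:ℝ) = P^2) (t : Fin 4 → ℝ) (ht : ∀ j, |t j| ≤ 2 * P) :
    |fr α β γ t| ≤ CF α β * P^2 := by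
  unfold fr CF
  have h1 : |∑ j, ((α j : ℝ) * t j ^ 2 + β j * t j)| ≤ ∑ j, (4 * |(α j : ℝ)| + 2 * |(β j : ℝ)|) * P^2 := by
    refine (abs_sum_le_sum_abs _ _).trans (sum_le_sum fun j _ => ?_)
    refine (abs_add_le _ _).trans ?_
    rw [abs_mul, abs_mul, abs_pow, add_mul]
    have h2 : |t j|^2 ≤ (2*P)^2 := by gcongr; exact ht j
    have h3 : |t j| ≤ 2 * P^2 := (ht j).trans (by nlinarith)
    have h4 := mul_le_mul_of_nonneg_left h2 (abs_nonneg (α j : ℝ))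
    have h5 := mul_le_mul_of_nonneg_left h3 (abs_nonneg (β j : ℝ))
    linarith
  rw [← sum_mul] at h1
  rw [hγ]
  have h6 := abs_sub (∑ j, ((α j : ℝ) * t j ^ 2 + β j * t j)) (P^2)
  rw [abs_of_nonneg (by positivity : 0 ≤ P^2)] at h6
  nlinarith [sq_nonneg P]

lemma ww_update (P : ℝ) (t : Fin 4 → ℝ) (j) (s : ℝ) :
    ww α P (Function.update t j s) = (∏ i ∈ univ.erase j, bb α P i (t i)) * bb α P j s := by
  unfold ww
  rw [← mul_prod_erase univ _ (mem_univ j), Function.update_self, mul_comm]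
  congr 1
  apply prod_congr rfl; intro i hi
  rw [Function.update_of_ne (ne_of_mem_erase hi)]

lemma fr_update (γ : ℤ) (t : Fin 4 → ℝ) (j) (s : ℝ) :
    fr α β γ (Function.update t j s) = α j * s^2 + β j * s + (∑ i ∈ univ.erase j, ((α i : ℝ) * t i ^ 2 + β i * t i) - γ) := by
  unfold fr
  rw [← add_sum_erase univ _ (mem_univ j), Function.update_self, add_sub_assoc]
  congr 2
  apply sum_congr rfl; intro i hi
  rw [Function.update_of_ne (ne_of_mem_erase hi)]

lemma pf_le (P : ℝ) (t : Fin 4 → ℝ) (j) : |∏ i ∈ univ.erase j, bb α P i (t i)| ≤ 1 := by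
  rw [abs_of_nonneg (prod_nonneg fun j _ => bb_nonneg α P j _)]
  exact prod_le_one (fun j _ => bb_nonneg α P j _) fun j _ => bb_le_one α P j _

lemma wt_w (hα : ∀ j, 0 < α j) (A : ℕ) : ∃ C, 0 < C ∧ ∀ P : ℝ, 1 ≤ P → Wt (ww α P) (2 * P) A (C * (1/P)^A) := by
  choose C hC0 hC using fun j => bw_iter (cc α j) (rr α j) (rr_pos α hα j) A
  refine ⟨∑ j, C j, sum_pos (fun j _ => hC0 j) ⟨0, mem_univ _⟩, fun P hP => ⟨?_, ?_, ?_⟩⟩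
  · intro t j h; exact ww_zero α hα P (by linarith) t j h
  · intro t j
    simp only [ww_update]
    exact contDiff_const.mul (bb_smooth α P j)
  · intro t j s
    simp only [ww_update]
    rw [iteratedDeriv_const_mul_field, abs_mul]
    have h1 := hC j P (by linarith) s
    have h2 : C j ≤ ∑ j, C j := single_le_sum (fun i _ => (hC0 i).le) (mem_univ j)
    calc _ ≤ 1 * (C j * (1/P)^A) := by
          gcongr
          · exact pf_le α P t j
          · exact h1
      _ ≤ _ := by rw [one_mul]; gcongr

lemma wom_zero (hα : ∀ j, 0 < α j) (P : ℝ) (hP : 1 ≤ P) (γ : ℤ) (hγ : (γ:ℝ) = P^2) (X : ℝ) (hX0 : 0 < X) (hX : CF α β * P^2 ≤ X) (t : Fin 4 → ℝ) :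
    ww α P t * om (fr α β γ t / X) = 0 := by
  by_cases h : ∃ j, 2 * P ≤ |t j|
  · obtain ⟨j, hj⟩ := h
    rw [ww_zero α hα P (by linarith) t j hj, zero_mul]
  · push Not at h
    rw [om_small, mul_zero]
    rw [abs_div, abs_of_pos hX0, div_le_one hX0]
    exact (fr_bound α β P hP γ hγ t fun j => (h j).le).trans hX

lemma wt_wom (hα : ∀ j, 0 < α j) (A : ℕ) : ∃ C, 0 < C ∧ ∀ P : ℝ, 1 ≤ P → ∀ γ : ℤ, (γ:ℝ) = P^2 → ∀ X : ℝ, 0 < X →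
    Wt (fun t => ww α P t * om (fr α β γ t / X)) (2 * P) A (C * (P/X)^A) := by
  choose C hC0 hC using fun j => prod_iter (α j) (β j) (cc α j) (rr α j) (CF α β) (rr_pos α hα j) (by linarith [CF_ge α β]) A
  refine ⟨∑ j, C j, sum_pos (fun j _ => hC0 j) ⟨0, mem_univ _⟩, fun P hP γ hγ X hX => ⟨?_, ?_, ?_⟩⟩
  · intro t j h; simp only [ww_zero α hα P (by linarith) t j h, zero_mul]
  · intro t j
    simp only [ww_update, fr_update]
    refine (contDiff_const.mul (bb_smooth α P j)).mul (om_smooth.comp ?_)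
    fun_prop
  · intro t j s
    have hCs : 0 ≤ ∑ j, C j := sum_nonneg fun i _ => (hC0 i).le
    have hP0 : 0 < P := by linarith
    rcases le_total X (CF α β * P^2) with h | h
    · simp only [ww_update, fr_update, mul_assoc (∏ i ∈ univ.erase j, bb α P i (t i))]
      rw [iteratedDeriv_const_mul_field, abs_mul]
      have h1 := hC j P hP X hX h (∑ i ∈ univ.erase j, ((α i : ℝ) * t i ^ 2 + β i * t i) - γ) s
      have h2 : C j ≤ ∑ j, C j := single_le_sum (fun i _ => (hC0 i).le) (mem_univ j)
      calc _ ≤ 1 * (C j * (P/X)^A) := by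
            gcongr
            · exact pf_le α P t j
            · exact h1
        _ ≤ _ := by rw [one_mul]; gcongr
    · simp only [wom_zero α β hα P hP γ hγ X hX h]
      rw [iteratedDeriv_const]
      split_ifs <;> (simp; positivity)

end
end PF

namespace PF
open Finset

noncomputable def hh (α : Fin 4 → ℤ) (d : ℕ) : ℝ :=
  if Nat.Coprime d (2 * ∏ j, α j).natAbs then (jacobiSym (∏ j, α j) d : ℝ) else 0

section
variable (α β : Fin 4 → ℤ)

lemma hh_one : hh α 1 = 1 := by
  unfold hh; simp

lemma hh_two : hh α 2 = 0 := by
  unfold hh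
  rw [if_neg]
  rw [Int.natAbs_mul]
  intro h
  have := Nat.Coprime.coprime_dvd_right (Dvd.intro _ rfl : 2 ∣ (2:ℤ).natAbs * (∏ j, α j).natAbs) h
  norm_num at this

lemma hh_zero : hh α 0 = 0 := by
  unfold hh
  rw [if_neg]
  rw [Nat.coprime_zero_left, Int.natAbs_mul]
  intro h
  have := Nat.eq_one_of_mul_eq_one_right h
  norm_num at this

lemma hh_mul (a b : ℕ) : hh α (a * b) = hh α a * hh α b := by
  rcases Nat.eq_zero_or_pos a with rfl | ha
  · simp [hh_zero]
  rcases Nat.eq_zero_or_pos b with rfl | hb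
  · simp [hh_zero]
  have : NeZero a := ⟨ha.ne'⟩
  have : NeZero b := ⟨hb.ne'⟩
  unfold hh
  have hc : Nat.Coprime (a*b) (2 * ∏ j, α j).natAbs ↔ Nat.Coprime a (2 * ∏ j, α j).natAbs ∧ Nat.Coprime b (2 * ∏ j, α j).natAbs :=
    Nat.coprime_mul_iff_left
  rw [jacobiSym.mul_right]
  by_cases h1 : Nat.Coprime a (2 * ∏ j, α j).natAbs
  · by_cases h2 : Nat.Coprime b (2 * ∏ j, α j).natAbs
    · rw [if_pos h1, if_pos h2, if_pos (hc.2 ⟨h1, h2⟩)]; push_cast; rfl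
    · rw [if_neg h2, if_neg (fun h => h2 (hc.1 h).2), mul_zero]
  · rw [if_neg h1, if_neg (fun h => h1 (hc.1 h).1), zero_mul]

lemma hh_abs (a : ℕ) : |hh α a| ≤ 1 := by
  unfold hh
  split_ifs
  · rcases jacobiSym.trichotomy (∏ j, α j) a with h | h | h <;> rw [h] <;> simp
  · simp

noncomputable def Fd (γ : ℤ) (d : ℕ) [NeZero d] (r : Fin 4 → ZMod d) : ℂ :=
  ∑ u : (ZMod d)ˣ, ZMod.stdAddChar (N := d) ((u : ZMod d) * (∑ j, ((α j : ZMod d) * r j ^ 2 + β j * r j) - γ))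

lemma Fd_cast (γ : ℤ) (d : ℕ) [NeZero d] (y : Fin 4 → ℤ) : Fd α β γ d (fun j => (y j : ZMod d)) = cram d (fq α β γ y) := by
  rw [← ram_eq_cram]
  unfold Fd ram fq
  push_cast
  rfl

lemma Fd_norm (γ : ℤ) (d : ℕ) [NeZero d] (r) : ‖Fd α β γ d r‖ ≤ d := by
  calc _ ≤ ∑ u : (ZMod d)ˣ, (1:ℝ) := norm_sum_le_of_le _ fun u _ => (AddChar.norm_apply _ _).le
    _ = (d.totient : ℝ) := by simp [ZMod.card_units_eq_totient]
    _ ≤ d := by exact_mod_cast Nat.totient_le d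

lemma Fd_sum (γ : ℤ) (d : ℕ) [NeZero d] : ∑ r, Fd α β γ d r = Ssum α β γ (ZMod.stdAddChar (N := d)) 0 := by
  unfold Fd Ssum gs
  rw [sum_comm]
  apply sum_congr rfl; intro u _
  rw [Finset.prod_univ_sum, mul_sum, Fintype.piFinset_univ]
  apply sum_congr rfl; intro r _
  rw [← char_sum, ← AddChar.map_add_eq_mul]
  congr 1
  rw [mul_sub, mul_sum, sub_eq_neg_add]
  congr 1
  apply sum_congr rfl; intro j _
  simp; ring


lemma Fd_sum' (hα : ∀ j, 0 < α j) (hα0 : ∀ p : ℕ, p.Prime → (p:ℤ) ∣ 2 * ∏ j, α j → (p:ℤ) ∣ α 0) (hβ0 : IsCoprime (β 0) (2 * ∏ j, α j)) (γ : ℤ) (d : ℕ) [NeZero d] : (∑ r, Fd α β γ d r) / d^4 = ((hh α d * crr d (DD α β γ) / (d:ℝ)^2 : ℝ) : ℂ) := by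
  have hdN : 0 < d := Nat.pos_of_ne_zero (NeZero.ne d)
  have hdC : (d:ℂ) ≠ 0 := by exact_mod_cast hdN.ne'
  rw [Fd_sum]
  have hB : 2 * ∏ j, α j ≠ 0 := by
    have : 0 < ∏ j, α j := prod_pos fun j _ => hα j
    omega
  unfold hh
  split_ifs with h
  · rw [Ssum_zero_good α β γ h, ram_eq_cram, cram_eq_crr d hdN]
    push_cast
    field_simp
  · rw [Ssum_zero_bad α β γ hα0 hβ0 hB _ (ZMod.isPrimitive_stdAddChar d) h]
    simp

lemma Nst_equi (hα : ∀ j, 0 < α j) (hα0 : ∀ p : ℕ, p.Prime → (p:ℤ) ∣ 2 * ∏ j, α j → (p:ℤ) ∣ α 0) (hβ0 : IsCoprime (β 0) (2 * ∏ j, α j)) (γ : ℤ) {Φ : (Fin 4 → ℝ) → ℝ} {R : ℝ} {A : ℕ} {M : ℝ} (h : Wt Φ R A M) (hA : 1 ≤ A)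
    (d K : ℕ) (hd : 0 < d) (hK : R + 1 ≤ K) :
    |∑ y ∈ bx K, Φ (fun j => (y j : ℝ)) * crr d (fq α β γ y) -
      (hh α d * crr d (DD α β γ) / (d:ℝ)^2) * ∑ y ∈ bx K, Φ (fun j => (y j : ℝ))| ≤ d^5 * (8 * ((d:ℝ)^A * ((bx K).card * M))) := by
  have : NeZero d := ⟨hd.ne'⟩
  have := equi h hA d K hK (Fd α β γ d) d (Fd_norm α β γ d)
  rw [Fd_sum' α β hα hα0 hβ0] at this
  simp only [Fd_cast, cram_eq_crr d hd] at this
  rw [← Real.norm_eq_abs, ← Complex.norm_real]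
  push_cast at this ⊢
  refine this.trans (le_of_eq ?_)
  ring
end
end PF

namespace PF
open Finset

lemma sum_crr (q : ℕ) (hq : 0 < q) (n : ℤ) : ∑ d ∈ q.divisors, crr d n = if (q:ℤ) ∣ n then (q:ℝ) else 0 := by
  have h := sum_cram q hq n
  rw [sum_congr rfl (fun d hd => cram_eq_crr d (Nat.pos_of_mem_divisors hd) n)] at h
  have : ((∑ d ∈ q.divisors, crr d n : ℝ) : ℂ) = ((if (q:ℤ) ∣ n then (q:ℝ) else 0 : ℝ) : ℂ) := by
    push_cast; rw [h]; split_ifs <;> simp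
  exact_mod_cast this

lemma sum_pairs (T : ℕ) (F : ℕ → ℕ → ℝ) (hF : ∀ d m, T < d * m → F d m = 0) :
    ∑ d ∈ Icc 1 T, ∑ m ∈ Icc 1 T, F d m = ∑ q ∈ Icc 1 T, ∑ d ∈ q.divisors, F d (q / d) := by
  rw [← sum_product', ← sum_filter_of_ne (p := fun x : ℕ × ℕ => x.1 * x.2 ∈ Icc 1 T)]
  · rw [← sum_fiberwise_of_maps_to (t := Icc 1 T) (g := fun x : ℕ × ℕ => x.1 * x.2) (fun x hx => (mem_filter.1 hx).2)]
    apply sum_congr rfl; intro q hq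
    rw [mem_Icc] at hq
    have : (filter (fun x : ℕ × ℕ => x.1 * x.2 = q) (filter (fun x : ℕ × ℕ => x.1 * x.2 ∈ Icc 1 T) (Icc 1 T ×ˢ Icc 1 T))) = q.divisorsAntidiagonal := by
      ext ⟨a, b⟩
      simp only [mem_filter, mem_product, mem_Icc, Nat.mem_divisorsAntidiagonal]
      constructor
      · rintro ⟨_, rfl⟩; exact ⟨rfl, by omega⟩
      · rintro ⟨rfl, h⟩
        have ha : 0 < a := Nat.pos_of_ne_zero (by rintro rfl; simp at h)
        have hb : 0 < b := Nat.pos_of_ne_zero (by rintro rfl; simp at h)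
        have h1 := Nat.le_mul_of_pos_right a hb
        have h2 := Nat.le_mul_of_pos_left b ha
        exact ⟨⟨⟨⟨ha, by omega⟩, hb, by omega⟩, by omega⟩, rfl⟩
    rw [this, Nat.sum_divisorsAntidiagonal F]
  · rintro ⟨a, b⟩ h1 h2
    simp only [mem_product, mem_Icc] at h1 ⊢
    refine ⟨Nat.mul_pos h1.1.1 h1.2.1, ?_⟩
    by_contra hc
    exact h2 (hF a b (by simpa using hc))

lemma switch (Q : ℝ) (hQ : 1 ≤ Q) (T : ℕ) (hT : 2 * Q ≤ T) (n : ℤ) (hn : n ≠ 0) (hnT : |(n:ℝ)| ≤ T) :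
    ∑ d ∈ Icc 1 T, ∑ m ∈ Icc 1 T, 1/(d:ℝ) * (1/(m:ℝ) * (crr d n * (om (d * m / Q) - om (n / (d * m * Q))))) = 0 := by
  have hQ0 : 0 < Q := by linarith
  rw [sum_pairs T (fun d m => 1/(d:ℝ) * (1/(m:ℝ) * (crr d n * (om (d * m / Q) - om (n / (d * m * Q))))))]
  · set g : ℕ → ℝ := fun q => om (q / Q) - om (n / (q * Q)) with hg
    have h1 : ∀ q ∈ Icc 1 T, ∑ d ∈ q.divisors, 1/(d:ℝ) * (1/((q/d : ℕ):ℝ) * (crr d n * (om (d * (q/d : ℕ) / Q) - om (n / (d * (q/d:ℕ) * Q))))) = if (q:ℤ) ∣ n then g q else 0 := by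
      intro q hq
      have hq0 : 0 < q := (mem_Icc.1 hq).1
      have hqR : (0:ℝ) < q := by exact_mod_cast hq0
      have : ∀ d ∈ q.divisors, 1/(d:ℝ) * (1/((q/d : ℕ):ℝ) * (crr d n * (om (d * (q/d : ℕ) / Q) - om (n / (d * (q/d:ℕ) * Q))))) = (g q / q) * crr d n := by
        intro d hd
        have hd' : d * (q/d) = q := Nat.mul_div_cancel' (Nat.dvd_of_mem_divisors hd)
        have hd2 : (d:ℝ) * (q/d : ℕ) = q := by exact_mod_cast hd'
        rw [hd2, ← mul_assoc, one_div_mul_one_div, hd2]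
        simp only [hg]
        ring
      rw [sum_congr rfl this, ← mul_sum, sum_crr q hq0]
      split_ifs
      · field_simp
      · simp
    rw [sum_congr rfl h1, ← sum_filter]
    have h2 : (filter (fun q : ℕ => (q:ℤ) ∣ n) (Icc 1 T)) = n.natAbs.divisors := by
      ext q
      simp only [mem_filter, mem_Icc, Nat.mem_divisors, Int.natCast_dvd]
      constructor
      · rintro ⟨_, h⟩; exact ⟨h, by simpa using hn⟩
      · rintro ⟨h, h0⟩
        have h3 : q ≤ n.natAbs := Nat.le_of_dvd (by omega) h
        have h4 : n.natAbs ≤ T := by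
          have : ((n.natAbs : ℕ):ℝ) ≤ T := by rw [Nat.cast_natAbs]; push_cast; exact hnT
          exact_mod_cast this
        exact ⟨⟨Nat.pos_of_dvd_of_pos h (by omega), by omega⟩, h⟩
    rw [h2]
    simp only [hg, sum_sub_distrib]
    rw [← Nat.sum_div_divisors n.natAbs (fun q => om ((q:ℝ)/Q)), sub_eq_zero]
    apply sum_congr rfl; intro q hq
    have hqd := Nat.dvd_of_mem_divisors hq
    have hq0 : (0:ℝ) < q := by exact_mod_cast Nat.pos_of_mem_divisors hq
    rw [Nat.cast_div hqd hq0.ne', Nat.cast_natAbs]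
    push_cast
    rcases abs_cases (n:ℝ) with ⟨h, _⟩ | ⟨h, _⟩ <;> rw [h]
    · congr 1; field_simp
    · rw [← om_neg]; congr 1; field_simp
  · intro d m hdm
    have h1 : (T:ℝ) < d * m := by exact_mod_cast hdm
    have hT0 : (0:ℝ) < T := by linarith
    rw [om_large, om_small]
    · simp
    · rw [abs_div, abs_of_pos (by nlinarith : (0:ℝ) < d * m * Q), div_le_one (by nlinarith)]
      nlinarith
    · rw [abs_of_nonneg (by positivity), le_div_iff₀ hQ0]; linarith

noncomputable def UU (α β : Fin 4 → ℤ) (γ : ℤ) (P Q : ℝ) (K T d : ℕ) : ℝ :=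
  ∑ m ∈ Icc 1 T, 1/(m:ℝ) * ∑ y ∈ bx K, ww α P (fun j => (y j : ℝ)) * (crr d (fq α β γ y) * (om (d * m / Q) - om (fr α β γ (fun j => (y j : ℝ)) / (d * m * Q))))

lemma UU_sum (α β : Fin 4 → ℤ) (hα : ∀ j, 0 < α j) (γ : ℤ) (P Q : ℝ) (hP : 1 ≤ P) (hγ : (γ:ℝ) = P^2) (K T : ℕ) (hQ : 1 ≤ Q) (hT : 2 * Q ≤ T)
    (hT' : CF α β * P^2 ≤ T) (h0 : ∀ y, fq α β γ y ≠ 0) : ∑ d ∈ Icc 1 T, 1/(d:ℝ) * UU α β γ P Q K T d = 0 := by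
  unfold UU
  simp only [mul_sum]
  have : ∀ d m : ℕ, ∀ y : Fin 4 → ℤ, 1/(d:ℝ) * (1/(m:ℝ) * (ww α P (fun j => (y j : ℝ)) * (crr d (fq α β γ y) * (om (d * m / Q) - om (fr α β γ (fun j => (y j : ℝ)) / (d * m * Q)))))) = ww α P (fun j => (y j : ℝ)) * (1/(d:ℝ) * (1/(m:ℝ) * (crr d (fq α β γ y) * (om (d * m / Q) - om ((fq α β γ y : ℝ) / (d * m * Q)))))) := by
    intro d m y
    rw [fr_cast]; ring
  simp only [this]
  rw [sum_congr rfl (fun d _ => sum_comm), sum_comm]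
  apply sum_eq_zero; intro y _
  simp only [← mul_sum]
  by_cases hw : ∃ j, 2 * P ≤ |(y j : ℝ)|
  · obtain ⟨j, hj⟩ := hw
    rw [ww_zero α hα P (by linarith) _ j hj, zero_mul]
  · push Not at hw
    simp only [mul_sum]
    have hs := switch Q hQ T hT (fq α β γ y) (h0 y) ?_
    · simp only [← mul_sum] at hs ⊢
      rw [hs, mul_zero]
    · rw [← fr_cast]
      exact (fr_bound α β P hP γ hγ _ fun j => (hw j).le).trans hT'
end PF

namespace PF
open Finset

lemma om_bdd : ∃ C, 0 < C ∧ ∀ v, |om v| ≤ C := by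
  obtain ⟨C, hC0, hC⟩ := bdd_iter om om_smooth 2 (fun x hx => om_large x hx) 0
  exact ⟨C, hC0, fun v => by simpa using hC v⟩

structure Par (α β : Fin 4 → ℤ) (L : ℝ) (γ : ℤ) (K T : ℕ) : Prop where
  hL : 1 ≤ L
  hγ : (γ:ℝ) = L^80
  hK : 2 * L^40 + 1 ≤ K
  hK' : (K:ℝ) ≤ 4 * L^40
  hT : CF α β * L^80 ≤ T
  hT' : (T:ℝ) ≤ 2 * CF α β * L^80

noncomputable def TT (α β : Fin 4 → ℤ) (γ : ℤ) (P Q : ℝ) (K T d : ℕ) : ℝ :=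
  ∑ m ∈ Icc 1 T, 1/(m:ℝ) * ∑ y ∈ bx K, ww α P (fun j => (y j : ℝ)) * (om (d * m / Q) - om (fr α β γ (fun j => (y j : ℝ)) / (d * m * Q)))

section
variable {α β : Fin 4 → ℤ} {L : ℝ} {γ : ℤ} {K T : ℕ}

lemma Par.hγ' (h : Par α β L γ K T) : (γ:ℝ) = (L^40)^2 := by rw [h.hγ]; ring
lemma Par.card (h : Par α β L γ K T) : ((bx K).card : ℝ) ≤ 9^4 * L^160 := by
  rw [card_bx]
  have h1 : (1:ℝ) ≤ L^40 := one_le_pow₀ h.hL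
  have h2 : (2*(K:ℝ)+1) ≤ 9 * L^40 := by linarith [h.hK']
  push_cast
  calc (2*(K:ℝ)+1)^4 ≤ (9 * L^40)^4 := by gcongr
    _ = _ := by ring
end

noncomputable def AA (α β : Fin 4 → ℤ) (γ : ℤ) (d : ℕ) : ℝ := hh α d * crr d (DD α β γ) / (d:ℝ)^2

lemma U_small (α β : Fin 4 → ℤ) (hα : ∀ j, 0 < α j) (hα0 : ∀ p : ℕ, p.Prime → (p:ℤ) ∣ 2 * ∏ j, α j → (p:ℤ) ∣ α 0)
    (hβ0 : IsCoprime (β 0) (2 * ∏ j, α j)) : ∃ C, 0 < C ∧ ∀ L γ K T, Par α β L γ K T → ∀ d : ℕ, 0 < d → (d:ℝ) ≤ CF α β * L^39 →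
    |UU α β γ (L^40) (L^41) K T d - AA α β γ d * TT α β γ (L^40) (L^41) K T d| ≤ C * (1/L)^40 := by
  obtain ⟨Co, hCo0, hCo⟩ := om_bdd
  obtain ⟨C1, hC10, hC1⟩ := wt_w α hα 475
  obtain ⟨C2, hC20, hC2⟩ := wt_wom α β hα 475
  have hF := CF_ge α β
  set F := CF α β with hFd
  refine ⟨2 * F * (F^5 * (8 * (9^4 * (Co * C1 * F^475 + C2)))), by positivity, ?_⟩
  intro L γ K T h d hd hdL
  have hL := h.hL
  have hL0 : 0 < L := by linarith
  have hd0 : (1:ℝ) ≤ d := by exact_mod_cast hd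
  have hdp : (0:ℝ) < d := by linarith
  have hP1 : (1:ℝ) ≤ L^40 := one_le_pow₀ h.hL
  have hcard := h.card
  unfold UU TT
  rw [mul_sum, ← sum_sub_distrib]
  have key : ∀ m ∈ Icc 1 T, |1/(m:ℝ) * ∑ y ∈ bx K, ww α (L^40) (fun j => (y j : ℝ)) * (crr d (fq α β γ y) * (om (d * m / L^41) - om (fr α β γ (fun j => (y j : ℝ)) / (d * m * L^41)))) - AA α β γ d * (1/(m:ℝ) * ∑ y ∈ bx K, ww α (L^40) (fun j => (y j : ℝ)) * (om (d * m / L^41) - om (fr α β γ (fun j => (y j : ℝ)) / (d * m * L^41))))| ≤ (F^5 * (8 * (9^4 * (Co * C1 * F^475 + C2)))) * L^355 * (1/L)^475 := by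
    intro m hm
    have hm1 : (1:ℝ) ≤ m := by exact_mod_cast (mem_Icc.1 hm).1
    have hm0 : (0:ℝ) < m := by linarith
    set X : ℝ := d * m * L^41 with hX
    have hX0 : 0 < X := by positivity
    have e1 := Nst_equi α β hα hα0 hβ0 γ (hC1 (L^40) hP1) (by norm_num) d K hd h.hK
    have e2 := Nst_equi α β hα hα0 hβ0 γ (hC2 (L^40) hP1 γ h.hγ' X hX0) (by norm_num) d K hd h.hK
    rw [show hh α d * crr d (DD α β γ) / (d:ℝ)^2 = AA α β γ d from rfl] at e1 e2
    have hd5 : (d:ℝ)^5 ≤ (F * L^39)^5 := by gcongr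
    have b1 : (d:ℝ)^5 * (8 * ((d:ℝ)^475 * ((bx K).card * (C1 * (1/L^40)^475)))) ≤ (F * L^39)^5 * (8 * (9^4 * L^160 * (C1 * (F * (1/L))^475))) := by
      have : (d:ℝ)^475 * ((bx K).card * (C1 * (1/L^40)^475)) = (bx K).card * (C1 * (d * (1 / L^40))^475) := by rw [mul_pow]; ring
      rw [this]
      have h2 : d * (1 / L^40) ≤ F * (1/L) := by
        calc d * (1/L^40) ≤ (F * L^39) * (1/L^40) := by gcongr
          _ = _ := by field_simp
      gcongr
    have b2 : (d:ℝ)^5 * (8 * ((d:ℝ)^475 * ((bx K).card * (C2 * (L^40/X)^475)))) ≤ (F * L^39)^5 * (8 * (9^4 * L^160 * (C2 * (1/L)^475))) := by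
      have : (d:ℝ)^475 * ((bx K).card * (C2 * (L^40/X)^475)) = (bx K).card * (C2 * (d * (L^40 / X))^475) := by rw [mul_pow]; ring
      rw [this]
      have h2 : d * (L^40 / X) ≤ 1/L := by
        have : d * (L^40 / X) = (1/L) * (1 / m) := by rw [hX]; field_simp
        rw [this]
        have : 1/(m:ℝ) ≤ 1 := by rw [div_le_one hm0]; exact hm1
        have h3 : 0 < 1/L := by positivity
        nlinarith
      gcongr
    have e1' := e1.trans b1
    have e2' := e2.trans b2
    set S1 := ∑ y ∈ bx K, ww α (L^40) (fun j => (y j : ℝ)) * crr d (fq α β γ y) with hS1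
    set S2 := ∑ y ∈ bx K, ww α (L^40) (fun j => (y j : ℝ)) with hS2
    set S3 := ∑ y ∈ bx K, ww α (L^40) (fun j => (y j : ℝ)) * om (fr α β γ (fun j => (y j : ℝ)) / X) * crr d (fq α β γ y) with hS3
    set S4 := ∑ y ∈ bx K, ww α (L^40) (fun j => (y j : ℝ)) * om (fr α β γ (fun j => (y j : ℝ)) / X) with hS4
    have r1 : ∑ y ∈ bx K, ww α (L^40) (fun j => (y j : ℝ)) * (crr d (fq α β γ y) * (om (d * m / L^41) - om (fr α β γ (fun j => (y j : ℝ)) / X))) = om (d * m / L^41) * S1 - S3 := by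
      rw [hS1, hS3, mul_sum, ← sum_sub_distrib]
      apply sum_congr rfl; intro y _; ring
    have r2 : ∑ y ∈ bx K, ww α (L^40) (fun j => (y j : ℝ)) * (om (d * m / L^41) - om (fr α β γ (fun j => (y j : ℝ)) / X)) = om (d * m / L^41) * S2 - S4 := by
      rw [hS2, hS4, mul_sum, ← sum_sub_distrib]
      apply sum_congr rfl; intro y _; ring
    rw [r1, r2]
    have r3 : 1/(m:ℝ) * (om (d * m / L^41) * S1 - S3) - AA α β γ d * (1/(m:ℝ) * (om (d * m / L^41) * S2 - S4)) = 1/(m:ℝ) * (om (d * m / L^41) * (S1 - AA α β γ d * S2) - (S3 - AA α β γ d * S4)) := by ring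
    rw [r3, abs_mul, abs_of_pos (by positivity : 0 < 1/(m:ℝ))]
    have r4 : |om (d * m / L^41) * (S1 - AA α β γ d * S2) - (S3 - AA α β γ d * S4)| ≤ Co * ((F * L^39)^5 * (8 * (9^4 * L^160 * (C1 * (F * (1/L))^475)))) + (F * L^39)^5 * (8 * (9^4 * L^160 * (C2 * (1/L)^475))) := by
      refine (abs_sub _ _).trans (add_le_add ?_ e2')
      rw [abs_mul]
      exact mul_le_mul (hCo _) e1' (abs_nonneg _) hCo0.le
    have r5 : Co * ((F * L^39)^5 * (8 * (9^4 * L^160 * (C1 * (F * (1/L))^475)))) + (F * L^39)^5 * (8 * (9^4 * L^160 * (C2 * (1/L)^475))) = (F^5 * (8 * (9^4 * (Co * C1 * F^475 + C2)))) * L^355 * (1/L)^475 := by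
      rw [mul_pow F (1/L)]
      generalize (1/L)^475 = l
      generalize F^475 = f
      ring
    rw [r5] at r4
    refine le_trans ?_ r4
    have : 1/(m:ℝ) ≤ 1 := by rw [div_le_one hm0]; exact hm1
    exact mul_le_of_le_one_left (abs_nonneg _) this
  refine (abs_sum_le_sum_abs _ _).trans ((sum_le_sum key).trans ?_)
  rw [sum_const, nsmul_eq_mul, Nat.card_Icc, Nat.add_sub_cancel]
  calc _ ≤ (2 * F * L^80) * ((F^5 * (8 * (9^4 * (Co * C1 * F^475 + C2)))) * L^355 * (1/L)^475) := by
        gcongr; exact h.hT'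
    _ = (2 * F * (F^5 * (8 * (9^4 * (Co * C1 * F^475 + C2))))) * (L^435 * (1/L)^475) := by
        generalize (1/L)^475 = l
        generalize F^475 = f
        ring
    _ = _ := by
        congr 1
        rw [show (475:ℕ) = 435 + 40 from rfl, pow_add, ← mul_assoc, ← mul_pow, mul_one_div_cancel hL0.ne', one_pow, one_mul]
end PF

namespace PF
open Finset

noncomputable def b0 (K : ℕ) : Finset (Fin 4 → ℤ) := Fintype.piFinset fun i => if i = 0 then {0} else Icc (-K : ℤ) K

lemma mem_b0 {K : ℕ} {y : Fin 4 → ℤ} : y ∈ b0 K ↔ y 0 = 0 ∧ ∀ j, j ≠ 0 → |y j| ≤ K := by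
  simp only [b0, Fintype.mem_piFinset]
  constructor
  · intro h
    refine ⟨by simpa using h 0, fun j hj => ?_⟩
    have := h j
    rw [if_neg hj, mem_Icc] at this
    exact abs_le.2 this
  · rintro ⟨h0, h⟩ j
    by_cases hj : j = 0
    · subst hj; simpa using h0
    · rw [if_neg hj, mem_Icc]; exact abs_le.1 (h j hj)

lemma card_b0 (K : ℕ) : (b0 K).card = (2*K+1)^3 := by
  simp only [b0, Fintype.card_piFinset, Fin.prod_univ_succ]
  have : ((K:ℤ) + 1 - -K).toNat = 2 * K + 1 := by omega
  have h1 : (Icc (-K:ℤ) K).card = 2 * K + 1 := by rw [Int.card_Icc, this]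
  simp only [Fin.succ_ne_zero, if_true, if_false, h1, card_singleton]
  simp; ring

lemma sum_split (K : ℕ) (G : (Fin 4 → ℤ) → ℝ) :
    ∑ y ∈ bx K, G y = ∑ y ∈ b0 K, ∑ k ∈ Icc (-K:ℤ) K, G (Function.update y 0 k) := by
  rw [← sum_product']
  symm
  refine sum_bij' (fun x _ => Function.update x.1 0 x.2) (fun y _ => (Function.update y 0 0, y 0)) ?_ ?_ ?_ ?_ ?_
  · rintro ⟨y, k⟩ h
    simp only [mem_product, mem_b0, mem_Icc] at h
    rw [mem_bx]; intro j
    by_cases hj : j = 0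
    · subst hj; simpa [abs_le] using h.2
    · rw [Function.update_of_ne hj]; exact h.1.2 j hj
  · intro y h
    rw [mem_bx] at h
    simp only [mem_product, mem_b0, mem_Icc]
    refine ⟨⟨by simp, fun j hj => ?_⟩, abs_le.1 (h 0)⟩
    rw [Function.update_of_ne hj]; exact h j
  · rintro ⟨y, k⟩ h
    simp only [mem_product, mem_b0, mem_Icc] at h
    ext j
    · by_cases hj : j = 0
      · subst hj; simp [h.1.1]
      · simp [Function.update_of_ne hj]
    · simp
  · intro y h; simp
  · intro x h; rfl

lemma b0_sum_ge (α : Fin 4 → ℤ) (hα : ∀ j, 0 < α j) : ∃ c, 0 < c ∧ ∀ P : ℝ, 1 ≤ P → ∀ K : ℕ, P ≤ K →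
    c * P^3 ≤ ∑ y ∈ b0 K, ∏ i ∈ univ.erase 0, bb α P i (y i) := by
  set ρ : ℝ := 1 / (8 * ∑ j, (α j : ℝ)) with hρ
  have hs : (1:ℝ) ≤ ∑ j, (α j : ℝ) := by
    have : (1:ℝ) ≤ α 0 := by exact_mod_cast hα 0
    exact this.trans (single_le_sum (f := fun j => (α j : ℝ)) (fun j _ => by exact_mod_cast (hα j).le) (mem_univ 0))
  have hρ0 : 0 < ρ := by positivity
  refine ⟨ρ^3, by positivity, fun P hP K hK => ?_⟩
  have hP0 : 0 < P := by linarith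
  set k := ⌊ρ * P⌋₊ with hk
  have hk1 : (k:ℝ) ≤ ρ * P := Nat.floor_le (by positivity)
  have hρ1 : ρ ≤ 1 := by rw [hρ, div_le_one (by positivity)]; linarith
  have hkK : k ≤ K := by
    have : (k:ℝ) ≤ K := by nlinarith
    exact_mod_cast this
  have hsub : b0 k ⊆ b0 K := by
    intro y; rw [mem_b0, mem_b0]
    rintro ⟨h0, h⟩
    exact ⟨h0, fun j hj => (h j hj).trans (by exact_mod_cast hkK)⟩
  calc ρ^3 * P^3 = (ρ * P)^3 := by ring
    _ ≤ (2 * (k:ℝ) + 1)^3 := by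
      have : ρ * P ≤ 2 * k + 1 := by
        have := (Nat.lt_floor_add_one (ρ * P)).le
        rw [← hk] at this
        have h0 : (0:ℝ) ≤ k := Nat.cast_nonneg _
        linarith
      gcongr
    _ = ∑ y ∈ b0 k, (1:ℝ) := by rw [sum_const, card_b0]; simp
    _ = ∑ y ∈ b0 k, ∏ i ∈ univ.erase 0, bb α P i (y i) := by
      apply sum_congr rfl; intro y hy
      symm
      apply prod_eq_one; intro i hi
      have hi0 := ne_of_mem_erase hi
      unfold bb bw
      apply bump_one
      have hr : ρ ≤ rr α i := by
        unfold rr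
        rw [if_neg hi0, hρ]
        have : (0:ℝ) < α i := by exact_mod_cast hα i
        gcongr
        exact (single_le_sum (f := fun j => (α j : ℝ)) (fun j _ => by exact_mod_cast (hα j).le) (mem_univ i))
      have hr0 := rr_pos α hα i
      have hc : cc α i = 0 := by unfold cc; rw [if_neg hi0]
      rw [hc, sub_zero, abs_div, abs_div, abs_of_pos hr0, abs_of_pos hP0, div_div, div_le_one (by positivity)]
      have h2 : |(y i : ℝ)| ≤ k := by exact_mod_cast (mem_b0.1 hy).2 i hi0
      nlinarith
    _ ≤ _ := sum_le_sum_of_subset_of_nonneg hsub fun y _ _ => prod_nonneg fun i _ => bb_nonneg α P i _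

set_option maxHeartbeats 2000000 in
lemma td_y (α β : Fin 4 → ℤ) (hα : ∀ j, 0 < α j) : ∃ C c P0 : ℝ, 0 < C ∧ 0 < c ∧ 1 ≤ P0 ∧ ∀ P : ℝ, P0 ≤ P → ∀ γ : ℤ, (γ:ℝ) = P^2 →
    ∀ t : Fin 4 → ℝ, ∀ K : ℕ, 2 * P + 1 ≤ K → ∃ g0 : ℝ, c / P ≤ g0 ∧ g0 ≤ C / P ∧ ∀ X : ℝ, 0 < X → ∀ M : ℕ, CF α β * P^2 ≤ M * X → 
    |(∫ s in (-K:ℝ)..(K+1), ww α P (Function.update t 0 s) * kap M (fr α β γ (Function.update t 0 s) / X)) - (∏ i ∈ univ.erase 0, bb α P i (t i)) * (X * g0)| ≤ C * X^2/P^3 ∧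
    |∫ s in (-K:ℝ)..(K+1), ww α P (Function.update t 0 s) * kap M (fr α β γ (Function.update t 0 s) / X)| ≤ C * X/P := by
  have ha0 : (0:ℝ) < α 0 := by exact_mod_cast hα 0
  have ha1 : (1:ℝ) ≤ α 0 := by exact_mod_cast hα 0
  obtain ⟨C, c, P0, hC, hc, hP0, H⟩ := td_int (α 0) (β 0) ha0
  set s := √(α 0 : ℝ) with hs
  have hs1 : 1 ≤ s := by rw [hs, Real.one_le_sqrt]; exact ha1
  have hss : s^2 = α 0 := Real.sq_sqrt ha0.le
  set Bs : ℝ := ∑ j, |(β j : ℝ)| with hBs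
  have hBs0 : 0 ≤ Bs := sum_nonneg fun j _ => abs_nonneg _
  refine ⟨C + c, c, P0 + 4 * Bs + 1, by positivity, hc, by linarith, ?_⟩
  intro P hP γ hγ t K hK
  have hP1 : 1 ≤ P := by linarith
  have hPp : 0 < P := by linarith
  simp only [ww_update, fr_update, mul_assoc, intervalIntegral.integral_const_mul]
  set W := ∏ i ∈ univ.erase 0, bb α P i (t i) with hW
  have hW0 : 0 ≤ W := prod_nonneg fun i _ => bb_nonneg α P i _
  have hW1 : W ≤ 1 := prod_le_one (fun j _ => bb_nonneg α P j _) fun j _ => bb_le_one α P j _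
  by_cases hWz : W = 0
  · refine ⟨c / P, le_rfl, by gcongr; linarith, fun X hX M hM => ?_⟩
    rw [hWz]
    simp only [zero_mul, sub_zero, abs_zero]
    constructor <;> positivity
  set n0 : ℝ := ∑ i ∈ univ.erase 0, ((α i : ℝ) * t i ^ 2 + β i * t i) - γ with hn0
  have ht : ∀ i ∈ univ.erase (0 : Fin 4), |t i| ≤ 3/16 * P / α i := by
    intro i hi
    by_contra hcon
    push Not at hcon
    apply hWz
    apply prod_eq_zero hi
    apply bw_zero _ _ _ _ (rr_pos α hα i) hPp
    have hc' : cc α i = 0 := by unfold cc; rw [if_neg (ne_of_mem_erase hi)]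
    have hr : rr α i = 1/(8 * (α i : ℝ)) := by unfold rr; rw [if_neg (ne_of_mem_erase hi)]
    rw [hc', hr, abs_zero, zero_add]
    refine le_trans (le_of_eq ?_) hcon.le
    have : (α i : ℝ) ≠ 0 := by exact_mod_cast (hα i).ne'
    field_simp; norm_num
  have haj : ∀ i, (1:ℝ) ≤ α i := fun i => by exact_mod_cast hα i
  have ht' : ∀ i ∈ univ.erase (0 : Fin 4), |t i| ≤ P := by
    intro i hi
    refine (ht i hi).trans ?_
    rw [div_le_iff₀ (by linarith [haj i])]
    nlinarith [haj i]
  have hcardE : (univ.erase (0 : Fin 4)).card = 3 := by decide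
  have hq1 : ∑ i ∈ univ.erase 0, (α i : ℝ) * t i ^ 2 ≤ 27/256 * P^2 := by
    have : ∀ i ∈ univ.erase (0:Fin 4), (α i : ℝ) * t i ^ 2 ≤ 9/256 * P^2 := by
      intro i hi
      have h1 := ht i hi
      rw [le_div_iff₀ (by linarith [haj i])] at h1
      have h2 : (|t i| * α i)^2 ≤ (3/16*P)^2 := by
        have := haj i
        gcongr
      rw [mul_pow, sq_abs] at h2
      have h3 : (α i : ℝ) * t i ^ 2 ≤ t i ^ 2 * (α i : ℝ)^2 := by nlinarith [haj i, sq_nonneg (t i), mul_nonneg (sq_nonneg (t i)) (by linarith [haj i] : (0:ℝ) ≤ α i - 1)]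
      nlinarith
    refine (sum_le_sum this).trans (le_of_eq ?_)
    rw [sum_const, hcardE]; simp; ring
  have hq0 : 0 ≤ ∑ i ∈ univ.erase 0, (α i : ℝ) * t i ^ 2 := sum_nonneg fun i _ => mul_nonneg (by linarith [haj i]) (sq_nonneg _)
  have hl : |∑ i ∈ univ.erase 0, (β i : ℝ) * t i| ≤ Bs * P := by
    refine (abs_sum_le_sum_abs _ _).trans ?_
    rw [hBs, sum_mul]
    refine le_trans (sum_le_sum fun i hi => ?_) (sum_le_sum_of_subset_of_nonneg (erase_subset 0 univ) fun i _ _ => by positivity)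
    rw [abs_mul]
    gcongr
    exact ht' i hi
  have hb0 : |(β 0 : ℝ)| ≤ Bs := single_le_sum (f := fun j => |(β j : ℝ)|) (fun j _ => abs_nonneg _) (mem_univ 0)
  rw [abs_le] at hl hb0
  have hn : n0 = ∑ i ∈ univ.erase 0, (α i : ℝ) * t i ^ 2 + ∑ i ∈ univ.erase 0, (β i : ℝ) * t i - P^2 := by
    rw [hn0, sum_add_distrib, hγ]
  have hr1 : P / (2*s) ≤ P := by rw [div_le_iff₀ (by linarith)]; nlinarith
  have hr10 : 0 ≤ P / (2*s) := by positivity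
  have hr2 : 3 * P / (2*s) ≤ 3/2 * P := by rw [div_le_iff₀ (by linarith)]; nlinarith
  have hr20 : 0 ≤ 3 * P / (2*s) := by positivity
  have hbt : ∀ r : ℝ, 0 ≤ r → -(Bs * r) ≤ β 0 * r ∧ β 0 * r ≤ Bs * r := fun r hr => ⟨by nlinarith, by nlinarith⟩
  obtain ⟨g0, hg1, hg2, hg⟩ := H P (by linarith) n0 (by
      have h1 : (α 0 : ℝ) * (P / (2*s))^2 = P^2/4 := by rw [← hss]; field_simp; norm_num
      have h2 := (hbt _ hr10).2
      have h3 : Bs * (P / (2*s)) ≤ Bs * P := by gcongr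
      rw [h1, hn]
      nlinarith) (by
      have h1 : (α 0 : ℝ) * (3 * P / (2*s))^2 = 9 * P^2/4 := by rw [← hss]; field_simp; norm_num
      have h2 := (hbt _ hr20).1
      have h3 : Bs * (3 * P / (2*s)) ≤ Bs * (3/2*P) := by gcongr
      rw [h1, hn]
      nlinarith)
  refine ⟨g0, hg1, hg2.trans (by gcongr; linarith), fun X hX M hM => ?_⟩
  have hg' := hg X hX M (by
    intro y hy
    have hlo : 0 ≤ P / (4*s) := by positivity
    have hhi : 7 * P / (4*s) ≤ 2 * P := by rw [div_le_iff₀ (by linarith)]; nlinarith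
    refine le_trans ?_ hM
    rw [hn0, ← fr_update]
    apply fr_bound α β P hP1 γ hγ
    intro j
    by_cases hj : j = 0
    · subst hj
      rw [Function.update_self, abs_le]
      exact ⟨by linarith [hy.1], by linarith [hy.2]⟩
    · rw [Function.update_of_ne hj]
      exact (ht' j (mem_erase.2 ⟨hj, mem_univ _⟩)).trans (by linarith))
  have hbb : ∀ y, bb α P 0 y = bw (1/s) (1/(2*s)) P y := by
    intro y; unfold bb cc rr; simp [hs]
  have hintg : ∫ x in (-K:ℝ)..(K+1), bb α P 0 x * kap M ((α 0 * x^2 + β 0 * x + n0) / X) = ∫ y in (P / (4 * s))..(7 * P / (4 * s)), bw (1/s) (1/(2*s)) P y * kap M ((α 0 * y^2 + β 0 * y + n0) / X) := by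
    simp only [← hbb]
    rw [intervalIntegral.integral_eq_integral_of_support_subset, intervalIntegral.integral_eq_integral_of_support_subset]
    · intro x hx
      have hx' := left_ne_zero_of_mul hx
      rw [hbb] at hx'
      by_contra hcon
      apply hx'
      unfold bw
      apply bump_zero
      have h1 : (x / P - 1/s) / (1/(2*s)) = 2 * s * x / P - 2 := by field_simp
      rw [h1]
      rw [Set.mem_Ioc, not_and_or, not_lt, not_le] at hcon
      rcases hcon with h | h
      · rw [abs_of_nonpos]
        · rw [le_div_iff₀ (by positivity)] at h
          have : 2 * s * x / P ≤ 1/2 := by rw [div_le_iff₀ hPp]; linarith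
          linarith
        · rw [le_div_iff₀ (by positivity)] at h
          have : 2 * s * x / P ≤ 1/2 := by rw [div_le_iff₀ hPp]; linarith
          linarith
      · rw [div_lt_iff₀ (by positivity)] at h
        have : 7/2 ≤ 2 * s * x / P := by rw [le_div_iff₀ hPp]; linarith
        rw [abs_of_nonneg (by linarith)]
        linarith
    · intro x hx
      have hx' := left_ne_zero_of_mul hx
      by_contra hcon
      apply hx'
      apply bb_zero α hα P hPp
      rw [Set.mem_Ioc, not_and_or, not_lt, not_le] at hcon
      rcases hcon with h | h
      · rw [le_abs]; right; linarith
      · rw [le_abs]; left; linarith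
  rw [hintg, ← mul_sub, abs_mul, abs_mul, abs_of_nonneg hW0]
  constructor
  · refine (mul_le_of_le_one_left (abs_nonneg _) hW1).trans (hg'.1.trans ?_)
    gcongr; linarith
  · refine (mul_le_of_le_one_left (abs_nonneg _) hW1).trans (hg'.2.trans ?_)
    gcongr; linarith
end PF

namespace PF
open Finset

lemma em_y (α β : Fin 4 → ℤ) (hα : ∀ j, 0 < α j) : ∃ C, 0 < C ∧ ∀ L γ K T, Par α β L γ K T → ∀ X : ℝ, L^41 ≤ X → ∀ t : Fin 4 → ℝ,
    |∑ k ∈ Icc (-K:ℤ) K, ww α (L^40) (Function.update t 0 (k:ℝ)) * kap T (fr α β γ (Function.update t 0 (k:ℝ)) / X) -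
      ∫ s in (-K:ℝ)..(K+1), ww α (L^40) (Function.update t 0 s) * kap T (fr α β γ (Function.update t 0 s) / X)| ≤ C * (1/L)^160 := by
  obtain ⟨C1, hC10, hC1⟩ := wt_w α hα 280
  obtain ⟨C2, hC20, hC2⟩ := wt_wom α β hα 280
  have hF := CF_ge α β
  refine ⟨9 * (|Om0| * C1 + 2 * CF α β * C2), by positivity, fun L γ K T h X hX t => ?_⟩
  have hL := h.hL
  have hL0 : 0 < L := by linarith
  have hP1 : (1:ℝ) ≤ L^40 := one_le_pow₀ h.hL
  have hX0 : 0 < X := lt_of_lt_of_le (by positivity) hX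
  have w1 := hC1 (L^40) hP1
  have w2 := fun X hX => hC2 (L^40) hP1 γ h.hγ' X hX
  have hfun : (fun s => ww α (L^40) (Function.update t 0 s) * kap T (fr α β γ (Function.update t 0 s) / X)) =
      fun s => Om0 * ww α (L^40) (Function.update t 0 s) - ∑ m ∈ Icc 1 T, (1/(m:ℝ)) * (ww α (L^40) (Function.update t 0 s) * om (fr α β γ (Function.update t 0 s) / (X * m))) := by
    funext s
    unfold kap
    rw [mul_sub, mul_sum]
    congr 1
    · ring
    · apply sum_congr rfl; intro m _
      rw [div_div]; ring
  have hsm : ∀ m : ℕ, 1 ≤ m → ContDiff ℝ (⊤:ℕ∞) (fun s => (1/(m:ℝ)) * (ww α (L^40) (Function.update t 0 s) * om (fr α β γ (Function.update t 0 s) / (X * m)))) := by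
    intro m hm
    have hm0 : (0:ℝ) < m := by exact_mod_cast hm
    exact contDiff_const.mul ((w2 (X * m) (by positivity)).sm t 0)
  have hsm0 : ContDiff ℝ (⊤:ℕ∞) (fun s => Om0 * ww α (L^40) (Function.update t 0 s)) := contDiff_const.mul (w1.sm t 0)
  have hsmS : ContDiff ℝ (⊤:ℕ∞) (fun s => ∑ m ∈ Icc 1 T, (1/(m:ℝ)) * (ww α (L^40) (Function.update t 0 s) * om (fr α β γ (Function.update t 0 s) / (X * m)))) :=
    ContDiff.sum fun m hm => hsm m (mem_Icc.1 hm).1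
  have hB := em_sum (fun s => ww α (L^40) (Function.update t 0 s) * kap T (fr α β γ (Function.update t 0 s) / X)) (by
      rw [hfun]; exact hsm0.sub hsmS) K (2 * L^40) h.hK (by
      intro x hx
      simp only [w1.supp (Function.update t 0 x) 0 (by simpa using hx), zero_mul]) 280 (by norm_num)
      ((|Om0| * C1 + 2 * CF α β * C2) * (L^80 * (1/L)^280)) (by
      intro s
      rw [hfun, iteratedDeriv_fun_sub (contDiff_infty.1 hsm0 280).contDiffAt (contDiff_infty.1 hsmS 280).contDiffAt,
        iteratedDeriv_fun_sum (fun m hm => (contDiff_infty.1 (hsm m (mem_Icc.1 hm).1) 280).contDiffAt)]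
      refine (abs_sub _ _).trans ?_
      have e1 : |iteratedDeriv 280 (fun s => Om0 * ww α (L^40) (Function.update t 0 s)) s| ≤ |Om0| * C1 * (L^80 * (1/L)^280) := by
        rw [iteratedDeriv_const_mul_field, abs_mul]
        have := w1.bd t 0 s
        have h3 : (1/L^40)^280 ≤ (1/L)^280 := by
          gcongr
          exact le_self_pow₀ hL (by norm_num)
        have h4 : (1:ℝ) ≤ L^80 := one_le_pow₀ hL
        calc _ ≤ |Om0| * (C1 * (1/L^40)^280) := by gcongr
          _ ≤ |Om0| * (C1 * (1 * (1/L)^280)) := by rw [one_mul]; gcongr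
          _ ≤ |Om0| * (C1 * (L^80 * (1/L)^280)) := by gcongr
          _ = _ := by ring
      have e2 : |∑ m ∈ Icc 1 T, iteratedDeriv 280 (fun s => (1/(m:ℝ)) * (ww α (L^40) (Function.update t 0 s) * om (fr α β γ (Function.update t 0 s) / (X * m)))) s| ≤ 2 * CF α β * C2 * (L^80 * (1/L)^280) := by
        have : ∀ m ∈ Icc 1 T, |iteratedDeriv 280 (fun s => (1/(m:ℝ)) * (ww α (L^40) (Function.update t 0 s) * om (fr α β γ (Function.update t 0 s) / (X * m)))) s| ≤ C2 * (1/L)^280 := by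
          intro m hm
          have hm1 : (1:ℝ) ≤ m := by exact_mod_cast (mem_Icc.1 hm).1
          have hm0 : (0:ℝ) < m := by linarith
          rw [iteratedDeriv_const_mul_field, abs_mul, abs_of_pos (by positivity : 0 < 1/(m:ℝ))]
          have h5 : 1/(m:ℝ) ≤ 1 := by rw [div_le_one hm0]; exact hm1
          refine (mul_le_of_le_one_left (abs_nonneg _) h5).trans (((w2 (X*m) (by positivity)).bd t 0 s).trans ?_)
          have h6 : L^40/(X*m) ≤ 1/L := by
            rw [div_le_div_iff₀ (by positivity) hL0]
            calc L^40 * L = L^41 * 1 := by ring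
              _ ≤ X * m := by gcongr
              _ = 1 * (X * m) := by ring
          gcongr
        refine (abs_sum_le_sum_abs _ _).trans ((sum_le_sum this).trans ?_)
        rw [sum_const, nsmul_eq_mul, Nat.card_Icc, Nat.add_sub_cancel]
        calc _ ≤ (2 * CF α β * L^80) * (C2 * (1/L)^280) := by gcongr; exact h.hT'
          _ = _ := by ring
      calc _ ≤ |Om0| * C1 * (L^80 * (1/L)^280) + 2 * CF α β * C2 * (L^80 * (1/L)^280) := add_le_add e1 e2
        _ = _ := by ring)
  refine hB.trans ?_
  have h2 : (2*(K:ℝ)+1) ≤ 9 * L^40 := by linarith [h.hK']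
  calc _ ≤ (9 * L^40) * ((|Om0| * C1 + 2 * CF α β * C2) * (L^80 * (1/L)^280)) := by gcongr
    _ = 9 * (|Om0| * C1 + 2 * CF α β * C2) * (L^120 * (1/L)^280) := by
      generalize (1/L)^280 = l
      ring
    _ = _ := by
      rw [show (280:ℕ) = 120 + 160 from rfl, pow_add, ← mul_assoc (L^120), ← mul_pow, mul_one_div_cancel hL0.ne', one_pow, one_mul]

lemma TT_kap (α β : Fin 4 → ℤ) : ∃ C, 0 < C ∧ ∀ L γ K T, Par α β L γ K T → CF α β ≤ L → ∀ d : ℕ, 0 < d → (d:ℝ) ≤ CF α β * L^39 →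
    |TT α β γ (L^40) (L^41) K T d - ∑ y ∈ bx K, ww α (L^40) (fun j => (y j : ℝ)) * kap T (fr α β γ (fun j => (y j : ℝ)) / (d * L^41))| ≤ C := by
  obtain ⟨C, hC0, hC⟩ := Om_sum 80 (by norm_num)
  have hF := CF_ge α β
  refine ⟨9^4 * (C * CF α β^80), by positivity, fun L γ K T h hFL d hd hdL => ?_⟩
  have hL := h.hL
  have hL0 : 0 < L := by linarith
  have hd0 : (0:ℝ) < d := by exact_mod_cast hd
  have hd1 : (1:ℝ) ≤ d := by exact_mod_cast hd
  have hV : 1 ≤ L^41 / d := by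
    rw [le_div_iff₀ hd0, one_mul]
    calc (d:ℝ) ≤ CF α β * L^39 := hdL
      _ ≤ L * L^39 := by gcongr
      _ = L^40 := by ring
      _ ≤ L^41 := pow_le_pow_right₀ hL (by norm_num)
  have hTT : 2 * (L^41/d) ≤ T := by
    have h1 : L^41/d ≤ L^41 := div_le_self (by positivity) hd1
    have h2 : L^41 ≤ L^80 := pow_le_pow_right₀ hL (by norm_num)
    have h3 : 2 * L^80 ≤ CF α β * L^80 := by gcongr
    linarith [h.hT]
  have e := hC (L^41/d) hV T hTT
  set ε := ∑ m ∈ Icc 1 T, om (m / (L^41/d)) / m - Om0 with hε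
  have e2 : |ε| ≤ C * (CF α β^80 * (1/L)^160) := by
    refine e.trans ?_
    gcongr
    have : 1 / (L^41/d) ≤ CF α β * (1/L)^2 := by
      rw [one_div_div, div_le_iff₀ (by positivity)]
      refine hdL.trans (le_of_eq ?_)
      field_simp
    calc (1 / (L^41/d))^80 ≤ (CF α β * (1/L)^2)^80 := by gcongr
      _ = _ := by rw [mul_pow, ← pow_mul]
  have r : TT α β γ (L^40) (L^41) K T d - ∑ y ∈ bx K, ww α (L^40) (fun j => (y j : ℝ)) * kap T (fr α β γ (fun j => (y j : ℝ)) / (d * L^41)) = ∑ y ∈ bx K, ww α (L^40) (fun j => (y j : ℝ)) * ε := by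
    unfold TT
    simp only [mul_sum]
    rw [sum_comm, ← sum_sub_distrib]
    apply sum_congr rfl; intro y _
    rw [hε]
    unfold kap
    have q1 : ∑ m ∈ Icc 1 T, 1/(m:ℝ) * (ww α (L^40) (fun j => (y j : ℝ)) * (om (d * m / L^41) - om (fr α β γ (fun j => (y j : ℝ)) / (d * m * L^41)))) =
        ww α (L^40) (fun j => (y j : ℝ)) * (∑ m ∈ Icc 1 T, om (m / (L^41/d)) / m - ∑ m ∈ Icc 1 T, om (fr α β γ (fun j => (y j : ℝ)) / (d * L^41) / m) / m) := by
      rw [← sum_sub_distrib, mul_sum]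
      apply sum_congr rfl; intro m hm
      have hm0 : (0:ℝ) < m := by exact_mod_cast (mem_Icc.1 hm).1
      have a1 : (m:ℝ) / (L^41/d) = d * m / L^41 := by field_simp
      have a2 : fr α β γ (fun j => (y j : ℝ)) / (d * L^41) / m = fr α β γ (fun j => (y j : ℝ)) / (d * m * L^41) := by
        rw [div_div]; congr 1; ring
      rw [a1, a2]; ring
    rw [q1]; ring
  rw [r, ← sum_mul, abs_mul]
  have hw : |∑ y ∈ bx K, ww α (L^40) (fun j => (y j : ℝ))| ≤ 9^4 * L^160 := by
    refine (abs_sum_le_sum_abs _ _).trans (le_trans (sum_le_sum (g := fun _ => (1:ℝ)) fun y _ => ?_) ?_)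
    · rw [abs_of_nonneg (ww_nonneg α _ _)]; exact ww_le_one α _ _
    · rw [sum_const]; simpa using h.card
  calc _ ≤ (9^4 * L^160) * (C * (CF α β^80 * (1/L)^160)) := by gcongr
    _ = 9^4 * (C * CF α β^80) * (L^160 * (1/L)^160) := by ring
    _ = _ := by rw [← mul_pow, mul_one_div_cancel hL0.ne', one_pow, mul_one]

lemma TT_est (α β : Fin 4 → ℤ) (hα : ∀ j, 0 < α j) : ∃ C c L0 : ℝ, 0 < C ∧ 0 < c ∧ 1 ≤ L0 ∧ ∀ L, L0 ≤ L → ∀ γ K T, Par α β L γ K T →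
    ∃ μ, c * L^80 ≤ μ ∧ μ ≤ C * L^80 ∧ ∀ d : ℕ, 0 < d → (d:ℝ) ≤ CF α β * L^39 →
    |TT α β γ (L^40) (L^41) K T d - (d * L^41) * μ| ≤ C * (d * L^41)^2 ∧ |TT α β γ (L^40) (L^41) K T d| ≤ C * (d * L^41) * L^80 := by
  obtain ⟨C1, hC10, hC1⟩ := em_y α β hα
  obtain ⟨C2, hC20, hC2⟩ := TT_kap α β
  obtain ⟨C3, c3, P0, hC3, hc3, hP0, H⟩ := td_y α β hα
  obtain ⟨c4, hc4, H4⟩ := b0_sum_ge α hα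
  have hF := CF_ge α β
  refine ⟨C2 + 9^3 * C1 + 9^3 * C3, c3 * c4, P0 + CF α β, by positivity, by positivity, by linarith, ?_⟩
  intro L hL0 γ K T h
  have hL := h.hL
  have hLp : 0 < L := by linarith
  have hP1 : (1:ℝ) ≤ L^40 := one_le_pow₀ hL
  have hLL : L ≤ L^40 := le_self_pow₀ hL (by norm_num)
  choose g hg1 hg2 hg using fun y : Fin 4 → ℤ => H (L^40) (by linarith) γ h.hγ' (fun j => (y j : ℝ)) K h.hK
  set W : (Fin 4 → ℤ) → ℝ := fun y => ∏ i ∈ univ.erase 0, bb α (L^40) i (y i) with hW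
  have hW0 : ∀ y, 0 ≤ W y := fun y => prod_nonneg fun i _ => bb_nonneg α _ i _
  have hW1 : ∀ y, W y ≤ 1 := fun y => prod_le_one (fun j _ => bb_nonneg α _ j _) fun j _ => bb_le_one α _ j _
  have hcard : ((b0 K).card : ℝ) ≤ 9^3 * L^120 := by
    rw [card_b0]
    have h2 : (2*(K:ℝ)+1) ≤ 9 * L^40 := by linarith [h.hK']
    push_cast
    calc (2*(K:ℝ)+1)^3 ≤ (9 * L^40)^3 := by gcongr
      _ = _ := by ring
  refine ⟨∑ y ∈ b0 K, W y * g y, ?_, ?_, ?_⟩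
  · have h1 := H4 (L^40) hP1 K (by linarith [h.hK])
    calc c3 * c4 * L^80 = (c4 * (L^40)^3) * (c3 / L^40) := by field_simp
      _ ≤ (∑ y ∈ b0 K, W y) * (c3 / L^40) := by gcongr
      _ ≤ _ := by
        rw [sum_mul]
        exact sum_le_sum fun y _ => mul_le_mul_of_nonneg_left (hg1 y) (hW0 y)
  · calc ∑ y ∈ b0 K, W y * g y ≤ ∑ y ∈ b0 K, 1 * (C3 / L^40) := by
          refine sum_le_sum fun y _ => ?_
          exact mul_le_mul (hW1 y) (hg2 y) (le_trans (by positivity) (hg1 y)) zero_le_one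
      _ ≤ 9^3 * L^120 * (C3 / L^40) := by
          rw [sum_const, nsmul_eq_mul, one_mul]; gcongr
      _ = 9^3 * C3 * L^80 := by field_simp
      _ ≤ _ := by gcongr; linarith
  intro d hd hdL
  have hd1 : (1:ℝ) ≤ d := by exact_mod_cast hd
  set X : ℝ := d * L^41 with hX
  have hX41 : L^41 ≤ X := by rw [hX]; exact le_mul_of_one_le_left (by positivity) hd1
  have hX1 : 1 ≤ X := (one_le_pow₀ hL).trans hX41
  have hX0 : 0 < X := by linarith
  have hTX : CF α β * (L^40)^2 ≤ T * X := by
    calc CF α β * (L^40)^2 = CF α β * L^80 := by ring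
      _ ≤ (T:ℝ) := h.hT
      _ ≤ T * X := le_mul_of_one_le_right (Nat.cast_nonneg _) hX1
  have e1 := hC2 L γ K T h (by linarith) d hd hdL
  rw [← hX] at e1
  rw [sum_split] at e1
  have hup : ∀ (y : Fin 4 → ℤ) (k : ℤ), (fun j => ((Function.update y 0 k) j : ℝ)) = Function.update (fun j => (y j : ℝ)) 0 (k:ℝ) := by
    intro y k; funext j
    by_cases hj : j = 0
    · subst hj; simp
    · simp [Function.update_of_ne hj]
  simp only [hup] at e1
  set I : (Fin 4 → ℤ) → ℝ := fun y => ∫ s in (-K:ℝ)..(K+1), ww α (L^40) (Function.update (fun j => (y j : ℝ)) 0 s) * kap T (fr α β γ (Function.update (fun j => (y j : ℝ)) 0 s) / X) with hI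
  set Sg : (Fin 4 → ℤ) → ℝ := fun y => ∑ k ∈ Icc (-K:ℤ) K, ww α (L^40) (Function.update (fun j => (y j : ℝ)) 0 (k:ℝ)) * kap T (fr α β γ (Function.update (fun j => (y j : ℝ)) 0 (k:ℝ)) / X) with hSg
  have e2 : |∑ y ∈ b0 K, Sg y - ∑ y ∈ b0 K, I y| ≤ 9^3 * C1 := by
    rw [← sum_sub_distrib]
    refine (abs_sum_le_sum_abs _ _).trans ((sum_le_sum fun y _ => hC1 L γ K T h X hX41 (fun j => (y j : ℝ))).trans ?_)
    rw [sum_const, nsmul_eq_mul]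
    calc _ ≤ 9^3 * L^120 * (C1 * (1/L)^160) := by gcongr
      _ = 9^3 * C1 * (1/L)^40 := by field_simp
      _ ≤ 9^3 * C1 * 1 := by
        gcongr
        exact pow_le_one₀ (by positivity) (by rw [div_le_one hLp]; exact hL)
      _ = _ := mul_one _
  have e3 : |∑ y ∈ b0 K, I y - X * ∑ y ∈ b0 K, W y * g y| ≤ 9^3 * C3 * X^2 := by
    rw [mul_sum, ← sum_sub_distrib]
    refine (abs_sum_le_sum_abs _ _).trans ((sum_le_sum (g := fun _ => C3 * X^2/(L^40)^3) fun y _ => ?_).trans ?_)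
    · have := (hg y X hX0 T hTX).1
      rw [show X * (W y * g y) = W y * (X * g y) by ring]
      exact this
    · rw [sum_const, nsmul_eq_mul]
      calc _ ≤ 9^3 * L^120 * (C3 * X^2/(L^40)^3) := by gcongr
        _ = _ := by field_simp
  have e4 : |∑ y ∈ b0 K, I y| ≤ 9^3 * C3 * X * L^80 := by
    refine (abs_sum_le_sum_abs _ _).trans ((sum_le_sum (g := fun _ => C3 * X/L^40) fun y _ => (hg y X hX0 T hTX).2).trans ?_)
    rw [sum_const, nsmul_eq_mul]
    calc _ ≤ 9^3 * L^120 * (C3 * X/L^40) := by gcongr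
      _ = _ := by field_simp
  have hXX : 1 ≤ X^2 := one_le_pow₀ hX1
  have hXL : 1 ≤ X * L^80 := one_le_mul_of_one_le_of_one_le hX1 (one_le_pow₀ hL)
  rw [abs_le] at e1 e2
  constructor
  · rw [abs_le] at e3 ⊢
    constructor <;> nlinarith
  · rw [abs_le] at e4 ⊢
    constructor <;> nlinarith
end PF

namespace PF
open Finset

lemma tau_L (e k : ℕ) (hk : 1 ≤ k) : ∃ C : ℝ, 1 ≤ C ∧ ∀ L c : ℝ, 1 ≤ L → 1 ≤ c → ∀ n : ℕ, 0 < n → (n:ℝ) ≤ c * L^k →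
    (n.divisors.card : ℝ)^e ≤ C * c * L := by
  obtain ⟨C, hC1, hC⟩ := tau_pow_le (e * k)
  have hC1' : (1:ℝ) ≤ C := by exact_mod_cast hC1
  refine ⟨C, hC1', fun L c hL hc n hn hnL => ?_⟩
  have h1 : ((n.divisors.card : ℝ)^e)^k ≤ C * n := by rw [← pow_mul]; exact_mod_cast hC n hn
  have h2 : ((n.divisors.card : ℝ)^e)^k ≤ (C * c * L)^k := by
    calc _ ≤ (C:ℝ) * n := h1
      _ ≤ (C:ℝ) * (c * L^k) := by gcongr
      _ = (C * c) * L^k := by ring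
      _ ≤ (C * c)^k * L^k := by
        gcongr
        exact le_self_pow₀ (one_le_mul_of_one_le_of_one_le hC1' hc) (by omega)
      _ = _ := by rw [← mul_pow]
  exact le_of_pow_le_pow_left₀ (by omega) (by positivity) h2

lemma DD_bd (α β : Fin 4 → ℤ) (hα : ∀ j, 0 < α j) : ∃ C : ℝ, 1 ≤ C ∧ ∀ L γ K T, Par α β L γ K T → 0 < DD α β γ ∧ (DD α β γ : ℝ) ≤ C * L^80 := by
  have hp : 0 < ∏ j, α j := prod_pos fun j _ => hα j
  have hs : 0 ≤ ∑ j, β j ^ 2 * ∏ i ∈ univ.erase j, α i := sum_nonneg fun j _ => mul_nonneg (sq_nonneg _) (prod_nonneg fun i _ => (hα i).le)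
  refine ⟨((4 * (∏ j, α j) + ∑ j, β j ^ 2 * ∏ i ∈ univ.erase j, α i : ℤ) : ℝ), by exact_mod_cast (by linarith), fun L γ K T h => ?_⟩
  have h1 : (1:ℝ) ≤ L^80 := one_le_pow₀ h.hL
  have hγ : (0:ℝ) < γ := by rw [h.hγ]; linarith
  have hγ' : 0 < γ := by exact_mod_cast hγ
  constructor
  · unfold DD; positivity
  · unfold DD
    set S := ∑ j, β j ^ 2 * ∏ i ∈ univ.erase j, α i
    push_cast [h.hγ]
    rw [add_mul]
    gcongr
    have : (0:ℝ) ≤ S := by exact_mod_cast hs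
    exact le_mul_of_one_le_right this h1

lemma U_large_d (α β : Fin 4 → ℤ) (hα : ∀ j, 0 < α j) : ∃ C, 0 < C ∧ ∀ L γ K T, Par α β L γ K T → ∀ j : ℕ, 2 * L^41 ≤ 2^j →
    ∀ d : ℕ, CF α β * L^39 < d → |UU α β γ (L^40) (L^41) K T d| ≤ if (d:ℝ) < 2 * L^41 then
      C * L^117 * (Nat.gcd d ((DD α β γ).natAbs * (2 * ∏ j, α j).natAbs ^ j)) else 0 := by
  obtain ⟨Co, hCo0, hCo⟩ := om_bdd
  obtain ⟨Ct, hCt0, hCt⟩ := tau_L 3 41 (by norm_num)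
  choose Cb hCb0 hCb using fun j => bw_iter (cc α j) (rr α j) (rr_pos α hα j) 2
  have hF := CF_ge α β
  set CB := ∑ j, Cb j with hCB
  have hCB0 : 0 < CB := sum_pos (fun j _ => hCb0 j) ⟨0, mem_univ _⟩
  have hpa : (1:ℝ) ≤ ∏ j, (α j : ℝ) := by
    have : (1:ℤ) ≤ ∏ j, α j := prod_pos fun j _ => hα j
    exact_mod_cast this
  set CS : ℝ := (16 * ∏ j, (α j : ℝ)) ^ 2 * 2^11 * (Ct * 2) with hCS
  have hCS1 : 1 ≤ CS := by
    have h1 : (1:ℝ) ≤ (16 * ∏ j, (α j : ℝ)) ^ 2 := one_le_pow₀ (by linarith)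
    rw [hCS]
    exact one_le_mul_of_one_le_of_one_le (one_le_mul_of_one_le_of_one_le h1 (by norm_num)) (by linarith)
  refine ⟨2 * Co * ((9 + 5 * CB)^4 * CS), by positivity, fun L γ K T h j hj d hd => ?_⟩
  have hL := h.hL
  have hL0 : 0 < L := by linarith
  have hP1 : (1:ℝ) ≤ L^40 := one_le_pow₀ h.hL
  have hd39 : L^39 ≤ d := by
    have : 0 < L^39 := by positivity
    nlinarith
  have hd0 : (0:ℝ) < d := lt_of_lt_of_le (by positivity) hd39
  have hdN : 0 < d := by exact_mod_cast hd0
  have : NeZero d := ⟨hdN.ne'⟩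
  set SS := ∑ y ∈ bx K, ww α (L^40) (fun j => (y j : ℝ)) * crr d (fq α β γ y) with hSS
  have hU : UU α β γ (L^40) (L^41) K T d = ∑ m ∈ Icc 1 T, 1/(m:ℝ) * om (d * m / L^41) * SS := by
    unfold UU
    apply sum_congr rfl; intro m hm
    have hm1 : (1:ℝ) ≤ m := by exact_mod_cast (mem_Icc.1 hm).1
    rw [hSS, mul_assoc (1/(m:ℝ)) (om _) _]
    congr 1
    rw [mul_sum]
    apply sum_congr rfl; intro y _
    have hz := wom_zero α β hα (L^40) hP1 γ h.hγ' (d * m * L^41) (by positivity) (by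
      calc CF α β * (L^40)^2 = CF α β * L^39 * 1 * L^41 := by ring
        _ ≤ d * m * L^41 := by gcongr) (fun j => (y j : ℝ))
    linear_combination (- crr d (fq α β γ y)) * hz
  rw [hU, ← sum_mul, abs_mul]
  split_ifs with hlt
  · have hSSb : |SS| ≤ ((9 + 5 * CB) * L)^4 * (CS * L^113 * (Nat.gcd d ((DD α β γ).natAbs * (2 * ∏ j, α j).natAbs ^ j))) := by
      have hN := Nst_le α β γ d K (bb α (L^40)) (CS * L^113 * (Nat.gcd d ((DD α β γ).natAbs * (2 * ∏ j, α j).natAbs ^ j))) ((9 + 5 * CB) * L) ?_ ?_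
      · rw [← Real.norm_eq_abs, ← Complex.norm_real, hSS]
        refine le_trans (le_of_eq ?_) hN
        push_cast
        congr 1
        apply sum_congr rfl; intro y _
        rw [cram_eq_crr d hdN]
        unfold ww
        push_cast; rfl
      · intro c
        have hb := Ssum_bound α β γ hα (ZMod.stdAddChar (N := d)) (ZMod.isPrimitive_stdAddChar d) c j (by
          have : (d:ℝ) ≤ 2^j := by linarith
          exact_mod_cast this)
        set G := Nat.gcd d ((DD α β γ).natAbs * (2 * ∏ j, α j).natAbs ^ j) with hG
        have hG1 : (1:ℝ) ≤ G := by exact_mod_cast Nat.gcd_pos_of_pos_left _ hdN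
        have ht := hCt L 2 hL (by norm_num) d hdN hlt.le
        have : ‖Ssum α β γ (ZMod.stdAddChar (N := d)) c‖ ^ 4 ≤ (CS * L^113 * G)^4 := by
          calc _ ≤ (16 * ∏ j, (α j : ℝ)) ^ 2 * (d:ℝ) ^ 11 * G * (d.divisors.card : ℝ) ^ 3 := hb
            _ ≤ (16 * ∏ j, (α j : ℝ)) ^ 2 * (2 * L^41) ^ 11 * G * (Ct * 2 * L) := by gcongr
            _ = CS * (L^113)^4 * G := by rw [hCS]; ring
            _ ≤ CS^4 * (L^113)^4 * (G:ℝ)^4 := by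
              gcongr
              · exact le_self_pow₀ hCS1 (by norm_num)
              · exact le_self_pow₀ hG1 (by norm_num)
            _ = _ := by ring
        exact le_of_pow_le_pow_left₀ (by norm_num) (by positivity) this
      · intro i
        refine (Wh_sum d K (bb α (L^40) i) (2 * L^40) (CB * (1/L^40)^2) h.hK (fun y hy => bb_zero α hα _ (by positivity) i y hy) (bb_smooth α _ i) ?_ ?_).trans ?_
        · intro y
          have hcb : Cb i ≤ CB := single_le_sum (fun i _ => (hCb0 i).le) (mem_univ i)
          exact (hCb i (L^40) (by positivity) y).trans (by gcongr)
        · intro y; rw [abs_of_nonneg (bb_nonneg α _ i y)]; exact bb_le_one α _ i y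
        · have h2 : (2*(K:ℝ)+1) ≤ 9 * L^40 := by linarith [h.hK']
          calc _ ≤ 9 * L^40 / L^39 + 9 * L^40 * (CB * (1/L^40)^2) * (2 * L^41) / 4 := by gcongr
            _ = (9 + 9/2 * CB) * L := by field_simp; ring
            _ ≤ _ := by gcongr; linarith
    have hsum : |∑ m ∈ Icc 1 T, 1/(m:ℝ) * om (d * m / L^41)| ≤ 2 * Co := by
      have hsub : ∀ m ∈ Icc 1 T, |1/(m:ℝ) * om (d * m / L^41)| ≤ if m ∈ Icc 1 (⌊2 * L^41 / d⌋₊) then Co * (d / L^41) else 0 := by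
        intro m hm
        have hm1 : (1:ℝ) ≤ m := by exact_mod_cast (mem_Icc.1 hm).1
        have hm0 : (0:ℝ) < m := by linarith
        have hpos : (0:ℝ) < d * m / L^41 := by positivity
        split_ifs with hmem
        · by_cases hs : (d * m / L^41) ≤ 1
          · rw [om_small _ (by rw [abs_of_pos hpos]; exact hs), mul_zero, abs_zero]; positivity
          · push Not at hs
            rw [abs_mul, abs_of_pos (by positivity : 0 < 1/(m:ℝ)), mul_comm]
            rw [lt_div_iff₀ (by positivity)] at hs
            exact mul_le_mul (hCo _) (by rw [div_le_div_iff₀ hm0 (by positivity)]; linarith) (by positivity) hCo0.le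
        · rw [om_large, mul_zero, abs_zero]
          rw [abs_of_pos hpos, le_div_iff₀ (by positivity)]
          rw [mem_Icc, not_and_or] at hmem
          rcases hmem with hmem | hmem
          · exact absurd (mem_Icc.1 hm).1 hmem
          · have := Nat.lt_of_floor_lt (not_le.1 hmem)
            rw [div_lt_iff₀ hd0] at this
            linarith
      refine (abs_sum_le_sum_abs _ _).trans ((sum_le_sum hsub).trans ?_)
      rw [← sum_filter, sum_const, nsmul_eq_mul]
      have hc1 : ((filter (fun m => m ∈ Icc 1 (⌊2 * L^41 / d⌋₊)) (Icc 1 T)).card : ℝ) ≤ 2 * L^41 / d := by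
        refine le_trans ?_ (Nat.floor_le (by positivity : 0 ≤ 2 * L^41 / d))
        have : (filter (fun m => m ∈ Icc 1 (⌊2 * L^41 / d⌋₊)) (Icc 1 T)) ⊆ Icc 1 (⌊2 * L^41 / d⌋₊) := fun m hm => (mem_filter.1 hm).2
        have := card_le_card this
        rw [Nat.card_Icc, Nat.add_sub_cancel] at this
        exact_mod_cast this
      calc _ ≤ 2 * L^41 / d * (Co * (d / L^41)) := by gcongr
        _ = 2 * Co := by field_simp
    calc _ ≤ 2 * Co * (((9 + 5 * CB) * L)^4 * (CS * L^113 * (Nat.gcd d ((DD α β γ).natAbs * (2 * ∏ j, α j).natAbs ^ j)))) := by gcongr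
      _ = _ := by ring
  · have : ∑ m ∈ Icc 1 T, 1/(m:ℝ) * om (d * m / L^41) = 0 := by
      apply sum_eq_zero; intro m hm
      have hm1 : (1:ℝ) ≤ m := by exact_mod_cast (mem_Icc.1 hm).1
      rw [om_large, mul_zero]
      rw [abs_of_nonneg (by positivity), le_div_iff₀ (by positivity)]
      push Not at hlt
      nlinarith
    rw [this]; simp

lemma U_large (α β : Fin 4 → ℤ) (hα : ∀ j, 0 < α j) : ∃ C, 0 < C ∧ ∀ L γ K T, Par α β L γ K T →
    |∑ d ∈ (Icc 1 T).filter (fun d : ℕ => CF α β * L^39 < d), 1/(d:ℝ) * UU α β γ (L^40) (L^41) K T d| ≤ C * L^120 := by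
  obtain ⟨C1, hC10, hC1⟩ := U_large_d α β hα
  obtain ⟨CD, hCD1, hCD⟩ := DD_bd α β hα
  set B := (2 * ∏ j, α j).natAbs with hB
  have hB0 : 0 < B := by
    have : 0 < ∏ j, α j := prod_pos fun j _ => hα j
    omega
  obtain ⟨b, hb⟩ : ∃ b : ℕ, B ≤ 2^b := ⟨B, Nat.lt_two_pow_self.le⟩
  obtain ⟨Ct, hCt1, hCt⟩ := tau_L 1 (80 + 41 * b) (by omega)
  have hF := CF_ge α β
  refine ⟨C1 * (2 * (Ct * (CD * 4^b))), by positivity, fun L γ K T h => ?_⟩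
  have hL := h.hL
  have hL0 : 0 < L := by linarith
  obtain ⟨j, hj1, hj2⟩ : ∃ j : ℕ, 2 * L^41 ≤ 2^j ∧ (2:ℝ)^j ≤ 4 * L^41 := by
    have h41 : (1:ℝ) ≤ L^41 := one_le_pow₀ hL
    obtain ⟨n, hn1, hn2⟩ := exists_nat_pow_near (x := 2 * L^41) (y := 2) (by linarith) (by norm_num)
    exact ⟨n+1, hn2.le, by rw [pow_succ]; linarith⟩
  obtain ⟨hD0, hDL⟩ := hCD L γ K T h
  set H := (DD α β γ).natAbs * B^j with hH
  have hH0 : 0 < H := Nat.mul_pos (by omega) (pow_pos hB0 _)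
  have hHL : (H:ℝ) ≤ (CD * 4^b) * L^(80 + 41 * b) := by
    have h1 : ((DD α β γ).natAbs : ℝ) ≤ CD * L^80 := by
      rw [Nat.cast_natAbs, abs_of_pos hD0]; exact hDL
    have h2 : (B:ℝ)^j ≤ (4 * L^41)^b := by
      calc (B:ℝ)^j ≤ ((2:ℝ)^b)^j := by gcongr; exact_mod_cast hb
        _ = ((2:ℝ)^j)^b := by rw [← pow_mul, ← pow_mul, mul_comm]
        _ ≤ _ := by gcongr
    rw [hH]; push_cast
    calc _ ≤ (CD * L^80) * (4 * L^41)^b := by gcongr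
      _ = _ := by rw [mul_pow, pow_add, pow_mul]; ring
  have hτ := hCt L (CD * 4^b) hL (one_le_mul_of_one_le_of_one_le hCD1 (one_le_pow₀ (by norm_num))) H hH0 hHL
  rw [pow_one] at hτ
  set X := ⌊2 * L^41⌋₊ with hX
  have hXle : (X:ℝ) ≤ 2 * L^41 := Nat.floor_le (by positivity)
  have hg : (∑ d ∈ Icc 1 X, (d.gcd H : ℝ)) ≤ 2 * L^41 * H.divisors.card := by
    calc (∑ d ∈ Icc 1 X, (d.gcd H : ℝ)) ≤ X * H.divisors.card := by exact_mod_cast sum_gcd_le X H hH0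
      _ ≤ _ := by gcongr
  calc _ ≤ ∑ d ∈ (Icc 1 T).filter (fun d : ℕ => CF α β * L^39 < d), (if d ∈ Icc 1 X then (1/L^39) * (C1 * L^117 * (d.gcd H)) else 0) := by
        refine (abs_sum_le_sum_abs _ _).trans (sum_le_sum fun d hd => ?_)
        rw [mem_filter, mem_Icc] at hd
        have hu := hC1 L γ K T h j hj1 d hd.2
        have hd0 : (0:ℝ) < d := by exact_mod_cast hd.1.1
        have hd39 : L^39 ≤ d := by
          have : 0 < L^39 := by positivity
          nlinarith
        rw [abs_mul, abs_of_pos (by positivity : 0 < 1/(d:ℝ))]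
        split_ifs at hu with hlt
        · rw [if_pos (mem_Icc.2 ⟨hd.1.1, Nat.le_floor hlt.le⟩)]
          gcongr
        · have : |UU α β γ (L^40) (L^41) K T d| = 0 := le_antisymm hu (abs_nonneg _)
          rw [this, mul_zero]
          split_ifs <;> positivity
    _ = ∑ d ∈ ((Icc 1 T).filter (fun d : ℕ => CF α β * L^39 < d)).filter (fun d => d ∈ Icc 1 X), (1/L^39) * (C1 * L^117 * (d.gcd H)) := by rw [← sum_filter]
    _ ≤ ∑ d ∈ Icc 1 X, (1/L^39) * (C1 * L^117 * (d.gcd H)) :=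
        sum_le_sum_of_subset_of_nonneg (fun d hd => (mem_filter.1 hd).2) fun d _ _ => by positivity
    _ = (1/L^39) * (C1 * L^117 * ∑ d ∈ Icc 1 X, (d.gcd H : ℝ)) := by rw [mul_sum, mul_sum]
    _ ≤ (1/L^39) * (C1 * L^117 * (2 * L^41 * (Ct * (CD * 4^b) * L))) := by
        gcongr
        exact hg.trans (by gcongr)
    _ = _ := by field_simp
end PF

namespace PF
open Finset

set_option maxHeartbeats 2000000 in
/-- Lower bound for the weighted sum, for parameters in range. -/
lemma Q_core (α β : Fin 4 → ℤ) (hα : ∀ j, 0 < α j) (hα0 : ∀ p : ℕ, p.Prime → (p:ℤ) ∣ 2 * ∏ j, α j → (p:ℤ) ∣ α 0)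
    (hβ0 : IsCoprime (β 0) (2 * ∏ j, α j)) : ∃ C c L0 : ℝ, 0 < C ∧ 0 < c ∧ 1 ≤ L0 ∧ ∀ L γ K T, L0 ≤ L → Par α β L γ K T →
    (∀ y, fq α β γ y ≠ 0) → ∃ τ : ℝ, 1 ≤ τ ∧ τ^6 ≤ C * L ∧ c * L ≤ C * τ^3 := by
  obtain ⟨Cs, hCs0, hCs⟩ := U_small α β hα hα0 hβ0
  obtain ⟨Ct, c, L0, hCt0, hc0, hL01, hCt⟩ := TT_est α β hα
  obtain ⟨Cl, hCl0, hCl⟩ := U_large α β hα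
  obtain ⟨CD, hCD1, hCD⟩ := DD_bd α β hα
  obtain ⟨Cτ, hCτ1, hCτ⟩ := tau_L 6 80 (by norm_num)
  have hF := CF_ge α β
  set F := CF α β with hFd
  have hM0 : 0 < 9 * Ct + Cs * F + Cl := by positivity
  refine ⟨max (Cτ * CD) (9 * Ct + Cs * F + Cl), 3/4 * c, L0, lt_max_of_lt_right hM0, by positivity, hL01, fun L γ K T hL0 h h0 => ?_⟩
  obtain ⟨μ, hμ1, hμ2, hT⟩ := hCt L hL0 γ K T h
  obtain ⟨hD0, hDL⟩ := hCD L γ K T h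
  have hL := h.hL
  have hLp : 0 < L := by linarith
  obtain ⟨D, hD⟩ := Int.eq_ofNat_of_zero_le hD0.le
  have hDp : 0 < D := by omega
  set τ : ℝ := (D.divisors.card : ℝ) with hτ
  have hτ1 : 1 ≤ τ := by
    have : 0 < D.divisors.card := card_pos.2 ⟨1, by simp; omega⟩
    rw [hτ]; exact_mod_cast this
  have hτp : 0 < τ := by linarith
  have hτ6 : τ^6 ≤ Cτ * CD * L := hCτ L CD hL hCD1 D hDp (by
    have : ((DD α β γ : ℤ) : ℝ) = D := by rw [hD]; simp
    rw [← this]; exact hDL)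
  refine ⟨τ, hτ1, hτ6.trans (by gcongr; exact le_max_left _ _), ?_⟩
  refine le_trans ?_ (mul_le_mul_of_nonneg_right (le_max_right _ _) (by positivity))
  set U := fun d => UU α β γ (L^40) (L^41) K T d with hU
  set A := fun d => AA α β γ d with hA
  set W := fun d => TT α β γ (L^40) (L^41) K T d with hW
  have hAb : ∀ d : ℕ, 0 < d → |A d| ≤ (d.gcd D : ℝ) / (d:ℝ)^2 * τ := by
    intro d hd
    simp only [hA]
    unfold AA
    rw [hD, abs_div, abs_mul, abs_of_nonneg (by positivity : 0 ≤ (d:ℝ)^2), div_mul_eq_mul_div]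
    refine div_le_div_of_nonneg_right ?_ (by positivity)
    calc |hh α d| * |crr d ((D:ℕ):ℤ)| ≤ 1 * (d.gcd D * τ) := by
          gcongr
          · exact hh_abs α d
          · exact crr_abs_le d hd D hDp
      _ = _ := one_mul _
  have h39 : (1:ℝ) ≤ L^39 := one_le_pow₀ hL
  have hsum := UU_sum α β hα γ (L^40) (L^41) (one_le_pow₀ hL) h.hγ' K T (one_le_pow₀ hL) (by
    refine le_trans ?_ h.hT
    rw [← hFd]
    have : L^41 ≤ L^80 := pow_le_pow_right₀ hL (by norm_num)
    gcongr) (by rw [← h.hγ', h.hγ]; exact h.hT) h0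
  rw [← sum_filter_add_sum_filter_not _ (fun d : ℕ => F * L^39 < d)] at hsum
  have hlarge := hCl L γ K T h
  set S0 := (Icc 1 T).filter (fun d : ℕ => ¬ F * L^39 < d) with hS0
  have hS0m : ∀ d ∈ S0, 0 < d ∧ (d:ℝ) ≤ F * L^39 := by
    intro d hd
    rw [hS0, mem_filter, mem_Icc, not_lt] at hd
    exact ⟨hd.1.1, hd.2⟩
  -- replace UU by AA * TT
  have herr : |∑ d ∈ S0, 1/(d:ℝ) * U d - ∑ d ∈ S0, 1/(d:ℝ) * (A d * W d)| ≤ Cs * F := by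
    rw [← sum_sub_distrib]
    have hcard : (S0.card : ℝ) ≤ F * L^39 := by
      have : S0 ⊆ Icc 1 ⌊F * L^39⌋₊ := fun d hd => mem_Icc.2 ⟨(hS0m d hd).1, Nat.le_floor (hS0m d hd).2⟩
      have := card_le_card this
      rw [Nat.card_Icc, Nat.add_sub_cancel] at this
      exact le_trans (by exact_mod_cast this) (Nat.floor_le (by positivity))
    calc _ ≤ ∑ d ∈ S0, Cs * (1/L)^40 := by
          refine (abs_sum_le_sum_abs _ _).trans (sum_le_sum fun d hd => ?_)
          have hd1 : (1:ℝ) ≤ d := by exact_mod_cast (hS0m d hd).1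
          rw [← mul_sub, abs_mul, abs_of_nonneg (by positivity)]
          calc 1/(d:ℝ) * |U d - A d * W d| ≤ 1 * (Cs * (1/L)^40) := by
                gcongr
                · rw [div_le_one (by linarith)]; exact hd1
                · exact hCs L γ K T h d (hS0m d hd).1 (hS0m d hd).2
            _ = _ := one_mul _
      _ = S0.card * (Cs * (1/L)^40) := by rw [sum_const, nsmul_eq_mul]
      _ ≤ F * L^39 * (Cs * (1/L)^40) := by gcongr
      _ = Cs * F * (1/L) := by field_simp
      _ ≤ Cs * F * 1 := by gcongr; rw [div_le_one hLp]; exact hL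
      _ = _ := mul_one _
  set Y := ⌊L⌋₊ with hY
  have hY1 : 0 < Y := Nat.floor_pos.2 hL
  have hYL : (Y:ℝ) ≤ L := Nat.floor_le hLp.le
  have hYL2 : L / 2 ≤ Y := by
    have := Nat.lt_floor_add_one L
    have h1 : (1:ℝ) ≤ Y := by exact_mod_cast hY1
    rw [← hY] at this
    linarith
  have hYp : (0:ℝ) < Y := by exact_mod_cast hY1
  have hLF : L ≤ F * L^39 := by
    calc L = 1 * L^1 := by ring
      _ ≤ F * L^39 := by
        have : L^1 ≤ L^39 := pow_le_pow_right₀ hL (by norm_num)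
        have h1F : 1 ≤ F := by linarith
        gcongr
  have hsub : Icc 1 Y ⊆ S0 := by
    intro d hd
    rw [mem_Icc] at hd
    have hdY : (d:ℝ) ≤ Y := by exact_mod_cast hd.2
    rw [hS0, mem_filter, mem_Icc, not_lt]
    refine ⟨⟨hd.1, ?_⟩, by linarith⟩
    have hdT : (d:ℝ) ≤ T := by
      calc (d:ℝ) ≤ F * L^39 := by linarith
        _ ≤ F * L^80 := by
          have : L^39 ≤ L^80 := pow_le_pow_right₀ hL (by norm_num)
          gcongr
        _ ≤ T := h.hT
    exact_mod_cast hdT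
  -- tail
  have htail : |∑ d ∈ S0 \ Icc 1 Y, 1/(d:ℝ) * (A d * W d)| ≤ 4 * Ct * τ^2 * L^120 := by
    calc _ ≤ ∑ d ∈ S0 \ Icc 1 Y, (Ct * L^121 * τ) * ((d.gcd D : ℝ) / (d:ℝ)^2) := by
          refine (abs_sum_le_sum_abs _ _).trans (sum_le_sum fun d hd => ?_)
          have hd' := hS0m d (mem_sdiff.1 hd).1
          have hd0 : (0:ℝ) < d := by exact_mod_cast hd'.1
          rw [abs_mul, abs_mul, abs_of_nonneg (by positivity)]
          calc 1/(d:ℝ) * (|A d| * |W d|) ≤ 1/(d:ℝ) * (((d.gcd D : ℝ) / (d:ℝ)^2 * τ) * (Ct * (d * L^41) * L^80)) := by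
                gcongr
                · exact hAb d hd'.1
                · exact (hT d hd'.1 hd'.2).2
            _ = _ := by field_simp
      _ ≤ ∑ d ∈ Ioc Y T, (Ct * L^121 * τ) * ((d.gcd D : ℝ) / (d:ℝ)^2) := by
          refine sum_le_sum_of_subset_of_nonneg (fun d hd => ?_) fun d _ _ => by positivity
          rw [mem_sdiff, hS0, mem_filter, mem_Icc, mem_Icc] at hd
          rw [mem_Ioc]; omega
      _ = (Ct * L^121 * τ) * ∑ d ∈ Ioc Y T, ((d.gcd D : ℝ) / (d:ℝ)^2) := by rw [mul_sum]
      _ ≤ (Ct * L^121 * τ) * (2 * τ / Y) := by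
          gcongr
          exact sum_gcd_tail Y T D hDp hY1
      _ ≤ (Ct * L^121 * τ) * (2 * τ / (L/2)) := by gcongr
      _ = _ := by field_simp; ring
  -- main
  have hmain : |∑ d ∈ Icc 1 Y, 1/(d:ℝ) * (A d * W d) - L^41 * μ * ∑ d ∈ Icc 1 Y, A d| ≤ Ct * τ * L^83 := by
    rw [mul_sum, ← sum_sub_distrib]
    calc _ ≤ ∑ d ∈ Icc 1 Y, Ct * τ * L^82 := by
          refine (abs_sum_le_sum_abs _ _).trans (sum_le_sum fun d hd => ?_)
          have hd' := hS0m d (hsub hd)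
          have hd0 : (0:ℝ) < d := by exact_mod_cast hd'.1
          have e : 1/(d:ℝ) * (A d * W d) - L^41 * μ * A d = 1/(d:ℝ) * (A d * (W d - (d * L^41) * μ)) := by field_simp
          rw [e, abs_mul, abs_mul, abs_of_nonneg (by positivity)]
          have hg : (d.gcd D : ℝ) ≤ d := by exact_mod_cast Nat.le_of_dvd hd'.1 (Nat.gcd_dvd_left _ _)
          calc 1/(d:ℝ) * (|A d| * |W d - (d * L^41) * μ|) ≤ 1/(d:ℝ) * (((d.gcd D : ℝ) / (d:ℝ)^2 * τ) * (Ct * (d * L^41)^2)) := by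
                gcongr
                · exact hAb d hd'.1
                · exact (hT d hd'.1 hd'.2).1
            _ ≤ 1/(d:ℝ) * (((d : ℝ) / (d:ℝ)^2 * τ) * (Ct * (d * L^41)^2)) := by gcongr
            _ = _ := by field_simp
      _ = Y * (Ct * τ * L^82) := by rw [sum_const, nsmul_eq_mul, Nat.card_Icc, Nat.add_sub_cancel]
      _ ≤ L * (Ct * τ * L^82) := by gcongr
      _ = _ := by ring
  have hsing : 3 / 4 / τ - 4 * τ / L ≤ ∑ d ∈ Icc 1 Y, A d := by
    have h1 := sing_ge (hh α) (hh_one α) (hh_mul α) (hh_abs α) (hh_two α) D Y hDp hY1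
    have h2 : 2 * τ / Y ≤ 4 * τ / L := by
      
      calc 2 * τ / Y ≤ 2 * τ / (L/2) := by gcongr
        _ = 4 * τ / L := by field_simp; ring
    have h3 : ∑ d ∈ Icc 1 Y, A d = ∑ d ∈ Icc 1 Y, hh α d * crr d D / (d:ℝ)^2 := by
      apply sum_congr rfl; intro d _
      simp only [hA]; unfold AA; rw [hD]
    rw [h3]; linarith
  have hμ0 : 0 < μ := lt_of_lt_of_le (by positivity) hμ1
  have hfin : L^41 * μ * (3 / 4 / τ - 4 * τ / L) ≤ Cs * F + 4 * Ct * τ^2 * L^120 + Ct * τ * L^83 + Cl * L^120 := by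
    have h1 := mul_le_mul_of_nonneg_left hsing (by positivity : 0 ≤ L^41 * μ)
    have h2 := (abs_le.1 hlarge).2
    have h2' := (abs_le.1 hlarge).1
    have h3 := abs_le.1 herr
    have h4 := abs_le.1 hmain
    have h5 := abs_le.1 htail
    simp only [hU] at h3
    have hsd := sum_sdiff hsub (f := fun d : ℕ => 1/(d:ℝ) * (A d * W d))
    beta_reduce at hsd
    linarith [h3.1, h3.2, h4.1, h4.2, h5.1, h5.2]
  have h6 : 3/4 * c * L^121 / τ ≤ (9 * Ct + Cs * F + Cl) * τ^2 * L^120 := by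
    have e1 : L^41 * μ * (3 / 4 / τ) ≥ 3/4 * c * L^121 / τ := by
      calc 3/4 * c * L^121 / τ = L^41 * (c * L^80) * (3/4/τ) := by ring
        _ ≤ _ := by gcongr
    have e2 : L^41 * μ * (4 * τ / L) ≤ 4 * Ct * τ * L^120 := by
      calc _ ≤ L^41 * (Ct * L^80) * (4 * τ / L) := by gcongr
        _ = _ := by field_simp
    have e3 : (1:ℝ) ≤ τ^2 * L^120 := one_le_mul_of_one_le_of_one_le (one_le_pow₀ hτ1) (one_le_pow₀ hL)
    have e4 : τ ≤ τ^2 := le_self_pow₀ hτ1 (by norm_num)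
    have e5 : L^83 ≤ L^120 := pow_le_pow_right₀ hL (by norm_num)
    have e6 : τ * L^120 ≤ τ^2 * L^120 := by gcongr
    have e7 : τ * L^83 ≤ τ^2 * L^120 := by gcongr
    have e8 : L^120 ≤ τ^2 * L^120 := le_mul_of_one_le_left (by positivity) (one_le_pow₀ hτ1)
    have f1 : Cs * F ≤ Cs * F * (τ^2 * L^120) := le_mul_of_one_le_right (by positivity) e3
    have f2 : Ct * (τ * L^120) ≤ Ct * (τ^2 * L^120) := by gcongr
    have f3 : Ct * (τ * L^83) ≤ Ct * (τ^2 * L^120) := by gcongr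
    have f4 : Cl * L^120 ≤ Cl * (τ^2 * L^120) := by gcongr
    have f5 : L^41 * μ * (3 / 4 / τ - 4 * τ / L) = L^41 * μ * (3 / 4 / τ) - L^41 * μ * (4 * τ / L) := by ring
    linarith
  rw [div_le_iff₀ hτp] at h6
  have hLL : 0 < L^120 := by positivity
  have h7 : (3/4 * c * L) * L^120 ≤ ((9 * Ct + Cs * F + Cl) * τ^3) * L^120 := by
    calc _ = 3/4 * c * L^121 := by ring
      _ ≤ _ := h6
      _ = _ := by ring
  exact le_of_mul_le_mul_right h7 hLL

theorem thmQ (α β : Fin 4 → ℤ) (hα : ∀ j, 0 < α j) (hα0 : ∀ p : ℕ, p.Prime → (p:ℤ) ∣ 2 * ∏ j, α j → (p:ℤ) ∣ α 0)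
    (hβ0 : IsCoprime (β 0) (2 * ∏ j, α j)) : ∃ G0 : ℤ, ∀ γ : ℤ, G0 ≤ γ → ∃ y : Fin 4 → ℤ, ∑ j, (α j * y j ^ 2 + β j * y j) = γ := by
  obtain ⟨C, c, L0, hC, hc, hL0, key⟩ := Q_core α β hα hα0 hβ0
  have hF := CF_ge α β
  set L1 := max L0 (C^3 / c^2 + 1) with hL1
  have hL1' : 1 ≤ L1 := le_max_of_le_left hL0
  refine ⟨⌈L1^80⌉, fun γ hγ => ?_⟩
  by_contra hcon
  push Not at hcon
  have hγ1 : L1^80 ≤ (γ:ℝ) := Int.ceil_le.1 hγ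
  have hγ0 : (0:ℝ) ≤ γ := le_trans (by positivity) hγ1
  set L : ℝ := (γ:ℝ)^((1:ℝ)/80) with hLd
  have hL80 : L^80 = γ := by
    rw [hLd, ← Real.rpow_natCast, ← Real.rpow_mul hγ0]; norm_num
  have hLn : 0 ≤ L := Real.rpow_nonneg hγ0 _
  have hLL1 : L1 ≤ L := le_of_pow_le_pow_left₀ (n := 80) (by norm_num) hLn (by rw [hL80]; exact hγ1)
  have hL : 1 ≤ L := hL1'.trans hLL1
  have h40 : (1:ℝ) ≤ L^40 := one_le_pow₀ hL
  have h80 : (1:ℝ) ≤ L^80 := one_le_pow₀ hL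
  have hpar : Par α β L γ ⌈2 * L^40 + 1⌉₊ ⌈CF α β * L^80⌉₊ := by
    refine ⟨hL, hL80.symm, Nat.le_ceil _, ?_, Nat.le_ceil _, ?_⟩
    · have := Nat.ceil_lt_add_one (by positivity : 0 ≤ 2 * L^40 + 1)
      linarith
    · have := Nat.ceil_lt_add_one (by positivity : 0 ≤ CF α β * L^80)
      nlinarith
  obtain ⟨τ, hτ1, hτ6, hτ3⟩ := key L γ _ _ ((le_max_left _ _).trans hLL1) hpar (fun y hy => hcon y (by unfold fq at hy; linarith))
  have h1 : (c * L)^2 ≤ (C * τ^3)^2 := by gcongr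
  have h2 : c^2 * L * L ≤ C^3 * L := by
    calc c^2 * L * L = (c*L)^2 := by ring
      _ ≤ _ := h1
      _ = C^2 * τ^6 := by ring
      _ ≤ C^2 * (C * L) := by gcongr
      _ = _ := by ring
  have h3 : c^2 * L ≤ C^3 := le_of_mul_le_mul_right h2 (by linarith)
  have h4 : C^3 / c^2 + 1 ≤ L := (le_max_right _ _).trans hLL1
  have h5 : L ≤ C^3 / c^2 := by rw [le_div_iff₀ (by positivity)]; linarith
  linarith

end PF

namespace PF
open Finset

lemma hens0 (p : ℕ) (hp : p.Prime) (A B C : ℤ) (hB : ¬ (p:ℤ) ∣ B) (V : ℕ) : ∃ h : ℤ, (p:ℤ)^V ∣ p * A * h^2 + B * h + C := by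
  have hcop : IsCoprime (p:ℤ) B := (Nat.prime_iff_prime_int.1 hp).coprime_iff_not_dvd.2 hB
  obtain ⟨u, v, huv⟩ := hcop
  induction V with
  | zero => exact ⟨0, by simp⟩
  | succ V ih =>
    obtain ⟨h, c, hc⟩ := ih
    refine ⟨h + p^V * (-c * v), ?_⟩
    have e : (p:ℤ) * A * (h + p^V * (-c * v))^2 + B * (h + p^V * (-c * v)) + C
      = p^(V+1) * (c * u + A * (-c * v) * (2 * h + p^V * (-c * v))) := by
      rw [pow_succ]
      linear_combination hc - (p:ℤ)^V * c * huv
    rw [e]; exact dvd_mul_right _ _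

lemma hens (p : ℕ) (hp : p.Prime) (k : ℕ) (A B C : ℤ) (hB : ¬ (p:ℤ)^(k+1) ∣ B) (hC : (p:ℤ)^(2*k+1) ∣ C) (V : ℕ) :
    ∃ h : ℤ, (p:ℤ) ∣ h ∧ (p:ℤ)^V ∣ A * h^2 + B * h + C := by
  have hB0 : B ≠ 0 := by rintro rfl; exact hB (dvd_zero _)
  have hpi := Nat.prime_iff_prime_int.1 hp
  obtain ⟨B', hBB, hB'⟩ := (Int.finiteMultiplicity_iff.2 ⟨by simpa using hp.ne_one, hB0⟩ : FiniteMultiplicity (p:ℤ) B).exists_eq_pow_mul_and_not_dvd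
  set v := multiplicity (p:ℤ) B
  have hv : v ≤ k := by
    by_contra hcon
    push Not at hcon
    exact hB (hBB ▸ (pow_dvd_pow _ (by omega)).mul_right _)
  obtain ⟨C', hC'⟩ : (p:ℤ)^(2*v+1) ∣ C := (pow_dvd_pow _ (by omega)).trans hC
  obtain ⟨h, q, hq⟩ := hens0 p hp A B' C' hB' V
  refine ⟨p^(v+1) * h, (dvd_pow_self _ (by omega)).mul_right _, p^(2*v+1) * q, ?_⟩
  have e : (p:ℤ)^(2*v+1) = p^v * p^v * p := by ring
  have e1 : (p:ℤ)^(v+1) = p^v * p := by ring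
  rw [hC', hBB, e, e1]
  linear_combination (p:ℤ)^v * p^v * p * hq

lemma add_four (x c : ℤ) (h : 4 ∣ x) (h' : ¬ 8 ∣ x) (hc : ¬ 2 ∣ c) : 8 ∣ x + c * 2^2 := by omega

lemma two_iso (c0 c1 c2 c3 c4 : ℤ) (h0 : ¬ 2 ∣ c0) (h1 : ¬ 2 ∣ c1) (h2 : ¬ 2 ∣ c2) (h3 : ¬ 4 ∣ c3) (h4 : ¬ 4 ∣ c4) :
    ∃ x1 x2 x3 x4 : ℤ, 8 ∣ c0 + c1 * x1^2 + c2 * x2^2 + c3 * x3^2 + c4 * x4^2 := by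
  by_cases g1 : 8 ∣ c0 + c1
  · exact ⟨1, 0, 0, 0, by simpa using g1⟩
  by_cases g2 : 4 ∣ c0 + c1
  · exact ⟨1, 2, 0, 0, by convert add_four _ _ g2 g1 h2 using 1; ring⟩
  by_cases g3 : 8 ∣ c0 + c2
  · exact ⟨0, 1, 0, 0, by simpa using g3⟩
  by_cases g4 : 4 ∣ c0 + c2
  · exact ⟨2, 1, 0, 0, by convert add_four _ _ g4 g3 h1 using 1; ring⟩
  by_cases g5 : 2 ∣ c3
  · have g : 4 ∣ c0 + c1 + c3 := by clear g1 g3 g4 h2 h4; omega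
    by_cases g6 : 8 ∣ c0 + c1 + c3
    · exact ⟨1, 0, 1, 0, by simpa using g6⟩
    · exact ⟨1, 2, 1, 0, by convert add_four _ _ g g6 h2 using 1; ring⟩
  by_cases g5' : 2 ∣ c4
  · have g : 4 ∣ c0 + c1 + c4 := by clear g1 g3 g4 h2 h3 g5; omega
    by_cases g6 : 8 ∣ c0 + c1 + c4
    · exact ⟨1, 0, 0, 1, by simpa using g6⟩
    · exact ⟨1, 2, 0, 1, by convert add_four _ _ g g6 h2 using 1; ring⟩
  by_cases g7 : 8 ∣ c0 + c3
  · exact ⟨0, 0, 1, 0, by simpa using g7⟩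
  by_cases g8 : 4 ∣ c0 + c3
  · exact ⟨2, 0, 1, 0, by convert add_four _ _ g8 g7 h1 using 1; ring⟩
  have e1 : 4 ∣ c0 - c1 := by clear g1 g3 g4 h2 h3 g5 h4 g5' g7 g8; omega
  have e2 : 4 ∣ c0 - c2 := by clear g1 g2 g3 h1 h3 g5 h4 g5' g7 g8; omega
  have e3 : 4 ∣ c0 - c3 := by clear g1 g2 g3 g4 h1 h2 h4 g5' g7; omega
  have g : 4 ∣ c0 + c1 + c2 + c3 := by clear g1 g2 g3 g4 h1 h2 h3 h4 g5' g7 g8 g5; omega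
  by_cases g9 : 8 ∣ c0 + c1 + c2 + c3
  · exact ⟨1, 1, 1, 0, by simpa using g9⟩
  · exact ⟨1, 1, 1, 2, by convert add_four _ _ g g9 g5' using 1; ring⟩

lemma odd_iso (p : ℕ) (hp : p.Prime) (hp2 : p ≠ 2) (c0 c1 c2 : ℤ) (h1 : ¬ (p:ℤ) ∣ c1) (h2 : ¬ (p:ℤ) ∣ c2) :
    ∃ x1 x2 : ℤ, (p:ℤ) ∣ c0 + c1 * x1^2 + c2 * x2^2 := by
  have := Fact.mk hp
  open Polynomial in
  obtain ⟨a, b, hab⟩ := FiniteField.exists_root_sum_quadratic (R := ZMod p) (f := C (c1 : ZMod p) * X^2) (g := C (c2 : ZMod p) * X^2 + C (c0 : ZMod p))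
    (by
      have : (c1 : ZMod p) ≠ 0 := by rwa [Ne, ZMod.intCast_zmod_eq_zero_iff_dvd]
      compute_degree!)
    (by
      have : (c2 : ZMod p) ≠ 0 := by rwa [Ne, ZMod.intCast_zmod_eq_zero_iff_dvd]
      compute_degree!)
    (by rw [ZMod.card]; exact hp.eq_two_or_odd.resolve_left hp2)
  simp at hab
  obtain ⟨x, rfl⟩ := ZMod.intCast_surjective a
  obtain ⟨y, rfl⟩ := ZMod.intCast_surjective b
  refine ⟨x, y, ?_⟩
  rw [← ZMod.intCast_zmod_eq_zero_iff_dvd]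
  push_cast
  linear_combination hab

lemma unit_iso (p : ℕ) (hp : p.Prime) (c : Fin 5 → ℤ) (h0 : ¬ (p:ℤ) ∣ c 0) (h1 : ¬ (p:ℤ) ∣ c 1) (h2 : ¬ (p:ℤ) ∣ c 2)
    (h3 : ¬ (p:ℤ)^2 ∣ c 3) (h4 : ¬ (p:ℤ)^2 ∣ c 4) (ρ : ℤ) (hρ : (p:ℤ)^3 ∣ ρ) (V : ℕ) :
    ∃ ξ : Fin 5 → ℤ, ¬ (p:ℤ) ∣ ξ 0 ∧ (p:ℤ)^V ∣ ∑ j, c j * ξ j^2 - ρ := by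
  have hpi := Nat.prime_iff_prime_int.1 hp
  have fin : ∀ k : ℕ, k ≤ 1 → ¬ (p:ℤ)^(k+1) ∣ 2 * c 0 → ∀ x1 x2 x3 x4 : ℤ, (p:ℤ)^(2*k+1) ∣ c 0 + c 1 * x1^2 + c 2 * x2^2 + c 3 * x3^2 + c 4 * x4^2 → 
      ∃ ξ : Fin 5 → ℤ, ¬ (p:ℤ) ∣ ξ 0 ∧ (p:ℤ)^V ∣ ∑ j, c j * ξ j^2 - ρ := by
    intro k hk hB x1 x2 x3 x4 hx
    have hρ' : (p:ℤ)^(2*k+1) ∣ ρ := (pow_dvd_pow _ (by omega)).trans hρ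
    obtain ⟨h, hh, hV⟩ := hens p hp k (c 0) (2 * c 0) (c 0 + c 1 * x1^2 + c 2 * x2^2 + c 3 * x3^2 + c 4 * x4^2 - ρ) hB (dvd_sub hx hρ') V
    refine ⟨![1 + h, x1, x2, x3, x4], ?_, ?_⟩
    · intro hd
      have : (p:ℤ) ∣ 1 := by simpa using dvd_sub hd hh
      exact hpi.not_dvd_one this
    · rw [Fin.sum_univ_five]
      convert hV using 1
      simp
      ring
  by_cases hp2 : p = 2
  · subst hp2
    have e4 : ((2:ℕ):ℤ)^2 = 4 := by norm_num
    have e2 : ((2:ℕ):ℤ) = 2 := by norm_num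
    rw [e4] at h3 h4
    rw [e2] at h0 h1 h2
    obtain ⟨x1, x2, x3, x4, hx⟩ := two_iso _ _ _ _ _ h0 h1 h2 h3 h4
    exact fin 1 le_rfl (by rw [e4]; omega) x1 x2 x3 x4 (by norm_num; exact hx)
  · obtain ⟨x1, x2, hx⟩ := odd_iso p hp hp2 (c 0) (c 1) (c 2) h1 h2
    refine fin 0 (by norm_num) ?_ x1 x2 0 0 (by simpa using hx)
    rw [zero_add, pow_one]
    intro hd
    rcases hpi.dvd_or_dvd hd with h | h
    · have : p ∣ 2 := by exact_mod_cast h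
      exact hp2 ((Nat.prime_dvd_prime_iff_eq hp Nat.prime_two).1 this)
    · exact h0 h

/-- split off an even power of `p` -/
lemma split_even (p : ℕ) (hp : p.Prime) (a : ℤ) (ha : a ≠ 0) : ∃ (s : ℕ) (c : ℤ), a = (p:ℤ)^(2*s) * c ∧ ¬ (p:ℤ)^2 ∣ c ∧
    (Even (multiplicity (p:ℤ) a) → ¬ (p:ℤ) ∣ c) := by
  obtain ⟨c, hc, hc'⟩ := (Int.finiteMultiplicity_iff.2 ⟨by simpa using hp.ne_one, ha⟩ : FiniteMultiplicity (p:ℤ) a).exists_eq_pow_mul_and_not_dvd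
  set v := multiplicity (p:ℤ) a
  have hp0 : (p:ℤ) ≠ 0 := by exact_mod_cast hp.ne_zero
  rcases Nat.even_or_odd' v with ⟨s, hs | hs⟩
  · refine ⟨s, c, by rw [← hs]; exact hc, fun h => hc' ((dvd_pow_self _ (by norm_num)).trans h), fun _ => hc'⟩
  · refine ⟨s, p * c, by rw [hc, hs]; ring, fun h => hc' ?_, fun h => absurd h (by rw [hs]; simp)⟩
    rw [pow_two] at h
    exact (mul_dvd_mul_iff_left hp0).1 h

lemma Z_even (p : ℕ) (hp : p.Prime) (a : Fin 5 → ℤ) (ha : ∀ j, a j ≠ 0) (h0 : Even (multiplicity (p:ℤ) (a 0)))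
    (h1 : Even (multiplicity (p:ℤ) (a 1))) (h2 : Even (multiplicity (p:ℤ) (a 2))) :
    ∃ k : ℕ, ∀ ρ : ℤ, (p:ℤ)^k ∣ ρ → ∀ V : ℕ, ∃ Y : Fin 5 → ℤ, (p:ℤ)^V ∣ ∑ j, a j * Y j^2 - ρ ∧ ∃ i, ¬ (p:ℤ)^k ∣ Y i := by
  choose s c hac hc hc' using fun j => split_even p hp (a j) (ha j)
  set t := ∑ j, s j with ht
  have hst : ∀ j, s j ≤ t := fun j => single_le_sum (f := s) (fun _ _ => Nat.zero_le _) (mem_univ j)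
  have hp0 : (p:ℤ) ≠ 0 := by exact_mod_cast hp.ne_zero
  refine ⟨2*t+3, fun ρ hρ V => ?_⟩
  obtain ⟨ρ', hρ'⟩ := hρ
  obtain ⟨ξ, hξ, hV⟩ := unit_iso p hp c (hc' 0 h0) (hc' 1 h1) (hc' 2 h2) (hc 3) (hc 4) ((p:ℤ)^3 * ρ') (dvd_mul_right _ _) V
  refine ⟨fun j => p^(t - s j) * ξ j, ?_, 0, ?_⟩
  · have e : ∑ j, a j * ((p:ℤ)^(t - s j) * ξ j)^2 - ρ = p^(2*t) * (∑ j, c j * ξ j^2 - (p:ℤ)^3 * ρ') := by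
      rw [mul_sub, mul_sum, hρ']
      congr 1
      · apply sum_congr rfl; intro j _
        rw [hac j]
        have : (p:ℤ)^(2*t) = p^(2 * s j) * (p^(t - s j))^2 := by
          rw [← pow_mul, ← pow_add]; congr 1; have := hst j; omega
        rw [this]; ring
      · ring
    rw [e]
    exact hV.mul_left _
  · intro h
    have h' : (p:ℤ)^(t - s 0) * p ∣ p^(t - s 0) * ξ 0 := by
      rw [← pow_succ]; exact (pow_dvd_pow _ (by omega)).trans h
    exact hξ ((mul_dvd_mul_iff_left (pow_ne_zero _ hp0)).1 h')

lemma Z_gen (p : ℕ) (hp : p.Prime) (a : Fin 5 → ℤ) (ha : ∀ j, a j ≠ 0) :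
    ∃ k : ℕ, ∀ ρ : ℤ, (p:ℤ)^k ∣ ρ → ∀ V : ℕ, ∃ Y : Fin 5 → ℤ, (p:ℤ)^V ∣ ∑ j, a j * Y j^2 - ρ ∧ ∃ i, ¬ (p:ℤ)^k ∣ Y i := by
  have pig : ∀ ε : Fin 5 → Bool, ∃ i j k : Fin 5, i ≠ j ∧ i ≠ k ∧ j ≠ k ∧ ε i = ε j ∧ ε j = ε k := by
    intro ε
    obtain ⟨b, -, hb⟩ := Finset.exists_lt_card_fiber_of_mul_lt_card_of_maps_to (s := (univ : Finset (Fin 5))) (t := (univ : Finset Bool)) (f := ε) (n := 2)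
      (fun _ _ => mem_univ _) (by simp)
    obtain ⟨i, hi, j, hj, k, hk, hij, hik, hjk⟩ := Finset.two_lt_card.1 hb
    simp only [mem_filter, mem_univ, true_and] at hi hj hk
    exact ⟨i, j, k, hij, hik, hjk, by rw [hi, hj], by rw [hj, hk]⟩
  have perm : ∀ i j k : Fin 5, i ≠ j → i ≠ k → j ≠ k → ∃ e : Equiv.Perm (Fin 5), e 0 = i ∧ e 1 = j ∧ e 2 = k := by
    intro i j k hij hik hjk
    obtain ⟨e, he⟩ := Equiv.Perm.exists_extending_pair (![(0 : Fin 5), 1, 2]) (![i, j, k]) (by decide) (by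
      intro x y hxy
      fin_cases x <;> fin_cases y <;> simp_all)
    exact ⟨e, he 0, he 1, he 2⟩
  obtain ⟨i, j, k, hij, hik, hjk, e1, e2⟩ := pig (fun j => decide (Even (multiplicity (p:ℤ) (a j))))
  obtain ⟨e, he0, he1, he2⟩ := perm i j k hij hik hjk
  have hpi := Nat.prime_iff_prime_int.1 hp
  have hp0 : (p:ℤ) ≠ 0 := by exact_mod_cast hp.ne_zero
  have hfm : ∀ j, FiniteMultiplicity (p:ℤ) (p * a j) := fun j => Int.finiteMultiplicity_iff.2 ⟨by simpa using hp.ne_one, mul_ne_zero hp0 (ha j)⟩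
  by_cases hev : Even (multiplicity (p:ℤ) (a i))
  · have hj : Even (multiplicity (p:ℤ) (a j)) := by simpa [hev] using e1
    have hk : Even (multiplicity (p:ℤ) (a k)) := by simpa [hj] using e2
    obtain ⟨K, hK⟩ := Z_even p hp (a ∘ e) (fun j => ha _) (by simpa [he0] using hev) (by simpa [he1] using hj) (by simpa [he2] using hk)
    refine ⟨K, fun ρ hρ V => ?_⟩
    obtain ⟨Y, hY, i', hi'⟩ := hK ρ hρ V
    refine ⟨Y ∘ e.symm, ?_, e i', by simpa using hi'⟩
    rw [← Equiv.sum_comp e]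
    simpa using hY
  · have hj : ¬ Even (multiplicity (p:ℤ) (a j)) := by simpa [hev] using e1
    have hk : ¬ Even (multiplicity (p:ℤ) (a k)) := by simpa [hj] using e2
    have hm : ∀ j, ¬ Even (multiplicity (p:ℤ) (a j)) → Even (multiplicity (p:ℤ) (p * a j)) := by
      intro j hj
      rw [multiplicity_mul hpi (hfm j), multiplicity_self]
      rw [Nat.not_even_iff_odd] at hj
      exact (odd_one).add_odd hj
    obtain ⟨K, hK⟩ := Z_even p hp (fun j => p * a (e j)) (fun j => mul_ne_zero hp0 (ha _)) (by simpa [he0] using hm _ hev) (by simpa [he1] using hm _ hj) (by simpa [he2] using hm _ hk)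
    refine ⟨K, fun ρ hρ V => ?_⟩
    obtain ⟨Y, hY, i', hi'⟩ := hK (p * ρ) (hρ.mul_left _) (V+1)
    refine ⟨Y ∘ e.symm, ?_, e i', by simpa using hi'⟩
    rw [← Equiv.sum_comp e]
    have e3 : ∑ j, (p * a (e j)) * Y j^2 - p * ρ = p * (∑ j, a (e j) * (Y j)^2 - ρ) := by
      rw [mul_sub, mul_sum]; congr 1; apply sum_congr rfl; intro j _; ring
    rw [e3, pow_succ'] at hY
    simpa using (mul_dvd_mul_iff_left hp0).1 hY
end PF

namespace PF
open Finset

def ph (M x : ℤ) : ℤ := M * x^2 + (2 - M) * x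
def FF (a : Fin 5 → ℤ) (M : ℤ) (x : Fin 5 → ℤ) : ℤ := ∑ j, a j * ph M (x j)
def yy (M x : ℤ) : ℤ := M * (2 * x - 1) + 2

lemma dvd_eq {q u v : ℤ} (h : q ∣ u) (e : v = u) : q ∣ v := e ▸ h

lemma nd_mul (p : ℕ) (hp : p.Prime) (k l : ℕ) (x y : ℤ) (hx : ¬ (p:ℤ)^k ∣ x) (hy : ¬ (p:ℤ)^l ∣ y) : ¬ (p:ℤ)^(k+l) ∣ x * y := by
  rw [← emultiplicity_lt_iff_not_dvd] at *
  rw [emultiplicity_mul (Nat.prime_iff_prime_int.1 hp)]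
  push_cast
  exact ENat.add_lt_add hx hy

lemma nd_mono (p : ℕ) (k l : ℕ) (h : k ≤ l) (x : ℤ) (hx : ¬ (p:ℤ)^k ∣ x) : ¬ (p:ℤ)^l ∣ x := fun h' => hx ((pow_dvd_pow _ h).trans h')

lemma nd_exists (p : ℕ) (hp : p.Prime) (x : ℤ) (hx : x ≠ 0) : ∃ s : ℕ, ¬ (p:ℤ)^s ∣ x := by
  obtain ⟨n, hn⟩ := (Int.finiteMultiplicity_iff.2 ⟨by simpa using hp.ne_one, hx⟩ : FiniteMultiplicity (p:ℤ) x)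
  exact ⟨n+1, hn⟩

lemma cop_pow (p : ℕ) (hp : p.Prime) (u : ℤ) (hu : ¬ (p:ℤ) ∣ u) (V : ℕ) : IsCoprime ((p:ℤ)^V) u :=
  ((Nat.prime_iff_prime_int.1 hp).coprime_iff_not_dvd.2 hu).pow_left

lemma subst_lin (p : ℕ) (hp : p.Prime) (a : Fin 5 → ℤ) (k : ℕ)
    (hk : ∀ ρ : ℤ, (p:ℤ)^k ∣ ρ → ∀ V : ℕ, ∃ Y : Fin 5 → ℤ, (p:ℤ)^V ∣ ∑ j, a j * Y j^2 - ρ ∧ ∃ i, ¬ (p:ℤ)^k ∣ Y i)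
    (M u v W Z κ : ℤ) (hu : ¬ (p:ℤ) ∣ u) (hW : ¬ (p:ℤ) ∣ W) (hph : ∀ x, W * ph M x = Z * (u * x + v)^2 + κ) (x0 : Fin 5 → ℤ) (V : ℕ) :
    ∃ x, (p:ℤ)^V ∣ FF a M x - FF a M x0 ∧ ∃ i, ¬ (p:ℤ)^k ∣ u * x i + v := by
  by_cases h : ∃ i, ¬ (p:ℤ)^k ∣ u * x0 i + v
  · exact ⟨x0, by simp, h⟩
  push Not at h
  obtain ⟨Y, hY, i, hi⟩ := hk (∑ j, a j * (u * x0 j + v)^2) (dvd_sum fun j _ => ((h j).trans (dvd_pow_self _ (by norm_num))).mul_left _) (max V k)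
  have hx : ∀ j, ∃ x : ℤ, (p:ℤ)^(max V k) ∣ u * x + v - Y j := by
    intro j
    obtain ⟨s, t, hst⟩ := cop_pow p hp u hu (max V k)
    refine ⟨t * (Y j - v), -(s * (Y j - v)), ?_⟩
    linear_combination (Y j - v) * hst
  choose x hx using hx
  refine ⟨x, ?_, i, ?_⟩
  · have e : W * (FF a M x - FF a M x0) = Z * (∑ j, a j * (u * x j + v - Y j) * (u * x j + v + Y j) + (∑ j, a j * Y j^2 - ∑ j, a j * (u * x0 j + v)^2)) := by
      unfold FF
      rw [mul_sub, mul_sum, mul_sum]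
      rw [← sum_sub_distrib, ← sum_sub_distrib, ← sum_add_distrib, mul_sum]
      apply sum_congr rfl; intro j _
      linear_combination a j * hph (x j) - a j * hph (x0 j)
    have : (p:ℤ)^(max V k) ∣ W * (FF a M x - FF a M x0) := by
      rw [e]
      exact (dvd_add (dvd_sum fun j _ => ((hx j).mul_left _).mul_right _) hY).mul_left _
    exact (cop_pow p hp W hW V).dvd_of_dvd_mul_left ((pow_dvd_pow _ (le_max_left _ _)).trans this)
  · intro hd
    have h1 := dvd_sub hd ((pow_dvd_pow _ (le_max_right V k)).trans (hx i))
    exact hi (by simpa using h1)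

lemma reg (p : ℕ) (hp : p.Prime) (a : Fin 5 → ℤ) (ha : ∀ j, a j ≠ 0) : ∃ k : ℕ, ∀ (M : ℤ) (x0 : Fin 5 → ℤ) (V : ℕ),
    ∃ x i, (p:ℤ)^V ∣ FF a M x - FF a M x0 ∧ ¬ (p:ℤ)^k ∣ yy M (x i) := by
  obtain ⟨k, hk⟩ := Z_gen p hp a ha
  have hpi := Nat.prime_iff_prime_int.1 hp
  refine ⟨k+2, fun M x0 V => ?_⟩
  by_cases hp2 : p = 2
  · subst hp2
    have c2 : ((2:ℕ):ℤ) = 2 := by norm_num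
    have c4 : ((2:ℕ):ℤ)^2 = 4 := by norm_num
    have hgood : ¬ 4 ∣ yy M (x0 0) → ∃ x i, ((2:ℕ):ℤ)^V ∣ FF a M x - FF a M x0 ∧ ¬ ((2:ℕ):ℤ)^(k+2) ∣ yy M (x i) := by
      intro h
      exact ⟨x0, 0, by simp, nd_mono 2 2 (k+2) (by omega) _ (by rw [c4]; exact h)⟩
    rcases Int.even_or_odd' M with ⟨μ, hμ | hμ⟩
    · rcases Int.even_or_odd' μ with ⟨w, hw | hw⟩
      · apply hgood
        have : yy M (x0 0) = 4 * (w * (2 * x0 0 - 1)) + 2 := by unfold yy; rw [hμ, hw]; ring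
        omega
      · obtain ⟨x, hx, i, hi⟩ := subst_lin 2 hp a k hk M μ (-w) μ 2 (-2*w^2) (by rw [c2]; omega) (by rw [c2]; omega) (by
          intro x; unfold ph; rw [hμ, hw]; ring) x0 V
        refine ⟨x, i, hx, fun hd => hi ?_⟩
        have e : yy M (x i) = ((2:ℕ):ℤ)^2 * (μ * x i + -w) := by unfold yy; rw [hμ, hw, c4]; ring
        rw [e, pow_add, mul_comm] at hd
        exact (mul_dvd_mul_iff_left (by norm_num)).1 hd
    · apply hgood
      have : yy M (x0 0) = 2 * (M * x0 0) - M + 2 := by unfold yy; ring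
      omega
  · have hp2' : ¬ (p:ℤ) ∣ 2 := by
      intro h
      have : p ∣ 2 := by exact_mod_cast h
      exact hp2 ((Nat.prime_dvd_prime_iff_eq hp Nat.prime_two).1 this)
    by_cases hM : (p:ℤ) ∣ M
    · refine ⟨x0, 0, by simp, nd_mono p 1 (k+2) (by omega) _ ?_⟩
      rw [pow_one]
      intro h
      unfold yy at h
      exact hp2' ((dvd_add_right (hM.mul_right _)).1 h)
    · obtain ⟨x, hx, i, hi⟩ := subst_lin p hp a k hk M (2 * M) (2 - M) (2 * 2 * M) 1 (-(2-M)^2)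
        (hpi.not_dvd_mul hp2' hM) (hpi.not_dvd_mul (hpi.not_dvd_mul hp2' hp2') hM) (by intro x; unfold ph; ring) x0 V
      refine ⟨x, i, hx, nd_mono p k (k+2) (by omega) _ ?_⟩
      have e : yy M (x i) = 2 * M * x i + (2 - M) := by unfold yy; ring
      rw [e]; exact hi

lemma FF_upd (a : Fin 5 → ℤ) (M : ℤ) (x : Fin 5 → ℤ) (i : Fin 5) (h : ℤ) :
    FF a M (Function.update x i (x i + h)) = FF a M x + a i * h * (yy M (x i) + M * h) := by
  unfold FF
  rw [← Finset.add_sum_erase univ _ (mem_univ i), ← Finset.add_sum_erase univ (fun j => a j * ph M (x j)) (mem_univ i)]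
  have : ∑ j ∈ univ.erase i, a j * ph M (Function.update x i (x i + h) j) = ∑ j ∈ univ.erase i, a j * ph M (x j) := by
    apply sum_congr rfl; intro j hj
    rw [Function.update_of_ne (mem_erase.1 hj).1]
  rw [this, Function.update_self]
  unfold ph yy; ring

lemma caseA (p : ℕ) (hp : p.Prime) (a : Fin 5 → ℤ) (M : ℤ) (x : Fin 5 → ℤ) (i j : Fin 5) (hij : i ≠ j) (k c : ℕ) (hc : 2*k+1 ≤ c)
    (hj : ¬ (p:ℤ)^(k+1) ∣ a j * yy M (x j)) (V : ℕ) : ∃ x' h, x' i = x i + p^c ∧ x' j = x j + h ∧ (∀ l, l ≠ i → l ≠ j → x' l = x l) ∧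
      FF a M x' - FF a M x = a i * p^c * (yy M (x i) + M * p^c) + a j * h * (yy M (x j) + M * h) ∧ (p:ℤ)^V ∣ FF a M x' - FF a M x := by
  obtain ⟨h, -, hV⟩ := hens p hp k (a j * M) (a j * yy M (x j)) (a i * p^c * (yy M (x i) + M * p^c)) hj
    (((pow_dvd_pow _ hc).mul_left _).mul_right _) V
  set x1 := Function.update x i (x i + p^c) with hx1
  have h1j : x1 j = x j := Function.update_of_ne hij.symm _ _
  have e : FF a M (Function.update x1 j (x1 j + h)) - FF a M x = a i * p^c * (yy M (x i) + M * p^c) + a j * h * (yy M (x j) + M * h) := by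
    rw [FF_upd, hx1, FF_upd, ← hx1, h1j]; ring
  refine ⟨Function.update x1 j (x1 j + h), h, ?_, ?_, ?_, e, ?_⟩
  · rw [Function.update_of_ne hij, hx1, Function.update_self]
  · rw [Function.update_self, h1j]
  · intro l hli hlj
    rw [Function.update_of_ne hlj, hx1, Function.update_of_ne hli]
  · rw [e]; exact dvd_eq hV (by ring)

lemma contra (p : ℕ) (hp : p.Prime) (ai aj xi xj M h : ℤ) (σ k c e : ℕ) (he : e = σ + (c + 1) + k) (hkc : k ≤ c) (hσ : ¬ (p:ℤ)^σ ∣ ai + aj)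
    (hj : ¬ (p:ℤ)^k ∣ yy M xj) (hx : (p:ℤ)^e ∣ xi - xj) (h1 : (p:ℤ)^e ∣ p^c - h)
    (h2 : (p:ℤ)^e ∣ ai * p^c * (yy M xi + M * p^c) + aj * h * (yy M xj + M * h)) : False := by
  have hp0 : (p:ℤ) ≠ 0 := by exact_mod_cast hp.ne_zero
  have key : (p:ℤ)^e ∣ (ai + aj) * p^c * (yy M xj + M * p^c) := by
    have : (ai + aj) * p^c * (yy M xj + M * p^c) = ai * p^c * (yy M xi + M * p^c) + aj * h * (yy M xj + M * h)
       + (p^c - h) * (aj * (yy M xj + M * (p^c + h))) - (xi - xj) * (ai * p^c * (2 * M)) := by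
      unfold yy; ring
    rw [this]
    exact dvd_sub (dvd_add h2 (h1.mul_right _)) (hx.mul_right _)
  rw [he] at key
  refine nd_mul p hp (σ + (c+1)) k _ _ (nd_mul p hp σ (c+1) _ _ hσ ?_) ?_ key
  · intro hd
    have : p^(c+1) ∣ p^c := by exact_mod_cast hd
    exact absurd ((Nat.pow_dvd_pow_iff_le_right hp.one_lt).1 this) (by omega)
  · intro hd
    exact hj ((dvd_add_left ((pow_dvd_pow (p:ℤ) hkc).mul_left _)).1 hd)

lemma local_p (p : ℕ) (hp : p.Prime) (a : Fin 5 → ℤ) (ha : ∀ j, 0 < a j) : ∃ e : ℕ, ∀ (M : ℤ) (x0 : Fin 5 → ℤ) (V : ℕ), e ≤ V →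
    ∃ x, (p:ℤ)^V ∣ FF a M x - FF a M x0 ∧ ¬ (p:ℤ)^e ∣ x 0 - x 1 := by
  obtain ⟨k, hk⟩ := reg p hp a (fun j => (ha j).ne')
  choose s hs using fun j => nd_exists p hp (a j) (ha j).ne'
  obtain ⟨σ, hσ⟩ := nd_exists p hp (a 0 + a 1) (by have := ha 0; have := ha 1; omega)
  set S := ∑ j, s j with hS
  have hs' : ∀ j, ¬ (p:ℤ)^S ∣ a j := fun j => nd_mono p (s j) S (single_le_sum (f := s) (fun _ _ => Nat.zero_le _) (mem_univ j)) _ (hs j)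
  set c := 2 * (S + k) + 1 with hc
  set e := σ + (c + 1) + k with he
  refine ⟨e, fun M x0 V hV => ?_⟩
  obtain ⟨x, i, hx, hi⟩ := hk M x0 V
  by_cases hgood : (p:ℤ)^e ∣ x 0 - x 1
  swap
  · exact ⟨x, hx, hgood⟩
  have hai : ¬ (p:ℤ)^(S + k + 1) ∣ a i * yy M (x i) := nd_mono p (S+k) _ (by omega) _ (nd_mul p hp S k _ _ (hs' i) hi)
  have hVe : (p:ℤ)^e ∣ (p:ℤ)^V := pow_dvd_pow _ hV
  by_cases hi0 : i = 0
  · subst hi0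
    obtain ⟨x', h, h1, h0, -, hF, hd⟩ := caseA p hp a M x 1 0 (by decide) (S+k) c le_rfl hai V
    refine ⟨x', ?_, fun hbad => ?_⟩
    · have := dvd_add hd hx; simpa using this
    · rw [h1, h0] at hbad
      refine contra p hp (a 1) (a 0) (x 1) (x 0) M h σ k c e he (by omega) (by rwa [add_comm]) hi ?_ ?_ (hF ▸ hVe.trans hd)
      · rw [← dvd_neg]; simpa using hgood
      · have := dvd_sub hgood hbad
        exact dvd_eq this (by ring)
  by_cases hi1 : i = 1
  · subst hi1
    obtain ⟨x', h, h0, h1, -, hF, hd⟩ := caseA p hp a M x 0 1 (by decide) (S+k) c le_rfl hai V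
    refine ⟨x', ?_, fun hbad => ?_⟩
    · have := dvd_add hd hx; simpa using this
    · rw [h1, h0] at hbad
      refine contra p hp (a 0) (a 1) (x 0) (x 1) M h σ k c e he (by omega) hσ hi hgood ?_ (hF ▸ hVe.trans hd)
      have := dvd_sub hbad hgood
      exact dvd_eq this (by ring)
  · obtain ⟨x', h, h0, -, hl, hF, hd⟩ := caseA p hp a M x 0 i (fun h => hi0 h.symm) (S+k) c le_rfl hai V
    refine ⟨x', ?_, fun hbad => ?_⟩
    · have := dvd_add hd hx; simpa using this
    · rw [h0, hl 1 (by decide) (fun h => hi1 h.symm)] at hbad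
      have h3 := dvd_sub hbad hgood
      have h4 : (p:ℤ)^e ∣ p^c := dvd_eq h3 (by ring)
      have h5 : p^e ∣ p^c := by exact_mod_cast h4
      exact absurd ((Nat.pow_dvd_pow_iff_le_right hp.one_lt).1 h5) (by omega)

lemma FF_congr (a : Fin 5 → ℤ) (M q : ℤ) (x y : Fin 5 → ℤ) (h : ∀ j, q ∣ x j - y j) : q ∣ FF a M x - FF a M y := by
  unfold FF
  rw [← sum_sub_distrib]
  refine dvd_sum fun j _ => ?_
  have : a j * ph M (x j) - a j * ph M (y j) = (x j - y j) * (a j * (M * (x j + y j) + (2 - M))) := by unfold ph; ring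
  rw [this]; exact (h j).mul_right _

lemma local_all (a : Fin 5 → ℤ) (ha : ∀ j, 0 < a j) (B : ℕ) (hB : 0 < B) : ∃ e : ℕ, 1 ≤ e ∧ ∀ (M : ℤ) (x0 : Fin 5 → ℤ) (R : ℕ), 0 < R →
    ∃ x, ((R:ℤ)^e) ∣ FF a M x - FF a M x0 ∧ ∀ p : ℕ, p.Prime → p ∣ R → p ∣ B → ¬ (p:ℤ)^e ∣ x 0 - x 1 := by
  have h : ∀ p : ℕ, ∃ e : ℕ, p.Prime → ∀ (M : ℤ) (x0 : Fin 5 → ℤ) (V : ℕ), e ≤ V →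
    ∃ x, (p:ℤ)^V ∣ FF a M x - FF a M x0 ∧ ¬ (p:ℤ)^e ∣ x 0 - x 1 := by
    intro p
    by_cases hp : p.Prime
    · obtain ⟨e, he⟩ := local_p p hp a ha
      exact ⟨e, fun _ => he⟩
    · exact ⟨0, fun h => absurd h hp⟩
  choose e he using h
  set E := (∑ p ∈ range (B+1), e p) + 1 with hE
  have heE : ∀ p, p ∣ B → e p ≤ E := by
    intro p hp
    have : e p ≤ ∑ p ∈ range (B+1), e p := single_le_sum (f := e) (fun _ _ => Nat.zero_le _) (mem_range.2 (by have := Nat.le_of_dvd hB hp; omega))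
    omega
  refine ⟨E, by omega, fun M x0 R => ?_⟩
  induction R using Nat.recOnPosPrimePosCoprime with
  | zero => intro h; omega
  | one => intro _; exact ⟨x0, by simp, fun p hp h1 => absurd (Nat.dvd_one.1 h1) hp.ne_one⟩
  | prime_pow q n hq hn =>
    intro _
    by_cases hqB : q ∣ B
    · obtain ⟨x, hx, hx'⟩ := he q hq M x0 (n * E) ((heE q hqB).trans (Nat.le_mul_of_pos_left _ hn))
      refine ⟨x, by push_cast; rw [← pow_mul]; exact hx, fun p hp hpq _ => ?_⟩
      have : p = q := (Nat.prime_dvd_prime_iff_eq hp hq).1 (hp.dvd_of_dvd_pow hpq)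
      subst this
      exact nd_mono p (e p) E (heE p hqB) _ hx'
    · refine ⟨x0, by simp, fun p hp hpq hpB => ?_⟩
      have : p = q := (Nat.prime_dvd_prime_iff_eq hp hq).1 (hp.dvd_of_dvd_pow hpq)
      subst this
      exact absurd hpB hqB
  | coprime u v hu hv huv ihu ihv =>
    intro _
    obtain ⟨x, hx, hx'⟩ := ihu (by omega)
    obtain ⟨y, hy, hy'⟩ := ihv (by omega)
    have hc : IsCoprime ((u:ℤ)^E) ((v:ℤ)^E) := (Nat.isCoprime_iff_coprime.2 huv).pow
    have hz : ∀ j, ∃ z : ℤ, (u:ℤ)^E ∣ z - x j ∧ (v:ℤ)^E ∣ z - y j := by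
      intro j
      obtain ⟨s, t, hst⟩ := hc
      refine ⟨s * u^E * y j + t * v^E * x j, ⟨s * (y j - x j), ?_⟩, ⟨t * (x j - y j), ?_⟩⟩
      · linear_combination x j * hst
      · linear_combination y j * hst
    choose z hz1 hz2 using hz
    have d1 := dvd_add (FF_congr a M _ z x hz1) hx
    have d2 := dvd_add (FF_congr a M _ z y hz2) hy
    rw [sub_add_sub_cancel] at d1 d2
    refine ⟨z, ?_, fun p hp hpR hpB hd => ?_⟩
    · push_cast; rw [mul_pow]; exact hc.mul_dvd d1 d2
    · rcases (Nat.Prime.dvd_mul hp).1 hpR with h | h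
      · have hpu : (p:ℤ)^E ∣ (u:ℤ)^E := pow_dvd_pow_of_dvd (by exact_mod_cast h) _
        apply hx' p hp h hpB
        have := dvd_sub hd (dvd_sub (hpu.trans (hz1 0)) (hpu.trans (hz1 1)))
        exact dvd_eq this (by ring)
      · have hpv : (p:ℤ)^E ∣ (v:ℤ)^E := pow_dvd_pow_of_dvd (by exact_mod_cast h) _
        apply hy' p hp h hpB
        have := dvd_sub hd (dvd_sub (hpv.trans (hz2 0)) (hpv.trans (hz2 1)))
        exact dvd_eq this (by ring)
end PF

namespace PF
open Finset

lemma four (b h : Fin 4 → ℤ) (hb : ∀ j, 0 < b j) (κ d : ℤ) (e : ℕ) (hκ : κ ∣ 2 * ∏ j, b j) (hh0 : 2 * h 0 = κ * d)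
    (hd : ∀ p : ℕ, p.Prime → (p:ℤ) ∣ 2 * ∏ j, b j → ¬ (p:ℤ)^e ∣ d) : ∃ G0 : ℤ, ∀ Γ : ℤ, G0 ≤ Γ → (2 * ∏ j, b j)^(2*e+3) ∣ Γ →
      ∃ z : Fin 4 → ℤ, ∑ j, (b j * z j^2 + 2 * h j * z j) = Γ := by
  set B := 2 * ∏ j, b j with hBd
  have hB0 : 0 < B := by
    have : 0 < ∏ j, b j := prod_pos fun j _ => hb j
    omega
  have hbB : ∀ j, b j ∣ B := fun j => (dvd_prod_of_mem b (mem_univ j)).mul_left _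
  set g : ℤ := (Int.gcd (2 * h 0) (B^(e+1)) : ℤ) with hg
  have hgpos : 0 < g := by
    rw [hg]; exact_mod_cast Int.gcd_pos_of_ne_zero_right _ (pow_ne_zero _ hB0.ne')
  obtain ⟨β0, hβ0⟩ : g ∣ 2 * h 0 := Int.gcd_dvd_left _ _
  obtain ⟨w, hw⟩ : g ∣ B^(e+1) := Int.gcd_dvd_right _ _
  have hwpos : 0 < w := by
    have : 0 < g * w := by rw [← hw]; positivity
    exact (mul_pos_iff_of_pos_left hgpos).1 this
  have hbez : IsCoprime β0 w := by
    have h1 := Int.gcd_eq_gcd_ab (2 * h 0) (B^(e+1))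
    rw [← hg] at h1
    refine ⟨Int.gcdA (2 * h 0) (B^(e+1)), Int.gcdB (2 * h 0) (B^(e+1)), mul_left_cancel₀ hgpos.ne' ?_⟩
    set s := Int.gcdA (2 * h 0) (B^(e+1))
    set t := Int.gcdB (2 * h 0) (B^(e+1))
    linear_combination -h1 - s * hβ0 - t * hw
  have hcop : ∀ p : ℕ, p.Prime → (p:ℤ) ∣ B → ¬ (p:ℤ) ∣ β0 := by
    intro p hp hpB hpβ
    have hpi := Nat.prime_iff_prime_int.1 hp
    have hp0 : (p:ℤ) ≠ 0 := by exact_mod_cast hp.ne_zero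
    have hpw : ¬ (p:ℤ) ∣ w := fun h => hpi.not_isUnit (hbez.isUnit_of_dvd' hpβ h)
    obtain ⟨B', hBB, hB'⟩ := (Int.finiteMultiplicity_iff.2 ⟨by simpa using hp.ne_one, hB0.ne'⟩ : FiniteMultiplicity (p:ℤ) B).exists_eq_pow_mul_and_not_dvd
    set v := multiplicity (p:ℤ) B
    have h1 : (p:ℤ)^(v+e) ∣ g * w := by
      rw [← hw, pow_add, pow_succ, mul_comm]
      exact mul_dvd_mul (pow_dvd_pow_of_dvd hpB e) (Dvd.intro _ hBB.symm)
    have h2 : (p:ℤ)^(v+e) ∣ g := ((hpi.coprime_iff_not_dvd.2 hpw).pow_left).dvd_of_dvd_mul_right h1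
    have h3 : (p:ℤ)^(v+e) * p ∣ g * β0 := mul_dvd_mul h2 hpβ
    rw [← hβ0, hh0] at h3
    obtain ⟨κ', hκ'⟩ := hκ
    have h4 : (p:ℤ)^(v+e) * p ∣ B * d := by
      rw [hκ']; exact (h3.mul_right κ').trans (dvd_of_eq (by ring))
    have h5 : (p:ℤ)^v * p^(e+1) ∣ p^v * (B' * d) := by
      have e1 : (p:ℤ)^v * p^(e+1) = (p:ℤ)^(v+e) * p := by ring
      have e2 : (p:ℤ)^v * (B' * d) = B * d := by rw [← mul_assoc, ← hBB]
      rw [e1, e2]; exact h4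
    have h6 := (mul_dvd_mul_iff_left (pow_ne_zero _ hp0)).1 h5
    have h7 : (p:ℤ)^(e+1) ∣ d := ((hpi.coprime_iff_not_dvd.2 hB').pow_left).dvd_of_dvd_mul_left h6
    exact hd p hp hpB ((pow_dvd_pow _ (by omega)).trans h7)
  set H := B^(e+2) with hH
  have hHpos : 0 < H := by positivity
  have hHg : H = B * w * g := by rw [hH, pow_succ, hw]; ring
  set α : Fin 4 → ℤ := ![b 0 * B * w, b 1 * (H * g), b 2 * (H * g), b 3 * (H * g)] with hα
  set β : Fin 4 → ℤ := ![β0, 2 * h 1, 2 * h 2, 2 * h 3] with hβ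
  have hb0 := hb 0
  have hb1 := hb 1
  have hb2 := hb 2
  have hb3 := hb 3
  have hαpos : ∀ j, 0 < α j := by
    intro j
    fin_cases j <;> simp [hα] <;> positivity
  have hprod : 2 * ∏ j, α j = B * (B * w * (H*g)^3) := by
    have hB4 : B = 2 * (b 0 * b 1 * b 2 * b 3) := by rw [hBd, Fin.prod_univ_four]
    rw [Fin.prod_univ_four]
    have q0 : α 0 = b 0 * B * w := rfl
    have q1 : α 1 = b 1 * (H * g) := rfl
    have q2 : α 2 = b 2 * (H * g) := rfl
    have q3 : α 3 = b 3 * (H * g) := rfl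
    rw [q0, q1, q2, q3]
    linear_combination (-(B*w*(H*g)^3)) * hB4
  have hpr : ∀ p : ℕ, p.Prime → (p:ℤ) ∣ 2 * ∏ j, α j → (p:ℤ) ∣ B := by
    intro p hp hpd
    have hpi := Nat.prime_iff_prime_int.1 hp
    rw [hprod] at hpd
    have hw' : (p:ℤ) ∣ w → (p:ℤ) ∣ B := fun h => hpi.dvd_of_dvd_pow (hw ▸ h.mul_left g)
    have hg' : (p:ℤ) ∣ g → (p:ℤ) ∣ B := fun h => hpi.dvd_of_dvd_pow (hw ▸ h.mul_right w)
    rcases hpi.dvd_or_dvd hpd with h | h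
    · exact h
    rcases hpi.dvd_or_dvd h with h | h
    · rcases hpi.dvd_or_dvd h with h | h
      · exact h
      · exact hw' h
    · rcases hpi.dvd_or_dvd (hpi.dvd_of_dvd_pow h) with h | h
      · exact hpi.dvd_of_dvd_pow h
      · exact hg' h
  obtain ⟨G0, hG0⟩ := thmQ α β hαpos (fun p hp hpd => by
      have : α 0 = b 0 * B * w := rfl
      rw [this]
      exact ((hpr p hp hpd).mul_left _).mul_right _) (by
      have : β 0 = β0 := rfl
      rw [this, Int.isCoprime_iff_gcd_eq_one]
      refine Nat.Coprime.gcd_eq_one (Nat.coprime_of_dvd fun p hp h1 h2 => ?_)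
      exact hcop p hp (hpr p hp (Int.natCast_dvd.2 h2)) (Int.natCast_dvd.2 h1))
  refine ⟨|G0| * (H * g), fun Γ hΓ hdv => ?_⟩
  have hHgp : 0 < H * g := by positivity
  obtain ⟨γ, hγ⟩ : H * g ∣ Γ := by
    refine Dvd.dvd.trans ?_ hdv
    refine ⟨w, ?_⟩
    rw [show 2*e+3 = (e+2) + (e+1) by ring, pow_add, hw]; ring
  obtain ⟨y, hy⟩ := hG0 γ (by
    rw [hγ, mul_comm] at hΓ
    exact (le_abs_self _).trans (le_of_mul_le_mul_left hΓ hHgp))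
  refine ⟨![H * y 0, H * g * y 1, H * g * y 2, H * g * y 3], ?_⟩
  rw [Fin.sum_univ_four] at hy ⊢
  simp [hα, hβ] at hy ⊢
  rw [hγ]
  linear_combination H * g * hy + b 0 * H * y 0 ^2 * hHg + H * y 0 * hβ0

def sA2 (a : Fin 5 → ℤ) : ℤ := a 0 + a 1
def sA3 (a : Fin 5 → ℤ) : ℤ := a 0 + a 1 + a 2
def sA4 (a : Fin 5 → ℤ) : ℤ := a 0 + a 1 + a 2 + a 3
def sA5 (a : Fin 5 → ℤ) : ℤ := a 0 + a 1 + a 2 + a 3 + a 4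
def bv (a : Fin 5 → ℤ) : Fin 4 → ℤ := ![a 0 * a 1 * sA2 a, a 2 * sA2 a * sA3 a, a 3 * sA3 a * sA4 a, a 4 * sA4 a * sA5 a]
def hv (a x : Fin 5 → ℤ) : Fin 4 → ℤ := ![a 0 * a 1 * (x 0 - x 1), a 2 * (a 0 * x 0 + a 1 * x 1 - sA2 a * x 2),
  a 3 * (a 0 * x 0 + a 1 * x 1 + a 2 * x 2 - sA3 a * x 3), a 4 * (a 0 * x 0 + a 1 * x 1 + a 2 * x 2 + a 3 * x 3 - sA4 a * x 4)]
def Xv (a x : Fin 5 → ℤ) (l : ℤ) (z : Fin 4 → ℤ) : Fin 5 → ℤ := ![x 0 + l + z 0 * a 1 + z 1 * a 2 + z 2 * a 3 + z 3 * a 4,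
  x 1 + l - z 0 * a 0 + z 1 * a 2 + z 2 * a 3 + z 3 * a 4, x 2 + l - z 1 * sA2 a + z 2 * a 3 + z 3 * a 4,
  x 3 + l - z 2 * sA3 a + z 3 * a 4, x 4 + l - z 3 * sA4 a]

lemma bv_pos (a : Fin 5 → ℤ) (ha : ∀ j, 0 < a j) (j) : 0 < bv a j := by
  have := ha 0; have := ha 1; have := ha 2; have := ha 3; have := ha 4
  fin_cases j <;> simp [bv, sA2, sA3, sA4, sA5] <;> positivity

lemma Xv_lin (a x : Fin 5 → ℤ) (l : ℤ) (z : Fin 4 → ℤ) : ∑ j, a j * Xv a x l z j = ∑ j, a j * x j + l * sA5 a := by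
  rw [Fin.sum_univ_five, Fin.sum_univ_five]
  simp [Xv, sA2, sA3, sA4, sA5]; ring

lemma Xv_sq (a x : Fin 5 → ℤ) (l : ℤ) (z : Fin 4 → ℤ) : ∑ j, a j * Xv a x l z j ^2 = ∑ j, a j * x j^2 + 2 * l * ∑ j, a j * x j + l^2 * sA5 a
    + ∑ j, (bv a j * z j^2 + 2 * hv a x j * z j) := by
  rw [Fin.sum_univ_five, Fin.sum_univ_five, Fin.sum_univ_five, Fin.sum_univ_four]
  simp [Xv, sA2, sA3, sA4, sA5, bv, hv]; ring

lemma cs_nonneg (a X : Fin 5 → ℤ) (ha : ∀ j, 0 < a j) (t S : ℤ) (h1 : ∑ j, a j * X j = t) (h2 : ∑ j, a j * X j^2 = S) (ht : 0 ≤ t)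
    (h : (sA5 a - 1) * S ≤ t^2) (i : Fin 5) : 0 ≤ X i := by
  by_contra hneg
  push Not at hneg
  have hA : ∑ j, a j = sA5 a := by rw [Fin.sum_univ_five]; rfl
  have cs := Finset.sum_sq_le_sum_mul_sum_of_sq_eq_mul (univ.erase i) (r := fun j => a j * X j) (f := fun j => a j) (g := fun j => a j * X j^2)
    (fun j _ => (ha j).le) (fun j _ => by have := ha j; positivity) (fun j _ => by ring)
  rw [← Finset.add_sum_erase univ _ (mem_univ i)] at h1 h2 hA
  set T := ∑ j ∈ univ.erase i, a j * X j
  set A' := ∑ j ∈ univ.erase i, a j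
  set S' := ∑ j ∈ univ.erase i, a j * X j^2
  have hai := ha i
  have hA' : 0 ≤ A' := sum_nonneg fun j _ => (ha j).le
  have hS' : 0 ≤ S' := sum_nonneg fun j _ => by have := ha j; positivity
  have hneg' : a i * X i < 0 := mul_neg_of_pos_of_neg hai hneg
  have hT : t < T := by linarith
  have h3 : t^2 < T^2 := by nlinarith
  have h4 : A' * S' ≤ (sA5 a - 1) * S := by
    have : 0 ≤ a i * X i^2 := by positivity
    apply mul_le_mul <;> linarith
  linarith

lemma five_one (a : Fin 5 → ℤ) (ha : ∀ j, 0 < a j) (e : ℕ) (x : Fin 5 → ℤ)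
    (hd : ∀ p : ℕ, p.Prime → (p:ℤ) ∣ 2 * ∏ j, bv a j → ¬ (p:ℤ)^e ∣ x 0 - x 1) : ∃ G0 : ℤ, ∀ Γ : ℤ, G0 ≤ Γ → (2 * ∏ j, bv a j)^(2*e+3) ∣ Γ →
      ∃ z : Fin 4 → ℤ, ∑ j, (bv a j * z j^2 + 2 * hv a x j * z j) = Γ := by
  refine four (bv a) (hv a x) (bv_pos a ha) (2 * a 0 * a 1) (x 0 - x 1) e ?_ ?_ hd
  · rw [Fin.prod_univ_four]
    refine ⟨sA2 a * bv a 1 * bv a 2 * bv a 3, ?_⟩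
    have : bv a 0 = a 0 * a 1 * sA2 a := rfl
    rw [this]; ring
  · have : hv a x 0 = a 0 * a 1 * (x 0 - x 1) := rfl
    rw [this]; ring

lemma five (a : Fin 5 → ℤ) (ha : ∀ j, 0 < a j) (e : ℕ) (E : ℤ) (hE : sA5 a * (2 * ∏ j, bv a j)^(2*e+3) ∣ E) : 
    ∃ K : ℤ, ∀ (t S : ℤ) (x : Fin 5 → ℤ), (∀ j, 0 ≤ x j ∧ x j < E) → (∀ p : ℕ, p.Prime → (p:ℤ) ∣ 2 * ∏ j, bv a j → ¬ (p:ℤ)^e ∣ x 0 - x 1) →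
      E ∣ t - ∑ j, a j * x j → E ∣ S - ∑ j, a j * x j^2 → K ≤ sA5 a * S - t^2 → 0 ≤ t → (sA5 a - 1) * S ≤ t^2 →
      ∃ X : Fin 5 → ℤ, (∀ j, 0 ≤ X j) ∧ ∑ j, a j * X j = t ∧ ∑ j, a j * X j^2 = S := by
  have hG : ∀ x : Fin 5 → ℤ, ∃ G0 : ℤ, (∀ p : ℕ, p.Prime → (p:ℤ) ∣ 2 * ∏ j, bv a j → ¬ (p:ℤ)^e ∣ x 0 - x 1) →
      ∀ Γ : ℤ, G0 ≤ Γ → (2 * ∏ j, bv a j)^(2*e+3) ∣ Γ → ∃ z : Fin 4 → ℤ, ∑ j, (bv a j * z j^2 + 2 * hv a x j * z j) = Γ := by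
    intro x
    by_cases h : ∀ p : ℕ, p.Prime → (p:ℤ) ∣ 2 * ∏ j, bv a j → ¬ (p:ℤ)^e ∣ x 0 - x 1
    · obtain ⟨G, hG⟩ := five_one a ha e x h
      exact ⟨G, fun _ => hG⟩
    · exact ⟨0, fun h' => absurd h' h⟩
  choose G hG using hG
  set G0 := ∑ x ∈ Fintype.piFinset (fun _ : Fin 5 => Ico 0 E), |G x| with hG0
  have hA : 0 < sA5 a := by
    have := ha 0; have := ha 1; have := ha 2; have := ha 3; have := ha 4
    unfold sA5; positivity
  have hAs : ∑ j, a j = sA5 a := by rw [Fin.sum_univ_five]; rfl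
  refine ⟨sA5 a * G0 + sA5 a * (sA5 a * E^2), fun t S x hx hd ht hS hK ht0 hcs => ?_⟩
  have hGx : G x ≤ G0 := (le_abs_self _).trans (single_le_sum (f := fun x => |G x|) (fun _ _ => abs_nonneg _) (Fintype.mem_piFinset.2 fun j => mem_Ico.2 (hx j)))
  obtain ⟨E1, hE1⟩ := hE
  obtain ⟨c, hc⟩ := ht
  set B := (2 * ∏ j, bv a j)^(2*e+3) with hB
  set l := B * E1 * c with hl
  have hl' : t = ∑ j, a j * x j + l * sA5 a := by rw [hl]; linear_combination hc + c * hE1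
  set τ := ∑ j, a j * x j with hτ
  set Q := ∑ j, a j * x j^2 with hQ
  have hQle : Q ≤ sA5 a * E^2 := by
    rw [hQ, ← hAs, sum_mul]
    apply sum_le_sum; intro j _
    have h1 := hx j
    have h2 := ha j
    gcongr
    · exact h1.1
    · exact h1.2.le
  set Γ := S - (Q + 2 * l * τ + l^2 * sA5 a) with hΓ
  have hAΓ : sA5 a * Γ = sA5 a * S - t^2 - sA5 a * Q + τ^2 := by
    rw [hΓ, hl']; ring
  have hΓG : G0 ≤ Γ := by
    have : sA5 a * Q ≤ sA5 a * (sA5 a * E^2) := by gcongr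
    have : sA5 a * G0 ≤ sA5 a * Γ := by rw [hAΓ]; nlinarith [sq_nonneg τ]
    exact le_of_mul_le_mul_left this hA
  have hBE : B ∣ E := ⟨sA5 a * E1, by rw [hE1]; ring⟩
  have hBl : B ∣ l := ⟨E1 * c, by rw [hl]; ring⟩
  have hBΓ : B ∣ Γ := by
    have : Γ = (S - Q) - l * (2 * τ + l * sA5 a) := by rw [hΓ]; ring
    rw [this]; exact dvd_sub (hBE.trans hS) (hBl.mul_right _)
  obtain ⟨z, hz⟩ := hG x hd Γ (hGx.trans hΓG) hBΓ
  have e1 : ∑ j, a j * Xv a x l z j = t := by rw [Xv_lin, hl']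
  have e2 : ∑ j, a j * Xv a x l z j^2 = S := by rw [Xv_sq, hz, hΓ]; ring
  exact ⟨Xv a x l z, cs_nonneg a _ ha t S e1 e2 ht0 hcs, e1, e2⟩
end PF

namespace PF
open Finset

set_option maxHeartbeats 1000000 in
lemma window (A E K T Q : ℝ) (hA : 5 ≤ A) (hE : 0 < E) (hT : 0 ≤ T) (hQ : 0 ≤ Q) :
    ∃ C : ℝ, 0 < C ∧ ∀ M N : ℝ, 1 ≤ M → C * M^3 ≤ N → ∃ w : ℝ, ∀ t S tr Sr : ℝ, w ≤ t → t ≤ w + E * M →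
      M * S = 2 * N + (M - 2) * t → 0 ≤ tr → tr ≤ T → 0 ≤ Sr → Sr ≤ Q →
      K ≤ A * (S - Sr) - (t - tr)^2 ∧ 0 ≤ t - tr ∧ (A - 1) * (S - Sr) ≤ (t - tr)^2 := by
  set U : ℝ := 8*A*E + 4*(A^2+1) + A*Q + |K| + 4*(A+2*T)*A + T with hU
  have hK := abs_nonneg K
  have hAE : 0 < A * E := by positivity
  have hAQ : 0 ≤ A * Q := by positivity
  have hTA : 0 ≤ (A+2*T)*A := by positivity
  have hA2 : 0 ≤ A^2 := by positivity
  have hUpos : 0 < U := by rw [hU]; linarith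
  refine ⟨U^2, by positivity, fun M N hM hN => ?_⟩
  have hMp : 0 < M := by linarith
  have hNp : 0 < N := lt_of_lt_of_le (by positivity) hN
  set u := Real.sqrt (2 * N / M) with hu
  have hu2 : u^2 = 2 * N / M := Real.sq_sqrt (by positivity)
  have hu0 : 0 ≤ u := Real.sqrt_nonneg _
  have huUM : U * M ≤ u := by
    refine Real.le_sqrt_of_sq_le ?_
    rw [le_div_iff₀ hMp]
    have : (U*M)^2 * M = U^2 * M^3 := by ring
    linarith
  have huU : U ≤ u := (le_mul_of_one_le_right hUpos.le hM).trans huUM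
  set θ := Real.sqrt (A - 3/4) with hθ
  have hθ2 : θ^2 = A - 3/4 := Real.sq_sqrt (by linarith)
  have hθ1 : 1 ≤ θ := Real.le_sqrt_of_sq_le (by linarith)
  have hθA : θ ≤ A := Real.sqrt_le_iff.2 ⟨by linarith, by clear * - hA; nlinarith⟩
  have hEM : 8 * A * (E * M) ≤ u := by
    have : 8*A*E ≤ U := by rw [hU]; linarith
    have := mul_le_mul_of_nonneg_right this hMp.le
    linarith
  refine ⟨θ * u, fun t S tr Sr h1 h2 h3 h4 h5 h6 h7 => ?_⟩
  have hMS : M * S = M * u^2 + (M-2) * t := by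
    rw [h3, hu2]; field_simp
  have hut : u ≤ t := (le_mul_of_one_le_left hu0 hθ1).trans h1
  have ht0 : 0 ≤ t := by linarith
  have hlow : (A - 3/4) * u^2 ≤ t^2 := by
    rw [← hθ2, ← mul_pow]
    exact pow_le_pow_left₀ (by positivity) h1 2
  have hup : t^2 ≤ (A - 1/4) * u^2 := by
    have e1 : t^2 ≤ (θ*u + E*M)^2 := pow_le_pow_left₀ ht0 h2 2
    have e2 : (θ*u+E*M)^2 = (A-3/4)*u^2 + 2 * θ * (E*M) * u + (E*M)^2 := by rw [← hθ2]; ring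
    have hEM0 : 0 < E * M := by positivity
    have e3 : 2 * θ * (E*M) ≤ u/4 := by
      have := mul_le_mul_of_nonneg_right hθA hEM0.le
      linarith
    have e4 : E * M ≤ u/4 := by
      have := mul_le_mul_of_nonneg_right hA hEM0.le
      linarith
    have e5 : 2 * θ * (E*M) * u ≤ u/4 * u := mul_le_mul_of_nonneg_right e3 hu0
    have e6 : (E*M)^2 ≤ (u/4)^2 := pow_le_pow_left₀ hEM0.le e4 2
    have e7 : 0 ≤ u^2 := sq_nonneg u
    linarith
  have htA : t ≤ A * u := by
    refine (pow_le_pow_iff_left₀ ht0 (by positivity) two_ne_zero).1 ?_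
    rw [mul_pow]
    have : A - 1/4 ≤ A^2 := by clear * - hA; nlinarith
    exact hup.trans (mul_le_mul_of_nonneg_right this (sq_nonneg u))
  have hS1 : u^2 - t ≤ S := by
    refine le_of_mul_le_mul_left ?_ hMp
    rw [hMS]; clear * - ht0 hM; nlinarith
  have hS2 : S ≤ u^2 + t := by
    refine le_of_mul_le_mul_left ?_ hMp
    rw [hMS]; clear * - ht0; nlinarith
  have hTu : T ≤ u := by rw [hU] at huU; linarith
  have htr : 0 ≤ t - tr := by linarith
  refine ⟨?_, htr, ?_⟩
  · have g1 : (t-tr)^2 ≤ t^2 := pow_le_pow_left₀ htr (by linarith) 2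
    have g2 : A * (u^2 - t - Q) ≤ A * (S - Sr) := mul_le_mul_of_nonneg_left (by linarith) (by linarith)
    have g3 : A * t ≤ A * (A * u) := mul_le_mul_of_nonneg_left htA (by linarith)
    have g4 : A * Q + |K| ≤ u := by rw [hU] at huU; linarith
    have g5 : 4*(A^2+1) ≤ u := by rw [hU] at huU; linarith
    have g6 : 4*(A^2+1) * u ≤ u*u := mul_le_mul_of_nonneg_right g5 hu0
    have g7 := le_abs_self K
    linarith
  · have g1 : t^2 - 2*T*t ≤ (t-tr)^2 := by
      have k1 : tr * t ≤ T * t := mul_le_mul_of_nonneg_right h5 ht0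
      have k2 := sq_nonneg tr
      linarith
    have g2 : (A-1) * (S - Sr) ≤ (A-1) * (u^2+t) := mul_le_mul_of_nonneg_left (by linarith) (by linarith)
    have g3 : 4*(A+2*T)*A ≤ u := by rw [hU] at huU; linarith
    have g4 : 4*(A+2*T)*A * u ≤ u*u := mul_le_mul_of_nonneg_right g3 hu0
    have g5 : (A + 2*T) * t ≤ (A+2*T) * (A*u) := mul_le_mul_of_nonneg_left htA (by linarith)
    linarith

lemma ph_split {ι : Type*} [Fintype ι] (a x : ι → ℤ) (M : ℤ) :
    ∑ j, a j * ph M (x j) = M * (∑ j, a j * x j^2 - ∑ j, a j * x j) + 2 * ∑ j, a j * x j := by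
  rw [← sum_sub_distrib, mul_sum, mul_sum, ← sum_add_distrib]
  refine sum_congr rfl fun j _ => ?_
  rw [ph]; ring

lemma even_split {ι : Type*} [Fintype ι] (a x : ι → ℤ) :
    (2:ℤ) ∣ ∑ j, a j * x j^2 - ∑ j, a j * x j := by
  rw [← sum_sub_distrib]
  refine dvd_sum fun j _ => ?_
  have : (2:ℤ) ∣ x j * (x j - 1) := (Int.even_mul_pred_self (x j)).two_dvd
  exact dvd_eq (this.mul_left (a j)) (by ring)

lemma emod_sum1 {ι : Type*} [Fintype ι] (a x : ι → ℤ) (E : ℤ) :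
    E ∣ ∑ j, a j * x j - ∑ j, a j * (x j % E) := by
  rw [← sum_sub_distrib]
  refine dvd_sum fun j _ => ?_
  have : E ∣ x j - x j % E := Int.dvd_self_sub_emod
  exact dvd_eq (this.mul_left (a j)) (by ring)

lemma emod_sum2 {ι : Type*} [Fintype ι] (a x : ι → ℤ) (E : ℤ) :
    E ∣ ∑ j, a j * x j^2 - ∑ j, a j * (x j % E)^2 := by
  rw [← sum_sub_distrib]
  refine dvd_sum fun j _ => ?_
  have : E ∣ x j - x j % E := Int.dvd_self_sub_emod
  exact dvd_eq (this.mul_left (a j * (x j + x j % E))) (by ring)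

lemma core (q : ℕ) (a : Fin 5 → ℤ) (ha : ∀ j, 0 < a j) (b : Fin q → ℤ) (hb : ∀ j, 0 < b j) :
    ∃ C : ℝ, 0 < C ∧ ∀ M N : ℤ, 1 ≤ M → C * (M:ℝ)^3 ≤ N →
      (∀ r : ℤ, 0 < r → ∃ (x : Fin 5 → ℤ) (y : Fin q → ℤ), r ∣ FF a M x + ∑ i, b i * ph M (y i) - 2 * N) →
      ∃ (X : Fin 5 → ℤ) (Y : Fin q → ℤ), (∀ j, 0 ≤ X j) ∧ (∀ j, 0 ≤ Y j) ∧ FF a M X + ∑ i, b i * ph M (Y i) = 2 * N := by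
  set B : ℤ := 2 * ∏ j, bv a j with hB
  have hBpos : 0 < B := by
    have : 0 < ∏ j, bv a j := prod_pos fun j _ => bv_pos a ha j
    omega
  obtain ⟨e, he1, he⟩ := local_all a ha B.toNat (by omega)
  have hA5 : 5 ≤ sA5 a := by
    have h0 := ha 0
    have h1 := ha 1
    have h2 := ha 2
    have h3 := ha 3
    have h4 := ha 4
    rw [sA5]; omega
  have hApos : 0 < sA5 a := by omega
  set E : ℤ := sA5 a * B^(2*e+3) with hE
  have hEpos : 0 < E := by positivity
  obtain ⟨K, hK⟩ := five a ha e E dvd_rfl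
  have hT0 : 0 ≤ ∑ i, b i * E := sum_nonneg fun i _ => (mul_pos (hb i) hEpos).le
  have hQ0 : 0 ≤ ∑ i, b i * E^2 := sum_nonneg fun i _ => (mul_pos (hb i) (by positivity)).le
  obtain ⟨C, hC, hwin⟩ := window (sA5 a : ℝ) (E:ℝ) (K:ℝ) ((∑ i, b i * E : ℤ):ℝ) ((∑ i, b i * E^2 : ℤ):ℝ)
    (by exact_mod_cast hA5) (by exact_mod_cast hEpos) (by exact_mod_cast hT0) (by exact_mod_cast hQ0)
  refine ⟨C, hC, fun M N hM hN hloc => ?_⟩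
  obtain ⟨w, hw⟩ := hwin M N (by exact_mod_cast hM) hN
  have hEM : 0 < E * M := mul_pos hEpos (by omega)
  set R : ℕ := (2 * (E * M)).toNat with hR
  have hRZ : (R:ℤ) = 2 * (E * M) := Int.toNat_of_nonneg (by omega)
  have hRpos : 0 < R := by omega
  obtain ⟨x0, y, hxy⟩ := hloc ((R:ℤ)^e) (by positivity)
  obtain ⟨x, hx, hxd⟩ := he M x0 R hRpos
  have hdiv : 2 * (E * M) ∣ FF a M x + ∑ i, b i * ph M (y i) - 2 * N := by
    rw [← hRZ]
    exact (dvd_pow_self (R:ℤ) (by omega)).trans (dvd_eq (dvd_add hx hxy) (by ring))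
  have hBE : B^e ∣ E := (pow_dvd_pow B (by omega)).mul_left _
  have hBE1 : B ∣ E := (dvd_pow_self B (by omega)).mul_left _
  rw [FF, ph_split, ph_split] at hdiv
  obtain ⟨s1, hs1⟩ := even_split a x
  obtain ⟨s2, hs2⟩ := even_split b y
  have hx1 := emod_sum1 a x E
  have hx2 := emod_sum2 a x E
  have hy1 := emod_sum1 b y E
  have hy2 := emod_sum2 b y E
  set t1 := ∑ j, a j * x j
  set S1 := ∑ j, a j * x j^2
  set t2 := ∑ j, b j * y j
  set S2 := ∑ j, b j * y j^2
  set tr := ∑ j, b j * (y j % E) with htr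
  set Sr := ∑ j, b j * (y j % E)^2 with hSr
  obtain ⟨l, hl⟩ := hdiv
  have hl' : M * (s1 + s2) + (t1 + t2) - N = E * M * l := by
    refine mul_left_cancel₀ (two_ne_zero (α := ℤ)) ?_
    linear_combination hl - M * hs1 - M * hs2
  set c := ⌈w⌉ with hc
  have hcd : E * M ∣ (t1 + t2 - c) - (t1 + t2 - c) % (E * M) := Int.dvd_self_sub_emod
  have hc0 := Int.emod_nonneg (t1 + t2 - c) hEM.ne'
  have hc1 := Int.emod_lt_of_pos (t1 + t2 - c) hEM
  set ρ := (t1 + t2 - c) % (E * M) with hρ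
  obtain ⟨k, hk⟩ := hcd
  set t := c + ρ with ht
  have htk : t = t1 + t2 - E * M * k := by linarith
  set s := s1 + s2 - E * l + E * k with hs
  have hsN : M * s + t = N := by
    rw [hs, htk]; linear_combination hl'
  set S := 2 * s + t with hS
  have hyr : ∀ i, 0 ≤ y i % E ∧ y i % E < E := fun i => ⟨Int.emod_nonneg _ hEpos.ne', Int.emod_lt_of_pos _ hEpos⟩
  have htr0 : 0 ≤ tr := sum_nonneg fun i _ => mul_nonneg (hb i).le (hyr i).1
  have hSr0 : 0 ≤ Sr := sum_nonneg fun i _ => mul_nonneg (hb i).le (sq_nonneg _)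
  have htrT : tr ≤ ∑ i, b i * E := sum_le_sum fun i _ => mul_le_mul_of_nonneg_left (hyr i).2.le (hb i).le
  have hSrQ : Sr ≤ ∑ i, b i * E^2 := sum_le_sum fun i _ => mul_le_mul_of_nonneg_left
    (pow_le_pow_left₀ (hyr i).1 (hyr i).2.le 2) (hb i).le
  have hMS : M * S = 2 * N + (M - 2) * t := by rw [hS, ← hsN]; ring
  obtain ⟨r1, r2, r3⟩ := hw (t:ℝ) (S:ℝ) (tr:ℝ) (Sr:ℝ) (by
      have : w ≤ (c:ℝ) := Int.le_ceil w
      have h2 : (c:ℝ) ≤ t := by exact_mod_cast (by omega : c ≤ t)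
      linarith) (by
      have : (c:ℝ) < w + 1 := Int.ceil_lt_add_one w
      have h2 : (t:ℝ) + 1 ≤ c + E * M := by exact_mod_cast (by omega : t + 1 ≤ c + E * M)
      linarith) (by exact_mod_cast hMS) (by exact_mod_cast htr0) (by exact_mod_cast htrT) (by exact_mod_cast hSr0) (by exact_mod_cast hSrQ)
  have r1' : K ≤ sA5 a * (S - Sr) - (t - tr)^2 := by exact_mod_cast r1
  have r2' : 0 ≤ t - tr := by exact_mod_cast r2
  have r3' : (sA5 a - 1) * (S - Sr) ≤ (t - tr)^2 := by exact_mod_cast r3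
  obtain ⟨X, hX0, hX1, hX2⟩ := hK (t - tr) (S - Sr) (fun j => x j % E)
    (fun j => ⟨Int.emod_nonneg _ hEpos.ne', Int.emod_lt_of_pos _ hEpos⟩) (by
      intro p hp hpB hpd
      have hpe : (p:ℤ)^e ∣ E := (pow_dvd_pow_of_dvd hpB e).trans hBE
      have q0 : E ∣ x 0 - x 0 % E := Int.dvd_self_sub_emod
      have q1 : E ∣ x 1 - x 1 % E := Int.dvd_self_sub_emod
      refine hxd p hp ?_ ?_ ?_
      · have : (p:ℤ) ∣ R := by
          rw [hRZ]; exact ((hpB.trans hBE1).mul_right M).mul_left 2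
        exact_mod_cast this
      · have : (p:ℤ) ∣ (B.toNat : ℤ) := by rw [Int.toNat_of_nonneg hBpos.le]; exact hpB
        exact_mod_cast this
      · exact dvd_eq (dvd_add hpd (dvd_sub (hpe.trans q0) (hpe.trans q1))) (by ring)) (by
      have h1 : E ∣ E * (M * k) := dvd_mul_right _ _
      exact dvd_eq (dvd_sub (dvd_add hx1 hy1) h1) (by rw [htk]; ring)) (by
      have h1 : E ∣ E * (2 * k - 2 * l - M * k) := dvd_mul_right _ _
      exact dvd_eq (dvd_add (dvd_add hx2 hy2) h1) (by rw [hS, hs, htk]; linear_combination - hs1 - hs2)) r1' r2' r3'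
  refine ⟨X, fun i => y i % E, hX0, fun i => (hyr i).1, ?_⟩
  rw [FF, ph_split, ph_split, hX1, hX2, ← hsN]
  rw [← htr, ← hSr, hS]; ring

end PF


lemma PF.two_polyNum (m x : ℤ) : 2 * polyNum m x = PF.ph (m-2) x := by
  have h : (2:ℤ) ∣ (m - 2) * (x * (x - 1)) := (Int.even_mul_pred_self x).two_dvd.mul_left _
  rw [polyNum, mul_add, Int.mul_ediv_cancel' h, PF.ph]; ring

/-- for `n ≥ 5` and positive integers `a₁, …, aₙ`, there is a constant
`C > 0` depending only on the `aᵢ` such that for all `m ≥ 3`, the `m`-gonal form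
`⟨a₁,…,aₙ⟩ₘ` represents over `ℕ₀` every positive integer `N` with `N ≥ C·(m-2)³`
that is locally represented by the form. -/
theorem stmt0 (n : ℕ) (hn : 5 ≤ n) (a : Fin n → ℤ) (ha : ∀ i, 0 < a i) :
    ∃ C : ℝ, 0 < C ∧
      ∀ m : ℤ, 3 ≤ m → ∀ N : ℤ, 0 < N →
        C * ((m : ℝ) - 2) ^ 3 ≤ (N : ℝ) →
        (∀ r : ℤ, 0 < r →
          ∃ x : Fin n → ℤ, (∑ i, a i * polyNum m (x i)) ≡ N [ZMOD r]) →
        ∃ x : Fin n → ℕ, ∑ i, a i * polyNum m ((x i : ℤ)) = N := by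
  obtain ⟨q, rfl⟩ := Nat.exists_eq_add_of_le hn
  obtain ⟨C, hC, h⟩ := PF.core q (fun j => a (Fin.castAdd q j)) (fun j => ha _) (fun j => a (Fin.natAdd 5 j)) (fun j => ha _)
  have key : ∀ (m : ℤ) (x : Fin (5+q) → ℤ), 2 * ∑ i, a i * polyNum m (x i) =
      PF.FF (fun j => a (Fin.castAdd q j)) (m-2) (fun j => x (Fin.castAdd q j))
        + ∑ i, a (Fin.natAdd 5 i) * PF.ph (m-2) (x (Fin.natAdd 5 i)) := by
    intro m x
    rw [Fin.sum_univ_add, mul_add, Finset.mul_sum, Finset.mul_sum, PF.FF]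
    congr 1 <;>
    · refine Finset.sum_congr rfl fun j _ => ?_
      rw [← PF.two_polyNum]; ring
  refine ⟨C, hC, fun m hm N _ hCN hloc => ?_⟩
  obtain ⟨X, Y, hX, hY, hXY⟩ := h (m-2) N (by omega) (by push_cast; exact hCN) (by
    intro r hr
    obtain ⟨x, hx⟩ := hloc r hr
    refine ⟨fun j => x (Fin.castAdd q j), fun j => x (Fin.natAdd 5 j), ?_⟩
    rw [← key m x]
    exact PF.dvd_eq (hx.symm.dvd.mul_left 2) (by ring))
  refine ⟨fun i => (Fin.append X Y i).toNat, ?_⟩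
  refine mul_left_cancel₀ (two_ne_zero (α := ℤ)) ?_
  rw [key m (fun i => ((Fin.append X Y i).toNat : ℤ)), ← hXY]
  simp only [Fin.append_left, Fin.append_right, Int.toNat_of_nonneg (hX _), Int.toNat_of_nonneg (hY _)]
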